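/- Let b be a blow-up point of u, write w = w_{b,T}, and assume ‖w(·,s) - κ‖_{L²_ρ} → 0 as s → ∞. Suppose that case (ii) of the classification holds with parameter l ∈ {1,…,n} and with the orthogonal map equal to the identity, i.e. ‖ w(y, s) - φ(s) + (κ/(4 p s)) (Σ_{j=1}^l y_j² - 2 l) ‖_{L²_ρ(dy)} = O(s^{-(a+1)}) + O(s^{-2} log s) as s → ∞. Then for every K₀ > 0 there exist C > 0 and s₁ such that for all s ≥ s₁: sup_{ξ ∈ ℝⁿ, |ξ| ≤ K₀} | w(ξ √s, s) - f_l(ξ) | ≤ C ( s^{-a} + s^{-1} log s ), where f_l(ξ) = κ (1 + ((p-1)/(4p)) Σ_{j=1}^l ξ_j²)^{-1/(p-1)}. -/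

import Mathlib

open MeasureTheory Real Filter Topology

noncomputable def hfun (p a μ : ℝ) (z : ℝ) : ℝ :=
  μ * |z| ^ (p - 1) * z / (Real.log (2 + z ^ 2)) ^ a

noncomputable def rho (n : ℕ) (y : EuclideanSpace ℝ (Fin n)) : ℝ :=
  (4 * Real.pi) ^ (-(n : ℝ) / 2) * Real.exp (-‖y‖ ^ 2 / 4)

noncomputable def lap (n : ℕ) (f : EuclideanSpace ℝ (Fin n) → ℝ)
    (y : EuclideanSpace ℝ (Fin n)) : ℝ :=
  ∑ i : Fin n, fderiv ℝ (fun z => fderiv ℝ f z (EuclideanSpace.single i 1)) y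
      (EuclideanSpace.single i 1)

/-- `u` is a classical solution of `u_t = Δu + |u|^{p-1}u + h(u)` on `ℝⁿ × [0,T)`,
bounded on `ℝⁿ × [0,t]` for every `t < T`, blowing up at time `T`. -/
def SolvesU (n : ℕ) (p a μ T : ℝ) (u : EuclideanSpace ℝ (Fin n) → ℝ → ℝ) : Prop :=
  (∀ t ∈ Set.Ico (0:ℝ) T, ContDiff ℝ 2 (fun x => u x t)) ∧
  (∀ x, ∀ t ∈ Set.Ico (0:ℝ) T, DifferentiableAt ℝ (fun t' => u x t') t) ∧
  (∀ x, ∀ t ∈ Set.Ico (0:ℝ) T,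
    deriv (fun t' => u x t') t =
      lap n (fun z => u z t) x + |u x t| ^ (p - 1) * u x t + hfun p a μ (u x t)) ∧
  (∀ t ∈ Set.Ico (0:ℝ) T, ∃ M : ℝ, ∀ x, ∀ t' ∈ Set.Icc (0:ℝ) t, |u x t'| ≤ M) ∧
  (∀ M : ℝ, ∃ t₁ ∈ Set.Ico (0:ℝ) T, ∀ t ∈ Set.Ico t₁ T, ∃ x, M ≤ |u x t|)

/-- The similarity-variables rescaled solution
`w_{b,T}(y,s) = (T-t)^{1/(p-1)} u(b + y√(T-t), t)` with `t = T - e^{-s}`. -/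
noncomputable def wSelf (n : ℕ) (p T : ℝ) (u : EuclideanSpace ℝ (Fin n) → ℝ → ℝ)
    (b y : EuclideanSpace ℝ (Fin n)) (s : ℝ) : ℝ :=
  Real.exp (-s / (p - 1)) * u (b + Real.exp (-s / 2) • y) (T - Real.exp (-s))

/-- `b` is a blow-up point of `u`: there exist `(xₖ, tₖ) → (b, T)` with `|u(xₖ,tₖ)| → ∞`. -/
def BlowupPt (n : ℕ) (T : ℝ) (u : EuclideanSpace ℝ (Fin n) → ℝ → ℝ)
    (b : EuclideanSpace ℝ (Fin n)) : Prop :=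
  ∃ x : ℕ → EuclideanSpace ℝ (Fin n), ∃ t : ℕ → ℝ,
    (∀ k, t k ∈ Set.Ico (0:ℝ) T) ∧ Tendsto x atTop (nhds b) ∧ Tendsto t atTop (nhds T) ∧
    Tendsto (fun k => |u (x k) (t k)|) atTop atTop
/-- The `L²_ρ` norm: `‖f‖ = (∫ f(y)² ρ(y) dy)^{1/2}`. -/
noncomputable def L2rho (n : ℕ) (f : EuclideanSpace ℝ (Fin n) → ℝ) : ℝ :=
  Real.sqrt (∫ y, f y ^ 2 * rho n y)

/-- The Hermite-type polynomial `h_m(x) = Σ_{k=0}^{⌊m/2⌋} m!/(k!(m-2k)!) (-1)^k x^{m-2k}`. -/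
noncomputable def hermLike (m : ℕ) (x : ℝ) : ℝ :=
  ∑ k ∈ Finset.range (m / 2 + 1),
    ((Nat.factorial m : ℝ) / ((Nat.factorial k : ℝ) * (Nat.factorial (m - 2 * k) : ℝ)))
      * (-1 : ℝ) ^ k * x ^ (m - 2 * k)

/-- The multi-dimensional Hermite-type polynomial `H_α(y) = Π_i h_{α_i}(y_i)`. -/
noncomputable def Hmulti (n : ℕ) (α : Fin n → ℕ) (y : EuclideanSpace ℝ (Fin n)) : ℝ :=
  ∏ i : Fin n, hermLike (α i) (y i)

/-- Case (i) of the classification: `w(y,s) = φ(s)` for all `y` and all `s` in the domain. -/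
def CaseI (n : ℕ) (sLow : ℝ) (w : EuclideanSpace ℝ (Fin n) → ℝ → ℝ) (φ : ℝ → ℝ) : Prop :=
  ∀ y : EuclideanSpace ℝ (Fin n), ∀ s : ℝ, sLow ≤ s → w y s = φ s

/-- Case (ii) of the classification: up to an orthogonal transformation `Q`,
`‖w(Qy,s) - φ(s) + (κ/(4ps))(Σ_{j≤l} y_j² - 2l)‖_{L²_ρ} ≤ C (s^{-(a+1)} + s^{-2} log s)`. -/
def CaseII (n : ℕ) (p a κ : ℝ) (w : EuclideanSpace ℝ (Fin n) → ℝ → ℝ) (φ : ℝ → ℝ) : Prop :=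
  ∃ l : ℕ, 1 ≤ l ∧ l ≤ n ∧
    ∃ Q : EuclideanSpace ℝ (Fin n) ≃ₗᵢ[ℝ] EuclideanSpace ℝ (Fin n),
      ∃ C > (0:ℝ), ∃ s₁ : ℝ, ∀ s : ℝ, s₁ ≤ s →
        L2rho n (fun y => w (Q y) s - φ s +
            κ / (4 * p * s) *
              ((∑ j ∈ Finset.univ.filter (fun j : Fin n => (j : ℕ) < l), (y j) ^ 2)
                - 2 * l)) ≤
          C * (s ^ (-(a + 1)) + s ^ (-(2:ℝ)) * Real.log s)

/-- Case (iii) of the classification: for some `m ≥ 3` and constants `c_α` not all zero,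
`e^{(m/2-1)s} ‖w(·,s) - φ(s) + e^{-(m/2-1)s} Σ_{|α|=m} c_α H_α‖_{L²_ρ} → 0`. -/
def CaseIII (n : ℕ) (w : EuclideanSpace ℝ (Fin n) → ℝ → ℝ) (φ : ℝ → ℝ) : Prop :=
  ∃ m : ℕ, 3 ≤ m ∧ ∃ c : (Fin n → ℕ) → ℝ,
    (∃ α ∈ Finset.Nat.antidiagonalTuple n m, c α ≠ 0) ∧
    Tendsto (fun s => Real.exp (((m : ℝ) / 2 - 1) * s) *
        L2rho n (fun y => w y s - φ s +
          Real.exp (-(((m : ℝ) / 2 - 1) * s)) *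
            ∑ α ∈ Finset.Nat.antidiagonalTuple n m, c α * Hmulti n α y))
      atTop (nhds 0)

namespace Blowup

open Set Metric EuclideanSpace

noncomputable section

open Set Metric

/-- Euclidean space of dimension `n`. -/
abbrev EE (n : ℕ) := EuclideanSpace ℝ (Fin n)

variable {n : ℕ} {p a μ T α β δ θ s M N C : ℝ} {i : Fin n} {e : Fin n → ℝ} {I : Set ℝ} {X : ℝ → ℝ}
  {x : EE n} {f g η ψ Ψ : EE n → ℝ} {u v F W H : EE n → ℝ → ℝ} {U : Set (EE n)}

theorem mul_le_left {a b c : ℝ} (h : b ≤ c) (ha : 0 ≤ a) : a * b ≤ a * c :=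
  mul_le_mul_of_nonneg_left h ha

theorem mul_le_right {a b c : ℝ} (h : b ≤ c) (ha : 0 ≤ a) : b * a ≤ c * a :=
  mul_le_mul_of_nonneg_right h ha

theorem mvt {S : Set ℝ} {f f' : ℝ → ℝ} {x y : ℝ} (hS : Convex ℝ S)
    (hf : ∀ t ∈ S, HasDerivAt f (f' t) t) (hC : ∀ t ∈ S, |f' t| ≤ C) (hx : x ∈ S) (hy : y ∈ S) :
    |f y - f x| ≤ C * |y - x| :=
  hS.norm_image_sub_le_of_norm_hasDerivWithin_le (fun t ht => (hf t ht).hasDerivWithinAt) hC hx hy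

/-- The `i`-th partial derivative. -/
def pd {n : ℕ} (i : Fin n) (f : EE n → ℝ) (x : EE n) : ℝ :=
  fderiv ℝ f x (single i 1)

theorem lap_eq (f : EE n → ℝ) (y : EE n) : lap n f y = ∑ i, pd i (pd i f) y := rfl

theorem rho_pos (y : EE n) : 0 < rho n y := by
  unfold rho; positivity

theorem rho_cont : Continuous (rho n) := by
  unfold rho; fun_prop

theorem rho_contDiff {m : ℕ∞} : ContDiff ℝ m (rho n) := by
  exact contDiff_const.mul (((contDiff_norm_sq ℝ).neg.div_const _).exp)

theorem rho_neg (y : EE n) : rho n (-y) = rho n y := by simp [rho]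

theorem integrable_exp_neg_sq {b : ℝ} (hb : 0 < b) :
    Integrable (fun y : EE n => exp (-b * ‖y‖^2)) := by
  apply Integrable.of_integral_ne_zero
  rw [GaussianFourier.integral_rexp_neg_mul_sq_norm hb]
  positivity

theorem integral_rho : ∫ y, rho n y = 1 := by
  unfold rho
  rw [integral_const_mul]
  have : (fun y : EE n => exp (-‖y‖^2 / 4)) = fun y => exp (-(1/4) * ‖y‖^2) := by
    grind
  rw [this, GaussianFourier.integral_rexp_neg_mul_sq_norm (by norm_num)]
  simp only [finrank_euclideanSpace, Fintype.card_fin]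
  rw [show π / (1 / 4) = 4 * π by ring, ← rpow_add (by positivity)]
  rw [show -(n:ℝ)/2 + n/2 = 0 by ring, rpow_zero]

/-- polynomials are dominated by Gaussians -/
theorem poly_le_exp (m) {b : ℝ} (hb : 0 < b) :
    ∃ C > 0, ∀ r, 0 ≤ r → (1 + r)^m ≤ C * exp (b * r^2) := by
  refine ⟨m.factorial * exp (1 + 1 / (4 * b)), by positivity, fun r hr => ?_⟩
  have h1 : (1 + r)^m ≤ m.factorial * exp (1 + r) := by
    have := pow_div_factorial_le_exp (1 + r) (by linarith) m
    rw [div_le_iff₀ (by positivity)] at this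
    linarith
  have h2 : exp (1 + r) ≤ exp (1 + 1 / (4 * b)) * exp (b * r^2) := by
    rw [← exp_add]; apply exp_le_exp.2
    have : 0 ≤ b * (r - 1 / (2 * b))^2 := by positivity
    have e : b * (r - 1 / (2 * b))^2 = b * r^2 - r + 1 / (4 * b) := by
      grind
    linarith
  nlinarith

theorem integrable_pow_mul_exp (m) {b : ℝ} (hb : 0 < b) :
    Integrable (fun y : EE n => (1 + ‖y‖)^m * exp (-b * ‖y‖^2)) := by
  obtain ⟨C, hC, h⟩ := poly_le_exp m (half_pos hb)
  refine Integrable.mono' ((integrable_exp_neg_sq (half_pos hb)).const_mul C)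
    (by fun_prop) (.of_forall fun y => ?_)
  rw [norm_of_nonneg (by positivity)]
  calc (1 + ‖y‖)^m * exp _
      ≤ C * exp _ * exp (-b * ‖y‖^2) := by
        bound
    _ = C * exp _ := by
        rw [mul_assoc, ← exp_add]; grind

theorem integrable_pow_mul_rho (m) :
    Integrable (fun y : EE n => (1 + ‖y‖)^m * rho n y) := by
  have := (integrable_pow_mul_exp (n := n) m (b := 1/4) (by norm_num)).const_mul
    ((4 * π)^(-(n : ℝ) / 2))
  refine this.congr (.of_forall fun y => ?_)
  simp [rho]
  grind

theorem rho_integrable : Integrable (rho n) := by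
  simpa using integrable_pow_mul_rho 0

/-- integrability of a function of polynomial growth against `rho` -/
theorem integrable_of_growth {m : ℕ}
    (hf : AEStronglyMeasurable f volume) (h : ∀ y, |f y| ≤ C * (1 + ‖y‖)^m) :
    Integrable (fun y => f y * rho n y) := by
  refine Integrable.mono' ((integrable_pow_mul_rho m).const_mul C)
    (hf.mul rho_cont.aestronglyMeasurable) (.of_forall fun y => ?_)
  rw [norm_eq_abs, abs_mul, abs_of_pos (rho_pos y), ← mul_assoc]
  exact mul_le_right (h y) (rho_pos y).le

theorem abs_integral_rho_le (h : ∀ y, |f y| ≤ C) :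
    |∫ y, f y * rho n y| ≤ C := by
  have h1 := norm_integral_le_of_norm_le (f := fun y => f y * rho n y)
    ((rho_integrable).const_mul C) (.of_forall fun y => by
      rw [norm_eq_abs, abs_mul, abs_of_pos (rho_pos y)]
      exact mul_le_right (h y) (rho_pos y).le)
  rwa [integral_const_mul, integral_rho, mul_one] at h1

theorem pd_add (hf : DifferentiableAt ℝ f x)
    (hg : DifferentiableAt ℝ g x) : pd i (fun y => f y + g y) x = pd i f x + pd i g x := by
  simp [pd, fderiv_fun_add hf hg]

theorem pd_sub (hf : DifferentiableAt ℝ f x)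
    (hg : DifferentiableAt ℝ g x) : pd i (fun y => f y - g y) x = pd i f x - pd i g x := by
  simp [pd, fderiv_fun_sub hf hg]

theorem pd_mul (hf : DifferentiableAt ℝ f x)
    (hg : DifferentiableAt ℝ g x) :
    pd i (fun y => f y * g y) x = pd i f x * g x + f x * pd i g x := by
  simp only [pd, fderiv_fun_mul hf hg]
  simp; ring

theorem pd_const_mul (c) :
    pd i (fun y => c * f y) x = c * pd i f x := by
  simp [pd]
  rw [(show (fun y => c * f y) = c • f by ext; simp), fderiv_const_smul_field]; simp

theorem pd_const {c : ℝ} : pd i (fun _ => c) x = 0 := by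
  simp [pd]

theorem pd_comp {g : ℝ → ℝ} {g' : ℝ}
    (hg : HasDerivAt g g' (f x)) (hf : DifferentiableAt ℝ f x) :
    pd i (fun y => g (f y)) x = g' * pd i f x := by
  have := (hg.comp_hasFDerivAt x hf.hasFDerivAt).fderiv
  simp [pd]
  have h2 : (fun y => g _) = g ∘ f := rfl
  aesop

theorem pd_coord {j : Fin n} : pd i (fun y => y j) x = if i = j then 1 else 0 := by
  have : (fun y : EE n => y j) = (EuclideanSpace.proj j) := by simp
  simp [pd]
  rw [this, ContinuousLinearMap.fderiv]
  aesop

theorem pd_normsq : pd i (fun y => ‖y‖^2) x = 2 * x i := by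
  simp only [pd]
  rw [(hasStrictFDerivAt_norm_sq x).hasFDerivAt.fderiv]
  simp [EuclideanSpace.inner_single_right]

/-- derivative of a rescaled and translated function -/
theorem pd_affine {c : EE n} {r : ℝ}
    (hf : DifferentiableAt ℝ f (c + r • x)) :
    pd i (fun y => f (c + r • y)) x = r * pd i f (c + r • x) := by
  have := (hf.hasFDerivAt.comp x ((by fun_prop) : HasFDerivAt (fun y : EE n => c + r • y) (r • ContinuousLinearMap.id ℝ (EE n)) x)).fderiv
  have h2 : (fun y => f _) = f ∘ (fun y => c + r • y) := rfl
  simp only [pd]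
  aesop

theorem pd_rho (x) : pd i (rho n) x = -(x i / 2) * rho n x := by
  have h2 : rho n = fun y => (4 * π)^(-(n : ℝ) / 2) * exp (-(1/4) * ‖y‖^2) := by
    ext y; unfold rho; congr 2; ring
  rw [h2, pd_const_mul, pd_comp (Real.hasDerivAt_exp _)
    ((contDiff_norm_sq ℝ (n := 1)).differentiable (by simp) x |>.const_mul _), pd_const_mul,
    pd_normsq]
  ring

theorem pd_contDiff {m k : ℕ∞} (hf : ContDiff ℝ k f) (h : m + 1 ≤ k) :
    ContDiff ℝ m (pd i f) := by
  have : ContDiff ℝ m _ := hf.fderiv_right (by exact_mod_cast h)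
  exact this.clm_apply contDiff_const

theorem pd_line (t)
    (hf : DifferentiableAt ℝ f (x + t • single i 1)) :
    HasDerivAt (fun t : ℝ => f (x + t • single i 1))
      (pd i f (x + t • single i 1)) t := by
  have h1 : HasDerivAt (fun t => x + t • (single i 1))
      (single i 1 : EE n) t := by
    simpa using ((hasDerivAt_id t).smul_const _).const_add x
  exact hf.hasFDerivAt.comp_hasDerivAt t h1

/-- integration by parts -/
theorem pd_ibp (hf : Differentiable ℝ f) (hg : Differentiable ℝ g)
    (h1 : Integrable (fun x => pd i f x * g x)) (h2 : Integrable (fun x => f x * pd i g x))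
    (h3 : Integrable (fun x => f x * g x)) :
    ∫ x, f x * pd i g x = - ∫ x, pd i f x * g x :=
  integral_mul_fderiv_eq_neg_fderiv_mul_of_integrable h1 h2 h3 (fun x _ => hf x) (fun x _ => hg x)

theorem pd_differentiable (hf : ContDiff ℝ 2 f) :
    Differentiable ℝ (pd i f) :=
  (pd_contDiff (m := 1) hf (by norm_num)).differentiable (by simp)

theorem pd_continuous (hf : ContDiff ℝ 1 f) :
    Continuous (pd i f) :=
  (pd_contDiff (m := 0) hf (by norm_num)).continuous

theorem pdpd_continuous {j : Fin n} (hf : ContDiff ℝ 2 f) :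
    Continuous (pd i (pd j f)) :=
  pd_continuous (pd_contDiff hf (by norm_num))

theorem lap_continuous (hf : ContDiff ℝ 2 f) : Continuous (lap n f) := by
  exact continuous_finsetSum _ fun i _ => pdpd_continuous hf

theorem lap_add (hf : ContDiff ℝ 2 f) (hg : ContDiff ℝ 2 g) (x : EE n) :
    lap n (fun y => f y + g y) x = lap n f x + lap n g x := by
  simp only [lap_eq, ← Finset.sum_add_distrib]
  refine Finset.sum_congr rfl fun i _ => ?_
  have : pd i (fun y => f y + g y) = fun y => pd i f y + pd i g y := by
    ext y; exact pd_add (hf.differentiable (by simp) y) (hg.differentiable (by simp) y)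
  rw [this, pd_add (pd_differentiable hf x) (pd_differentiable hg x)]

theorem lap_mul (hf : ContDiff ℝ 2 f) (hg : ContDiff ℝ 2 g) (x : EE n) :
    lap n (fun y => f y * g y) x =
      lap n f x * g x + 2 * ∑ i, pd i f x * pd i g x + f x * lap n g x := by
  simp only [lap_eq, Finset.mul_sum, Finset.sum_mul, ← Finset.sum_add_distrib]
  refine Finset.sum_congr rfl fun i _ => ?_
  have df := hf.differentiable (by simp)
  have dg := hg.differentiable (by simp)
  have : pd i (fun y => f y * g y) = fun y => pd i f y * g y + f y * pd i g y := by
    ext y; exact pd_mul (df y) (dg y)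
  rw [this, pd_add ((pd_differentiable hf x).fun_mul (dg x))
    ((df x).fun_mul (pd_differentiable hg x)),
    pd_mul (pd_differentiable hf x) (dg x), pd_mul (df x) (pd_differentiable hg x)]
  ring

/-- the heat kernel -/
def GK (n : ℕ) (q : ℝ) (z : EE n) : ℝ :=
  (4 * π * q)^(-(n : ℝ) / 2) * exp (-‖z‖^2 / (4 * q))

theorem GK_nonneg (hθ : 0 ≤ θ) (z) : 0 ≤ GK n θ z := by
  unfold GK; positivity

theorem GK_contDiff (θ) (x) (m : ℕ∞) : ContDiff ℝ m (fun y => GK n θ (x - y)) := by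
  exact contDiff_const.mul ((((contDiff_norm_sq ℝ).comp
    (by fun_prop)).neg.div_const _).exp)

theorem GK_pd (x y) (i) :
    pd i (fun y => GK n θ (x - y)) y = (x - y) i / (2 * θ) * GK n θ (x - y) := by
  have h2 : (fun y => GK n θ (x - y)) = fun y => (4 * π * θ)^(-(n : ℝ) / 2) *
      exp (-(1 / (4 * θ)) * ‖x + (-1 : ℝ) • y‖^2) := by
    ext y; unfold GK; rw [show x + (-1 : ℝ) • y = x - y by aesop]; ring
  have hd : Differentiable ℝ (fun z : EE n => ‖z‖^2) :=
    (contDiff_norm_sq ℝ (n := 1)).differentiable (by simp)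
  rw [h2, pd_const_mul, pd_comp (f := fun y => -(1 / (4 * θ)) * ‖x + (-1 : ℝ) • y‖^2)
    (Real.hasDerivAt_exp _) (((hd _).comp y (by fun_prop)).const_mul _), pd_const_mul,
    pd_affine (hd _), pd_normsq]
  have e : x + (-1 : ℝ) • y = x - y := by aesop
  rw [e]; unfold GK
  grind

theorem GK_pd_fun (x) (i) :
    pd i (fun y => GK n θ (x - y)) = fun y => (x - y) i / (2 * θ) * GK n θ (x - y) := by
  ext y; exact GK_pd x y i

theorem GK_lap (hθ : 0 < θ) (x y : EE n) :
    lap n (fun y => GK n θ (x - y)) y =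
      (‖x - y‖^2 / (4 * θ^2) - n / (2 * θ)) * GK n θ (x - y) := by
  have : ∀ i, pd i (pd i (fun y => GK n θ (x - y))) y =
      ((x - y) i^2 / (4 * θ^2) - 1 / (2 * θ)) * GK n θ (x - y) := by
    intro i
    have e : pd i (fun y => (x - y) i / (2 * θ)) y = - (1 / (2 * θ)) := by
      have : (fun y => (x - y) i / (2 * θ)) =
          fun y => x i / (2 * θ) - (1 / (2 * θ)) * y i := by
        ext y; simp; ring
      rw [this, pd_sub (by fun_prop) (by fun_prop), pd_const, pd_const_mul, pd_coord]
      simp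
    rw [GK_pd_fun, pd_mul (by fun_prop) ((GK_contDiff θ x 1).differentiable (by simp) y), e,
      GK_pd]
    ring
  rw [lap_eq, Finset.sum_congr rfl fun i _ => this i, ← Finset.sum_mul, Finset.sum_sub_distrib,
    ← Finset.sum_div, ← EuclideanSpace.real_norm_sq_eq]
  simp
  left; field_simp

theorem GK_hasDerivAt (hθ : 0 < q) (z : EE n) :
    HasDerivAt (fun q => GK n q z) ((‖z‖^2 / (4 * q^2) - n / (2 * q)) * GK n q z) q := by
  have h1 : HasDerivAt (fun q : ℝ => (4 * π * q)^(-(n : ℝ) / 2))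
      ((4 * π) * (-n / 2) * (4 * π * q)^(-(n : ℝ) / 2 - 1)) q := by
    have := ((hasDerivAt_id q).const_mul (4 * π)).rpow_const (p := -n / 2)
      (Or.inl (by positivity))
    grind
  have h2 : HasDerivAt (fun q : ℝ => exp (-‖z‖^2 / (4 * q)))
      (exp (-‖z‖^2 / (4 * q)) * (‖z‖^2 / (4 * q^2))) q := by
    have h3 : HasDerivAt (fun q : ℝ => -‖z‖^2 / (4 * q)) (‖z‖^2 / (4 * q^2)) q := by
      have := (hasDerivAt_const q (-‖z‖^2)).div ((hasDerivAt_id q).const_mul 4)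
        (by positivity)
      convert! this using 1
      simp; field_simp
    exact h3.exp
  refine (h1.mul h2).congr_deriv ?_
  unfold GK
  rw [rpow_sub_one (by positivity)]
  field_simp
  ring

theorem GK_eq_rho (hθ : 0 < θ) (z) :
    GK n θ z = (√θ^n)⁻¹ * rho n ((√θ)⁻¹ • z) := by
  unfold GK rho
  have h1 : (4 * π * θ)^(-(n : ℝ) / 2) = (√θ^n)⁻¹ * (4 * π)^(-(n : ℝ) / 2) := by
    rw [mul_rpow (by positivity) hθ.le, mul_comm]
    rw [sqrt_eq_rpow, ← rpow_natCast, ← rpow_mul hθ.le, ← rpow_neg hθ.le]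
    grind
  rw [h1, norm_smul, mul_pow, mul_assoc, norm_inv, inv_pow,
    norm_of_nonneg (sqrt_nonneg _), sq_sqrt hθ.le]
  field_simp

theorem integral_GK (hθ : 0 < θ) (x) (f : EE n → ℝ) :
    ∫ y, f y * GK n θ (x - y) = ∫ ζ, f (x + √θ • ζ) * rho n ζ := by
  have h1 : ∫ ζ, f (x + √θ • ζ) * rho n ζ
      = ∫ ζ, (fun z => f (x + z) * rho n ((√θ)⁻¹ • z)) (√θ • ζ) := by
    refine integral_congr_ae (.of_forall fun ζ => ?_)
    simp only [smul_smul, inv_mul_cancel₀ (sqrt_pos.2 hθ).ne', one_smul]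
  rw [h1, Measure.integral_comp_smul volume (fun z => f _ * rho n _) _,
    finrank_euclideanSpace, Fintype.card_fin,
    abs_of_pos (by positivity), smul_eq_mul, ← integral_const_mul,
    ← integral_add_left_eq_self (fun y => f y * GK n θ _) x]
  refine integral_congr_ae (.of_forall fun z => ?_)
  simp only [GK_eq_rho hθ]
  rw [show (√θ)⁻¹ • (x - (x + z)) = -((√θ)⁻¹ • z) by simp, rho_neg]
  ring

theorem GK_integrable (hθ : 0 < θ) (x) :
    Integrable (fun y => GK n θ (x - y)) := by
  apply Integrable.of_integral_ne_zero
  have := integral_GK hθ x (fun _ => 1)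
  simp [one_mul] at this
  rw [this, integral_rho]; norm_num

/-- Weak solutions of `v_t = Δv + F` in `U × (a,b)` -/
structure WSol (U : Set (EE n)) (a b : ℝ) (v F : EE n → ℝ → ℝ) : Prop where
  contv : ∀ t ∈ Ioo a b, Continuous (fun y => v y t)
  contF : ∀ t ∈ Ioo a b, Continuous (fun y => F y t)
  timev : ∀ y, ContinuousOn (v y) (Ioo a b)
  bv : ∃ M, ∀ y, ∀ t ∈ Ioo a b, |v y t| ≤ M
  wf : ∀ f : EE n → ℝ, ContDiff ℝ 2 f → HasCompactSupport f → tsupport f ⊆ U →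
    ∀ t ∈ Ioo a b, HasDerivAt (fun i => ∫ y, v y i * f y)
      (∫ y, (v y t * lap n f y + F y t * f y)) t

theorem WSol.mono {U' : Set _} {α' β' : ℝ} (h : WSol U α β v F)
    (hU : U' ⊆ U) (ha : α ≤ α') (hb : β' ≤ β) : WSol U' α' β' v F := by
  have hs := Ioo_subset_Ioo ha hb
  obtain ⟨M, hM⟩ := h.bv
  exact ⟨fun t ht => h.contv t (hs ht), fun t ht => h.contF t (hs ht),
    fun y => (h.timev y).mono hs, ⟨M, fun y t ht => hM y t (hs ht)⟩,
    fun ψ h1 h2 h3 t ht => h.wf ψ h1 h2 (h3.trans hU) t (hs ht)⟩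

theorem lap_eq_zero_of_notMem {y : EE n} (hy : y ∉ tsupport ψ) :
    lap n ψ y = 0 := by
  rw [lap_eq]
  refine Finset.sum_eq_zero fun i _ => ?_
  have h1 : pd i ψ =ᶠ[𝓝 y] 0 := by
    filter_upwards [(notMem_tsupport_iff_eventuallyEq.1 hy).eventuallyEq_nhds] with z hz
    have : fderiv ℝ ψ z = fderiv ℝ (fun _ => 0) z := Filter.EventuallyEq.fderiv_eq hz
    simp [pd, this]
  have : fderiv ℝ _ y = fderiv ℝ (fun _ => (0:ℝ)) y := Filter.EventuallyEq.fderiv_eq h1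
  unfold pd at this ⊢
  rw [this]; simp

theorem integrable_mul_of_compact (hf : Continuous f) (hψ : Continuous ψ)
    (hc : HasCompactSupport ψ) : Integrable (fun y => f y * ψ y) :=
  (hf.mul hψ).integrable_of_hasCompactSupport hc.mul_left

theorem lap_hasCompactSupport (hc : HasCompactSupport ψ) :
    HasCompactSupport (lap n ψ) :=
  HasCompactSupport.intro hc fun _ hy => lap_eq_zero_of_notMem hy

/-- time dependent test functions -/
theorem WSol.time_test {K : Set (EE n)} {Ψ Ψ' : EE n → ℝ → ℝ}
    (h : WSol U α β v F) (hK : IsCompact K) (hKU : K ⊆ U)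
    (h2 : ∀ σ ∈ Ioo α β, ContDiff ℝ 2 (fun y => Ψ y σ))
    (hsupp : ∀ σ ∈ Ioo α β, ∀ y ∉ K, Ψ y σ = 0)
    (hd : ∀ y, ∀ σ ∈ Ioo α β, HasDerivAt (Ψ y) (Ψ' y σ) σ) (hC : ∀ y ∈ K, ∀ σ ∈ Ioo α β, |Ψ' y σ| ≤ C)
    {σ : ℝ} (hσ : σ ∈ Ioo α β) (hm : Continuous (fun y => Ψ' y σ)) :
    HasDerivAt (fun σ => ∫ y, v y σ * Ψ y σ)
      (∫ y, (v y σ * (lap n (fun y => Ψ y σ) y + Ψ' y σ) + F y σ * Ψ y σ)) σ := by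
  obtain ⟨M, hM⟩ := h.bv
  have hcs : ∀ σ ∈ Ioo α β, HasCompactSupport (fun y => Ψ y σ) := fun σ hσ =>
    HasCompactSupport.intro hK (hsupp σ hσ)
  have hΨ'0 : ∀ σ ∈ Ioo α β, ∀ y ∉ K, Ψ' y σ = 0 := by
    intro σ hσ y hy
    have h0 : Ψ y =ᶠ[𝓝 σ] fun _ => 0 := by
      filter_upwards [Ioo_mem_nhds hσ.1 hσ.2] with τ hτ using hsupp τ hτ y hy
    exact ((hd y σ hσ).congr_of_eventuallyEq h0.symm).unique (hasDerivAt_const σ 0)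
  have hC' : ∀ y, ∀ τ ∈ Ioo α β, |Ψ' y τ| ≤ K.indicator (fun _ => C) y := by
    intro y τ hτ
    by_cases hy : y ∈ K
    · simpa [hy] using hC y hy τ hτ
    · simp [hy, hΨ'0 τ hτ y hy]
  have hsl : ∀ y, ∀ τ ∈ Ioo α β, |Ψ y τ - Ψ y σ| ≤ K.indicator (fun _ => C) y * |τ - σ| := by
    intro y τ hτ
    have := mvt (convex_Ioo α β)
      (f := Ψ y) (f' := Ψ' y) (C := K.indicator (fun _ => C) y)
      (hd y) (hC' y) hσ hτ
    simpa using this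
  -- static part
  have hA := h.wf _ (h2 σ hσ) (hcs σ hσ)
    ((closure_minimal (fun y hy => by
      by_contra hyK; exact hy (hsupp σ hσ y hyK)) hK.isClosed).trans hKU) σ hσ
  rw [hasDerivAt_iff_tendsto_slope] at hA ⊢
  have hint : ∀ τ ∈ Ioo α β, ∀ τ' ∈ Ioo α β, Integrable (fun y => v y τ * Ψ y τ') :=
    fun τ hτ τ' hτ' => integrable_mul_of_compact (h.contv τ hτ) (by fun_prop) (hcs τ' hτ')
  have hB : Tendsto (fun τ => ∫ y, v y τ * ((τ - σ)⁻¹ * (Ψ y τ - Ψ y σ))) (𝓝[≠] σ)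
      (𝓝 (∫ y, v y σ * Ψ' y σ)) := by
    have hev : ∀ᶠ τ in 𝓝[≠] σ, τ ∈ Ioo α β :=
      eventually_nhdsWithin_of_eventually_nhds (Ioo_mem_nhds hσ.1 hσ.2)
    refine tendsto_integral_filter_of_dominated_convergence
      (bound := fun y => M * K.indicator (fun _ => C) y) ?_ ?_ ?_ ?_
    · filter_upwards [hev] with τ hτ
      exact ((h.contv τ hτ).mul (by fun_prop)).aestronglyMeasurable
    · filter_upwards [hev, self_mem_nhdsWithin] with τ hτ hne
      refine .of_forall fun y => ?_
      have hne' : 0 < |τ - σ| := abs_pos.2 (sub_ne_zero.2 hne)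
      rw [norm_eq_abs, abs_mul, abs_mul, abs_inv]
      have h3 : |τ - σ|⁻¹ * |Ψ y τ - Ψ y σ| ≤ K.indicator (fun _ => C) y := by
        rw [inv_mul_le_iff₀ hne', mul_comm]; bound
      exact mul_le_mul (hM y τ hτ) h3 (by positivity) ((abs_nonneg _).trans (hM y τ hτ))
    · exact ((integrable_indicator_iff hK.measurableSet).2
        (integrableOn_const hK.measure_lt_top.ne)).const_mul M
    · refine .of_forall fun y => ?_
      have t1 : Tendsto (v y) (𝓝[≠] σ) (𝓝 (v y σ)) :=
        ((h.timev y).continuousAt (Ioo_mem_nhds hσ.1 hσ.2)).tendsto.mono_left nhdsWithin_le_nhds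
      have t2 := (hasDerivAt_iff_tendsto_slope.1 (hd y σ hσ))
      exact t1.mul t2
  have hsum := hA.add hB
  have e1 : (∫ y, (v y σ * lap n (fun y => Ψ y σ) y + F y σ * Ψ y σ)) + ∫ y, v y σ * Ψ' y σ
      = ∫ y, (v y σ * (lap n (fun y => Ψ y σ) y + Ψ' y σ) + F y σ * Ψ y σ) := by
    rw [← integral_add]
    · congr 1; ext y; ring
    · exact (integrable_mul_of_compact (h.contv σ hσ) (lap_continuous (h2 σ hσ))
        (lap_hasCompactSupport (hcs σ hσ))).add
        (integrable_mul_of_compact (h.contF σ hσ) (by fun_prop) (hcs σ hσ))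
    · exact integrable_mul_of_compact (h.contv σ hσ) hm (HasCompactSupport.intro hK (hΨ'0 σ hσ))
  rw [e1] at hsum
  refine hsum.congr' ?_
  filter_upwards [eventually_nhdsWithin_of_eventually_nhds (Ioo_mem_nhds hσ.1 hσ.2)] with τ hτ
  simp only [slope, vsub_eq_sub, smul_eq_mul]
  rw [← integral_sub (hint τ hτ σ hσ) (hint σ hσ σ hσ),
    ← integral_sub (hint τ hτ τ hτ) (hint σ hσ σ hσ), ← integral_const_mul, ← integral_const_mul,
    ← integral_add]
  · grind
  · exact ((hint τ hτ σ hσ).sub (hint σ hσ σ hσ)).const_mul _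
  · have := ((hint τ hτ τ hτ).sub (hint τ hτ σ hσ)).const_mul (τ - σ)⁻¹
    refine this.congr (.of_forall fun y => ?_)
    simp only [Pi.sub_apply]; ring

/-- Duhamel's formula with a cutoff, in differential form -/
theorem WSol.duhamel
    (h : WSol U α β v F) (hη : ContDiff ℝ 2 η) (hηc : HasCompactSupport η)
    (hηU : tsupport η ⊆ U) {τ : ℝ} (hτ : β < τ) {σ : ℝ} (hσ : σ ∈ Ioo α β) :
    HasDerivAt (fun σ => ∫ y, v y σ * (η y * GK n (τ - σ) (x - y)))
      (∫ y, (v y σ * (lap n η y * GK n (τ - σ) (x - y) +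
          2 * ∑ i, pd i η y * ((x - y) i / (2 * (τ - σ)) * GK n (τ - σ) (x - y)))
        + F y σ * (η y * GK n (τ - σ) (x - y)))) σ := by
  have hcont : ContinuousOn (fun q : EE n × ℝ => -(η q.1 *
      ((‖x - q.1‖^2 / (4 * (τ - q.2)^2) - n / (2 * (τ - q.2))) * GK n (τ - q.2) (x - q.1))))
      (tsupport η ×ˢ Icc α β) := by
    have hp : ∀ q ∈ tsupport η ×ˢ Icc α β, 0 < τ - q.2 := fun q hq => by
      have := hq.2.2; linarith
    unfold GK
    have := hη.continuous
    refine ContinuousOn.neg (ContinuousOn.mul (by fun_prop) (ContinuousOn.mul (ContinuousOn.sub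
      (ContinuousOn.div (by fun_prop) (by fun_prop) fun q hq => ?_)
      (ContinuousOn.div (by fun_prop) (by fun_prop) fun q hq => ?_)) (ContinuousOn.mul
        (ContinuousOn.rpow_const (by fun_prop) fun q hq => Or.inl ?_)
        (ContinuousOn.rexp (ContinuousOn.div (by fun_prop) (by fun_prop) fun q hq => ?_)))))
    all_goals have := hp q hq; positivity
  obtain ⟨C, hC⟩ := (hηc.isCompact.prod isCompact_Icc).exists_bound_of_continuousOn hcont
  have := h.time_test (K := tsupport η)
    (Ψ' := fun y σ => -(η y * ((‖x - y‖^2 / (4 * (τ - σ)^2) - n / (2 * (τ - σ))) *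
      GK n (τ - σ) (x - y)))) hηc hηU
    (fun σ _ => hη.mul (GK_contDiff _ _ 2))
    (fun σ _ y hy => by simp [image_eq_zero_of_notMem_tsupport hy])
    (fun y σ hσ => by
      have hp : 0 < τ - σ := by grind
      have := ((GK_hasDerivAt hp (x - y)).comp σ ((hasDerivAt_id σ).const_sub τ)).const_mul (η y)
      exact this.congr_deriv (by simp))
    (C := C) (fun y hy σ hσ => hC (y, σ) ⟨hy, Ioo_subset_Icc_self hσ⟩) hσ
    (by
      have h2 := (GK_contDiff (τ - σ) x 0).continuous
      fun_prop)
  convert this using 3 with y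
  rw [lap_mul hη (GK_contDiff _ _ 2), GK_lap (by linarith [hσ.2])]
  simp only [GK_pd]
  ring

/-- the heat semigroup -/
def SG (n : ℕ) (q : ℝ) (f : EE n → ℝ) (x : EE n) : ℝ :=
  ∫ z, f (x + √q • z) * rho n z

theorem rho_line_deriv (z h : EE n) (t : ℝ) :
    HasDerivAt (fun t : ℝ => rho n (z + t • h))
      (-((inner ℝ z h + t * ‖h‖^2) / 2) * rho n (z + t • h)) t := by
  have e : ∀ t, ‖z + t • h‖^2 = ‖z‖^2 + 2 * (t * inner ℝ z h) + t^2 * ‖h‖^2 := by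
    intro t
    rw [norm_add_sq_real, inner_smul_right, norm_smul, mul_pow, norm_eq_abs, sq_abs]
  unfold rho
  simp only [e]
  have h1 : HasDerivAt (fun t => -(‖z‖^2 + 2 * (t * inner ℝ z h) + t^2 * ‖h‖^2) / 4)
      (-((inner ℝ z h + t * ‖h‖^2) / 2)) t := by
    have a2 := ((hasDerivAt_pow 2 t).mul_const (‖h‖^2))
    have a3 := ((((((hasDerivAt_id t).mul_const (inner ℝ z h)).const_mul 2).const_add (‖z‖^2)).add a2).neg).div_const 4
    refine HasDerivAt.congr_deriv a3 ?_
    ring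
  refine (h1.exp.const_mul _).congr_deriv ?_
  ring

/-- majorant for the increments of the Gaussian -/
def rhoMaj (n : ℕ) (z : EE n) : ℝ :=
  (4 * π)^(-(n : ℝ) / 2) * exp (1 / 4) *
    ((1 + ‖z‖)^2 * exp (-(1 / 8) * ‖z‖^2))

theorem rho_shift_le (z h : EE n) (hh : ‖h‖ ≤ 1) {t : ℝ} (ht : |t| ≤ 1) :
    rho n (z + t • h) ≤ (4 * π)^(-(n : ℝ) / 2) * exp (1 / 4) *
      exp (-(1 / 8) * ‖z‖^2) := by
  unfold rho
  rw [mul_assoc, ← exp_add]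
  gcongr
  have h1 : ‖t • h‖ ≤ 1 := by
    rw [norm_smul, norm_eq_abs]; bound
  have h2 : ‖z‖ ≤ ‖z + t • h‖ + 1 := by
    have := norm_sub_le (z + t • h) (t • h)
    simp only [add_sub_cancel_right] at this
    linarith
  nlinarith [norm_nonneg z, sq_nonneg (‖z + t • h‖ - 1)]

theorem rho_deriv_bound (z h : EE n) (hh : ‖h‖ ≤ 1) {t : ℝ} (ht : |t| ≤ 1) :
    |-((inner ℝ z h + t * ‖h‖^2) / 2) * rho n (z + t • h)| ≤ ‖h‖ * rhoMaj n z := by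
  have h0 := rho_shift_le z h hh ht
  have h1 : |inner ℝ z h + t * ‖h‖^2| ≤ ‖h‖ * (1 + ‖z‖) := by
    have a1 := abs_real_inner_le_norm z h
    have a2 : |t * ‖h‖^2| ≤ ‖h‖ := by
      rw [abs_mul, abs_of_nonneg (sq_nonneg ‖h‖)]
      nlinarith [norm_nonneg h]
    calc _ ≤ |inner ℝ z h| + |t * ‖h‖^2| := abs_add_le _ _
      _ ≤ _ := by nlinarith
  rw [abs_mul, abs_of_pos (rho_pos _), abs_neg, abs_div, abs_two]
  unfold rhoMaj
  calc |inner ℝ z h + t * ‖h‖^2| / 2 * rho n _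
      ≤ (‖h‖ * (1 + ‖z‖)^2) * ((4 * π)^(-(n : ℝ) / 2) * exp (1 / 4) *
      exp _) := by
        refine mul_le_mul ?_ h0 (rho_pos _).le (by positivity)
        nlinarith [norm_nonneg z, norm_nonneg h]
    _ = _ := by ring

theorem rho_diff1 (z h : EE n) (hh : ‖h‖ ≤ 1) :
    |rho n (z + h) - rho n z| ≤ ‖h‖ * rhoMaj n z := by
  have := mvt (convex_Icc (0:ℝ) 1)
    (f := fun t : ℝ => rho n (z + t • h)) (C := ‖h‖ * rhoMaj n z)
    (fun t _ => rho_line_deriv z h t)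
    (fun t ht => rho_deriv_bound z h hh (by grind))
    (left_mem_Icc.2 zero_le_one) (right_mem_Icc.2 zero_le_one)
  aesop

theorem rho_diff2 (z h : EE n) (hh : ‖h‖ ≤ 1) :
    |rho n (z + h) + rho n (z - h) - 2 * rho n z| ≤ 4 * (‖h‖^2 * rhoMaj n z) := by
  set d : ℝ → ℝ := fun t => -((inner ℝ z h + t * ‖h‖^2) / 2) * rho n (z + t • h)
  have hd2 : ∀ t, HasDerivAt d (-(‖h‖^2 / 2) * rho n (z + t • h) +
      -((inner ℝ z h + t * ‖h‖^2) / 2) *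
        (-((inner ℝ z h + t * ‖h‖^2) / 2) * rho n (z + t • h))) t := by
    intro t
    refine HasDerivAt.mul ?_ (rho_line_deriv z h t)
    have := ((((hasDerivAt_id t).mul_const (‖h‖^2)).const_add (inner ℝ z h)).div_const 2).fun_neg
    aesop
  have hb : ∀ t, |t| ≤ 1 → |-(‖h‖^2 / 2) * rho n (z + t • h) +
      -((inner ℝ z h + t * ‖h‖^2) / 2) *
        (-((inner ℝ z h + t * ‖h‖^2) / 2) * rho n (z + t • h))| ≤ ‖h‖^2 * rhoMaj n z := by
    intro t ht
    have h0 := rho_shift_le z h hh ht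
    have h1 : |inner ℝ z h + t * ‖h‖^2| ≤ ‖h‖ * (1 + ‖z‖) := by
      have a1 := abs_real_inner_le_norm z h
      have a2 : |t * ‖h‖^2| ≤ ‖h‖ := by
        rw [abs_mul, abs_of_nonneg (sq_nonneg ‖h‖)]
        nlinarith [abs_nonneg t, norm_nonneg h]
      calc _ ≤ |inner ℝ z h| + |t * ‖h‖^2| := abs_add_le _ _
        _ ≤ _ := by nlinarith
    have h2 : (inner ℝ z h + t * ‖h‖^2)^2 ≤ (‖h‖ * (1 + ‖z‖))^2 :=
      sq_le_sq' (by linarith [(abs_le.1 h1).1]) (abs_le.1 h1).2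
    have h3 : 1 ≤ (1 + ‖z‖)^2 := by bound
    rw [show -(‖h‖^2 / 2) * rho n (z + t • h) + -((inner ℝ z h + t * ‖h‖^2) / 2) *
        (-((inner ℝ z h + t * ‖h‖^2) / 2) * rho n (z + t • h)) =
        ((inner ℝ z h + t * ‖h‖^2)^2 / 4 - ‖h‖^2 / 2) * rho n (z + t • h) by ring, abs_mul,
        abs_of_pos (rho_pos _)]
    unfold rhoMaj
    calc _ ≤ (‖h‖^2 * (1 + ‖z‖)^2) * ((4 * π)^(-(n : ℝ) / 2) * exp (1 / 4) *
      exp (-(1 / 8) * ‖z‖^2)) := by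
          refine mul_le_mul ?_ h0 (rho_pos _).le (by positivity)
          rw [mul_pow] at h2
          rw [abs_le]
          constructor <;> nlinarith [sq_nonneg ‖h‖, sq_nonneg (inner ℝ z h + t * ‖h‖^2)]
      _ = _ := by ring
  have hdl : ∀ t ∈ Icc (-1:ℝ) 1, ∀ t' ∈ Icc (-1:ℝ) 1,
      |d t - d t'| ≤ ‖h‖^2 * rhoMaj n z * |t - t'| := by
    intro t ht t' ht'
    exact mvt (convex_Icc _ _) (fun t _ => hd2 t) (fun t ht => hb t (abs_le.2 ht)) ht' ht
  have hK : 0 ≤ ‖h‖^2 * rhoMaj n z := by unfold rhoMaj; positivity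
  have := mvt (convex_Icc (0:ℝ) 1)
    (f := fun t : ℝ => rho n (z + t • h) + rho n (z + (-t) • h))
    (f' := fun t => d t - d (-t)) (C := 2 * (‖h‖^2 * rhoMaj n z))
    (fun t _ => by
      have h1 := rho_line_deriv z h t
      have h2 := (rho_line_deriv z h (-t)).scomp t (hasDerivAt_neg t)
      refine (h1.add h2).congr_deriv ?_
      simp [d])
    (fun t ht => by
      refine (hdl t ⟨by linarith [ht.1], ht.2⟩ (-t) ⟨by linarith [ht.2], by linarith [ht.1]⟩).trans ?_
      rw [show t - -t = 2 * t by ring, abs_of_nonneg (by grind)]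
      nlinarith [ht.2])
    (left_mem_Icc.2 zero_le_one) (right_mem_Icc.2 zero_le_one)
  simp at this
  have e : rho n (z + h) + rho n (z - h) - 2 * rho n z
    = rho n (z + h) + rho n (z + -h) - (rho n z + rho n z) := by
    rw [← sub_eq_add_neg]; ring
  rw [e]; linarith

theorem rhoMaj_integrable (n) : Integrable (fun z => (1 + ‖z‖) * rhoMaj n z) := by
  have := (integrable_pow_mul_exp (n := n) 3 (b := 1/8) (by norm_num)).const_mul
    ((4 * π)^(-(n : ℝ) / 2) * exp (1 / 4))
  refine this.congr (.of_forall fun y => ?_)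
  simp only [rhoMaj]; ring

theorem shift_integrable (hΨ : Continuous Ψ)
    (hN : ∀ ζ, |Ψ ζ| ≤ N * (1 + ‖ζ‖)) (h) :
    Integrable (fun ζ => Ψ (ζ + h) * rho n ζ) := by
  have hN0 : 0 ≤ N := by have := (abs_nonneg _).trans (hN 0); aesop
  refine integrable_of_growth (C := N * (1 + ‖h‖)) (m := 1) (by fun_prop) fun y => ?_
  refine (hN _).trans ?_
  rw [pow_one, mul_assoc]
  nlinarith [norm_add_le y h, mul_nonneg (norm_nonneg h) (norm_nonneg y)]

theorem shift_bound
    (hN : ∀ ζ, |Ψ ζ| ≤ N * (1 + ‖ζ‖)) (h) :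
    |∫ ζ, Ψ (ζ + h) * rho n ζ| ≤ N * (1 + ‖h‖) * ∫ ζ : EE n, (1 + ‖ζ‖) * rho n ζ := by
  have hN0 : 0 ≤ N := by have := (abs_nonneg _).trans (hN 0); aesop
  have := norm_integral_le_of_norm_le (f := fun ζ => Ψ (ζ + h) * rho n ζ)
    (by simpa using (integrable_pow_mul_rho 1).const_mul (N * (1 + ‖h‖)))
    (.of_forall fun y => by
      rw [norm_eq_abs, abs_mul, abs_of_pos (rho_pos y), ← mul_assoc]
      refine mul_le_right ?_ (rho_pos y).le
      refine (hN _).trans ?_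
      rw [mul_assoc]
      nlinarith [norm_add_le y h, mul_nonneg (norm_nonneg h) (norm_nonneg y)])
  rwa [integral_const_mul] at this

theorem shift_eq (h) :
    ∫ ζ, Ψ (ζ + h) * rho n ζ = ∫ ζ, Ψ ζ * rho n (ζ - h) := by
  rw [← integral_add_right_eq_self (fun ζ => Ψ ζ * rho n _) h]
  simp

theorem shift_integrable' (hΨ : Continuous Ψ)
    (hN : ∀ ζ, |Ψ ζ| ≤ N * (1 + ‖ζ‖)) (h : EE n) :
    Integrable (fun ζ => Ψ ζ * rho n (ζ - h)) := by
  have := (shift_integrable hΨ hN h).comp_sub_right h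
  aesop

theorem exists_shift1 (n : ℕ) : ∃ C > 0, ∀ (Ψ) (N : ℝ), Continuous Ψ →
    (∀ ζ, |Ψ ζ| ≤ N * (1 + ‖ζ‖)) → ∀ h : EE n, ‖h‖ ≤ 1 →
    |(∫ ζ, Ψ (ζ + h) * rho n ζ) - ∫ ζ, Ψ ζ * rho n ζ| ≤ C * N * ‖h‖ := by
  set A := ∫ ζ : EE n, (1 + ‖ζ‖) * rhoMaj n ζ
  have hA : 0 ≤ A := integral_nonneg fun ζ => by simp only [rhoMaj]; positivity
  refine ⟨A + 1, by positivity, fun Ψ N hΨ hN h hh => ?_⟩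
  have hN0 : 0 ≤ N := by have := (abs_nonneg _).trans (hN 0); aesop
  rw [shift_eq]
  rw [← integral_sub (shift_integrable' hΨ hN h) (by simpa using shift_integrable hΨ hN 0)]
  have := norm_integral_le_of_norm_le
    (f := fun ζ => Ψ ζ * rho n (ζ - h) - Ψ ζ * rho n ζ)
    ((rhoMaj_integrable n).const_mul (N * ‖h‖))
    (.of_forall fun y => by
      rw [norm_eq_abs, ← mul_sub, abs_mul]
      have := rho_diff1 y (-h) (by aesop)
      rw [norm_neg, ← sub_eq_add_neg] at this
      calc _ ≤ (N * (1 + ‖y‖)) * (‖h‖ * rhoMaj n y) := by bound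
        _ = _ := by ring)
  rw [integral_const_mul] at this
  refine this.trans ?_
  nlinarith [mul_nonneg hN0 (norm_nonneg h)]

theorem exists_shift2 (n : ℕ) : ∃ C > 0, ∀ (Ψ : EE n → ℝ) (N : ℝ), Continuous Ψ →
    (∀ z, |Ψ z| ≤ N * (1 + ‖z‖)) → ∀ h : EE n,
    |(∫ z, Ψ (z + h) * rho n z) + (∫ z, Ψ (z - h) * rho n z) - 2 * ∫ z, Ψ z * rho n z|
      ≤ C * N * ‖h‖^2 := by
  set A := ∫ z : EE n, (1 + ‖z‖) * rhoMaj n z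
  set B := ∫ z : EE n, (1 + ‖z‖) * rho n z
  have hA : 0 ≤ A := integral_nonneg fun z => by simp only [rhoMaj]; positivity
  have hB : 0 ≤ B := integral_nonneg fun z => by have := rho_pos z; positivity
  refine ⟨4 * A + 6 * B + 1, by positivity, fun Ψ N hΨ hN h => ?_⟩
  have hN0 : 0 ≤ N := by have := (abs_nonneg _).trans (hN 0); aesop
  rcases le_total ‖h‖ 1 with hh | hh
  · have e2 : ∫ z, Ψ (z - h) * rho n z = ∫ z, Ψ z * rho n (z + h) := by
      have := shift_eq (Ψ := Ψ) (-h); aesop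
    rw [shift_eq, e2]
    have i0 : Integrable (fun z => Ψ z * rho n z) := by simpa using shift_integrable hΨ hN 0
    have i2 : Integrable (fun z => Ψ z * rho n (z + h)) := by
      simpa using shift_integrable' hΨ hN (-h)
    rw [← integral_add (shift_integrable' hΨ hN h) i2, ← integral_const_mul,
      ← integral_sub ((shift_integrable' hΨ hN h).fun_add i2) (i0.const_mul 2)]
    have := norm_integral_le_of_norm_le (μ := volume)
      (f := fun z => Ψ z * rho n (z - h) + Ψ z * rho n (z + h) - 2 * (Ψ z * rho n z))
      ((rhoMaj_integrable n).const_mul (4 * (N * ‖h‖^2)))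
      (.of_forall fun y => by
        have e : Ψ y * rho n (y - h) + Ψ y * rho n (y + h) - 2 * (Ψ y * rho n y) =
          Ψ y * (rho n (y + h) + rho n (y - h) - 2 * rho n y) := by ring
        rw [norm_eq_abs, e, abs_mul]
        calc _ ≤ (N * (1 + ‖y‖)) * (4 * (‖h‖^2 * rhoMaj n y)) := by
              gcongr
              · exact hN y
              · exact rho_diff2 y h hh
          _ = _ := by ring)
    rw [integral_const_mul] at this
    refine this.trans ?_
    nlinarith [mul_nonneg hN0 (sq_nonneg ‖h‖)]
  · have b0 := shift_bound hN 0
    have b1 := shift_bound hN h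
    have b2 := shift_bound hN (-h)
    simp only [add_zero, norm_zero, mul_one, norm_neg, ← sub_eq_add_neg] at b0 b1 b2
    have h3 : 1 + ‖h‖ ≤ 2 * ‖h‖^2 := by nlinarith
    have hBd : ∫ z : EE n, (1 + ‖z‖) * rho n z = B := rfl
    rw [hBd] at b0 b1 b2
    clear_value A B
    generalize ‖h‖ = H at *
    generalize ∫ z, Ψ (z + h) * rho n z = I1 at *
    generalize ∫ z, Ψ (z - h) * rho n z = I2 at *
    generalize ∫ z, Ψ z * rho n z = I0 at *
    have hNB : 0 ≤ N * B := mul_nonneg hN0 hB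
    have h4 : N * (1 + H) * B ≤ 2 * (N * B * H^2) := by
      nlinarith
    have h5 : N * B ≤ N * B * H^2 := (by bound)
    obtain ⟨_, _⟩ := abs_le.1 b0
    obtain ⟨_, _⟩ := abs_le.1 b1
    obtain ⟨_, _⟩ := abs_le.1 b2
    have hAA : 0 ≤ N * H^2 * A := by positivity
    have hAB : 0 ≤ N * H^2 := by positivity
    grind

theorem SG_shift (hθ : 0 < θ) (f) (x e) :
    SG n θ f (x + e) = ∫ ζ, (fun ζ => f (x + √θ • ζ)) (ζ + (√θ)⁻¹ • e) * rho n ζ := by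
  unfold SG
  congr 1; ext ζ
  simp only [smul_add, smul_smul, mul_inv_cancel₀ ((sqrt_pos.2 hθ).ne'), one_smul]
  congr 2; abel

theorem exists_SG_lip (n : ℕ) : ∃ C > 0, ∀ (f : EE n → ℝ) (N : ℝ), Continuous f →
    (∀ y, |f y| ≤ N) → ∀ q > 0, ∀ x e : EE n,
    |SG n q f (x + e) - SG n q f x| ≤ C * N * ‖e‖ / √q := by
  obtain ⟨C, hC, h⟩ := exists_shift1 n
  refine ⟨C + 2, by positivity, fun f N hf hN q hθ x e => ?_⟩
  have hs := sqrt_pos.2 hθ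
  have hN0 : 0 ≤ N := (abs_nonneg _).trans (hN 0)
  have hnorm : ‖(√q)⁻¹ • e‖ = ‖e‖ / √q := by
    rw [norm_smul, norm_inv, norm_of_nonneg hs.le]; ring
  rcases le_total ‖(√q)⁻¹ • e‖ 1 with hh | hh
  · have := h (fun z => f (x + √q • z)) N (by fun_prop) (fun z => (hN _).trans (by
      bound)) ((√q)⁻¹ • e) hh
    rw [← SG_shift hθ, hnorm] at this
    have e1 : (C + 2) * N * ‖e‖ / √q = C * N * (‖e‖ / √q) + 2 * (N * (‖e‖ / √q)) := by ring
    rw [e1]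
    refine this.trans ?_
    bound
  · have b1 := abs_le.1 (abs_integral_rho_le (fun z => hN (x + √q • z)))
    have b2 := abs_le.1 (abs_integral_rho_le (fun z => hN (x + e + √q • z)))
    have e1 : (C + 2) * N * ‖e‖ / √q = (C + 2) * (N * (‖e‖ / √q)) := by ring
    rw [hnorm] at hh
    have h2 : N ≤ N * (‖e‖ / √q) := (by bound)
    have h3 : 0 ≤ C * (N * (‖e‖ / √q)) := by positivity
    unfold SG
    rw [abs_le]; bound

theorem exists_SG_diff2 (n) : ∃ C > 0, ∀ (f) (N), Continuous f →
    ∀ q > 0, ∀ x e, (∀ z, |f (x + √q • z)| ≤ N * (1 + ‖z‖)) →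
    |SG n q f (x + e) + SG n q f (x - e) - 2 * SG n q f x| ≤ C * N * ‖e‖^2 / q := by
  obtain ⟨C, hC, h⟩ := exists_shift2 n
  refine ⟨C, hC, fun f N hf q hθ x e hN => ?_⟩
  have hnorm : ‖(√q)⁻¹ • e‖^2 = ‖e‖^2 / q := by
    rw [norm_smul, norm_inv, norm_of_nonneg (sqrt_pos.2 hθ).le, mul_pow, inv_pow, sq_sqrt hθ.le]
    ring
  have := h (fun z => f _) N (by fun_prop) hN ((√q)⁻¹ • e)
  rw [hnorm, ← SG_shift hθ] at this
  have e2 : SG n q f (x - e) =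
      ∫ z, (fun z => f (x + √q • z)) (z - (√q)⁻¹ • e) * rho n z := by
    rw [sub_eq_add_neg, SG_shift hθ]; simp [← sub_eq_add_neg]
  rw [← e2] at this
  refine this.trans (le_of_eq (by ring))

/-- convergence of the semigroup -/
theorem SG_tendsto (hf : Continuous f) (hN : ∀ y, |f y| ≤ N) (x)
    (q) : Tendsto (fun θ' => SG n θ' f x) (𝓝 q) (𝓝 (SG n q f x)) := by
  refine tendsto_integral_filter_of_dominated_convergence (bound := fun z => N * rho n z) ?_ ?_ ?_ ?_
  · exact .of_forall fun θ' =>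
      ((hf.comp (by fun_prop)).mul rho_cont).aestronglyMeasurable
  · refine .of_forall fun θ' => Eventually.of_forall fun z => ?_
    rw [norm_eq_abs, abs_mul, abs_of_pos (rho_pos z)]
    exact mul_le_right (hN _) (rho_pos z).le
  · exact rho_integrable.const_mul N
  · refine .of_forall fun z => ?_
    have : Continuous fun θ' => f (x + √θ' • z) * rho n z := by fun_prop
    exact this.tendsto q

theorem SG_zero (f) (x) : SG n 0 f x = f x := by
  unfold SG; simp [sqrt_zero, zero_smul, add_zero]
  rw [integral_const_mul, integral_rho, mul_one]

/-- effect of a bound on second differences at a point -/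
theorem SG_sub_le (hf : Continuous f) (hM : ∀ y, |f y| ≤ M) (x : EE n)
    (hN0 : 0 ≤ N)
    (hN : ∀ e, |f (x + e) + f (x - e) - 2 * f x| ≤ N * ‖e‖^2) (hθ : 0 ≤ θ) :
    |SG n θ f x - f x| ≤ N * θ * ∫ ζ : EE n, (1 + ‖ζ‖)^2 * rho n ζ := by
  have hi : ∀ e : ℝ, Integrable (fun ζ : EE n => f (x + e • ζ) * rho n ζ) := fun e =>
    integrable_of_growth (C := M) (m := 0) (by fun_prop) (fun y => by simpa using hM _)
  have e1 : SG n θ f x = ∫ ζ, f (x + (-√θ) • ζ) * rho n ζ := by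
    unfold SG
    rw [← integral_neg_eq_self]
    simp [rho_neg]
  have e2 : 2 * (SG n θ f x - f x) =
      ∫ ζ, (f (x + √θ • ζ) + f (x - √θ • ζ) - 2 * f x) * rho n ζ := by
    have : (fun ζ => (f (x + √θ • ζ) + f (x - √θ • ζ) - 2 * f x) * rho n ζ) = fun ζ =>
      (f (x + √θ • ζ) * rho n ζ + f (x + (-√θ) • ζ) * rho n ζ) - 2 * f x * rho n ζ := by
      ext ζ; rw [neg_smul, ← sub_eq_add_neg]; ring
    rw [this, integral_sub (by fun_prop) (rho_integrable.const_mul _),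
      integral_add (hi _) (hi _), ← e1, integral_const_mul, integral_rho]
    unfold SG; ring
  have := norm_integral_le_of_norm_le
    (f := fun ζ => (f _ + f (x - √θ • ζ) - 2 * f x) * rho n ζ)
    ((integrable_pow_mul_rho (n := n) 2).const_mul (N * θ))
    (.of_forall fun ζ => by
      rw [norm_eq_abs, abs_mul, abs_of_pos (rho_pos ζ), ← mul_assoc]
      refine mul_le_right ?_ (rho_pos ζ).le
      refine (hN _).trans ?_
      rw [norm_smul, mul_pow, norm_of_nonneg (sqrt_nonneg _), sq_sqrt hθ, ← mul_assoc]
      bound)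
  rw [← e2, integral_const_mul, norm_eq_abs, abs_mul, abs_two] at this
  have h0 : 0 ≤ |SG n θ f x - f x| := abs_nonneg _
  linarith

theorem exists_second_diff_bound (hf : ContDiff ℝ 2 f) (x : EE n) (R : ℝ) :
    ∃ K : ℝ, 0 ≤ K ∧ ∀ y e : EE n, y + e ∈ closedBall x R → y - e ∈ closedBall x R →
      |f (y + e) + f (y - e) - 2 * f y| ≤ K * ‖e‖^2 := by
  have hd1 : ContDiff ℝ 1 (fderiv ℝ f) := hf.fderiv_right (by norm_num)
  have hc : Continuous (fderiv ℝ (fderiv ℝ f)) := hd1.continuous_fderiv (by norm_num)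
  obtain ⟨K, hK⟩ := ((isCompact_closedBall x R).image ((continuous_norm (E := EE n →L[ℝ] EE n →L[ℝ] ℝ)).comp hc)).bddAbove
  replace hK : ∀ z ∈ closedBall x R, ‖fderiv ℝ (fderiv ℝ f) z‖ ≤ K := fun z hz =>
    hK ⟨z, hz, rfl⟩
  have hK' : ∀ z ∈ closedBall x R, ∀ z' ∈ closedBall x R,
      ‖fderiv ℝ f z - fderiv ℝ f z'‖ ≤ |K| * ‖z - z'‖ := fun z hz z' hz' =>
    (convex_closedBall x R).norm_image_sub_le_of_norm_fderiv_le
      (fun y _ => hd1.differentiable (by norm_num) y)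
      (fun y hy => (hK y hy).trans (le_abs_self K)) hz' hz
  refine ⟨2 * |K|, by positivity, fun y e h1 h2 => ?_⟩
  have hseg : ∀ t ∈ Icc (0:ℝ) 1, y + t • e ∈ closedBall x R ∧
      y - t • e ∈ closedBall x R := by
    intro t ht
    have hcv := convex_closedBall x R
    constructor
    · have := hcv h1 h2 (a := (1 + t) / 2) (b := (1 - t) / 2) (by linarith [ht.1])
        (by grind) (by ring)
      convert this using 1; module
    · have := hcv h1 h2 (a := (1 - t) / 2) (b := (1 + t) / 2) (by linarith [ht.2])
        (by linarith [ht.1]) (by ring)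
      convert this using 1; module
  have hdf : Differentiable ℝ f := hf.differentiable (by norm_num)
  have hl : ∀ c : ℝ, ∀ t : ℝ, HasDerivAt (fun t : ℝ => f (y + (c * t) • e))
      (c * fderiv ℝ f (y + (c * t) • e) e) t := by
    intro c t
    have h1 : HasDerivAt (fun t : ℝ => y + (c * t) • e) (c • e) t := by
      simpa using (((hasDerivAt_id t).const_mul c).smul_const e).const_add y
    have := (hdf (y + (c * t) • e)).hasFDerivAt.comp_hasDerivAt t h1
    exact this.congr_deriv (by simp)
  have := mvt (convex_Icc (0:ℝ) 1)
    (C := 2 * |K| * ‖e‖^2)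
    (fun t _ => (hl 1 t).fun_add (hl (-1) t))
    (fun t ht => by
      obtain ⟨a1, a2⟩ := hseg t ht
      have e1 : (1:ℝ) * fderiv ℝ f (y + (1 * t) • e) e + -1 * fderiv ℝ f (y + (-1 * t) • e) e
        = (fderiv ℝ f (y + t • e) - fderiv ℝ f (y - t • e)) e := by
        simp [sub_eq_add_neg]
      rw [e1, ← norm_eq_abs]
      refine (ContinuousLinearMap.le_opNorm _ _).trans ?_
      have h3 := hK' _ a1 _ a2
      have h4 : ‖y + t • e - (y - t • e)‖ ≤ 2 * ‖e‖ := by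
        rw [show y + t • e - (y - t • e) = (2 * t) • e by module, norm_smul,
          norm_of_nonneg (by linarith [ht.1])]
        nlinarith [ht.2, norm_nonneg e]
      calc _ ≤ |K| * (2 * ‖e‖) * ‖e‖ := by
            refine mul_le_right (h3.trans ?_) (norm_nonneg _)
            gcongr
        _ = _ := by ring)
    (left_mem_Icc.2 zero_le_one) (right_mem_Icc.2 zero_le_one)
  simp at this
  rw [sub_eq_add_neg y e, show f (y + e) + f (y + -e) - 2 * f y = f (y + e) + f (y + -e) -
    (f y + f y) by ring]
  exact this

theorem abs_pdpd_le (hf : ContDiff ℝ 2 f) (y : EE n) (i : Fin n) {r : ℝ}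
    (hr : 0 < r) (h : ∀ e : EE n, ‖e‖ < r → |f (y + e) + f (y - e) - 2 * f y| ≤ N * ‖e‖^2) :
    |pd i (pd i f) y| ≤ N := by
  have hdf := hf.differentiable (by norm_num)
  have hd1 : Differentiable ℝ (pd i f) := pd_differentiable hf
  set e : EE n := single i 1
  have hl : ∀ t : ℝ, HasDerivAt (fun t : ℝ => f (y + t • e) + f (y + (-t) • e) - 2 * f y)
      (pd i f (y + t • e) - pd i f (y + (-t) • e)) t := by
    intro t
    refine HasDerivAt.congr_deriv (((pd_line (i := i) t (hdf (y + t • e))).fun_add ((pd_line (i := i) (x := y) (-t) (hdf (y + (-t) • e))).scomp t (hasDerivAt_neg t))).sub_const (2 * f y)) ?_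
    ring
  have hl2 : HasDerivAt (fun t : ℝ => pd i f (y + t • e) - pd i f (y + (-t) • e))
      (2 * pd i (pd i f) y) 0 := by
    refine HasDerivAt.congr_deriv ((pd_line (i := i) (x := y) 0 (hd1 _)).fun_sub ((pd_line (i := i) (x := y) (-0) (hd1 _)).scomp 0 (hasDerivAt_neg 0))) ?_
    simp [two_mul]
  have hsl := hl2.tendsto_slope_zero
  simp only [zero_add, zero_smul, neg_zero, sub_self, sub_zero, smul_eq_mul] at hsl
  have hlim : Tendsto (fun t : ℝ => (f (y + t • e) + f (y + (-t) • e) - 2 * f y) / t^2)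
      (𝓝[≠] 0) (𝓝 (pd i (pd i f) y)) := by
    refine HasDerivAt.lhopital_zero_nhdsNE (g' := fun t => 2 * t)
      (.of_forall hl) (.of_forall fun t => ?_) ?_ ?_ ?_ ?_
    · simpa using hasDerivAt_pow 2 t
    · filter_upwards [self_mem_nhdsWithin] with t ht
      simpa using ht
    · have := (hl 0).continuousAt.tendsto
      simp only [zero_smul, neg_zero, add_zero] at this
      rw [show f y + f y - 2 * f y = 0 by ring] at this
      exact this.mono_left nhdsWithin_le_nhds
    · have : Tendsto (fun t : ℝ => t^2) (𝓝 0) _ := (continuous_pow 2).tendsto 0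
      simp only [ne_eq, OfNat.ofNat_ne_zero, not_false_eq_true, zero_pow] at this
      exact this.mono_left nhdsWithin_le_nhds
    · have := hsl.div_const 2
      rw [mul_div_cancel_left₀ _ (two_ne_zero)] at this
      refine this.congr fun t => ?_
      by_cases ht : t = 0
      · simp [ht]
      · field_simp
  refine le_of_tendsto hlim.abs ?_
  filter_upwards [nhdsWithin_le_nhds (ball_mem_nhds 0 hr), self_mem_nhdsWithin] with t ht ht0
  have hne : ‖t • e‖ = |t| := by simp [norm_smul, e]
  have := h (t • e) (by rw [hne]; simpa using ht)
  rw [hne, sq_abs, sub_eq_add_neg y, ← neg_smul] at this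
  rw [abs_div, abs_of_nonneg (sq_nonneg t)]
  have hpos : 0 < t^2 := by
    have : t ≠ 0 := ht0
    positivity
  rwa [div_le_iff₀ hpos]

theorem integrable_mul_GK (hθ : 0 < θ) (x)
    (hf : Integrable (fun ζ => f (x + √θ • ζ) * rho n ζ)) :
    Integrable (fun y => f y * GK n θ (x - y)) := by
  have hs := (sqrt_pos.2 hθ).ne'
  refine (((hf.comp_smul (inv_ne_zero hs)).comp_sub_right x).const_mul (√θ^n)⁻¹).congr (.of_forall fun y => ?_)
  simp only [GK_eq_rho hθ, smul_smul, mul_inv_cancel₀ hs, one_smul, add_sub_cancel]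
  rw [← rho_neg, ← smul_neg, neg_sub]
  ring

theorem integral_GK_one (hθ : 0 < θ) (x) : ∫ y, GK n θ (x - y) = 1 := by
  have := integral_GK hθ x (fun _ => 1)
  simpa [integral_rho] using this

theorem integrable_sq_GK (hθ : 0 < θ) (x) :
    Integrable (fun y => (1 + ‖(√θ)⁻¹ • (x - y)‖)^2 * GK n θ (x - y)) := by
  have hs := (sqrt_pos.2 hθ).ne'
  refine integrable_mul_GK hθ x ((integrable_pow_mul_rho 2).congr (.of_forall fun ζ => ?_))
  aesop

theorem integral_sq_GK (hθ : 0 < θ) (x) :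
    ∫ y, (1 + ‖(√θ)⁻¹ • (x - y)‖)^2 * GK n θ (x - y) = ∫ ζ : EE n, (1 + ‖ζ‖)^2 * rho n ζ := by
  have hs := (sqrt_pos.2 hθ).ne'
  rw [integral_GK hθ x (fun y => (1 + ‖(√θ)⁻¹ • (x - y)‖)^2)]
  aesop

/-- the error terms produced by a cutoff in Duhamel's formula -/
theorem cutoff_error {v : EE n → ℝ} {A L : ℝ} (hθ : 0 < θ) (x : EE n)
    (hM : ∀ y ∈ tsupport η, |v y| ≤ M) (hM0 : 0 ≤ M) (hL0 : 0 ≤ L) (hA : ∀ y, |lap n η y| ≤ A)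
    (hL : ∀ i y, |pd i η y * (x - y) i| ≤ θ * (L * (1 + ‖(√θ)⁻¹ • (x - y)‖)^2)) :
    |∫ y, v y * (lap n η y * GK n θ (x - y) +
          2 * ∑ i, pd i η y * ((x - y) i / (2 * θ) * GK n θ (x - y)))| ≤
      M * (A + n * L * ∫ ζ : EE n, (1 + ‖ζ‖)^2 * rho n ζ) := by
  have hA0 := (abs_nonneg _).trans (hA 0)
  have := norm_integral_le_of_norm_le
    (f := fun y => v y * (lap n η y * GK n θ (x - y) +
          2 * ∑ i, pd i η y * ((x - y) i / (2 * θ) * GK n θ (x - y))))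
    (((GK_integrable hθ x).const_mul (M * A)).fun_add
      ((integrable_sq_GK hθ x).const_mul (M * (n * L))))
    (.of_forall fun y => by
      have hG := GK_nonneg (n := n) hθ.le (x - y)
      by_cases hy : y ∈ tsupport η
      · rw [norm_eq_abs, abs_mul]
        have h1 : |2 * ∑ i, pd i η y * ((x - y) i / (2 * θ) * GK n θ (x - y))| ≤
            n * (L * (1 + ‖(√θ)⁻¹ • (x - y)‖)^2 * GK n θ (x - y)) := by
          rw [Finset.mul_sum]
          refine (Finset.abs_sum_le_sum_abs _ _).trans ?_
          refine (Finset.sum_le_card_nsmul _ _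
            (L * (1 + ‖(√θ)⁻¹ • (x - y)‖)^2 * GK n θ (x - y)) fun i _ => ?_).trans ?_
          · rw [show 2 * (pd i η y * ((x - y) i / (2 * θ) * GK n θ (x - y))) =
              (pd i η y * (x - y) i) / θ * GK n θ (x - y) by field_simp, abs_mul, abs_of_nonneg hG]
            refine mul_le_right ?_ hG
            rw [abs_div, abs_of_pos hθ, div_le_iff₀ hθ]
            linarith [hL i y]
          · simp
        calc _ ≤ M * (A * GK n θ (x - y) +
              n * (L * (1 + ‖(√θ)⁻¹ • (x - y)‖)^2 * GK n θ (x - y))) := by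
              refine mul_le_mul (hM y hy) ((abs_add_le _ _).trans (add_le_add ?_ h1))
                (abs_nonneg _) hM0
              rw [abs_mul, abs_of_nonneg hG]
              exact mul_le_right (hA y) hG
          _ = _ := by ring
      · have h1 : ∀ i, pd i η y = 0 := by
          intro i
          have : η =ᶠ[𝓝 y] fun _ => 0 := notMem_tsupport_iff_eventuallyEq.1 hy
          unfold pd; rw [this.fderiv_eq]; simp
        rw [lap_eq_zero_of_notMem hy]
        simp only [h1, zero_mul, Finset.sum_const_zero, mul_zero, add_zero, norm_zero]
        positivity)
  rw [integral_add ((GK_integrable hθ x).const_mul _) ((integrable_sq_GK hθ x).const_mul _),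
    integral_const_mul, integral_const_mul, integral_GK_one hθ, integral_sq_GK hθ] at this
  refine this.trans (le_of_eq (by ring))

theorem GK_le {ε : ℝ} (hε : 0 < ε) (h : ε ≤ θ) (z) :
    GK n θ z ≤ (4 * π * ε)^(-(n : ℝ) / 2) := by
  unfold GK
  have h1 : (4 * π * θ)^(-(n : ℝ) / 2) ≤ (4 * π * ε)^(-(n : ℝ) / 2) := by
    refine rpow_le_rpow_of_nonpos (by positivity) (by gcongr) ?_
    grind
  have h2 : exp (-‖z‖^2 / (4 * θ)) ≤ 1 := by
    rw [exp_le_one_iff, neg_div]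
    have : 0 ≤ ‖z‖^2 / (4 * θ) := by bound
    linarith
  calc _ ≤ (4 * π * ε)^(-(n : ℝ) / 2) * 1 := by gcongr
    _ = _ := mul_one _

theorem GK_continuousAt (hθ : 0 < q) (z) :
    ContinuousAt (fun q => GK n q z) q := by
  exact (GK_hasDerivAt hθ z).continuousAt

theorem tendsto_integral_GK {ι : Type*} {l : Filter ι} [l.IsCountablyGenerated]
    {U : ι → EE n → ℝ} {V : EE n → ℝ} {Θ : ι → ℝ} (hθ : 0 < θ) (x)
    (hη : Continuous η) (hηc : HasCompactSupport η)
    (hU : ∀ᶠ i in l, Continuous (U i)) (hM : ∀ᶠ i in l, ∀ y, |U i y| ≤ M)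
    (hV : ∀ y, Tendsto (fun i => U i y) l (𝓝 (V y))) (hΘ : Tendsto Θ l (𝓝 θ)) :
    Tendsto (fun i => ∫ y, U i y * (η y * GK n (Θ i) (x - y))) l
      (𝓝 (∫ y, V y * (η y * GK n θ (x - y)))) := by
  refine tendsto_integral_filter_of_dominated_convergence
    (fun y => M * (|η y| * (4 * π * (θ / 2))^(-(n : ℝ) / 2))) ?_ ?_ ?_ ?_
  · filter_upwards [hU] with i hi
    exact (hi.mul (hη.mul (GK_contDiff (Θ i) x 0).continuous)).aestronglyMeasurable
  · filter_upwards [hM, hΘ.eventually (lt_mem_nhds (half_lt_self hθ))] with i h1 h2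
    refine .of_forall fun y => ?_
    rw [norm_eq_abs, abs_mul, abs_mul, abs_of_nonneg (GK_nonneg (n := n) (by linarith) (x - y))]
    have := GK_le (half_pos hθ) h2.le (x - y)
    have h0 : 0 ≤ M := (abs_nonneg _).trans (h1 y)
    gcongr
    · exact mul_nonneg (abs_nonneg _) (GK_nonneg (by linarith) _)
    bound
  · exact (((hη.abs).integrable_of_hasCompactSupport hηc.norm).mul_const _).const_mul _
  · exact .of_forall fun y =>
      (hV y).mul (((GK_continuousAt hθ (x - y)).tendsto.comp hΘ).const_mul (η y))

/-- Duhamel's formula with a cutoff, error term separated -/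
theorem WSol.duhamel_split
    (h : WSol U α β v F) (hη : ContDiff ℝ 2 η) (hηc : HasCompactSupport η)
    (hηU : tsupport η ⊆ U) (x) {τ : ℝ} (hτ : β < τ) {σ : ℝ} (hσ : σ ∈ Ioo α β) :
    HasDerivAt (fun σ => ∫ y, v y σ * (η y * GK n (τ - σ) (x - y)))
      ((∫ y, v y σ * (lap n η y * GK n (τ - σ) (x - y) +
          2 * ∑ i, pd i η y * ((x - y) i / (2 * (τ - σ)) * GK n (τ - σ) (x - y))))
        + SG n (τ - σ) (fun y => F y σ * η y) x) σ := by
  refine (h.duhamel hη hηc hηU hτ hσ).congr_deriv ?_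
  have hG := (GK_contDiff (τ - σ) x 0).continuous
  have e : SG n (τ - σ) (fun y => F y σ * η y) x =
      ∫ y, F y σ * (η y * GK n (τ - σ) (x - y)) := by
    unfold SG
    rw [← integral_GK (by linarith [hσ.2]) x (fun y => F y σ * η y)]
    simp only [mul_assoc]
  rw [e]
  refine integral_add (integrable_mul_of_compact (h.contv σ hσ) ?_ ?_)
    (integrable_mul_of_compact (h.contF σ hσ) (hη.continuous.mul hG) hηc.mul_right)
  · refine ((lap_continuous hη).mul hG).add (continuous_const.mul (continuous_finsetSum _ fun i _ => ?_))
    refine (pd_continuous (hη.of_le (by norm_num))).mul (Continuous.mul ?_ hG)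
    fun_prop
  · refine HasCompactSupport.intro hηc fun y hy => ?_
    have h1 : ∀ i, pd i η y = 0 := by
      intro i
      have : η =ᶠ[𝓝 y] fun _ => 0 := notMem_tsupport_iff_eventuallyEq.1 hy
      unfold pd; rw [this.fderiv_eq]; simp
    rw [lap_eq_zero_of_notMem hy]
    simp [h1]

theorem exists_bound_of_compactSupport (hf : Continuous f)
    (hc : HasCompactSupport f) : ∃ A, 0 ≤ A ∧ ∀ y, |f y| ≤ A := by
  obtain ⟨A, hA⟩ := hc.exists_bound_of_continuous hf
  exact ⟨A, (norm_nonneg _).trans (hA 0), hA⟩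

theorem pd_hasCompactSupport (hc : HasCompactSupport ψ) (i) :
    HasCompactSupport (pd i ψ) := by
  refine HasCompactSupport.intro hc fun y hy => ?_
  have := notMem_tsupport_iff_eventuallyEq.1 hy
  unfold pd; rw [this.fderiv_eq]; simp

/-- a fixed cutoff in a ball -/
theorem exists_cutoff (x0 : EE n) {r : ℝ} (hr : 0 < r) : ∃ h, ContDiff ℝ 2 h ∧
    HasCompactSupport h ∧ tsupport h ⊆ ball x0 r ∧ (∀ y, 0 ≤ h y ∧ h y ≤ 1) ∧
    (∀ y ∈ ball x0 (3 * r / 4), h y = 1) ∧ ∃ A B, 0 ≤ A ∧ 0 ≤ B ∧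
    (∀ y, |lap n h y| ≤ A) ∧ (∀ i y, |pd i h y| ≤ B) ∧
    (∀ i, ∀ y ∈ ball x0 (3 * r / 4), pd i h y = 0) := by
  let h : ContDiffBump x0 := ⟨3 * r / 4, 7 * r / 8, by positivity, by linarith⟩
  have hη : ContDiff ℝ 2 h := h.contDiff
  have h1 : ∀ y ∈ ball x0 _, h y = 1 := fun y hy =>
    h.one_of_mem_closedBall (ball_subset_closedBall hy)
  obtain ⟨A, hA0, hA⟩ := exists_bound_of_compactSupport (lap_continuous hη)
    (lap_hasCompactSupport h.hasCompactSupport)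
  have hB := fun i => exists_bound_of_compactSupport (pd_continuous
    (hη.of_le (by norm_num))) (pd_hasCompactSupport h.hasCompactSupport i)
  choose B hB0 hB using hB
  refine ⟨h, hη, h.hasCompactSupport, ?_, fun y => ⟨h.nonneg, h.le_one⟩, h1, A, ∑ i, B i, hA0,
    Finset.sum_nonneg fun i _ => hB0 i, hA, fun i y => (hB i y).trans
    (Finset.single_le_sum (fun i _ => hB0 i) (Finset.mem_univ i)), fun i y hy => ?_⟩
  · rw [h.tsupport_eq]
    exact closedBall_subset_ball (by change 7 * r / 8 < r; linarith)
  · have : h =ᶠ[𝓝 y] fun _ => 1 := by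
      filter_upwards [isOpen_ball.mem_nhds hy] with z hz using h1 z hz
    unfold pd; rw [this.fderiv_eq]; simp

theorem abs_coord_le (z : EE n) (i) : |z i| ≤ ‖z‖ := PiLp.norm_apply_le z i

theorem gap_bound (x0 : EE n) {r : ℝ} (hr : 0 < r) {N2 : ℝ} (hM0 : 0 ≤ M) (hN0 : 0 ≤ N)
    (hN20 : 0 ≤ N2) : ∃ C, 0 ≤ C ∧ ∀ (a b : ℝ) (u f : EE n → ℝ → ℝ),
    WSol (ball x0 r) a b u f →
    (∀ y, ∀ t ∈ Ioo a b, |u y t| ≤ M ∧ |f y t| ≤ N) → (∀ y, |u y a| ≤ M) →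
    (∀ y, Tendsto (u y) (𝓝[>] a) (𝓝 (u y a))) → Continuous (fun y => u y a) →
    (∀ y e, y ∈ ball x0 r → y + e ∈ ball x0 r → y - e ∈ ball x0 r →
      |u (y + e) a + u (y - e) a - 2 * u y a| ≤ N2 * ‖e‖^2) →
    ∀ x ∈ ball x0 (r / 2), ∀ t ∈ Ioo a b, |u x t - u x a| ≤ C * (t - a) := by
  obtain ⟨η, hη, hηc, hηU, hη01, hη1, A, B, hA0, hB0, hA, hB, hpd0⟩ := exists_cutoff x0 hr
  set K2 := ∫ z : EE n, (1 + ‖z‖)^2 * rho n z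
  have hK2 : 0 ≤ K2 := integral_nonneg fun z => by have := rho_pos z; positivity
  set L := B * (4 / r)
  have hL0 : 0 ≤ L := by positivity
  set C1 := M * (A + n * L * K2) + N
  have hC1 : 0 ≤ C1 := by positivity
  set N' := N2 + 64 * M / r^2
  have hN' : 0 ≤ N' := by positivity
  refine ⟨C1 + N' * K2, by positivity, ?_⟩
  intro a b u f h hb hbα hlim hcα hdiff x hx t ht
  have hηx : η x = 1 := hη1 x (ball_subset_ball (by linarith) hx)
  have hηabs : ∀ y, |η y| ≤ 1 := fun y => abs_le.2 ⟨by linarith [(hη01 y).1], (hη01 y).2⟩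
  have hL : ∀ θ > 0, ∀ i y, |pd i η y * (x - y) i| ≤
      θ * (L * (1 + ‖(√θ)⁻¹ • (x - y)‖)^2) := by
    intro θ hθ i y
    by_cases hy : y ∈ ball x0 (3 * r / 4)
    · rw [hpd0 i y hy, zero_mul, abs_zero]; positivity
    · rw [mem_ball, not_lt] at hy
      have h1 : r / 4 ≤ ‖x - y‖ := by
        rw [mem_ball] at hx
        have := dist_triangle y x x0
        rw [← dist_eq_norm, dist_comm]; linarith
      have h2 : θ * ‖(√θ)⁻¹ • (x - y)‖^2 = ‖x - y‖^2 := by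
        rw [norm_smul, norm_inv, norm_of_nonneg (sqrt_nonneg _), mul_pow, inv_pow, sq_sqrt hθ.le]
        field_simp
      calc |pd i η y * (x - y) i| ≤ B * ‖x - y‖ := by
            rw [abs_mul]; exact mul_le_mul (hB i y) (abs_coord_le _ i) (abs_nonneg _) hB0
        _ ≤ B * ((4 / r) * ‖x - y‖^2) := by
            gcongr
            rw [div_mul_eq_mul_div, le_div_iff₀ hr]
            nlinarith [norm_nonneg (x - y)]
        _ = L * (θ * ‖(√θ)⁻¹ • (x - y)‖^2) := by rw [h2]; ring
        _ ≤ L * (θ * (1 + ‖(√θ)⁻¹ • (x - y)‖)^2) := by gcongr; linarith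
        _ = _ := by ring
  -- main estimate with regularisation
  have hmain : ∀ Z > 0, ∀ s ∈ Ioo a t,
      |(∫ y, u y t * (η y * GK n (t + Z - t) (x - y))) -
        ∫ y, u y s * (η y * GK n (t + Z - s) (x - y))| ≤ C1 * (t - a) := by
    intro Z hε s hs
    have htm : t < min b (t + Z / 2) := lt_min ht.2 (by linarith)
    have := mvt (convex_Icc s t) (C := C1)
      (fun σ hσ => (h.mono subset_rfl le_rfl (min_le_left _ _)).duhamel_split hη hηc hηU x (τ := t + Z) (σ := σ)
        ((min_le_right _ _).trans_lt (by linarith))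
        ⟨hs.1.trans_le hσ.1, hσ.2.trans_lt htm⟩)
      (fun σ hσ => by
        have hσ' : σ ∈ Ioo a b := ⟨hs.1.trans_le hσ.1, hσ.2.trans_lt ht.2⟩
        have hθ : 0 < t + Z - σ := by linarith [hσ.2]
        refine (abs_add_le _ _).trans (add_le_add ?_ ?_)
        · exact cutoff_error hθ x (fun y _ => (hb y σ hσ').1) hM0 hL0 hA (hL _ hθ)
        · refine abs_integral_rho_le fun z => ?_
          rw [abs_mul]
          calc _ ≤ N * 1 := mul_le_mul (hb _ σ hσ').2 (hηabs _) (abs_nonneg _) hN0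
            _ = N := mul_one _)
      (left_mem_Icc.2 hs.2.le) (right_mem_Icc.2 hs.2.le)
    refine this.trans ?_
    rw [abs_of_nonneg (by linarith [hs.2])]
    exact mul_le_left (by linarith [hs.1]) hC1
  have hmain2 : ∀ Z > 0, |SG n Z (fun y => u y t * η y) x -
      SG n (t + Z - a) (fun y => u y a * η y) x| ≤ C1 * (t - a) := by
    intro Z hε
    have e1 : ∀ s, s < t + Z → SG n (t + Z - s) (fun y => u y s * η y) x =
        ∫ y, u y s * (η y * GK n (t + Z - s) (x - y)) := by
      intro s hs
      unfold SG
      rw [← integral_GK (by linarith) x (fun y => u y s * η y)]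
      simp only [mul_assoc]
    rw [e1 a (by linarith [ht.1])]
    have e2 := e1 t (by linarith)
    rw [add_sub_cancel_left] at e2
    have hm := fun s hs => hmain Z hε s hs
    rw [add_sub_cancel_left, ← e2] at hm
    have hev : Ioo a t ∈ 𝓝[>] a := Ioo_mem_nhdsGT ht.1
    have htd := tendsto_integral_GK (l := 𝓝[>] a) (U := fun s y => u y s) (V := fun y => u y a)
      (η := η) (Θ := fun s => t + Z - s) (θ := t + Z - a) (M := M) (by linarith [ht.1]) x
      hη.continuous hηc
      (by filter_upwards [hev] with s hs using h.contv s ⟨hs.1, hs.2.trans ht.2⟩)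
      (by filter_upwards [hev] with s hs y using (hb y s ⟨hs.1, hs.2.trans ht.2⟩).1)
      hlim ((tendsto_const_nhds.sub tendsto_id).mono_left nhdsWithin_le_nhds)
    refine le_of_tendsto (tendsto_const_nhds.sub htd).abs ?_
    filter_upwards [hev] with s hs using hm s hs
  have hc1 : Continuous fun y => u y t * η y := (h.contv t ht).mul hη.continuous
  have hc2 : Continuous fun y => u y a * η y := hcα.mul hη.continuous
  have hb1 : ∀ y, |u y t * η y| ≤ M := fun y => by
    rw [abs_mul]
    calc _ ≤ M * 1 := mul_le_mul (hb _ t ht).1 (hηabs _) (abs_nonneg _) hM0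
      _ = M := mul_one _
  have hb2 : ∀ y, |u y a * η y| ≤ M := fun y => by
    rw [abs_mul]
    calc _ ≤ M * 1 := mul_le_mul (hbα _) (hηabs _) (abs_nonneg _) hM0
      _ = M := mul_one _
  have hmain3 : |u x t - SG n (t - a) (fun y => u y a * η y) x| ≤ C1 * (t - a) := by
    have t1 := (SG_tendsto hc1 hb1 x 0).mono_left (nhdsWithin_le_nhds (s := Ioi 0))
    rw [SG_zero, hηx, mul_one] at t1
    have t2 : Tendsto (fun Z => SG n (t + Z - a) (fun y => u y a * η y) x) (𝓝[>] 0)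
        (𝓝 (SG n (t - a) (fun y => u y a * η y) x)) := by
      refine (SG_tendsto hc2 hb2 x (t - a)).comp (Tendsto.mono_left ?_ nhdsWithin_le_nhds)
      have : Continuous fun Z : ℝ => t + Z - a := by fun_prop
      simpa using this.tendsto 0
    refine le_of_tendsto (t1.sub t2).abs ?_
    filter_upwards [self_mem_nhdsWithin] with Z hε using hmain2 Z hε
  have hd2 : ∀ e : EE n, |u (x + e) a * η (x + e) + u (x - e) a * η (x - e) - 2 * (u x a * η x)|
      ≤ N' * ‖e‖^2 := by
    intro e
    rcases lt_or_ge ‖e‖ (r / 4) with he | he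
    · have hx1 : dist x x0 < r / 2 := hx
      have m1 : x + e ∈ ball x0 (3 * r / 4) := by
        have := dist_triangle (x + e) x x0
        rw [dist_eq_norm (x + e) x, add_sub_cancel_left] at this
        rw [mem_ball]; linarith
      have m2 : x - e ∈ ball x0 (3 * r / 4) := by
        have := dist_triangle (x - e) x x0
        rw [dist_eq_norm (x - e) x, sub_sub_cancel_left, norm_neg] at this
        rw [mem_ball]; linarith
      rw [hη1 _ m1, hη1 _ m2, hηx, mul_one, mul_one, mul_one]
      have hsub : ball x0 (3 * r / 4) ⊆ ball x0 r :=
        ball_subset_ball (by linarith)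
      refine (hdiff x e (ball_subset_ball (by linarith) hx) (hsub m1) (hsub m2)).trans ?_
      gcongr
      exact le_add_of_nonneg_right (by positivity)
    · have a1 := abs_le.1 (hb2 (x + e))
      have a2 := abs_le.1 (hb2 (x - e))
      have a3 := abs_le.1 (hb2 x)
      have h4 : 4 * M ≤ 64 * M / r^2 * ‖e‖^2 := by
        rw [div_mul_eq_mul_div, le_div_iff₀ (by positivity)]
        have : r^2 ≤ 16 * ‖e‖^2 := by nlinarith
        nlinarith
      have h5 : 0 ≤ N2 * ‖e‖^2 := by positivity
      have e3 : N' * ‖e‖^2 = N2 * ‖e‖^2 + 64 * M / r^2 * ‖e‖^2 := by ring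
      rw [e3, abs_le]
      constructor <;> linarith
  have hfin := SG_sub_le hc2 hb2 x hN' hd2 (θ := t - a) (by linarith [ht.1])
  simp only [hηx, mul_one] at hfin
  calc |u x t - u x a| ≤ |u x t - SG n (t - a) (fun y => u y a * η y) x| +
        |SG n (t - a) (fun y => u y a * η y) x - u x a| := abs_sub_le _ _ _
    _ ≤ C1 * (t - a) + N' * (t - a) * K2 := add_le_add hmain3 hfin
    _ = _ := by ring

theorem green {u : EE n → ℝ} (hu : ContDiff ℝ 2 u) (hψ : ContDiff ℝ 2 ψ)
    (hc : HasCompactSupport ψ) : ∫ y, lap n u y * ψ y = ∫ y, u y * lap n ψ y := by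
  have hu0 := hu.continuous
  have hψ0 := hψ.continuous
  have hu1 : ∀ i, Continuous (pd i u) := fun i => pd_continuous (hu.of_le (by norm_num))
  have hψ1 : ∀ i, Continuous (pd i ψ) := fun i => pd_continuous (hψ.of_le (by norm_num))
  have hcs := fun i => pd_hasCompactSupport hc i
  have e : ∀ i, ∫ y, pd i (pd i u) y * ψ y = ∫ y, u y * pd i (pd i ψ) y := by
    intro i
    have h1 := pd_ibp (hu.differentiable (by norm_num))
      (pd_differentiable hψ) (integrable_mul_of_compact (hu1 i) (hψ1 i) (hcs i))
      (integrable_mul_of_compact hu0 (pdpd_continuous hψ) (pd_hasCompactSupport (hcs i) i))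
      (integrable_mul_of_compact hu0 (hψ1 i) (hcs i))
    have h2 := pd_ibp (pd_differentiable hu)
      (hψ.differentiable (by norm_num)) (integrable_mul_of_compact (pdpd_continuous hu) hψ0 hc)
      (integrable_mul_of_compact (hu1 i) (hψ1 i) (hcs i))
      (integrable_mul_of_compact (hu1 i) hψ0 hc)
    linarith
  simp only [lap_eq, Finset.sum_mul, Finset.mul_sum]
  rw [integral_finsetSum _ fun i _ => integrable_mul_of_compact (pdpd_continuous hu) hψ0 hc,
    integral_finsetSum _ fun i _ => integrable_mul_of_compact hu0 (pdpd_continuous hψ)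
      (pd_hasCompactSupport (hcs i) i)]
  exact Finset.sum_congr rfl fun i _ => e i

/-- pointwise classical solutions with bounded data -/
structure CSol (a b : ℝ) (u f : EE n → ℝ → ℝ) (M N : ℝ) : Prop where
  c2 : ∀ t ∈ Ioo a b, ContDiff ℝ 2 (fun y => u y t)
  ut : ∀ x, ∀ t ∈ Ioo a b, HasDerivAt (u x) (lap n (fun y => u y t) x + f x t) t
  fc : ∀ t ∈ Ioo a b, Continuous (fun y => f y t)
  ft : ∀ y, ContinuousOn (f y) (Ioo a b)
  bu : ∀ y, ∀ t ∈ Ioo a b, |u y t| ≤ M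
  bf : ∀ y, ∀ t ∈ Ioo a b, |f y t| ≤ N

/-- the weak formulation for a single test function at a single time -/
def WF (u f : EE n → ℝ → ℝ) (Z : EE n → ℝ) (t : ℝ) : Prop :=
  HasDerivAt (fun i => ∫ y, u y i * Z y) (∫ y, (u y t * lap n Z y + f y t * Z y)) t

theorem CSol.timeu {f : EE n → ℝ → ℝ} (h : CSol α β u f M N) (y) :
    ContinuousOn (u y) (Ioo α β) := fun t ht => (h.ut y t ht).continuousAt.continuousWithinAt

theorem CSol.wsol {α' β' : ℝ} {f : EE n → ℝ → ℝ} (h : CSol α β u f M N) (hα : α ≤ α')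
    (hβ : β' ≤ β)
    (hwf : ∀ t ∈ Ioo α' β', ∀ ψ, ContDiff ℝ 2 ψ → HasCompactSupport ψ →
      tsupport ψ ⊆ U → WF u f ψ t) : WSol U α' β' u f := by
  have hs := Ioo_subset_Ioo hα hβ
  exact ⟨fun t ht => (h.c2 t (hs ht)).continuous, fun t ht => h.fc t (hs ht),
    fun y => (h.timeu y).mono hs, ⟨M, fun y t ht => h.bu y t (hs ht)⟩,
    fun ψ h1 h2 h3 t ht => hwf t ht ψ h1 h2 h3⟩

theorem CSol.abs_ut_le {f : EE n → ℝ → ℝ} (h : CSol α β u f M N) {t : ℝ}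
    (ht : t ∈ Ioo α β) {x0 : EE n} {r N2 : ℝ} (hx : x ∈ ball x0 r)
    (hd : ∀ y e, y ∈ ball x0 r → y + e ∈ ball x0 r → y - e ∈ ball x0 r →
      |u (y + e) t + u (y - e) t - 2 * u y t| ≤ N2 * ‖e‖^2) :
    |lap n (fun y => u y t) x + f x t| ≤ n * N2 + N := by
  refine (abs_add_le _ _).trans (add_le_add ?_ (h.bf x t ht))
  refine (Finset.abs_sum_le_sum_abs _ _).trans ((Finset.sum_le_card_nsmul _ _ N2 fun i _ => ?_).trans
    (by simp))
  rw [mem_ball] at hx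
  refine abs_pdpd_le (h.c2 t ht) x i (r := r - dist x x0) (by linarith) fun e he => ?_
  refine hd x e hx ?_ ?_
  · have := dist_triangle (x + e) x x0
    rw [dist_eq_norm _ x, add_sub_cancel_left] at this
    rw [mem_ball]; linarith
  · have := dist_triangle (x - e) x x0
    rw [dist_eq_norm _ x, sub_sub_cancel_left, norm_neg] at this
    rw [mem_ball]; linarith

/-- continuous induction across a closed set and its gaps -/
theorem lip_of_gaps {A : Set ℝ} (hA : IsClosed A) {t b : ℝ} (htA : t ∈ A) {f : ℝ → ℝ}
    (hφ : ContinuousOn f (Icc t b))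
    (h1 : ∀ s ∈ A, s ∈ Ico t b → ∀ᶠ s' in 𝓝[>] s, |f s' - f s| ≤ C * (s' - s))
    (h2 : ∀ s ∈ A, ∀ s', t ≤ s → s < s' → s' < b → (∀ i ∈ Ioc s s', i ∉ A) →
      |f s' - f s| ≤ C * (s' - s)) :
    ∀ s ∈ Ico t b, |f s - f t| ≤ C * (s - t) := by
  rcases lt_or_ge t b with htb | htb
  swap
  · intro s hs; exact absurd (hs.1.trans_lt hs.2) (not_lt.2 htb)
  set S : Set ℝ := {t' | ∀ s, s < t' → t ≤ s → |f s - f t| ≤ C * (s - t)}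
  have hS : IsClosed S := by
    simp [S, ofPred_forall]
    exact isClosed_iInter fun s => isClosed_imp isOpen_Ioi isClosed_const
  have hP : ∀ t' ∈ S, t' ∈ Ico t b → |f t' - f t| ≤ C * (t' - t) := by
    intro t' ht' hm
    rcases eq_or_lt_of_le hm.1 with he | hlt
    · subst he; simp
    · haveI := right_nhdsWithin_Ioo_neBot hlt
      refine le_of_tendsto_of_tendsto ((((hφ t' ⟨hm.1, hm.2.le⟩).mono (fun z hz => ⟨hz.1.le, hz.2.le.trans hm.2.le⟩))).sub_const _).abs (Tendsto.mono_left (Continuous.tendsto (by fun_prop) t') nhdsWithin_le_nhds : Tendsto (fun s => C * (s - t)) (𝓝[Ioo t t'] t') (𝓝 (C * (t' - t)))) ?_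
      filter_upwards [self_mem_nhdsWithin] with s hs using ht' s hs.2 hs.1.le
  have := (hS.inter isClosed_Icc).Icc_subset_of_forall_exists_gt
    (fun s h1 h2 => absurd h1 (not_lt.2 h2)) (fun t' ht' y hy => by
      have hPt := hP t' ht'.1 ht'.2
      suffices hsuf : ∀ᶠ s in 𝓝[>] t', |f s - f t| ≤ C * (s - t) by
        obtain ⟨w, hw, hsub⟩ := mem_nhdsGT_iff_exists_Ioo_subset.1 hsuf
        refine ⟨min w y, fun s hs hts => ?_, lt_min hw hy, min_le_right _ _⟩
        rcases lt_trichotomy s t' with hc | hc | hc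
        · exact ht'.1 s hc hts
        · rw [hc]; exact hPt
        · exact hsub ⟨hc, hs.trans_le (min_le_left _ _)⟩
      by_cases htA' : t' ∈ A
      · filter_upwards [h1 t' htA' ht'.2] with s hs
        calc _ ≤ |f s - f t'| + |f t' - f t| := abs_sub_le _ _ _
          _ ≤ C * (s - t') + C * (t' - t) := add_le_add hs hPt
          _ = _ := by ring
      · obtain ⟨α', hα'⟩ := (isCompact_Icc.inter_left hA).exists_isGreatest (⟨t, htA, le_rfl, ht'.2.1⟩)
        have hαt := lt_of_le_of_ne hα'.1.2.2 fun hh => htA' (hh ▸ hα'.1.1)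
        obtain ⟨w, hw, hsub⟩ := mem_nhdsGT_iff_exists_Ioo_subset.1
          (nhdsWithin_le_nhds (hA.isOpen_compl.mem_nhds htA'))
        filter_upwards [Ioo_mem_nhdsGT (lt_min hw ht'.2.2)] with s hs
        have := h2 α' hα'.1.1 s hα'.1.2.1 (hαt.trans hs.1) (hs.2.trans_le (min_le_right _ _))
          (fun i hσ hσA => by
            rcases lt_trichotomy i t' with hc | hc | hc
            · exact absurd (hα'.2 ⟨hσA, hα'.1.2.1.trans hσ.1.le, hc.le⟩) (not_le.2 hσ.1)
            · exact htA' (hc ▸ hσA)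
            · exact hsub ⟨hc, hσ.2.trans_lt (hs.2.trans_le (min_le_left _ _))⟩ hσA)
        calc _ ≤ |f s - f α'| + |f α' - f t| := abs_sub_le _ _ _
          _ ≤ C * (s - α') + C * (α' - t) := add_le_add this (hP α' (fun s hs => ht'.1 s (hs.trans hαt)) ⟨hα'.1.2.1, hαt.trans ht'.2.2⟩)
          _ = _ := by ring)
  intro s hs
  exact this (right_mem_Icc.2 htb.le) s hs.2 hs.1

theorem CSol.local_wf {f : EE n → ℝ → ℝ} (h : CSol α β u f M N) (hM0 : 0 ≤ M)
    (hN0 : 0 ≤ N) {x0 : EE n} {r N2 : ℝ} (hr : 0 < r) (hN20 : 0 ≤ N2) {b : ℝ}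
    (ha : α < a) (hb : b < β) {A : Set ℝ} (hA : IsClosed A)
    (h1 : ∀ t ∈ A, t ∈ Icc a b → ∀ y e, y ∈ ball x0 r → y + e ∈ ball x0 r →
      y - e ∈ ball x0 r → |u (y + e) t + u (y - e) t - 2 * u y t| ≤ N2 * ‖e‖^2)
    (h2 : ∀ t ∉ A, t ∈ Icc a b → ∀ ψ : EE n → ℝ, ContDiff ℝ 2 ψ → HasCompactSupport ψ →
      tsupport ψ ⊆ ball x0 r → WF u f ψ t) :
    ∀ t ∈ Ioo a b, ∀ ψ : EE n → ℝ, ContDiff ℝ 2 ψ → HasCompactSupport ψ →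
      tsupport ψ ⊆ ball x0 (r / 2) → WF u f ψ t := by
  have hI : Icc a b ⊆ Ioo α β := fun z hz => ⟨ha.trans_le hz.1, hz.2.trans_lt hb⟩
  obtain ⟨C, hC0, hC⟩ := gap_bound x0 hr hM0 hN0 hN20
  set C' := C + (n * N2 + N + 1)
  have hn0 : (0:ℝ) ≤ n * N2 := by positivity
  have hlip : ∀ t ∈ A, t ∈ Icc a b → ∀ x ∈ ball x0 (r / 2), ∀ s ∈ Ico t b,
      |u x s - u x t| ≤ C' * (s - t) := by
    intro t htA ht x hx
    have hxr : x ∈ ball x0 r := ball_subset_ball (by linarith) hx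
    refine lip_of_gaps hA htA ((h.timeu x).mono fun z hz => hI ⟨ht.1.trans hz.1, hz.2⟩) ?_ ?_
    · intro s hsA hs
      have hsI : s ∈ Icc a b := ⟨ht.1.trans hs.1, hs.2.le⟩
      have hb1 := h.abs_ut_le (hI hsI) hxr (h1 s hsA hsI)
      have := ((h.ut x s (hI hsI)).hasDerivWithinAt (s := Ioi s)).limsup_norm_slope_le
        (r := C') (by rw [norm_eq_abs]; linarith)
      filter_upwards [this, self_mem_nhdsWithin] with s' hs' hgt
      have hpos : 0 < s' - s := sub_pos.2 hgt
      rw [norm_of_nonneg hpos.le, inv_mul_lt_iff₀ hpos, norm_eq_abs] at hs'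
      linarith
    · intro s hsA s' hts hss' hs'b hgap
      have hsI : s ∈ Icc a b := ⟨ht.1.trans hts, (hss'.trans hs'b).le⟩
      obtain ⟨w, hw, hwA⟩ : ∃ w > s', ∀ σ ∈ Ioo s' w, σ ∉ A := by
        obtain ⟨w, hw, hsub⟩ := mem_nhdsGT_iff_exists_Ioo_subset.1
          (nhdsWithin_le_nhds (s := Ioi s') (hA.isOpen_compl.mem_nhds (hgap s' ⟨hss', le_rfl⟩)))
        exact ⟨w, hw, fun σ hσ => hsub hσ⟩
      have hsub : ∀ σ ∈ Ioo s (min w b), σ ∈ Icc a b := fun σ hσ =>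
        ⟨hsI.1.trans hσ.1.le, hσ.2.le.trans (min_le_right _ _)⟩
      have hnA : ∀ σ ∈ Ioo s (min w b), σ ∉ A := by
        intro σ hσ
        rcases le_or_gt σ s' with hc | hc
        · exact hgap σ ⟨hσ.1, hc⟩
        · exact hwA σ ⟨hc, hσ.2.trans_le (min_le_left _ _)⟩
      have hws : WSol (ball x0 r) s (min w b) u f :=
        h.wsol (hI hsI).1.le ((min_le_right _ _).trans hb.le)
          fun τ hτ ψ c1 c2 c3 => h2 τ (hnA τ hτ) (hsub τ hτ) ψ c1 c2 c3
      have := hC s (min w b) u f hws (fun y τ hτ => ⟨h.bu y τ (hI (hsub τ hτ)),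
        h.bf y τ (hI (hsub τ hτ))⟩) (fun y => h.bu y s (hI hsI))
        (fun y => (h.ut y s (hI hsI)).continuousAt.tendsto.mono_left nhdsWithin_le_nhds)
        (h.c2 s (hI hsI)).continuous (h1 s hsA hsI) x hx s' ⟨hss', lt_min hw hs'b⟩
      refine this.trans (mul_le_right ?_ (sub_nonneg.2 hss'.le))
      linarith
  intro t ht ψ hψ hψc hψU
  have hψ0 := hψ.continuous
  have hl0 := lap_continuous hψ
  have hlc := lap_hasCompactSupport hψc
  set R : ℝ → ℝ := fun τ => ∫ y, (u y τ * lap n ψ y + f y τ * ψ y)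
  set k : ℝ → ℝ := fun τ => ∫ y, u y τ * ψ y
  have hRc : ContinuousOn R (Icc a b) := by
    refine continuousOn_of_dominated (bound := fun y => M * |lap n ψ y| + N * |ψ y|) ?_ ?_ ?_ ?_
    · intro τ hτ
      exact (((h.c2 τ (hI hτ)).continuous.mul hl0).add ((h.fc τ (hI hτ)).mul hψ0)).aestronglyMeasurable
    · intro τ hτ
      refine .of_forall fun y => (norm_add_le _ _).trans ?_
      simp only [norm_mul, norm_eq_abs]
      exact add_le_add (mul_le_right (h.bu y τ (hI hτ)) (abs_nonneg _))
        (mul_le_right (h.bf y τ (hI hτ)) (abs_nonneg _))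
    · exact ((hl0.abs.integrable_of_hasCompactSupport hlc.norm).const_mul M).add
        ((hψ0.abs.integrable_of_hasCompactSupport hψc.norm).const_mul N)
    · exact .of_forall fun y => (((h.timeu y).mono hI).mul continuousOn_const).add
        (((h.ft y).mono hI).mul continuousOn_const)
  have hkc : ContinuousOn k (Icc a b) := by
    refine continuousOn_of_dominated (bound := fun y => M * |ψ y|) ?_ ?_ ?_ ?_
    · intro τ hτ
      exact ((h.c2 τ (hI hτ)).continuous.mul hψ0).aestronglyMeasurable
    · intro τ hτ
      refine .of_forall fun y => ?_
      simp only [norm_mul, norm_eq_abs]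
      exact mul_le_right (h.bu y τ (hI hτ)) (abs_nonneg _)
    · exact (hψ0.abs.integrable_of_hasCompactSupport hψc.norm).const_mul M
    · exact .of_forall fun y => ((h.timeu y).mono hI).mul continuousOn_const
  have hab : a ≤ b := (ht.1.trans ht.2).le
  have hkR : ∀ τ ∈ Ico a b, HasDerivWithinAt k (R τ) (Ici τ) τ := by
    intro τ hτ
    have hτI : τ ∈ Icc a b := ⟨hτ.1, hτ.2.le⟩
    by_cases hτA : τ ∈ A
    · rw [← hasDerivWithinAt_Ioi_iff_Ici, hasDerivWithinAt_iff_tendsto_slope' (by simp)]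
      have hev : Ioo τ b ∈ 𝓝[>] τ := Ioo_mem_nhdsGT hτ.2
      have e1 : R τ = ∫ y, (lap n (fun z => u z τ) y + f y τ) * ψ y := by
        have hu2 := h.c2 τ (hI hτI)
        simp only [R, add_mul]
        rw [integral_add (integrable_mul_of_compact hu2.continuous hl0 hlc)
          (integrable_mul_of_compact (h.fc τ (hI hτI)) hψ0 hψc),
          integral_add (integrable_mul_of_compact (lap_continuous hu2) hψ0 hψc)
          (integrable_mul_of_compact (h.fc τ (hI hτI)) hψ0 hψc), green hu2 hψ hψc]
      rw [e1]
      have htend : Tendsto (fun s => ∫ y, ((s - τ)⁻¹ * (u y s - u y τ)) * ψ y) (𝓝[>] τ)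
          (𝓝 (∫ y, (lap n (fun z => u z τ) y + f y τ) * ψ y)) := by
        refine tendsto_integral_filter_of_dominated_convergence (fun y => C' * |ψ y|) ?_ ?_ ?_ ?_
        · filter_upwards [hev] with s hs
          exact ((continuous_const.mul ((h.c2 s (hI ⟨hτ.1.trans hs.1.le, hs.2.le⟩)).continuous.sub
            (h.c2 τ (hI hτI)).continuous)).mul hψ0).aestronglyMeasurable
        · filter_upwards [hev] with s hs
          refine .of_forall fun y => ?_
          by_cases hy : y ∈ tsupport ψ
          · rw [norm_mul, norm_eq_abs, norm_eq_abs, abs_mul]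
            refine mul_le_right ?_ (abs_nonneg _)
            have hpos : 0 < s - τ := sub_pos.2 hs.1
            rw [abs_inv, abs_of_pos hpos, inv_mul_le_iff₀ hpos, mul_comm]
            exact hlip τ hτA hτI y (hψU hy) s ⟨hs.1.le, hs.2⟩
          · simp [image_eq_zero_of_notMem_tsupport hy]
        · exact (hψ0.abs.integrable_of_hasCompactSupport hψc.norm).const_mul C'
        · refine .of_forall fun y => Tendsto.mul_const _ ?_
          have := (h.ut y τ (hI hτI)).hasDerivWithinAt (s := Ioi τ)
          rw [hasDerivWithinAt_iff_tendsto_slope' (by simp)] at this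
          exact this
      refine htend.congr' ?_
      filter_upwards [hev] with s hs
      have hsI : s ∈ Icc a b := ⟨hτ.1.trans hs.1.le, hs.2.le⟩
      rw [slope_def_module, smul_eq_mul]
      simp only [k]
      rw [← integral_sub (integrable_mul_of_compact (h.c2 s (hI hsI)).continuous hψ0 hψc)
        (integrable_mul_of_compact (h.c2 τ (hI hτI)).continuous hψ0 hψc), ← integral_const_mul]
      congr 1; ext y; ring
    · exact (h2 τ hτA hτI ψ hψ hψc (hψU.trans (ball_subset_ball (by linarith)))).hasDerivWithinAt
  have hRi : IntervalIntegrable R volume a b := by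
    apply ContinuousOn.intervalIntegrable; rwa [uIcc_of_le hab]
  have hFTC : ∀ τ ∈ Ico a b, HasDerivWithinAt (fun τ => ∫ σ in a..τ, R σ) (R τ) (Ici τ) τ := by
    intro τ hτ
    refine intervalIntegral.integral_hasDerivWithinAt_right
      (hRi.mono_set (by
        rw [uIcc_of_le hτ.1, uIcc_of_le hab]; exact Icc_subset_Icc_right hτ.2.le))
      (t := Ioi τ) ?_ ?_
    · refine ⟨Icc a b, ?_, hRc.aestronglyMeasurable measurableSet_Icc⟩
      exact mem_of_superset (Ioo_mem_nhdsGT hτ.2) fun z hz => ⟨hτ.1.trans hz.1.le, hz.2.le⟩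
    · refine (hRc τ ⟨hτ.1, hτ.2.le⟩).mono_of_mem_nhdsWithin ?_
      exact mem_of_superset (Ioo_mem_nhdsGT hτ.2) fun z hz => ⟨hτ.1.trans hz.1.le, hz.2.le⟩
  have hconst := constant_of_has_deriv_right_zero (f := fun τ => k τ - ∫ σ in a..τ, R σ)
    (a := a) (b := b) (hkc.sub (intervalIntegral.continuousOn_primitive_interval
      (by rw [uIcc_of_le hab]; exact hRc.integrableOn_Icc) |>.mono (by rw [uIcc_of_le hab])))
    (fun τ hτ => ((hkR τ hτ).sub (hFTC τ hτ)).congr_deriv (sub_self _))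
  have hkeq : ∀ τ ∈ Icc a b, k τ = (k a - ∫ σ in a..a, R σ) + ∫ σ in a..τ, R σ := by
    intro τ hτ; have := hconst τ hτ; linarith
  have hd : HasDerivAt (fun τ => ∫ σ in a..τ, R σ) (R t) t := by
    refine intervalIntegral.integral_hasDerivAt_right (hRi.mono_set (by
        rw [uIcc_of_le ht.1.le, uIcc_of_le hab]; exact Icc_subset_Icc_right ht.2.le))
      ⟨Icc a b, Icc_mem_nhds ht.1 ht.2, hRc.aestronglyMeasurable measurableSet_Icc⟩
      (hRc.continuousAt (Icc_mem_nhds ht.1 ht.2))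
  refine (hd.const_add (k a - ∫ σ in a..a, R σ)).congr_of_eventuallyEq ?_
  filter_upwards [Icc_mem_nhds ht.1 ht.2] with τ hτ using hkeq τ hτ

theorem CSol.wf_sub {f : EE n → ℝ → ℝ} (h : CSol α β u f M N) {t : ℝ}
    (ht : t ∈ Ioo α β) {ψ1 ψ2 : EE n → ℝ} (h1 : ContDiff ℝ 2 ψ1) (h1c : HasCompactSupport ψ1)
    (h2 : ContDiff ℝ 2 ψ2) (h2c : HasCompactSupport ψ2) (w1 : WF u f ψ1 t) (w2 : WF u f ψ2 t) :
    WF u f (fun y => ψ1 y + ψ2 y) t := by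
  have hu := fun τ hτ => (h.c2 τ hτ).continuous
  have := (w1.fun_add w2).congr_of_eventuallyEq
    (f₁ := fun τ => ∫ y, u y τ * (ψ1 y + ψ2 y)) (by
      filter_upwards [Ioo_mem_nhds ht.1 ht.2] with τ hτ
      rw [← integral_add (integrable_mul_of_compact (hu τ hτ) h1.continuous h1c)
        (integrable_mul_of_compact (hu τ hτ) h2.continuous h2c)]
      simp [mul_add])
  refine this.congr_deriv ?_
  have i : ∀ {ψ : EE n → ℝ}, ContDiff ℝ 2 ψ → HasCompactSupport ψ →
      Integrable fun y => u y t * lap n ψ y + f y t * ψ y := fun hψ hc =>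
    (integrable_mul_of_compact (hu t ht) (lap_continuous hψ) (lap_hasCompactSupport hc)).add
      (integrable_mul_of_compact (h.fc t ht) hψ.continuous hc)
  rw [← integral_add (i h1 h1c) (i h2 h2c)]
  congr 1; ext y
  rw [lap_add h1 h2]; ring

theorem CSol.patch {f : EE n → ℝ → ℝ} (h : CSol α β u f M N) {t : ℝ}
    (ht : t ∈ Ioo α β) (hψ : ContDiff ℝ 2 ψ) (hc : HasCompactSupport ψ)
    (hloc : ∀ x ∈ tsupport ψ, ∃ r > 0, ∀ ψ', ContDiff ℝ 2 ψ' → HasCompactSupport ψ' →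
      tsupport ψ' ⊆ ball x r → WF u f ψ' t) : WF u f ψ t := by
  let P : Set (EE n) → Prop := fun S => ∃ χ, ContDiff ℝ 2 χ ∧ (∀ y ∈ S, χ y = 1) ∧
    ∀ ψ', ContDiff ℝ 2 ψ' → HasCompactSupport ψ' → WF u f (fun y => χ y * ψ' y) t
  have hP : P (tsupport ψ) := by
    refine IsCompact.induction_on hc ?_ ?_ ?_ ?_
    · refine ⟨fun _ => 0, contDiff_const, by simp, fun ψ' _ _ => ?_⟩
      have h0 : lap n (fun _ => (0:ℝ)) = fun _ => 0 := by
        ext y; exact lap_eq_zero_of_notMem (by simp)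
      simp only [WF, zero_mul, mul_zero, h0, add_zero, integral_zero]
      exact hasDerivAt_const _ _
    · rintro S S' hS ⟨χ, h1, h2, h3⟩
      exact ⟨χ, h1, fun y hy => h2 y (hS hy), h3⟩
    · rintro S S' ⟨χ, h1, h2, h3⟩ ⟨χ', h1', h2', h3'⟩
      refine ⟨fun y => χ y + χ' y * (1 - χ y), h1.add (h1'.mul (contDiff_const.sub h1)), ?_, ?_⟩
      · rintro y (hy | hy)
        · simp [h2 y hy]
        · simp [h2' y hy]
      · intro ψ' a1 a2
        have b1 : ContDiff ℝ 2 fun y => (1 - χ y) * ψ' y := (contDiff_const.sub h1).mul a1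
        have b2 : HasCompactSupport fun y => (1 - χ y) * ψ' y := a2.mul_left
        have := h.wf_sub ht (h1.mul a1) a2.mul_left (h1'.mul b1) b2.mul_left (h3 ψ' a1 a2)
          (h3' _ b1 b2)
        convert this using 2
        ring
    · intro x hx
      obtain ⟨r, hr, hw⟩ := hloc x hx
      obtain ⟨η, e1, e2, e3, -, e5, -⟩ := exists_cutoff x hr
      refine ⟨ball x _, mem_nhdsWithin_of_mem_nhds
        (ball_mem_nhds x (by positivity)), η, e1, e5, fun ψ' a1 a2 => ?_⟩
      exact hw _ (e1.mul a1) a2.mul_left ((tsupport_mul_subset_left).trans e3)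
  obtain ⟨χ, -, h2, h3⟩ := hP
  have : (fun y => χ y * ψ y) = ψ := by
    ext y
    by_cases hy : y ∈ tsupport ψ
    · rw [h2 y hy, one_mul]
    · rw [image_eq_zero_of_notMem_tsupport hy, mul_zero]
  rw [← this]
  exact h3 ψ hψ hc

theorem CSol.toWSol {f : EE n → ℝ → ℝ} (h : CSol α β u f M N) :
    WSol univ α β u f := by
  let G : Set (EE n × ℝ) := {q | ∃ r > 0, ∀ τ ∈ Ioo α β, |τ - q.2| < r → ∀ ψ : EE n → ℝ,
    ContDiff ℝ 2 ψ → HasCompactSupport ψ → tsupport ψ ⊆ ball q.1 r → WF u f ψ τ}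
  have hG : IsOpen G := by
    refine Metric.isOpen_iff.2 ?_
    rintro ⟨x, t⟩ ⟨r, hr, hq⟩
    refine ⟨r / 2, by positivity, ?_⟩
    rintro ⟨x', t'⟩ hd
    rw [mem_ball, Prod.dist_eq, max_lt_iff] at hd
    refine ⟨r / 2, by positivity, fun τ hτ hτ' ψ a1 a2 a3 => hq τ hτ ?_ ψ a1 a2 (a3.trans ?_)⟩
    · have h1 := hd.2
      simp only [dist_eq] at h1 hτ' ⊢
      calc |τ - t| ≤ |τ - t'| + |t' - t| := abs_sub_le _ _ _
        _ < r := by linarith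
    · exact ball_subset_ball' (by linarith [hd.1])
  have key : ∀ q : EE n × ℝ, q.2 ∈ Ioo α β → q ∈ G := by
    by_contra hcon
    push Not at hcon
    obtain ⟨q1, hq1, hq1G⟩ := hcon
    have hM0 : 0 ≤ M := (abs_nonneg _).trans (h.bu 0 _ hq1)
    have hN0 : 0 ≤ N := (abs_nonneg _).trans (h.bf 0 _ hq1)
    let Bd : Set (EE n × ℝ) := (Prod.snd ⁻¹' Ioo α β) ∩ Gᶜ
    have hBd : IsLocallyClosed Bd :=
      ⟨_, _, isOpen_Ioo.preimage continuous_snd, hG.isClosed_compl, rfl⟩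
    have := hBd.locallyCompactSpace
    have : Nonempty Bd := ⟨⟨q1, hq1, hq1G⟩⟩
    let P : ℕ → Set Bd := fun k => {q | ∀ y e, y ∈ ball q.1.1 (1 / (k + 1)) →
      y + e ∈ ball q.1.1 (1 / (k + 1)) → y - e ∈ ball q.1.1 (1 / (k + 1)) →
      |u (y + e) q.1.2 + u (y - e) q.1.2 - 2 * u y q.1.2| ≤ k * ‖e‖^2}
    have hPc : ∀ k, IsClosed (P k) := by
      intro k
      have huc : ∀ y, Continuous fun q : Bd => u y q.1.2 := fun y =>
        (h.timeu y).comp_continuous (continuous_snd.comp continuous_subtype_val) fun q => q.2.1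
      have ho : ∀ z : EE n, IsOpen {q : Bd | z ∈ ball q.1.1 (1 / ((k:ℝ) + 1))} := by
        intro z
        simp only [mem_ball]
        exact isOpen_lt (continuous_const.dist (continuous_fst.comp continuous_subtype_val))
          continuous_const
      have hP : P k = ⋂ y, ⋂ e, {q : Bd | y ∈ ball q.1.1 (1 / ((k:ℝ) + 1)) →
          y + e ∈ ball q.1.1 (1 / (k + 1)) → y - e ∈ ball q.1.1 (1 / (k + 1)) →
          |u (y + e) q.1.2 + u (y - e) q.1.2 - 2 * u y q.1.2| ≤ k * ‖e‖^2} := by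
        ext q; simp only [P, mem_iInter, mem_setOf_eq]
      rw [hP]
      refine isClosed_iInter fun y => isClosed_iInter fun e =>
        isClosed_imp (ho _) (isClosed_imp (ho _) (isClosed_imp (ho _) ?_))
      exact isClosed_le (((huc (y + e)).add (huc (y - e))).sub
        ((huc y).const_mul 2)).abs continuous_const
    have hPu : ⋃ k, P k = univ := by
      refine eq_univ_of_forall fun q => mem_iUnion.2 ?_
      obtain ⟨K, -, hK⟩ := exists_second_diff_bound (h.c2 q.1.2 q.2.1) q.1.1 1
      obtain ⟨k, hk⟩ := exists_nat_ge K
      have hsub : ball q.1.1 (1 / ((k:ℝ) + 1)) ⊆ closedBall q.1.1 1 :=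
        (ball_subset_ball (by
          rw [div_le_one (by positivity)]; linarith [(Nat.cast_nonneg k : (0:ℝ) ≤ k)])).trans
          ball_subset_closedBall
      exact ⟨k, fun y e _ a2 a3 => (hK y e (hsub a2) (hsub a3)).trans
        (mul_le_right hk (by positivity))⟩
    obtain ⟨k, q0, hq0⟩ := nonempty_interior_of_iUnion_of_closed hPc hPu
    rw [mem_interior_iff_mem_nhds, mem_nhds_subtype] at hq0
    obtain ⟨V, hV, hVP⟩ := hq0
    obtain ⟨⟨x₀, t0⟩, ht0, hx0⟩ := q0
    simp only [mem_preimage] at ht0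
    obtain ⟨δ, hδ, hδV⟩ := Metric.mem_nhds_iff.1 hV
    have hk1 : (0:ℝ) < 1 / (k + 1) := by positivity
    obtain ⟨r, hr, hr'⟩ := exists_between (lt_min hδ (half_pos hk1))
    obtain ⟨hrδ, hrk⟩ := lt_min_iff.1 hr'
    obtain ⟨w, hw, hw'⟩ := exists_between (lt_min hδ (lt_min (sub_pos.2 ht0.1) (sub_pos.2 ht0.2)))
    obtain ⟨hwδ, hw2⟩ := lt_min_iff.1 hw'
    obtain ⟨hwa, hwb⟩ := lt_min_iff.1 hw2
    let Kc : Set (EE n × ℝ) := (closedBall x₀ r ×ˢ Icc (t0 - w) (t0 + w)) ∩ Gᶜ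
    have hKc : IsCompact Kc :=
      ((isCompact_closedBall x₀ r).prod isCompact_Icc).inter_right hG.isClosed_compl
    have hI : ∀ t ∈ Icc (t0 - w) (t0 + w), t ∈ Ioo α β := fun t ht =>
      ⟨by linarith [ht.1], by linarith [ht.2]⟩
    have := h.local_wf hM0 hN0 (x0 := x₀) (r := r) (N2 := k) hr (Nat.cast_nonneg k)
      (a := t0 - w) (b := t0 + w) (by linarith) (by linarith) ((hKc.image continuous_snd).isClosed) ?_ ?_
    · refine hx0 ⟨min (r / 2) w, by positivity, fun τ hτ hτ' ψ a1 a2 a3 =>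
        this τ ?_ ψ a1 a2 (a3.trans (ball_subset_ball (min_le_left _ _)))⟩
      have := (hτ'.trans_le (min_le_right _ _))
      rw [abs_lt] at this
      exact ⟨by linarith [this.1], by linarith [this.2]⟩
    · rintro t ⟨⟨x, t⟩, ⟨⟨hx, ht⟩, hb⟩, rfl⟩ - y e b1 b2 b3
      simp only at hx ht b1 b2 b3 ⊢
      have hmem : (⟨(x, t), hI t ht, hb⟩ : Bd) ∈ P k := by
        refine hVP (hδV ?_)
        rw [mem_ball, Prod.dist_eq, max_lt_iff]
        refine ⟨(mem_closedBall.1 hx).trans_lt hrδ, ?_⟩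
        simp only [dist_eq]
        rw [abs_lt]
        exact ⟨by linarith [ht.1], by linarith [ht.2]⟩
      have hsub : ball x₀ r ⊆ ball x (1 / ((k:ℝ) + 1)) := by
        refine ball_subset_ball' ?_
        rw [dist_comm]
        linarith [mem_closedBall.1 hx]
      exact hmem y e (hsub b1) (hsub b2) (hsub b3)
    · intro t htA ht ψ a1 a2 a3
      refine h.patch (hI t ht) a1 a2 fun x hx => ?_
      have hxG : (x, t) ∈ G := by
        by_contra hb
        exact htA ⟨(x, t), ⟨⟨ball_subset_closedBall (a3 hx), ht⟩, hb⟩, rfl⟩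
      obtain ⟨r', hr', hG'⟩ := hxG
      exact ⟨r', hr', hG' t (hI t ht) (by simpa using hr')⟩
  refine h.wsol le_rfl le_rfl fun t ht ψ a1 a2 _ => h.patch ht a1 a2 fun x _ => ?_
  obtain ⟨r, hr, hG'⟩ := key (x, t) ht
  exact ⟨r, hr, hG' t ht (by simpa using hr)⟩

theorem exists_big_cutoff (n : ℕ) : ∃ (h : ℕ → EE n → ℝ) (d : ℕ → ℝ), Tendsto d atTop (𝓝 0) ∧
    (∀ k, 0 ≤ d k) ∧ (∀ k, ContDiff ℝ 2 (h k)) ∧ (∀ k, HasCompactSupport (h k)) ∧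
    (∀ k y, 0 ≤ h k y ∧ h k y ≤ 1) ∧ (∀ y, Tendsto (fun k => h k y) atTop (𝓝 1)) ∧
    (∀ k y z, |h k y - h k z| ≤ d k * ‖y - z‖) ∧ (∀ k y, |lap n (h k) y| ≤ d k) ∧
    (∀ k i y, |pd i (h k) y| ≤ d k) := by
  obtain ⟨h, h1, h2, -, h4, h5, A, B, hA0, hB0, hA, hB, -⟩ := exists_cutoff 0 one_pos
  obtain ⟨K, hK⟩ := ContDiff.lipschitzWith_of_hasCompactSupport h2 h1 (by norm_num)
  have hr : ∀ k : ℕ, (0:ℝ) < ((k:ℝ) + 1)⁻¹ := fun k => by positivity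
  have e : ∀ k : ℕ, (fun y : EE n => h _) =
      fun y => h ((0 : EE n) + ((k:ℝ) + 1)⁻¹ • y) := fun k => by ext y; rw [zero_add]
  have hpd : ∀ (k : ℕ) i, pd i (fun y : EE n => h (((k:ℝ) + 1)⁻¹ • y)) =
      fun y => ((k:ℝ) + 1)⁻¹ * pd i h (((k:ℝ) + 1)⁻¹ • y) := by
    intro k i; ext y
    rw [e, pd_affine (h1.differentiable (by norm_num) _), zero_add]
  have hlim : Tendsto (fun k : ℕ => ((k:ℝ) + 1)⁻¹) atTop (𝓝 0) := by
    simpa using tendsto_one_div_add_atTop_nhds_zero_nat (𝕜 := ℝ)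
  refine ⟨fun k y => h (((k:ℝ) + 1)⁻¹ • y), fun k => (A + B + K) * ((k:ℝ) + 1)⁻¹, ?_, ?_, ?_, ?_, ?_,
    ?_, ?_, ?_, ?_⟩
  · simpa using hlim.const_mul (A + B + K)
  · intro k; have := hr k; positivity
  · intro k; exact h1.comp (contDiff_const_smul _)
  · intro k
    exact h2.comp_homeomorph (Homeomorph.smulOfNeZero _ (hr k).ne')
  · intro k y; exact h4 _
  · intro y
    have : Tendsto (fun k : ℕ => ((k:ℝ) + 1)⁻¹ • y) atTop (𝓝 0) := by simpa using hlim.smul_const y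
    refine tendsto_const_nhds.congr' ?_
    filter_upwards [this (ball_mem_nhds 0 (by norm_num : (0:ℝ) < 3 * 1 / 4))] with k hk
    exact (h5 _ hk).symm
  · intro k y z
    have := hK.dist_le_mul (((k:ℝ) + 1)⁻¹ • y) (((k:ℝ) + 1)⁻¹ • z)
    rw [dist_eq_norm, dist_eq_norm, ← smul_sub, norm_smul, norm_of_nonneg (hr k).le] at this
    refine this.trans ?_
    have : (0:ℝ) ≤ ((k:ℝ) + 1)⁻¹ * ‖y - z‖ := mul_nonneg (hr k).le (norm_nonneg _)
    nlinarith
  · intro k y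
    have : lap n (fun y : EE n => h (((k:ℝ) + 1)⁻¹ • y)) y =
        (((k:ℝ) + 1)⁻¹)^2 * lap n h (((k:ℝ) + 1)⁻¹ • y) := by
      simp only [lap_eq, Finset.mul_sum]
      refine Finset.sum_congr rfl fun i _ => ?_
      rw [hpd, pd_const_mul]
      have e2 : (fun y : EE n => pd i h (((k:ℝ) + 1)⁻¹ • y)) =
        fun y => pd i h (0 + ((k:ℝ) + 1)⁻¹ • y) := by ext y; rw [zero_add]
      rw [e2, pd_affine (pd_differentiable h1 _), zero_add]; ring
    rw [this, abs_mul, abs_of_nonneg (sq_nonneg _)]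
    calc _ ≤ (((k:ℝ) + 1)⁻¹ * 1) * A := by
          rw [pow_two]
          exact mul_le_mul (mul_le_left ((fun k =>
    inv_le_one_of_one_le₀ (by linarith [(Nat.cast_nonneg k : (0:ℝ) ≤ k)])) k) (hr k).le) (hA _) (abs_nonneg _)
            (by have := hr k; positivity)
      _ ≤ _ := by
          have : 0 ≤ (B + K) * ((k:ℝ) + 1)⁻¹ := by have := hr k; positivity
          linarith
  · intro k i y
    rw [hpd, abs_mul, abs_of_pos (hr k)]
    calc _ ≤ ((k:ℝ) + 1)⁻¹ * B := mul_le_left (hB _ _) (hr k).le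
      _ ≤ _ := by
          have : 0 ≤ (A + K) * ((k:ℝ) + 1)⁻¹ := by positivity
          linarith

theorem SG_mul_cutoff {v : EE n → ℝ} {η : ℕ → EE n → ℝ} (hv : Continuous v)
    (hM : ∀ y, |v y| ≤ M) (hη : ∀ k, Continuous (η k)) (h01 : ∀ k y, 0 ≤ η k y ∧ η k y ≤ 1)
    (hlim : ∀ y, Tendsto (fun k => η k y) atTop (𝓝 1)) (θ) (x) :
    Tendsto (fun k => SG n θ (fun y => v y * η k y) x) atTop (𝓝 (SG n θ v x)) := by
  refine tendsto_integral_filter_of_dominated_convergence (bound := fun ζ => M * rho n ζ) ?_ ?_ ?_ ?_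
  · refine .of_forall fun k => ?_
    have := hη k
    exact (((hv.comp (by fun_prop)).mul (this.comp (by fun_prop))).mul
      rho_cont).aestronglyMeasurable
  · refine .of_forall fun k => Eventually.of_forall fun ζ => ?_
    rw [norm_eq_abs, abs_mul, abs_mul, abs_of_pos (rho_pos ζ), abs_of_nonneg (h01 k _).1]
    refine mul_le_right ?_ (rho_pos ζ).le
    calc _ ≤ M * 1 := mul_le_mul (hM _) (h01 k _).2 (h01 k _).1 ((abs_nonneg _).trans (hM 0))
      _ = M := mul_one _
  · exact (rho_integrable).const_mul M
  · refine .of_forall fun ζ => ?_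
    simpa using (((hlim _).const_mul _).mul_const _)

theorem WSol.duhamel_bound (h : WSol univ α β v F)
    (hM : ∀ y, ∀ t ∈ Ioo α β, |v y t| ≤ M) {t0 t : ℝ} (ht0 : α < t0) (htt : t0 < t) (ht : t < β)
    {m : ℕ} (c : Fin m → ℝ) (x : Fin m → EE n) {b B : ℝ → ℝ} (hB : ∀ θ > 0, HasDerivAt B (b θ) θ)
    (hB0 : Tendsto B (𝓝[>] 0) (𝓝 (B 0)))
    (hb : ∀ σ ∈ Icc t0 t, ∀ η : EE n → ℝ, Continuous η → (∀ y, 0 ≤ η y ∧ η y ≤ 1) →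
      (∀ y z, |η y - η z| ≤ ‖y - z‖) → ∀ θ > 0,
      |∑ j, c j * SG n θ (fun y => F y σ * η y) (x j)| ≤ b θ) :
    |∑ j, c j * v (x j) t - ∑ j, c j * SG n (t - t0) (fun y => v y t0) (x j)| ≤ B (t - t0) - B 0 := by
  have hI : Icc t0 t ⊆ Ioo α β := fun z hz => ⟨ht0.trans_le hz.1, hz.2.trans_lt ht⟩
  obtain ⟨η, δ, hδ, hδ0, hη, hηc, h01, hlim, hlip, hlap, hpd⟩ := exists_big_cutoff n
  set K2 := ∫ ζ : EE n, (1 + ‖ζ‖)^2 * rho n ζ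
  have hmain : ∀ ε > 0, |∑ j, c j * SG n ε (fun y => v y t) (x j) -
      ∑ j, c j * SG n (t + ε - t0) (fun y => v y t0) (x j)| ≤ B (t + ε - t0) - B ε := by
    intro ε hε
    have hk : ∀ k, δ k ≤ 1 → |∑ j, c j * SG n ε (fun y => v y t * η k y) (x j) -
        ∑ j, c j * SG n (t + ε - t0) (fun y => v y t0 * η k y) (x j)| ≤
        (∑ j, |c j|) * (M * (δ k + n * (δ k / √ε) * K2)) * (t - t0) + (B (t + ε - t0) - B ε) := by
      intro k hk1
      have e1 : ∀ s, s < t + ε → ∀ x, SG n (t + ε - s) (fun y => v y s * η k y) x =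
          ∫ y, v y s * (η k y * GK n (t + ε - s) (x - y)) := by
        intro s hs x
        unfold SG
        rw [← integral_GK (by linarith) x (fun y => v y s * η k y)]
        simp only [mul_assoc]
      have hL : ∀ θ ≥ ε, ∀ (x : EE n) i y, |pd i (η k) y * (x - y) i| ≤
          θ * (δ k / √ε * (1 + ‖(√θ)⁻¹ • (x - y)‖)^2) := by
        intro θ hθ x i y
        have hθ0 : 0 < θ := hε.trans_le hθ
        have h2 : ‖x - y‖ = √θ * ‖(√θ)⁻¹ • (x - y)‖ := by
          rw [norm_smul, norm_inv, norm_of_nonneg (sqrt_nonneg _)]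
          field_simp
        rw [abs_mul]
        calc _ ≤ δ k * ‖x - y‖ :=
              mul_le_mul (hpd k i y) (abs_coord_le _ i) (abs_nonneg _) (hδ0 k)
          _ = δ k * (√θ * ‖(√θ)⁻¹ • (x - y)‖) := by rw [← h2]
          _ ≤ δ k * ((√θ * (√θ / √ε)) * (1 + ‖(√θ)⁻¹ • (x - y)‖)^2) := by
              refine mul_le_left ?_ (hδ0 k)
              refine mul_le_mul ?_ ?_ (norm_nonneg _) (by positivity)
              · exact le_mul_of_one_le_right (sqrt_nonneg _) ((one_le_div (sqrt_pos.2 hε)).2 (sqrt_le_sqrt hθ))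
              · nlinarith
          _ = _ := by rw [← mul_div_assoc, mul_self_sqrt hθ0.le]; ring
      have hder : ∀ σ ∈ Icc t0 t, HasDerivAt
          (fun σ => ∑ j, c j * ∫ y, v y σ * (η k y * GK n (t + ε - σ) (x j - y)))
          (∑ j, c j * ((∫ y, v y σ * (lap n (η k) y * GK n (t + ε - σ) (x j - y) +
          2 * ∑ i, pd i (η k) y * ((x j - y) i / (2 * (t + ε - σ)) * GK n (t + ε - σ) (x j - y))))
          + SG n (t + ε - σ) (fun y => F y σ * η k y) (x j))) σ := by
        intro σ hσ
        refine HasDerivAt.fun_sum fun j _ => HasDerivAt.const_mul (c j) ?_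
        exact (h.mono subset_rfl le_rfl (min_le_left _ _)).duhamel_split (hη k) (hηc k) (subset_univ _) (x j) (τ := t + ε)
          ((min_le_right _ _).trans_lt (by linarith))
          ⟨ht0.trans_le hσ.1, hσ.2.trans_lt (lt_min ht (by linarith) : t < min β (t + ε / 2))⟩
      set e := (∑ j, |c j|) * (M * (δ k + n * (δ k / √ε) * K2)) with he
      have hBd : ∀ σ ∈ Icc t0 t, HasDerivAt
          (fun σ => e * (σ - t0) + (B (t + ε - t0) - B (t + ε - σ))) (e + b (t + ε - σ)) σ := by
        intro σ hσ
        have h1 := (hB (t + ε - σ) (by linarith [hσ.2])).comp_const_sub (t + ε) σ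
        exact ((((hasDerivAt_id' σ).sub_const t0).const_mul e).fun_add
          (h1.const_sub (B (t + ε - t0)))).congr_deriv (by ring)
      have hbd := image_norm_le_of_norm_deriv_right_le_deriv_boundary'
        (f := fun σ => ∑ j, c j * (∫ y, v y σ * (η k y * GK n (t + ε - σ) (x j - y))) -
          ∑ j, c j * (∫ y, v y t0 * (η k y * GK n (t + ε - t0) (x j - y)))) (a := t0) (b := t)
        (fun σ hσ => ((hder σ hσ).sub_const _).continuousAt.continuousWithinAt)
        (fun σ hσ => ((hder σ ⟨hσ.1, hσ.2.le⟩).sub_const _).hasDerivWithinAt)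
        (by simp) (fun σ hσ => (hBd σ hσ).continuousAt.continuousWithinAt)
        (fun σ hσ => (hBd σ ⟨hσ.1, hσ.2.le⟩).hasDerivWithinAt)
        (fun σ hσ => by
          have hσ' : σ ∈ Icc t0 t := ⟨hσ.1, hσ.2.le⟩
          have hθ : ε ≤ t + ε - σ := by linarith [hσ.2]
          have hθ0 : 0 < t + ε - σ := hε.trans_le hθ
          rw [(fun X Y => by simp only [mul_add, Finset.sum_add_distrib] : ∀ X Y : Fin m → ℝ, ∑ j, c j * (X j + Y j) = ∑ j, c j * X j + ∑ j, c j * Y j)]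
          refine (norm_add_le _ _).trans (add_le_add ?_ ?_)
          · refine (norm_sum_le _ _).trans ?_
            rw [he, Finset.sum_mul]
            refine Finset.sum_le_sum fun j _ => ?_
            rw [norm_mul, norm_eq_abs]
            refine mul_le_left ?_ (abs_nonneg _)
            exact cutoff_error hθ0 (x j) (fun y _ => hM y σ (hI hσ')) ((abs_nonneg _).trans (hM 0 t (hI ⟨htt.le, le_rfl⟩)))
              (div_nonneg (hδ0 k) (sqrt_nonneg _)) (hlap k) (hL _ hθ (x j))
          · exact hb σ hσ' (η k) (hη k).continuous (h01 k) (fun y z => (hlip k y z).trans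
              (mul_le_of_le_one_left (norm_nonneg _) hk1)) _ hθ0)
        (right_mem_Icc.2 htt.le)
      have e2 := fun j => (e1 t (by linarith) (x j)).symm
      simp only [e2, (fun j => (e1 t0 (by linarith) (x j)).symm)] at hbd
      rw [add_sub_cancel_left] at hbd
      exact hbd
    have hc : ∀ s ∈ Icc t0 t, ∀ θ, Tendsto (fun k => ∑ j, c j *
        SG n θ (fun y => v y s * η k y) (x j)) atTop
        (𝓝 (∑ j, c j * SG n θ (fun y => v y s) (x j))) := fun s hs θ =>
      tendsto_finsetSum _ fun j _ => (SG_mul_cutoff (h.contv s (hI hs))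
        (fun y => hM y s (hI hs)) (fun k => (hη k).continuous) h01 hlim θ (x j)).const_mul _
    have hl1 := ((hc t (right_mem_Icc.2 htt.le) ε).sub
      (hc t0 (left_mem_Icc.2 htt.le) (t + ε - t0))).abs
    have hl2 : Tendsto (fun k => (∑ j, |c j|) * (M * (δ k + n * (δ k / √ε) * K2)) * (t - t0) +
        (B (t + ε - t0) - B ε)) atTop (𝓝 ((∑ j, |c j|) * (M * (0 + n * (0 / √ε) * K2)) * (t - t0) +
        (B (t + ε - t0) - B ε))) := by
      refine Tendsto.add_const _ (Tendsto.mul_const _ (Tendsto.const_mul _ (Tendsto.const_mul _ ?_)))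
      exact hδ.add ((Tendsto.const_mul _ (hδ.div_const _)).mul_const _)
    simp only [zero_div, mul_zero, zero_mul, add_zero, zero_add] at hl2
    refine le_of_tendsto_of_tendsto hl1 hl2 ?_
    filter_upwards [hδ.eventually_le_const zero_lt_one] with k hk1 using hk k hk1
  have hs : ∀ s ∈ Icc t0 t, ∀ θ, Tendsto (fun ε => ∑ j, c j * SG n (θ + ε) (fun y => v y s) (x j))
      (𝓝[>] 0) (𝓝 (∑ j, c j * SG n θ (fun y => v y s) (x j))) := fun s hs θ => by
    refine tendsto_finsetSum _ fun j _ => Tendsto.const_mul _ ?_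
    refine (SG_tendsto (h.contv s (hI hs)) (fun y => hM y s (hI hs)) (x j) θ).comp ?_
    have : Tendsto (fun ε : ℝ => θ + ε) (𝓝 0) (𝓝 (θ + 0)) := Continuous.tendsto (by fun_prop) 0
    rw [add_zero] at this
    exact this.mono_left nhdsWithin_le_nhds
  have l1 := ((hs t (right_mem_Icc.2 htt.le) 0).sub (hs t0 (left_mem_Icc.2 htt.le) (t - t0))).abs
  simp only [SG_zero] at l1
  have l2 : Tendsto (fun ε => B (t - t0 + ε) - B ε) (𝓝[>] 0) (𝓝 (B (t - t0) - B 0)) := by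
    refine Tendsto.sub ?_ hB0
    have hc := (hB (t - t0) (by linarith)).continuousAt.tendsto
    have : Tendsto (fun ε : ℝ => t - t0 + ε) (𝓝 0) (𝓝 _) :=
      Continuous.tendsto (by fun_prop) 0
    rw [add_zero] at this
    exact hc.comp (this.mono_left nhdsWithin_le_nhds)
  refine le_of_tendsto_of_tendsto l1 l2 ?_
  filter_upwards [self_mem_nhdsWithin] with ε hε
  have := hmain ε hε
  rw [show t + ε - t0 = t - t0 + ε by ring] at this
  simpa using this

theorem sqrt_barrier (c) : (∀ q > 0, HasDerivAt (fun q => 2 * c * √q) (c / √q) q) ∧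
    Tendsto (fun q => 2 * c * √q) (𝓝[>] 0) (𝓝 (2 * c * √0)) := by
  constructor
  · intro q hθ
    refine ((hasDerivAt_sqrt hθ.ne').const_mul _).congr_deriv ?_
    field_simp
  · exact (Continuous.tendsto (by fun_prop) 0).mono_left nhdsWithin_le_nhds

theorem exists_wsol_lip (n : ℕ) : ∃ C > 0, ∀ (a b M N : ℝ) (v F : EE n → ℝ → ℝ),
    WSol univ a b v F → (∀ y, ∀ t ∈ Ioo a b, |v y t| ≤ M) →
    (∀ y, ∀ t ∈ Ioo a b, |F y t| ≤ N) → ∀ t0 t, a < t0 → t0 < t → t < b → ∀ x e,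
    |v (x + e) t - v x t| ≤ C * (M / √(t - t0) + N * √(t - t0)) * ‖e‖ := by
  obtain ⟨C, hC, hS⟩ := exists_SG_lip n
  refine ⟨2 * C, by positivity, fun a b M N v F h hM hN t0 t ht0 htt ht x e => ?_⟩
  have hI : Icc t0 t ⊆ Ioo a b := fun z hz => ⟨ht0.trans_le hz.1, hz.2.trans_lt ht⟩
  have h0 : t0 ∈ Icc t0 t := ⟨le_rfl, htt.le⟩
  have hM0 := (abs_nonneg _).trans (hM 0 t0 (hI h0))
  have hb := h.duhamel_bound hM ht0 htt ht ![1, -1] ![x + e, x]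
    (sqrt_barrier _).1 (sqrt_barrier _).2 (fun s hσ i hη h01 _ q hθ => by
      have := hS (fun y => F y s * i y) N ((h.contF s (hI hσ)).mul hη) (fun y => by
        rw [abs_mul, abs_of_nonneg (h01 y).1]
        exact (mul_le_mul (hN y s (hI hσ)) (h01 y).2 (h01 y).1 ((abs_nonneg _).trans (hN 0 t0 (hI h0)))).trans_eq (mul_one _)) q hθ x e
      simpa [← sub_eq_add_neg] using this)
  have h2 := hS (fun y => v y t0) M (h.contv t0 (hI h0)) (fun y => hM y t0 (hI h0)) (t - t0)
    (by linarith) x e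
  simp only [Fin.sum_univ_two, Matrix.cons_val_zero, Matrix.cons_val_one, one_mul, neg_mul,
    ← sub_eq_add_neg, sqrt_zero] at hb
  have h3 := abs_sub_abs_le_abs_sub (v (x + e) t - v x t)
    (SG n (t - t0) (fun y => v y t0) (x + e) - SG n (t - t0) (fun y => v y t0) x)
  have hp : 0 ≤ C * M * ‖e‖ / √(t - t0) := by positivity
  rw [(show 2 * C * (M / √(t - t0) + N * √(t - t0)) * ‖e‖ =
    2 * (C * M * ‖e‖ / √(t - t0)) + 2 * (C * N * ‖e‖) * √(t - t0) by ring)]; linarith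

theorem SG_sub_const (hf : Continuous f) (hM : ∀ y, |f y| ≤ M) (θ c)
    (x) : SG n θ (fun y => f y - c) x = SG n θ f x - c := by
  unfold SG
  simp only [sub_mul]
  rw [integral_sub (integrable_of_growth (m := 0) (by fun_prop)
    (fun y => by simpa using hM _)) (rho_integrable.const_mul c), integral_const_mul,
    integral_rho, mul_one]

theorem exists_wsol_diff2 (n : ℕ) : ∃ C > 0, ∀ (α β M N K) (v F : EE n → ℝ → ℝ),
    WSol univ α β v F → (∀ y, ∀ t ∈ Ioo α β, |v y t| ≤ M) →
    (∀ y, ∀ t ∈ Ioo α β, |F y t| ≤ N) → ∀ t0 t, α < t0 → t0 < t → t < β → 0 ≤ K →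
    (∀ σ ∈ Icc t0 t, ∀ y z, |F y σ - F z σ| ≤ K * ‖y - z‖) → ∀ x e,
    |v (x + e) t + v (x - e) t - 2 * v x t| ≤
      C * (M / (t - t0) + (N + K) * √(t - t0)) * ‖e‖^2 := by
  obtain ⟨C, hC, hS⟩ := exists_SG_diff2 n
  refine ⟨2 * C, by positivity, fun α β M N K v F h hM hN t0 t ht0 htt ht hK0 hK x e => ?_⟩
  have hI : Icc t0 t ⊆ Ioo α β := fun z hz => ⟨ht0.trans_le hz.1, hz.2.trans_lt ht⟩
  have h0 : t0 ∈ Icc t0 t := ⟨le_rfl, htt.le⟩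
  have hN0 : 0 ≤ N := (abs_nonneg _).trans (hN 0 t0 (hI h0))
  have hM0 := (abs_nonneg _).trans (hM 0 t0 (hI h0))
  have hb := h.duhamel_bound hM ht0 htt ht (m := 3) ![1, 1, -2] ![x + e, x - e, x]
    (sqrt_barrier _).1 (sqrt_barrier _).2
    (fun σ hσ η hη h01 hlip θ hθ => by
      have hcF : Continuous fun y => F y σ * η y := (h.contF σ (hI hσ)).mul hη
      have hbF : ∀ y, |F y σ * η y| ≤ N := fun y => by
        rw [abs_mul, abs_of_nonneg (h01 y).1]
        exact (mul_le_mul (hN y σ (hI hσ)) (h01 y).2 (h01 y).1 hN0).trans_eq (mul_one _)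
      have hs := sqrt_pos.2 hθ
      have := hS (fun y => F y σ * η y - F x σ * η x) ((N + K) * √θ) (hcF.sub continuous_const)
        θ hθ x e (fun ζ => by
          have l1 := hK σ hσ (x + √θ • ζ) x
          have l2 := hlip (x + √θ • ζ) x
          rw [add_sub_cancel_left, norm_smul, norm_of_nonneg hs.le] at l1 l2
          simp only [(show F (x + √θ • ζ) σ * η (x + √θ • ζ) - F x σ * η x =
            (F (x + √θ • ζ) σ - F x σ) * η (x + √θ • ζ) + F x σ * (η (x + √θ • ζ) - η x) by ring)]
          refine (abs_add_le _ _).trans ?_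
          rw [abs_mul, abs_mul, abs_of_nonneg (h01 _).1]
          have a1 := mul_le_mul l1 (h01 (x + √θ • ζ)).2 (h01 _).1 ((abs_nonneg _).trans l1)
          have a2 := mul_le_mul (hN x σ (hI hσ)) l2 (abs_nonneg _) hN0
          have a3 : 0 ≤ (N + K) * √θ := by positivity
          linarith)
      rw [SG_sub_const hcF hbF, SG_sub_const hcF hbF, SG_sub_const hcF hbF] at this
      have e5 : C * ((N + K) * √θ) * ‖e‖^2 / θ = C * (N + K) * ‖e‖^2 / √θ := by
        rw [div_eq_div_iff hθ.ne' hs.ne']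
        calc _ = C * (N + K) * ‖e‖^2 * (√θ * √θ) := by ring
          _ = _ := by rw [mul_self_sqrt hθ.le]
      rw [e5] at this
      simp only [Fin.sum_univ_three, Matrix.cons_val_zero, Matrix.cons_val_one, Matrix.cons_val_two,
        Matrix.tail_cons, Matrix.head_cons, one_mul]
      convert this using 2
      ring)
  have h2 := hS (fun y => v y t0) M (h.contv t0 (hI h0)) (t - t0)
    (by linarith) x e (fun y => (hM _ t0 (hI h0)).trans
      (le_mul_of_one_le_right hM0 (by linarith [norm_nonneg y])))
  simp only [Fin.sum_univ_three, Matrix.cons_val_zero, Matrix.cons_val_one, Matrix.cons_val_two,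
        Matrix.tail_cons, Matrix.head_cons, one_mul, sqrt_zero, mul_zero, sub_zero] at hb
  have h3 := abs_sub_abs_le_abs_sub (v (x + e) t + v (x - e) t + -2 * v x t)
    (SG n (t - t0) (fun y => v y t0) (x + e) + SG n (t - t0) (fun y => v y t0) (x - e) +
      -2 * SG n (t - t0) (fun y => v y t0) x)
  have hp : 0 ≤ C * M * ‖e‖^2 / (t - t0) :=
    div_nonneg (by positivity) (by linarith)
  rw [(show 2 * C * (M / (t - t0) + (N + K) * √(t - t0)) * ‖e‖^2 =
    2 * (C * M * ‖e‖^2 / (t - t0)) + 2 * (C * (N + K) * ‖e‖^2) * √(t - t0) by ring)]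
  simp only [neg_mul, ← sub_eq_add_neg] at h3 hb
  linarith

theorem WSol.abs_sub_SG_le (h : WSol univ α β v F)
    (hM : ∀ y, ∀ t ∈ Ioo α β, |v y t| ≤ M) (hN : ∀ y, ∀ t ∈ Ioo α β, |F y t| ≤ N)
    {t0 t : ℝ} (ht0 : α < t0) (htt : t0 < t) (ht : t < β) (x) :
    |v x t - SG n (t - t0) (fun y => v y t0) x| ≤ N * (t - t0) := by
  have hI : Icc t0 t ⊆ Ioo α β := fun z hz => ⟨ht0.trans_le hz.1, hz.2.trans_lt ht⟩
  have hb := h.duhamel_bound hM ht0 htt ht ![1] ![x]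
    (fun θ _ => by simpa using (hasDerivAt_id' θ).const_mul N)
    ((Continuous.tendsto (by fun_prop) 0).mono_left nhdsWithin_le_nhds)
    (fun σ hσ η hη h01 _ θ hθ => by
      have : |SG n θ (fun y => F y σ * η y) x| ≤ N := abs_integral_rho_le fun ζ => by
        rw [abs_mul, abs_of_nonneg (h01 _).1]
        exact (mul_le_mul (hN _ σ (hI hσ)) (h01 _).2 (h01 _).1 ((abs_nonneg _).trans (hN 0 t0 (hI ⟨le_rfl, htt.le⟩)))).trans_eq (mul_one _)
      simpa using this)
  simpa using hb

theorem abs_pd_le_of_lip {K : ℝ} (hK : 0 ≤ K)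
    (h : ∀ x y, |f x - f y| ≤ K * ‖x - y‖) (i) (x) : |pd i f x| ≤ K := by
  have h2 := (fderiv ℝ f x).le_opNorm (single i 1)
  rw [(show ‖(single i 1 : EE n)‖ = 1 by simp), mul_one] at h2
  exact h2.trans (norm_fderiv_le_of_lip' ℝ (f := f) (x₀ := x) hK (.of_forall fun y => h y x))

theorem abs_diff_quot_le (hf : ContDiff ℝ 2 f) (i : Fin n)
    (hN : ∀ x, |pd i (pd i f) x| ≤ N) (x) {h : ℝ} (hh : 0 ≤ h) :
    |f (x + h • single i 1) - f x - h * pd i f x| ≤ N * h * h := by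
  have h0 : (x + (0:ℝ) • (single i 1)) = x := by simp
  have h1 : ∀ s ∈ Icc 0 h, |pd i f (x + s • single i 1) - pd i f x| ≤ N * h := by
    intro s hs
    have := mvt (convex_Icc 0 h)
      (fun s _ => pd_line (x := x) s (pd_differentiable hf _))
      (fun s _ => hN _) (left_mem_Icc.2 hh) hs
    rw [h0, sub_zero, abs_of_nonneg hs.1] at this
    exact this.trans (mul_le_left hs.2 ((abs_nonneg _).trans (hN 0)))
  have := mvt (convex_Icc 0 h)
      (fun s _ => (pd_line (x := x) s ((hf.differentiable (by norm_num)) _)).fun_sub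
        ((hasDerivAt_id' s).mul_const _))
      (fun s hs => by rw [one_mul]; exact h1 s hs) (left_mem_Icc.2 hh) (right_mem_Icc.2 hh)
  rw [h0, sub_zero, abs_of_nonneg hh, zero_mul, sub_zero] at this
  rwa [sub_right_comm] at this

/-- classical solutions with the regularity provided by interior estimates -/
structure RSol (a b : ℝ) (u f : EE n → ℝ → ℝ) (K : ℝ) : Prop where
  c2 : ∀ t ∈ Ioo a b, ContDiff ℝ 2 (fun y => u y t)
  ut : ∀ x, ∀ t ∈ Ioo a b, HasDerivAt (u x) (lap n (fun y => u y t) x + f x t) t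
  bu : ∀ y, ∀ t ∈ Ioo a b, |u y t| ≤ K
  bf : ∀ y, ∀ t ∈ Ioo a b, |f y t| ≤ K
  lipx : ∀ t ∈ Ioo a b, ∀ x y, |u x t - u y t| ≤ K * ‖x - y‖
  lipt : ∀ x, ∀ t ∈ Ioo a b, ∀ s ∈ Ioo a b, |u x t - u x s| ≤ K * |t - s|
  bgrad : ∀ t ∈ Ioo a b, ∀ i x, |pd i (fun y => u y t) x| ≤ K
  bhess : ∀ t ∈ Ioo a b, ∀ i x, |pd i (pd i (fun y => u y t)) x| ≤ K
  cgrad : ∀ i, ContinuousOn (fun q : EE n × ℝ => pd i (fun y => u y q.2) q.1)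
    (univ ×ˢ Ioo a b)
  clap : ContinuousOn (fun q : EE n × ℝ => lap n (fun y => u y q.2) q.1)
    (univ ×ˢ Ioo a b)

theorem continuousOn_of_bound {g : EE n × ℝ → ℝ}
    (h : ∀ e > 0, ∃ C, ∀ x y, ∀ t ∈ I, ∀ s ∈ I, |g (x, t) - g (y, s)| ≤ e + C * (‖x - y‖ + |t - s|)) :
    ContinuousOn g (univ ×ˢ I) := by
  rintro ⟨x, t⟩ ⟨-, ht⟩
  refine Metric.tendsto_nhds.2 fun e hε => ?_
  obtain ⟨C, hC⟩ := h (e / 2) (by positivity)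
  have hc : Tendsto (fun q => C * (‖q.1 - x‖ + |q.2 - t|)) (𝓝[univ ×ˢ I] (x, t))
      _ :=
    (Continuous.tendsto (by fun_prop)
      _).mono_left nhdsWithin_le_nhds
  rw [sub_self, sub_self, norm_zero, abs_zero, add_zero, mul_zero] at hc
  filter_upwards [hc.eventually_lt_const (half_pos hε), self_mem_nhdsWithin] with q hq hqI
  rw [dist_eq]
  have := hC q.1 x q.2 hqI.2 t ht
  linarith

theorem SG_sub_le_of_lip {K : ℝ} (hK : 0 ≤ K) (hM : ∀ y, |f y| ≤ M)
    (h : ∀ x y, |f x - f y| ≤ K * ‖x - y‖) (hf : Continuous f) (θ) (x) :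
    |SG n θ f x - f x| ≤ K * √θ * ∫ ζ : EE n, (1 + ‖ζ‖)^1 * rho n ζ := by
  rw [← SG_sub_const hf hM θ _ x]
  rw [← integral_const_mul]
  refine (abs_integral_le_integral_abs).trans (integral_mono_of_nonneg
    (.of_forall fun _ => abs_nonneg _) ((integrable_pow_mul_rho 1).const_mul _)
    (.of_forall fun ζ => ?_))
  beta_reduce
  rw [abs_mul, abs_of_pos (rho_pos ζ), ← mul_assoc]
  refine mul_le_right ?_ (rho_pos ζ).le
  refine (h _ _).trans ?_
  rw [add_sub_cancel_left, norm_smul, norm_of_nonneg (sqrt_nonneg _), ← mul_assoc]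
  exact mul_le_left (by simp) (by positivity)

theorem WSol.diff_quot (h : WSol univ α β v F) {ε : ℝ}
    (hε : 0 ≤ ε) : WSol univ α (β - ε) (fun x t => ε⁻¹ * (v x (t + ε) - v x t))
      (fun x t => ε⁻¹ * (F x (t + ε) - F x t)) := by
  have hI : ∀ t ∈ Ioo α (β - ε), t ∈ Ioo α β ∧ t + ε ∈ Ioo α β := fun t ht =>
    ⟨⟨ht.1, by linarith [ht.2]⟩, by linarith [ht.1], by linarith [ht.2]⟩
  obtain ⟨M, hM⟩ := h.bv
  refine ⟨fun t ht => continuous_const.mul ((fun t ht => (h.contv _ (hI t ht).2).sub (h.contv _ (hI t ht).1)) t ht), fun t ht => continuous_const.mul ((fun t ht => (h.contF _ (hI t ht).2).sub (h.contF _ (hI t ht).1)) t ht),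
    fun y => continuousOn_const.mul (((h.timev y).comp (by fun_prop) fun t ht => (hI t ht).2).sub
      ((h.timev y).mono fun t ht => (hI t ht).1)), ⟨|ε⁻¹| * (M + M), fun y t ht => ?_⟩, ?_⟩
  · rw [abs_mul]
    exact mul_le_left ((abs_sub _ _).trans
      (add_le_add (hM y _ (hI t ht).2) (hM y _ (hI t ht).1))) (abs_nonneg _)
  · intro ψ hψ hc hU t ht
    have hψ0 := hψ.continuous
    have e : ∀ τ ∈ Ioo α (β - ε), ∫ y, (ε⁻¹ * (v y (τ + ε) - v y τ)) * ψ y =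
        ε⁻¹ * ((∫ y, v y (τ + ε) * ψ y) - ∫ y, v y τ * ψ y) := by
      intro τ hτ
      rw [← integral_sub (integrable_mul_of_compact (h.contv _ (hI τ hτ).2) hψ0 hc)
        (integrable_mul_of_compact (h.contv _ (hI τ hτ).1) hψ0 hc), ← integral_const_mul]
      exact integral_congr_ae (.of_forall fun y => by ring)
    refine (((((h.wf ψ hψ hc hU _ (hI t ht).2).comp_add_const t ε).sub
      (h.wf ψ hψ hc hU _ (hI t ht).1)).const_mul ε⁻¹).congr_deriv ?_).congr_of_eventuallyEq ?_
    · have i1 := fun σ (hσ : σ ∈ Ioo α β) =>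
        (integrable_mul_of_compact (h.contv _ hσ) (lap_continuous hψ) (lap_hasCompactSupport hc)).fun_add
          (integrable_mul_of_compact (h.contF _ hσ) hψ0 hc)
      rw [← integral_sub (i1 _ (hI t ht).2) (i1 _ (hI t ht).1), ← integral_const_mul]
      exact integral_congr_ae (.of_forall fun y => by ring)
    · filter_upwards [isOpen_Ioo.mem_nhds ht] with τ hτ using e τ hτ

theorem CSol.toRSol {L : ℝ} {f : EE n → ℝ → ℝ} (h : CSol α β u f M N)
    (hL : 0 ≤ L) (hf : ∀ x y, ∀ t ∈ Ioo α β, ∀ s ∈ Ioo α β,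
      |f x t - f y s| ≤ L * |u x t - u y s|) {α' : ℝ} (hα : α < α') :
    ∃ K, RSol α' β u f K := by
  rcases lt_or_ge α' β with hβ | hβ
  swap
  · have : Ioo α' β = ∅ := Ioo_eq_empty (not_lt.2 hβ)
    exact ⟨0, by constructor <;> simp [this]⟩
  obtain ⟨C1, hC1, H1⟩ := exists_wsol_lip n
  obtain ⟨C2, hC2, H2⟩ := exists_wsol_diff2 n
  set m1 := ∫ ζ : EE n, (1 + ‖ζ‖)^1 * rho n ζ
  set m2 := ∫ ζ : EE n, (1 + ‖ζ‖)^2 * rho n ζ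
  have hm1 : 0 ≤ m1 := integral_nonneg fun ζ => mul_nonneg (by positivity) (rho_pos ζ).le
  have hm2 : 0 ≤ m2 := integral_nonneg fun ζ => mul_nonneg (by positivity) (rho_pos ζ).le
  have hW := h.toWSol
  obtain ⟨δ, hδ, hδα⟩ : ∃ δ > 0, α' = α + 4 * δ := ⟨(α' - α) / 4, by linarith, by ring⟩
  have ht0 : (α + β) / 2 ∈ Ioo α β := ⟨by linarith, by linarith⟩
  have hM0 : 0 ≤ M := (abs_nonneg _).trans (h.bu 0 _ ht0)
  have hN0 : 0 ≤ N := (abs_nonneg _).trans (h.bf 0 _ ht0)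
  obtain ⟨K1, hK1, l1⟩ : ∃ K1, 0 ≤ K1 ∧ ∀ t ∈ Ioo (α + δ) β, ∀ x y,
      |u x t - u y t| ≤ K1 * ‖x - y‖ := by
    refine ⟨C1 * (M / √δ + N * √δ), by positivity, fun t ht x y => ?_⟩
    have := H1 α β M N u f hW h.bu h.bf (t - δ) t (by linarith [ht.1]) (by linarith) ht.2 y (x - y)
    simpa using this
  have lf : ∀ t ∈ Ioo (α + δ) β, ∀ x y, |f x t - f y t| ≤ L * K1 * ‖x - y‖ := by
    intro t ht x y
    have ht' : t ∈ Ioo α β := ⟨by linarith [ht.1], ht.2⟩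
    rw [mul_assoc]
    exact (hf x y t ht' t ht').trans (mul_le_left (l1 t ht x y) hL)
  obtain ⟨K2, hK2, d2⟩ : ∃ K2, 0 ≤ K2 ∧ ∀ t ∈ Ioo (α + 2 * δ) β, ∀ x e,
      |u (x + e) t + u (x - e) t - 2 * u x t| ≤ K2 * ‖e‖^2 := by
    refine ⟨C2 * (M / (δ / 2) + (N + L * K1) * √(δ / 2)), by positivity, fun t ht x e => ?_⟩
    have := H2 α β M N (L * K1) u f hW h.bu h.bf (t - δ / 2) t (by linarith [ht.1]) (by linarith)
      ht.2 (by positivity)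
      (fun σ hσ y z => lf σ ⟨by linarith [ht.1, hσ.1], hσ.2.trans_lt ht.2⟩ y z) x e
    simpa using this
  have bh : ∀ t ∈ Ioo (α + 2 * δ) β, ∀ i x, |pd i (pd i (fun y => u y t)) x| ≤ K2 :=
    fun t ht i x => abs_pdpd_le (h.c2 t ⟨by linarith [ht.1], ht.2⟩) x i one_pos
      fun e _ => d2 t ht x e
  -- Lipschitz in time
  obtain ⟨K3, hK3, l3⟩ : ∃ K3, 0 ≤ K3 ∧ ∀ x, ∀ t ∈ Ioo (α + 2 * δ) β,
      ∀ s ∈ Ioo (α + 2 * δ) β, |u x t - u x s| ≤ K3 * |t - s| := by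
    refine ⟨N + K2 * m2, by positivity, fun x t ht s hs => ?_⟩
    wlog hst : s < t generalizing s t
    · rcases (not_lt.1 hst).eq_or_lt with rfl | h
      · simp
      · rw [abs_sub_comm, abs_sub_comm t]; exact this s hs t ht h
    · have hs' : s ∈ Ioo α β := ⟨by linarith [hs.1], hs.2⟩
      have e1 := hW.abs_sub_SG_le h.bu h.bf hs'.1 hst ht.2 x
      have e2 := SG_sub_le ((fun t ht => (h.c2 t ht).continuous) s hs') (fun y => h.bu y s hs') x hK2 (d2 s hs x)
        (sub_nonneg.2 hst.le)
      rw [abs_of_pos (sub_pos.2 hst)]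
      calc |u x t - u x s| ≤ _ := abs_sub_le _ (SG n (t - s) (fun y => u y s) x) _
        _ ≤ N * (t - s) + K2 * (t - s) * m2 := add_le_add e1 e2
        _ = _ := by ring
  -- the difference quotients in time
  have hW2 : WSol univ (α + 2 * δ) β u f := hW.mono subset_rfl (by linarith) le_rfl
  have bD : ∀ ε > 0, ∀ x, ∀ t ∈ Ioo (α + 2 * δ) (β - ε),
      |ε⁻¹ * (u x (t + ε) - u x t)| ≤ K3 := by
    intro ε hε x t ht
    have := l3 x (t + ε) ⟨by linarith [ht.1], by linarith [ht.2]⟩ t ⟨ht.1, by linarith [ht.2]⟩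
    rw [add_sub_cancel_left, abs_of_pos hε] at this
    rw [abs_mul, abs_of_pos (inv_pos.2 hε), inv_mul_le_iff₀ hε]
    linarith
  have bDf : ∀ ε > 0, ∀ x, ∀ t ∈ Ioo (α + 2 * δ) (β - ε),
      |ε⁻¹ * (f x (t + ε) - f x t)| ≤ L * K3 := by
    intro ε hε x t ht
    have := bD ε hε x t ht
    have h2 := hf x x (t + ε) ⟨by linarith [ht.1], by linarith [ht.2]⟩ t
      ⟨by linarith [ht.1], by linarith [ht.2]⟩
    rw [abs_mul, abs_of_pos (inv_pos.2 hε)] at this ⊢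
    refine (mul_le_left h2 (inv_pos.2 hε).le).trans ?_
    rw [mul_left_comm]
    exact mul_le_left this hL
  have tD : ∀ x, ∀ t ∈ Ioo α β, Tendsto (fun ε => ε⁻¹ * (u x (t + ε) - u x t)) (𝓝[>] 0)
      (𝓝 (lap n (fun y => u y t) x + f x t)) := fun x t ht =>
    ((hasDerivAt_iff_tendsto_slope_zero.1 (h.ut x t ht)).mono_left
      (nhdsWithin_mono _ fun y (hy : 0 < y) => hy.ne'))
  obtain ⟨K4, hK4, l4⟩ : ∃ K4, 0 ≤ K4 ∧ ∀ ε > 0, ∀ t ∈ Ioo (α + 3 * δ) (β - ε), ∀ x y,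
      |ε⁻¹ * (u x (t + ε) - u x t) - ε⁻¹ * (u y (t + ε) - u y t)| ≤ K4 * ‖x - y‖ := by
    refine ⟨C1 * (K3 / √δ + L * K3 * √δ), by positivity, fun ε hε t ht x y => ?_⟩
    have := H1 (α + 2 * δ) (β - ε) K3 (L * K3) _ _ (hW2.diff_quot hε.le) (bD ε hε) (bDf ε hε)
      (t - δ) t (by linarith [ht.1]) (by linarith) ht.2 y (x - y)
    simpa using this
  obtain ⟨K5, hK5, l5⟩ : ∃ K5, 0 ≤ K5 ∧ ∀ ε > 0, ∀ x, ∀ t ∈ Ioo (α + 3 * δ) (β - ε),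
      ∀ s ∈ Ioo (α + 3 * δ) (β - ε), t < s →
      |ε⁻¹ * (u x (s + ε) - u x s) - ε⁻¹ * (u x (t + ε) - u x t)| ≤
        K5 * ((s - t) + √(s - t)) := by
    refine ⟨L * K3 + K4 * m1, by positivity, fun ε hε x t ht s hs hts => ?_⟩
    have hD := hW2.diff_quot hε.le
    have ht' : t ∈ Ioo (α + 2 * δ) (β - ε) := ⟨by linarith [ht.1], ht.2⟩
    have e1 := hD.abs_sub_SG_le (bD ε hε) (bDf ε hε) ht'.1 hts hs.2 x
    have e2 := SG_sub_le_of_lip hK4 (fun y => bD ε hε y t ht') (l4 ε hε t ht)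
      (hD.contv t ht') (s - t) x
    have a1 := sub_nonneg.2 hts.le
    have a2 := sqrt_nonneg (s - t)
    refine (abs_sub_le _ _ _).trans ((add_le_add e1 e2).trans ?_)
    change L * K3 * (s - t) + K4 * √(s - t) * m1 ≤ _
    nlinarith [mul_nonneg (mul_nonneg hL hK3) a2, mul_nonneg (mul_nonneg hK4 hm1) a1]
  have hev : ∀ t ∈ Ioo (α + 3 * δ) β, ∀ᶠ ε in 𝓝[>] (0:ℝ),
      0 < ε ∧ t ∈ Ioo (α + 3 * δ) (β - ε) := by
    intro t ht
    filter_upwards [self_mem_nhdsWithin, nhdsWithin_le_nhds (gt_mem_nhds (sub_pos.2 ht.2))]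
      with ε h1 h2 using ⟨h1, ht.1, by linarith⟩
  have l4' : ∀ t ∈ Ioo (α + 3 * δ) β, ∀ x y,
      |(lap n (fun y => u y t) x + f x t) - (lap n (fun y => u y t) y + f y t)|
        ≤ K4 * ‖x - y‖ := by
    intro t ht x y
    have ht' : t ∈ Ioo α β := ⟨by linarith [ht.1], ht.2⟩
    refine le_of_tendsto ((tD x t ht').sub (tD y t ht')).abs ?_
    filter_upwards [hev t ht] with ε hε using l4 ε hε.1 t hε.2 x y
  have l5' : ∀ x, ∀ t ∈ Ioo (α + 3 * δ) β, ∀ s ∈ Ioo (α + 3 * δ) β,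
      |(lap n (fun y => u y t) x + f x t) - (lap n (fun y => u y s) x + f x s)|
        ≤ K5 * (|t - s| + √|t - s|) := by
    intro x t ht s hs
    wlog hst : s < t generalizing s t
    · rcases (not_lt.1 hst).eq_or_lt with rfl | h
      · simp
      · rw [abs_sub_comm, abs_sub_comm t]; exact this s hs t ht h
    · rw [abs_of_pos (sub_pos.2 hst)]
      refine le_of_tendsto ((tD x t ⟨by linarith [ht.1], ht.2⟩).sub
        (tD x s ⟨by linarith [hs.1], hs.2⟩)).abs ?_
      filter_upwards [hev t ht, hev s hs] with ε h1 h2 using l5 ε h1.1 x s h2.2 t h1.2 hst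
  have hsub : Ioo α' β ⊆ Ioo (α + 3 * δ) β := Ioo_subset_Ioo_left (by linarith)
  have hsub2 : Ioo α' β ⊆ Ioo (α + 2 * δ) β := Ioo_subset_Ioo_left (by linarith)
  have hsub1 : Ioo α' β ⊆ Ioo (α + δ) β := Ioo_subset_Ioo_left (by linarith)
  have hsub0 : Ioo α' β ⊆ Ioo α β := Ioo_subset_Ioo_left (by linarith)
  have lj : ∀ x y, ∀ t ∈ Ioo α' β, ∀ s ∈ Ioo α' β,
      |u x t - u y s| ≤ (K1 + K3) * (‖x - y‖ + |t - s|) := by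
    intro x y t ht s hs
    have := abs_sub_le (u x t) (u y t) (u y s)
    have a := l1 t (hsub1 ht) x y
    have b := l3 y t (hsub2 ht) s (hsub2 hs)
    nlinarith [mul_nonneg hK1 (abs_nonneg (t - s)), mul_nonneg hK3 (norm_nonneg (x - y))]
  refine ⟨M + N + K1 + K2 + K3, fun t ht => h.c2 t (hsub0 ht),
    fun x t ht => h.ut x t (hsub0 ht), fun y t ht => (h.bu y t (hsub0 ht)).trans (by linarith),
    fun y t ht => (h.bf y t (hsub0 ht)).trans (by linarith),
    fun t ht x y => (l1 t (hsub1 ht) x y).trans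
      (mul_le_right (by linarith) (norm_nonneg _)),
    fun x t ht s hs => (l3 x t (hsub2 ht) s (hsub2 hs)).trans
      (mul_le_right (by linarith) (abs_nonneg _)),
    fun t ht i x => (abs_pd_le_of_lip hK1 (l1 t (hsub1 ht)) i x).trans (by linarith),
    fun t ht i x => (bh t (hsub2 ht) i x).trans (by linarith), fun i => ?_, ?_⟩
  · refine continuousOn_of_bound fun ε hε => ?_
    obtain ⟨η, hη, hηε⟩ : ∃ η > 0, 2 * (K2 * η) ≤ ε := by
      refine ⟨ε / (2 * (K2 + 1)), by positivity, ?_⟩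
      rw [mul_div_assoc', mul_div_assoc', div_le_iff₀ (by positivity)]
      nlinarith
    refine ⟨2 * (K1 + K3) / η, fun x y t ht s hs => ?_⟩
    have q1 := abs_diff_quot_le (h.c2 t (hsub0 ht)) i (bh t (hsub2 ht) i) x hη.le
    have q2 := abs_diff_quot_le (h.c2 s (hsub0 hs)) i (bh s (hsub2 hs) i) y hη.le
    have q3 := lj x y t ht s hs
    have q4 := lj (x + η • single i 1) (y + η • single i 1) t ht s hs
    rw [add_sub_add_right_eq_sub] at q4
    beta_reduce
    set d := ‖x - y‖ + |t - s|
    set A := pd i (fun y => u y t) x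
    set B := pd i (fun y => u y s) y
    have : η * |A - B| ≤ η * (ε + 2 * (K1 + K3) / η * d) := by
      rw [← abs_of_pos hη, ← abs_mul, abs_of_pos hη]
      have e : η * (ε + 2 * (K1 + K3) / η * d) = η * ε + 2 * (K1 + K3) * d := by field_simp
      rw [e, abs_le]
      rw [abs_le] at q1 q2 q3 q4
      constructor <;> nlinarith
    exact le_of_mul_le_mul_left this hη
  · refine continuousOn_of_bound fun ε hε => ?_
    refine ⟨K4 + L * (K1 + K3) + K5 + K5 * (K5 / (4 * ε)), fun x y t ht s hs => ?_⟩
    have q1 := l4' t (hsub ht) x y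
    have q2 := l5' y t (hsub ht) s (hsub hs)
    have q3 := (hf x y t (hsub0 ht) s (hsub0 hs)).trans
      (mul_le_left (lj x y t ht s hs) hL)
    have q4 : K5 * √|t - s| ≤ ε + K5 * (K5 / (4 * ε)) * |t - s| := by
      have e : K5 * (K5 / (4 * ε)) * |t - s| = (K5 * √|t - s|)^2 / (4 * ε) := by
        rw [mul_pow, sq_sqrt (abs_nonneg _)]; ring
      rw [e, ← sub_nonneg]
      have : ε + (K5 * √|t - s|)^2 / (4 * ε) - K5 * √|t - s| =
        (2 * ε - K5 * √|t - s|)^2 / (4 * ε) := by field_simp; ring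
      rw [this]; positivity
    beta_reduce
    have hq : 0 ≤ K5 * (K5 / (4 * ε)) := by positivity
    generalize K5 * (K5 / (4 * ε)) = Q at *
    have z1 := norm_nonneg (x - y)
    have z2 := abs_nonneg (t - s)
    have r1 : (K4 + L * (K1 + K3) + K5 + Q) * (‖x - y‖ + |t - s|) =
      K4 * ‖x - y‖ + L * ((K1 + K3) * (‖x - y‖ + |t - s|)) + (K5 * |t - s|) + Q * |t - s|
      + (K4 * |t - s| + K5 * ‖x - y‖ + Q * ‖x - y‖) := by ring
    have r2 : 0 ≤ K4 * |t - s| + K5 * ‖x - y‖ + Q * ‖x - y‖ := by positivity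
    rw [r1]
    have r3 : K5 * (|t - s| + √|t - s|) = K5 * |t - s| + K5 * √|t - s| := by ring
    rw [r3] at q2
    generalize L * ((K1 + K3) * (‖x - y‖ + |t - s|)) = P at *
    rw [abs_le] at q1 q2 q3 ⊢
    constructor <;> linarith

variable {ι : Type*}

/-- polynomial growth in space, uniformly in the parameter -/
def Gr (I : Set ι) (q : EE n → ι → ℝ) : Prop :=
  ∃ C : ℝ, ∃ m : ℕ, 0 ≤ C ∧ ∀ s ∈ I, ∀ y, |q y s| ≤ C * (1 + ‖y‖)^m

namespace Gr

variable {I : Set ι} {θ η : EE n → ι → ℝ}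

theorem of_le (h : Gr I η) (hle : ∀ s ∈ I, ∀ y, |θ y s| ≤ |η y s|) : Gr I θ := by
  obtain ⟨C, m, hC, h⟩ := h
  exact ⟨C, m, hC, fun s hs y => (hle s hs y).trans (h s hs y)⟩

theorem of_bdd (h : ∀ s ∈ I, ∀ y, |θ y s| ≤ C) : Gr I θ :=
  ⟨|C|, 0, abs_nonneg _, fun s hs y => by simpa using (h s hs y).trans (le_abs_self C)⟩

theorem const (c) : Gr (n := n) I (fun _ _ => c) := of_bdd fun _ _ _ => le_rfl

theorem coord (i : Fin n) : Gr I (fun y _ => y i) :=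
  ⟨1, 1, zero_le_one, fun s _ y => by
    have h2 := PiLp.norm_apply_le y i
    rw [norm_eq_abs] at h2
    linarith⟩

theorem norm : Gr I (fun (y : EE n) _ => ‖y‖) :=
  ⟨1, 1, zero_le_one, fun s _ y => by rw [abs_of_nonneg (norm_nonneg y)]; linarith⟩

theorem mul (h1 : Gr I θ) (h2 : Gr I η) : Gr I (fun y s => θ y s * η y s) := by
  obtain ⟨C, m, hC, h⟩ := h1
  obtain ⟨D, k, hD, h'⟩ := h2
  refine ⟨C * D, m + k, by positivity, fun s hs y => ?_⟩
  rw [abs_mul, pow_add, mul_mul_mul_comm]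
  exact mul_le_mul (h s hs y) (h' s hs y) (abs_nonneg _) (by positivity)

theorem add (h1 : Gr I θ) (h2 : Gr I η) : Gr I (fun y s => θ y s + η y s) := by
  obtain ⟨C, m, hC, h⟩ := h1
  obtain ⟨D, k, hD, h'⟩ := h2
  refine ⟨C + D, m + k, by positivity, fun s hs y => ?_⟩
  have h1 : 1 ≤ 1 + ‖y‖ := by linarith [norm_nonneg y]
  rw [add_mul]
  exact (abs_add_le _ _).trans (add_le_add ((h s hs y).trans (mul_le_left (pow_le_pow_right₀ h1 (by lia)) hC))
    ((h' s hs y).trans (mul_le_left (pow_le_pow_right₀ h1 (by lia)) hD)))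

theorem const_mul (c) (h : Gr I θ) : Gr I (fun y s => c * θ y s) := (const c).mul h

theorem neg (h : Gr I θ) : Gr I (fun y s => - θ y s) := h.of_le fun s _ y => by rw [abs_neg]

theorem sub (h1 : Gr I θ) (h2 : Gr I η) : Gr I (fun y s => θ y s - η y s) := by
  simpa only [sub_eq_add_neg] using h1.add h2.neg

theorem sum {J : Type*} {S : Finset J} {q : J → EE n → ι → ℝ} (h : ∀ j ∈ S, Gr I (q j)) :
    Gr I (fun y s => ∑ j ∈ S, q j y s) := by
  classical
  induction S using Finset.induction_on with
  | empty => simpa using const 0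
  | insert a S ha ih =>
    simp [Finset.sum_insert ha]
    exact (h a (Finset.mem_insert_self _ _)).add
      (ih fun j hj => h j (Finset.mem_insert_of_mem hj))

theorem pow (h : Gr I θ) (k) : Gr I (fun y s => θ y s^k) := by
  induction k with
  | zero => simpa using const 1
  | succ k ih => simpa only [pow_succ] using ih.mul h

theorem integrable (h : Gr I θ) {s : ι} (hs : s ∈ I) (hc : Continuous fun y => θ y s) :
    Integrable (fun y => θ y s * rho n y) := by
  obtain ⟨C, m, hC, h⟩ := h
  exact integrable_of_growth hc.aestronglyMeasurable (h s hs)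

theorem single {s : ι} (h : Gr I θ) (hs : s ∈ I) (he : ∀ y, f y = θ y s) :
    Gr (univ : Set Unit) (fun y _ => f y) := by
  obtain ⟨C, m, hC, h⟩ := h
  exact ⟨C, m, hC, fun _ _ y => by change |f y| ≤ _; rw [he]; exact h s hs y⟩

end Gr

/-- differentiation under the Gaussian integral -/
theorem hasDerivAt_integral_rho (hI : IsOpen I) {θ θ' : EE n → ℝ → ℝ}
    (hd : ∀ y, ∀ s ∈ I, HasDerivAt (θ y) (θ' y s) s)
    (hc : ∀ s ∈ I, Continuous fun y => θ y s) (hc' : ∀ s ∈ I, Continuous fun y => θ' y s)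
    (hg : Gr I θ) (hg' : Gr I θ') (hs : s ∈ I) :
    HasDerivAt (fun s => ∫ y, θ y s * rho n y) (∫ y, θ' y s * rho n y) s := by
  obtain ⟨C, m, hC, h⟩ := hg'
  refine (hasDerivAt_integral_of_dominated_loc_of_deriv_le
    (F' := fun s y => θ' y s * rho n y) (hI.mem_nhds hs) ?_ (hg.integrable hs (hc s hs)) ?_ ?_
    ((integrable_pow_mul_rho m).const_mul C) ?_).2
  · filter_upwards [hI.mem_nhds hs] with t ht using
      ((hc t ht).mul rho_cont).aestronglyMeasurable
  · exact ((hc' s hs).mul rho_cont).aestronglyMeasurable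
  · refine .of_forall fun y t ht => ?_
    rw [norm_mul, norm_eq_abs, norm_of_nonneg (rho_pos y).le, ← mul_assoc]
    exact mul_le_right (h t ht y) (rho_pos y).le
  · exact .of_forall fun y t ht => (hd y t ht).mul_const _

/-- the Ornstein-Uhlenbeck operator -/
def OU (f : EE n → ℝ) (y : EE n) : ℝ :=
  lap n f y - ∑ i, y i / 2 * pd i f y

abbrev Gr1 (f : EE n → ℝ) : Prop := Gr (univ : Set Unit) (fun y _ => f y)

theorem Gr1.int (h : Gr1 f) (hc : Continuous f) :
    Integrable (fun y => f y * rho n y) := Gr.integrable h (mem_univ ()) hc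

theorem OU_continuous (hf : ContDiff ℝ 2 f) : Continuous (OU f) := by
  have := fun i => pd_continuous (i := i) (hf.of_le (by norm_num))
  have := lap_continuous hf
  unfold OU
  fun_prop

theorem ou_ibp {W : EE n → ℝ} (hψ : ContDiff ℝ 1 ψ) (hW : ContDiff ℝ 2 W) (gψ : Gr1 ψ)
    (gψ' : ∀ i, Gr1 (pd i ψ)) (gW' : ∀ i, Gr1 (pd i W)) (gW'' : ∀ i, Gr1 (pd i (pd i W))) :
    ∫ y, ψ y * OU W y * rho n y = - ∫ y, (∑ i, pd i ψ y * pd i W y) * rho n y := by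
  have cψ := hψ.continuous
  have cψ' := fun i => pd_continuous (i := i) hψ
  have cW' := fun i => pd_continuous (i := i) (hW.of_le (by norm_num))
  have hdψ := hψ.differentiable (by norm_num)
  have hdρ : Differentiable ℝ (rho n) := (rho_contDiff (m := 1)).differentiable (by norm_num)
  have e1 : ∀ i, pd i (fun y => ψ y * rho n y) = fun y => (pd i ψ y - y i / 2 * ψ y) * rho n y := by
    intro i; ext y
    rw [pd_mul (hdψ y) (hdρ y), pd_rho]; ring
  have i1 : ∀ i, Integrable fun y => pd i ψ y * pd i W y * rho n y :=
    fun i => Gr1.int ((gψ' i).mul (gW' i)) ((cψ' i).mul (cW' i))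
  have i2 : ∀ i, Integrable fun y => 2⁻¹ * y i * ψ y * pd i W y * rho n y := fun i =>
    Gr1.int (((((fun i => (Gr.coord (n := n) (I := (univ : Set Unit)) i)) i).const_mul 2⁻¹).mul gψ).mul (gW' i))
      (((continuous_const.mul (by fun_prop)).mul cψ).mul (cW' i))
  have i3 : ∀ i, Integrable fun y => ψ y * pd i (pd i W) y * rho n y :=
    fun i => Gr1.int (gψ.mul (gW'' i)) (cψ.mul ((fun i => pdpd_continuous (i := i) (j := i) hW) i))
  have i4 : ∀ i, Integrable fun y => ψ y * pd i W y * rho n y :=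
    fun i => Gr1.int (gψ.mul (gW' i)) (cψ.mul (cW' i))
  have key : ∀ i, ∫ y, (ψ y * pd i (pd i W) y - 2⁻¹ * y i * ψ y * pd i W y) * rho n y =
      - ∫ y, (pd i ψ y * pd i W y) * rho n y := by
    intro i
    have := pd_ibp (i := i) (f := fun y => ψ y * rho n y) (hdψ.mul hdρ)
      (pd_differentiable hW) (((i1 i).sub (i2 i)).congr (.of_forall fun y => by
        simp only [e1, Pi.sub_apply]; ring))
      ((i3 i).congr (.of_forall fun y => by ring))
      ((i4 i).congr (.of_forall fun y => by ring))
    have e2 : ∫ y, pd i (fun y => ψ y * rho n y) y * pd i W y =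
        (∫ y, pd i ψ y * pd i W y * rho n y) - ∫ y, 2⁻¹ * y i * ψ y * pd i W y * rho n y := by
      rw [← integral_sub (i1 i) (i2 i)]
      exact integral_congr_ae (.of_forall fun y => by simp only [e1]; ring)
    rw [e2, (integral_congr_ae (.of_forall fun y => by beta_reduce; ring) : ∫ y, ψ y * rho n y * pd i (pd i W) y = ∫ y, ψ y * pd i (pd i W) y * rho n y)] at this
    simp only [sub_mul]
    rw [integral_sub (i3 i) (i2 i), this]
    ring
  simp only [Finset.sum_mul]
  rw [integral_finsetSum _ fun i _ => i1 i, ← Finset.sum_neg_distrib]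
  simp only [← key]
  rw [← integral_finsetSum _ fun i _ => ((i3 i).sub (i2 i)).congr
    (.of_forall fun y => by simp only [Pi.sub_apply]; ring)]
  refine integral_congr_ae (.of_forall fun y => ?_)
  beta_reduce
  rw [OU, lap_eq, mul_sub, Finset.mul_sum, Finset.mul_sum, ← Finset.sum_sub_distrib, Finset.sum_mul]
  exact Finset.sum_congr rfl fun i _ => by ring

/-- classical solutions of `W_s = 𝓛 W + H` with polynomial growth -/
structure SSol (I : Set ℝ) (W H : EE n → ℝ → ℝ) : Prop where
  c2 : ∀ s ∈ I, ContDiff ℝ 2 (fun y => W y s)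
  ws : ∀ y, ∀ s ∈ I, HasDerivAt (W y) (OU (fun y => W y s) y + H y s) s
  cH : ∀ s ∈ I, Continuous (fun y => H y s)
  gW : Gr I W
  gH : Gr I H
  gW' : ∀ i, Gr I (fun y s => pd i (fun y => W y s) y)
  gW'' : ∀ i, Gr I (fun y s => pd i (pd i (fun y => W y s)) y)

namespace SSol

theorem gOU (h : SSol I W H) : Gr I (fun y s => OU (fun y => W y s) y) := by
  refine (Gr.sum fun i _ => h.gW'' i).sub (Gr.sum fun i _ => ?_)
  exact ((Gr.coord i).mul (Gr.const _)).mul (h.gW' i)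

theorem cWs (h : SSol I W H) (hs : s ∈ I) :
    Continuous fun y => OU (fun y => W y s) y + H y s :=
  (OU_continuous (h.c2 s hs)).add (h.cH s hs)

end SSol

theorem fderiv_eq_sum_pd (f) (x : EE n) :
    fderiv ℝ f x = ∑ i, pd i f x • (EuclideanSpace.proj i) := by
  ext v
  have hv : v = ∑ i, v i • (single i 1) := by
    ext j
    simp [Pi.single_apply]
  conv_lhs => rw [hv]
  simp [pd, mul_comm]

/-- chain rule along a space-time curve -/
theorem hasDerivAt_curve
    (hd : ∀ t ∈ Ioo α β, Differentiable ℝ fun y => v y t)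
    (hc : ∀ i, ContinuousOn (fun q => pd i (fun y => v y q.2) q.1)
      (univ ×ˢ Ioo α β)) {X : ℝ → EE n} {τ : ℝ → ℝ} {X' : EE n} {τ' d : ℝ}
    (ht : τ s ∈ Ioo α β) (hv : HasDerivAt (v (X s)) d (τ s)) (hX : HasDerivAt X X' s)
    (hτ : HasDerivAt τ τ' s) :
    HasDerivAt (fun s => v (X s) (τ s)) (∑ i, X' i * pd i (fun y => v y (τ s)) (X s) + d * τ') s := by
  have hT : Tendsto (fun q => fderiv ℝ (fun y => v y (τ q.1)) q.2)
      (𝓝 s ×ˢ 𝓝[univ] (X s)) (𝓝 (fderiv ℝ (fun y => v y (τ s)) (X s))) := by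
    simp only [fderiv_eq_sum_pd, nhdsWithin_univ]
    refine tendsto_finsetSum _ fun i _ => Tendsto.smul_const ?_ _
    have h2 : Tendsto (fun q => (q.2, τ q.1)) (𝓝 s ×ˢ 𝓝 (X s)) (𝓝 (X s, τ s)) := by
      rw [nhds_prod_eq (x := X s)]
      exact tendsto_snd.prodMk (hτ.continuousAt.tendsto.comp tendsto_fst)
    exact ((hc i).continuousAt ((isOpen_univ.prod isOpen_Ioo).mem_nhds ⟨trivial, ht⟩)).tendsto.comp h2
  have ho : (fun r => v (X r) (τ r) - v (X s) (τ r)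
      - fderiv ℝ (fun y => v y (τ s)) (X s) (X r - X s)) =o[𝓝 s] fun r => X r - X s := by
    rw [Asymptotics.isLittleO_iff]
    intro ε hε
    have h0 := hT (closedBall_mem_nhds _ hε)
    rw [nhdsWithin_univ] at h0
    obtain ⟨pa, ha, pb, hb, hab⟩ := eventually_prod_iff.1 h0
    obtain ⟨δ, hδ, hball⟩ := eventually_nhds_iff_ball.1 hb
    filter_upwards [ha, hτ.continuousAt.eventually (isOpen_Ioo.mem_nhds ht), hX.continuousAt.eventually (ball_mem_nhds _ hδ)] with r hr hr' hXr
    exact (convex_ball (X s) δ).norm_image_sub_le_of_norm_hasFDerivWithin_le'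
      (fun y _ => ((hd _ hr') y).hasFDerivAt.hasFDerivWithinAt)
      (fun y hy => by simpa [dist_eq_norm] using hab hr (hball y hy)) (mem_ball_self hδ) hXr
  have h1 : HasDerivAt (fun r => v (X r) (τ r) - v (X s) (τ r)
      - fderiv ℝ (fun y => v y (τ s)) (X s) (X r - X s)) 0 s := by
    rw [hasDerivAt_iff_isLittleO]
    simpa using ho.trans_isBigO (hX.isBigO_sub)
  have h2 : HasDerivAt (fun r => fderiv ℝ (fun y => v y (τ s)) (X s) (X r - X s))
      (fderiv ℝ (fun y => v y (τ s)) (X s) X') s :=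
    (fderiv ℝ (fun y => v y (τ s)) (X s)).hasFDerivAt.comp_hasDerivAt s (hX.sub_const _)
  have h3 : HasDerivAt (fun r => v (X s) (τ r)) (d * τ') s := hv.comp s hτ
  refine ((h1.add h2).add h3).congr_deriv ?_ |>.congr_of_eventuallyEq ?_
  · rw [zero_add, fderiv_eq_sum_pd]
    simp [mul_comm]
  · exact .of_forall fun r => by simp only [Pi.add_apply]; ring

theorem Gr.comp_affine {ι k : Type*} {J : Set k} {I : Set ι} {q : EE n → k → ℝ} (h : Gr J q)
    (c) {r : ι → ℝ} {τ : ι → k} {R : ℝ} (hτ : ∀ s ∈ I, τ s ∈ J) (hr : ∀ s ∈ I, |r s| ≤ R) :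
    Gr I (fun y s => q (c + r s • y) (τ s)) := by
  obtain ⟨C, m, hC, h⟩ := h
  refine ⟨C * (1 + ‖c‖ + |R|)^m, m, by positivity, fun s hs y => (h _ (hτ s hs) _).trans ?_⟩
  rw [mul_assoc, ← mul_pow]
  refine mul_le_left (pow_le_pow_left₀ (by positivity) ?_ m) hC
  have h1 := norm_add_le c (r s • y)
  rw [norm_smul, norm_eq_abs] at h1
  have h2 := mul_le_right ((hr s hs).trans (le_abs_self R)) (norm_nonneg y)
  nlinarith [norm_nonneg y, norm_nonneg c, abs_nonneg R]

/-- classical solutions of `v_t = Δ v + f` with polynomial growth -/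
structure PSol (a b : ℝ) (v f : EE n → ℝ → ℝ) : Prop where
  c2 : ∀ t ∈ Ioo a b, ContDiff ℝ 2 (fun y => v y t)
  vt : ∀ x, ∀ t ∈ Ioo a b, HasDerivAt (v x) (lap n (fun y => v y t) x + f x t) t
  cf : ∀ t ∈ Ioo a b, Continuous (fun y => f y t)
  gv : Gr (Ioo a b) v
  gf : Gr (Ioo a b) f
  gv' : ∀ i, Gr (Ioo a b) (fun y t => pd i (fun y => v y t) y)
  gv'' : ∀ i, Gr (Ioo a b) (fun y t => pd i (pd i (fun y => v y t)) y)
  cgrad : ∀ i, ContinuousOn (fun q : EE n × ℝ => pd i (fun y => v y q.2) q.1)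
    (univ ×ˢ Ioo a b)

theorem RSol.toPSol {K : ℝ} {f : EE n → ℝ → ℝ} (h : RSol α β u f K)
    (hf : ∀ t ∈ Ioo α β, Continuous (fun y => f y t)) : PSol α β u f :=
  ⟨h.c2, h.ut, hf, .of_bdd fun s hs y => h.bu y s hs, .of_bdd fun s hs y => h.bf y s hs,
    fun i => .of_bdd fun s hs y => h.bgrad s hs i y, fun i => .of_bdd fun s hs y => h.bhess s hs i y,
    h.cgrad⟩

theorem pdpd_affine (hf : ContDiff ℝ 2 f) (c) (r) :
    pd i (pd i (fun y => f (c + r • y))) = fun x => r^2 * pd i (pd i f) (c + r • x) := by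
  rw [(funext fun x => pd_affine (hf.differentiable (by norm_num) _) : pd i (fun y => f (c + r • y)) = fun x => r * pd i f (c + r • x))]
  ext x
  rw [pd_const_mul, pd_affine (pd_differentiable hf _)]
  ring

/-- passage to similarity variables centred at `(c, T')` -/
theorem PSol.toSSol {f : EE n → ℝ → ℝ} (h : PSol α β v f) (c : EE n) (T' : ℝ) (hI : ∀ s ∈ I, T' - exp (-s) ∈ Ioo α β) :
    SSol I (fun y s => v (c + exp (-s / 2) • y) (T' - exp (-s)))
      (fun y s => exp (-s) * f (c + exp (-s / 2) • y) (T' - exp (-s))) := by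
  have hsq : ∀ s : ℝ, exp (-s / 2)^2 = exp (-s) := fun s => by
    rw [← exp_nat_mul]; ring
  have hr : ∀ s ∈ I, |exp (-s / 2)| ≤ 1 + (T' - α) := by
    intro s hs
    have h1 := (hI s hs).1
    rw [abs_of_pos (exp_pos _)]
    nlinarith [hsq s]
  have ge : Gr (n := n) I (fun _ s => exp (-s)) := .of_bdd fun s hs y => (fun s hs => by
    have h1 := (hI s hs).1
    rw [abs_of_pos (exp_pos _)]; linarith : ∀ s ∈ I, |exp (-s)| ≤ T' - α) s hs
  have ge' : Gr (n := n) I (fun _ s => exp (-s / 2)) := .of_bdd fun s hs y => hr s hs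
  refine ⟨fun s hs => (h.c2 _ (hI s hs)).comp (by fun_prop), fun y s hs => ?_,
    fun s hs => continuous_const.mul ((h.cf _ (hI s hs)).comp (by fun_prop)),
    h.gv.comp_affine c hI hr, ge.mul (h.gf.comp_affine c hI hr), fun i => ?_, fun i => ?_⟩
  · have d1 : HasDerivAt (fun s : ℝ => exp (-s / 2)) (exp (-s / 2) * (-1 / 2)) s :=
      (((hasDerivAt_id' s).fun_neg).div_const 2).exp
    have d2 : HasDerivAt (fun s : ℝ => T' - exp (-s)) (exp (-s)) s := by
      simpa using ((hasDerivAt_id' s).fun_neg.exp).const_sub T'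
    refine (hasDerivAt_curve (X := fun s => c + exp (-s / 2) • y) (s := s) (fun t ht => (h.c2 t ht).differentiable (by norm_num)) h.cgrad
      (hI s hs) (h.vt _ _ (hI s hs)) ((d1.smul_const y).const_add c) d2).congr_deriv ?_
    have hc2 := h.c2 _ (hI s hs)
    rw [OU, lap_eq, lap_eq]
    simp only [pdpd_affine hc2, hsq]
    have e1 : ∀ i, pd i (fun y => v _ _) y =
        exp (-s / 2) * pd i (fun y => v y _) (c + exp (-s / 2) • y) :=
      fun i => pd_affine
        (hc2.differentiable (by norm_num) _)
    simp only [e1, ← Finset.mul_sum]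
    have e2 : ∑ i, ((exp (-s / 2) * (-1 / 2)) • y) i *
        pd i (fun y => v y (T' - exp (-s))) (c + exp (-s / 2) • y) =
        -∑ i, y i / 2 * (exp (-s / 2) *
          pd i (fun y => v y (T' - exp (-s))) (c + exp (-s / 2) • y)) := by
      rw [← Finset.sum_neg_distrib]
      exact Finset.sum_congr rfl fun i _ => by simp only [PiLp.smul_apply, smul_eq_mul]; ring
    rw [e2]; ring
  · refine (ge'.mul ((h.gv' i).comp_affine c hI hr)).of_le fun s hs y => ?_
    rw [pd_affine
        ((h.c2 _ (hI s hs)).differentiable (by norm_num) _)]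
  · refine ((ge'.pow 2).mul ((h.gv'' i).comp_affine c hI hr)).of_le fun s hs y => ?_
    have := congrFun (pdpd_affine (i := i) (h.c2 _ (hI s hs)) c (exp (-s / 2))) y
    rw [this]

/-- the slowly varying factor `1 + m log(2+z²)^{-a}` -/
def mf (a m z : ℝ) : ℝ := 1 + m * log (2 + z^2)^(-a)

def mf' (a m z : ℝ) : ℝ :=
  m * (-a * log (2 + z^2)^(-a - 1) * (2 * z / (2 + z^2)))

/-- the full nonlinearity -/
def gf (p a m z : ℝ) : ℝ := |z|^(p - 1) * z * mf a m z

def gf' (p a m z : ℝ) : ℝ :=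
  p * |z|^(p - 1) * mf a m z + |z|^(p - 1) * z * mf' a m z

def Gf (p a m z : ℝ) : ℝ := ∫ t in (0 : ℝ)..z, gf p a m t

def Kf (p a m z : ℝ) : ℝ := z * gf p a m z - (p + 1) * Gf p a m z

theorem gf_eq (z) : gf p a μ z = |z|^(p - 1) * z + hfun p a μ z := by
  rw [gf, mf, hfun, rpow_neg (log_nonneg (by nlinarith [sq_nonneg z]))]
  ring

theorem log_two_add_pos (z) : 0 < log (2 + z^2) :=
  log_pos (by nlinarith)

theorem log_two_le (z) : log 2 ≤ log (2 + z^2) :=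
  log_le_log (by norm_num) (by nlinarith)

theorem log_rpow_neg_le {b : ℝ} (hb : 0 ≤ b) (z) :
    log (2 + z^2)^(-b) ≤ log 2^(-b) :=
  rpow_le_rpow_of_nonpos (log_pos (by norm_num)) (log_two_le z) (by linarith)

theorem hasDerivAt_log (z) :
    HasDerivAt (fun z => log (2 + z^2)) (2 * z / (2 + z^2)) z := by
  have := ((hasDerivAt_pow 2 z).const_add 2).log (by positivity)
  simpa using this

theorem hasDerivAt_mf (z) : HasDerivAt (mf a μ) (mf' a μ z) z := by
  have := (((hasDerivAt_log z).rpow_const (p := -a) (Or.inl (log_two_add_pos z).ne')).const_mul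
    μ).const_add 1
  refine this.congr_deriv ?_
  rw [mf']; ring

theorem hasDerivAt_abs_rpow_mul (hp : 1 < p) (z) :
    HasDerivAt (fun z => |z|^(p - 1) * z) (p * |z|^(p - 1)) z := by
  rcases lt_trichotomy z 0 with h | h | h
  · have h1 := (((hasDerivAt_id' z).fun_neg).rpow_const (p := p) (Or.inl (by linarith))).fun_neg
    refine (h1.congr_of_eventuallyEq ?_).congr_deriv ?_
    · filter_upwards [gt_mem_nhds h] with y hy
      rw [abs_of_neg hy, ← neg_neg (( -y)^(p - 1) * y), ← mul_neg]
      nth_rw 2 [← rpow_one (-y)]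
      rw [← rpow_add (by linarith)]; simp
    · rw [abs_of_neg h]; ring
  · subst h
    have hp0 : p - 1 ≠ 0 := by linarith
    rw [abs_zero, zero_rpow hp0, mul_zero, hasDerivAt_iff_isLittleO]
    have hc : Tendsto (fun z : ℝ => |z|^(p - 1)) (𝓝 0) (𝓝 0) := by
      have : Continuous fun z => |z|^(p - 1) :=
        continuous_abs.rpow_const fun _ => Or.inr (by linarith)
      simpa [zero_rpow hp0] using this.tendsto 0
    have := ((Asymptotics.isLittleO_one_iff ℝ).2 hc).mul_isBigO
      (Asymptotics.isBigO_refl (fun z => z) _)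
    simpa using this
  · refine (((hasDerivAt_id' z).rpow_const (p := p) (Or.inl h.ne')).congr_of_eventuallyEq ?_).congr_deriv ?_
    · filter_upwards [lt_mem_nhds h] with y hy
      rw [abs_of_pos hy]
      nth_rw 2 [← rpow_one y]
      rw [← rpow_add hy]; simp
    · rw [abs_of_pos h]; ring

theorem hasDerivAt_gf (hp : 1 < p) (z) : HasDerivAt (gf p a μ) (gf' p a μ z) z :=
  (hasDerivAt_abs_rpow_mul hp z).mul (hasDerivAt_mf z)

theorem continuous_gf (hp : 1 < p) : Continuous (gf p a μ) :=
  continuous_iff_continuousAt.2 fun z => (hasDerivAt_gf hp z).continuousAt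

theorem hasDerivAt_Gf (hp : 1 < p) (z) : HasDerivAt (Gf p a μ) (gf p a μ z) z :=
  intervalIntegral.integral_hasDerivAt_right ((continuous_gf hp).intervalIntegrable _ _)
    (continuous_gf hp).stronglyMeasurable.stronglyMeasurableAtFilter (continuous_gf hp).continuousAt

theorem abs_rpow_mul_self (hp : 1 < p) (z : ℝ) : |z|^(p - 1) * |z| = |z|^p := by
  rcases eq_or_ne z 0 with rfl | h
  · rw [abs_zero, mul_zero, zero_rpow (by linarith)]
  · nth_rw 2 [← rpow_one |z|]
    rw [← rpow_add (abs_pos.2 h)]; simp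

theorem abs_rpow_mul_sq (hp : 1 < p) (z : ℝ) : |z|^(p - 1) * z^2 = |z|^(p + 1) := by
  rcases eq_or_ne z 0 with rfl | h
  · rw [abs_zero, zero_rpow (by linarith), zero_rpow (by linarith)]; ring
  · rw [← sq_abs, ← rpow_natCast, ← rpow_add (abs_pos.2 h)]; ring

theorem abs_mf_sub_one (z) : |mf a μ z - 1| = |μ| * log (2 + z^2)^(-a) := by
  rw [mf, add_sub_cancel_left, abs_mul, abs_of_pos (rpow_pos_of_pos (log_two_add_pos z) _)]

theorem abs_mf_le (ha : 0 < a) (z) : |mf a μ z| ≤ 1 + |μ| * log 2^(-a) := by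
  have h := abs_mf_sub_one (a := a) (μ := μ) z
  have h2 := mul_le_left (log_rpow_neg_le ha.le z) (abs_nonneg μ)
  have h3 := abs_add_le (mf a μ z - 1) 1
  rw [sub_add_cancel, abs_one] at h3
  linarith

theorem abs_mul_mf' (ha : 0 < a) (z) :
    |z * mf' a μ z| ≤ 2 * a * |μ| * log (2 + z^2)^(-a - 1) := by
  have hL := rpow_pos_of_pos (log_two_add_pos z) (-a - 1)
  have e : z * mf' a μ z = -(2 * a * μ * log (2 + z^2)^(-a - 1) * (z^2 / (2 + z^2))) := by
    rw [mf']; ring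
  rw [e, abs_neg, abs_mul, abs_mul, abs_mul, abs_mul, abs_of_pos hL, abs_of_nonneg (show 0 ≤ z^2 / (2 + z^2) by positivity),
    abs_of_pos ha, abs_two]
  exact mul_le_of_le_one_right (by positivity) ((div_le_one (by positivity)).2 (by linarith))

theorem exists_gf_le (hp : 1 < p) (ha : 0 < a) :
    ∃ C, 0 < C ∧ ∀ z, |gf p a μ z| ≤ C * |z|^p ∧ |gf' p a μ z| ≤ C * |z|^(p - 1) := by
  have hl : 0 < log 2 := log_pos (by norm_num)
  have h3 := rpow_pos_of_pos hl (-a - 1)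
  set A := 1 + |μ| * log 2^(-a) with hA
  have hA0 : 0 < A := by positivity
  refine ⟨p * A + 2 * a * |μ| * log 2^(-a - 1), by positivity, fun z => ⟨?_, ?_⟩⟩
  · rw [gf, abs_mul, abs_mul, abs_of_nonneg (rpow_nonneg (abs_nonneg z) _), abs_rpow_mul_self hp,
      mul_comm]
    refine mul_le_right ((abs_mf_le ha z).trans ?_) (rpow_nonneg (abs_nonneg z) _)
    have : 0 ≤ 2 * a * |μ| * log 2^(-a - 1) := by positivity
    nlinarith
  · have e : gf' p a μ z = |z|^(p - 1) * (p * mf a μ z + z * mf' a μ z) := by rw [gf']; ring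
    rw [e, abs_mul, abs_of_nonneg (rpow_nonneg (abs_nonneg z) _), mul_comm]
    refine mul_le_right ((abs_add_le _ _).trans (add_le_add ?_ ?_))
      (rpow_nonneg (abs_nonneg z) _)
    · rw [abs_mul, abs_of_pos (by linarith)]
      exact mul_le_left (abs_mf_le ha z) (by linarith)
    · refine (abs_mul_mf' ha z).trans (mul_le_left ?_ (by positivity))
      have := log_rpow_neg_le (b := a + 1) (by linarith) z
      rwa [show -(a + 1) = -a - 1 by ring] at this

theorem abs_gf_sub_le (hp : 1 < p) (hC : ∀ z, |gf' p a μ z| ≤ C * |z|^(p - 1))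
    (hC0 : 0 ≤ C) {x y : ℝ} (hx : |x| ≤ M) (hy : |y| ≤ M) :
    |gf p a μ x - gf p a μ y| ≤ C * M^(p - 1) * |x - y| := by
  have h := mvt (convex_Icc (-M) M)
    (fun z _ => hasDerivAt_gf hp z)
    (fun z hz => (hC z).trans (mul_le_left
      (rpow_le_rpow (abs_nonneg z) (abs_le.2 hz) (by linarith)) hC0)) (abs_le.1 hy) (abs_le.1 hx)
  simpa using h

theorem abs_Gf_le (hp : 1 < p) (hC : ∀ z, |gf p a μ z| ≤ C * |z|^p) (hC0 : 0 ≤ C)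
    (z) : |Gf p a μ z| ≤ C * |z|^(p + 1) := by
  have h : ‖∫ t in 0..z, gf p a μ t‖ ≤ C * |z|^p * |z - 0| := by
    refine intervalIntegral.norm_integral_le_of_norm_le_const fun t ht => (hC t).trans ?_
    refine mul_le_left (rpow_le_rpow (abs_nonneg t) ?_ (by linarith)) hC0
    rw [mem_uIoc] at ht
    rcases ht with ht | ht
    · rw [abs_of_pos ht.1]; exact ht.2.trans (le_abs_self z)
    · rw [abs_of_nonpos ht.2, abs_of_neg (by linarith)]; linarith
  rw [sub_zero, mul_assoc] at h
  refine h.trans_eq ?_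
  rcases eq_or_ne z 0 with rfl | hz
  · rw [abs_zero, zero_rpow (by linarith : p + 1 ≠ 0)]; ring
  · rw [rpow_add (abs_pos.2 hz), rpow_one]

theorem hasDerivAt_Kf (hp : 1 < p) (z) :
    HasDerivAt (Kf p a μ) (|z|^(p + 1) * mf' a μ z) z := by
  refine (((hasDerivAt_id' z).fun_mul (hasDerivAt_gf hp z)).fun_sub
    ((hasDerivAt_Gf hp z).const_mul _)).congr_deriv ?_
  rw [← abs_rpow_mul_sq hp, gf, gf']
  ring

theorem Kf_neg (hp : 1 < p) (z) : Kf p a μ (-z) = Kf p a μ z := by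
  have h : ∀ x, HasDerivAt (fun x => Kf p a μ x - Kf p a μ (-x)) 0 x := fun x => by
    refine ((hasDerivAt_Kf hp x).fun_sub
      ((hasDerivAt_Kf hp (-x)).comp x (hasDerivAt_id' x).fun_neg)).congr_deriv ?_
    rw [abs_neg, mf', mf', neg_sq]; ring
  have := is_const_of_deriv_eq_zero (fun x => (h x).differentiableAt) (fun x => (h x).deriv) z 0
  simp [neg_zero] at this
  linarith

theorem exists_Kf_le (hp : 1 < p) (ha : 0 < a) :
    ∃ C, 0 < C ∧ ∀ z, |Kf p a μ z| ≤ C * (|z|^(p + 1) * log (2 + z^2)^(-a - 1)) + C := by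
  set v0 := exp (a + 1) with hv0
  have hv0p : 0 < v0 := exp_pos _
  have hcK : Continuous (Kf p a μ) :=
    continuous_iff_continuousAt.2 fun z => (hasDerivAt_Kf hp z).continuousAt
  obtain ⟨C1, hC1⟩ := isCompact_Icc.exists_bound_of_continuousOn
    (hcK.continuousOn (s := Icc (-v0) v0))
  have hC10 : 0 ≤ C1 := (norm_nonneg _).trans (hC1 0 ⟨by linarith, hv0p.le⟩)
  set A := 2 * a * |μ| with hA
  have hA0 : 0 ≤ A := by positivity
  set B : ℝ → ℝ := fun z => z^(p + 1) * log (2 + z^2)^(-a - 1) with hB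
  set B' : ℝ → ℝ := fun z => (p + 1) * z^p * log (2 + z^2)^(-a - 1) +
    z^(p + 1) * (2 * z / (2 + z^2) * (-a - 1) * log (2 + z^2)^(-a - 1 - 1)) with hB'
  have dB : ∀ z, 0 < z → HasDerivAt B (B' z) z := fun z hz => by
    refine ((hasDerivAt_rpow_const (p := p + 1) (Or.inl hz.ne')).mul
      ((hasDerivAt_log z).rpow_const (p := -a - 1) (Or.inl (log_two_add_pos z).ne'))).congr_deriv ?_
    rw [hB']; simp only [add_sub_cancel_right]
  have hBB : ∀ z, v0 ≤ z → |z^(p + 1) * mf' a μ z| ≤ A * B' z := fun z hz => by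
    have hz0 : 0 < z := hv0p.trans_le hz
    have hL := log_two_add_pos z
    have hLL : 2 * (a + 1) ≤ log (2 + z^2) := by
      rw [le_log_iff_exp_le (by positivity)]
      have : exp (2 * (a + 1)) = v0^2 := by rw [hv0, ← exp_nat_mul]; congr 1
      rw [this]; nlinarith
    set Q := log (2 + z^2)^(-a - 1) with hQ
    have hQ0 : 0 < Q := rpow_pos_of_pos hL _
    have hQ1 : log (2 + z^2)^(-a - 1 - 1) = Q / log (2 + z^2) := by rw [rpow_sub_one hL.ne']
    have hzp : z^(p + 1) = z^p * z := rpow_add_one hz0.ne' p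
    have hzp0 : 0 < z^p := rpow_pos_of_pos hz0 p
    have h1 : |z^(p + 1) * mf' a μ z| ≤ z^p * (A * Q) := by
      rw [hzp, mul_assoc, abs_mul, abs_of_pos hzp0]
      exact mul_le_left (abs_mul_mf' ha z) hzp0.le
    have h2 : z^p * Q ≤ B' z := by
      simp only [hB', ← hQ]
      rw [hQ1, hzp]
      have e : z^p * z * (2 * z / (2 + z^2) * (-a - 1) * (Q / log (2 + z^2))) =
        -(z^p * Q * (z^2 / (2 + z^2) * (2 * (a + 1) / log (2 + z^2)))) := by ring
      rw [e]
      have h3 : z^2 / (2 + z^2) * (2 * (a + 1) / log (2 + z^2)) ≤ 1 :=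
        mul_le_one₀ ((div_le_one (by positivity)).2 (by linarith)) (by positivity)
          ((div_le_one hL).2 hLL)
      have h5 := mul_pos hzp0 hQ0
      nlinarith
    calc _ ≤ _ := h1
      _ = A * (z^p * Q) := by ring
      _ ≤ _ := mul_le_left h2 hA0
  have key : ∀ z, v0 ≤ z → |Kf p a μ z| ≤ C1 + A * B z := fun z hz => by
    have hcont : ∀ f : ℝ → ℝ, ∀ f' : ℝ → ℝ, (∀ x, 0 < x → HasDerivAt f (f' x) x) →
        (∀ x, v0 ≤ x → 0 ≤ f' x) → f v0 ≤ f z := fun f f' hf hf' => by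
      refine (monotoneOn_of_deriv_nonneg (convex_Ici v0)
        (fun x hx => (hf x (hv0p.trans_le hx)).continuousAt.continuousWithinAt)
        (fun x hx => ?_) fun x hx => ?_) (mem_Ici.2 le_rfl) hz hz
      · rw [interior_Ici] at hx
        exact (hf x (hv0p.trans hx)).differentiableAt.differentiableWithinAt
      · rw [interior_Ici] at hx
        rw [(hf x (hv0p.trans hx)).deriv]; exact hf' x hx.le
    have h1 := hcont (fun x => A * B x - Kf p a μ x) (fun x => A * B' x - |x|^(p + 1) * mf' a μ x)
      (fun x hx => ((dB x hx).const_mul A).fun_sub (hasDerivAt_Kf hp x)) fun x hx => by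
        have := (abs_le.1 (hBB x hx)).2
        rw [abs_of_pos (hv0p.trans_le hx)]; linarith
    have h2 := hcont (fun x => A * B x + Kf p a μ x) (fun x => A * B' x + |x|^(p + 1) * mf' a μ x)
      (fun x hx => ((dB x hx).const_mul A).fun_add (hasDerivAt_Kf hp x)) fun x hx => by
        have := (abs_le.1 (hBB x hx)).1
        rw [abs_of_pos (hv0p.trans_le hx)]; linarith
    have h3 := abs_le.1 (hC1 v0 ⟨by linarith, le_rfl⟩)
    have h4 : 0 ≤ A * B v0 := mul_nonneg hA0 (mul_nonneg (rpow_nonneg hv0p.le _)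
      (rpow_nonneg (log_two_add_pos _).le _))
    rw [abs_le]; constructor <;> linarith [h3.1, h3.2]
  refine ⟨C1 + A + 1, by positivity, fun z => ?_⟩
  have hBa : |z|^(p + 1) * log (2 + z^2)^(-a - 1) = B |z| := by simp only [hB, sq_abs]
  rw [hBa]
  have hB0 : 0 ≤ B |z| := mul_nonneg (rpow_nonneg (abs_nonneg _) _)
      (rpow_nonneg (log_two_add_pos _).le _)
  have hK : |Kf p a μ z| = |Kf p a μ (|z|)| := by
    rcases abs_choice z with h | h <;> rw [h]
    rw [Kf_neg hp]
  rw [hK]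
  rcases le_total v0 |z| with h | h
  · have := key _ h
    nlinarith
  · have := hC1 |z| ⟨by linarith [abs_nonneg z], h⟩
    rw [norm_eq_abs] at this
    nlinarith

/-- for `|z|` large exponential, `log (2+z²)` is at least linear -/
theorem log_ge_of_exp_le {c z : ℝ} (h : exp (c * s) ≤ |z|) :
    2 * (c * s) ≤ log (2 + z^2) := by
  rw [le_log_iff_exp_le (by positivity)]
  have : exp (2 * (c * s)) = exp (c * s)^2 := by rw [← exp_nat_mul]; congr 1
  rw [this, ← sq_abs z]
  nlinarith [exp_pos (c * s)]

theorem exp_mul_abs_rpow {c q w : ℝ} :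
    |exp (c * s) * w|^q = exp (c * q * s) * |w|^q := by
  rw [abs_mul, abs_of_pos (exp_pos _), mul_rpow (exp_pos _).le (abs_nonneg _), ← exp_mul]
  ring

theorem exists_scaled_Kf_le (hp : 1 < p) (ha : 0 < a) :
    ∃ C, 0 < C ∧ ∀ s w, 0 < s → exp (-(p + 1) / (p - 1) * s) *
      |Kf p a μ (exp (1 / (p - 1) * s) * w)| ≤
        C * s^(-a - 1) * |w|^(p + 1) + C * exp (-(p + 1) / (2 * (p - 1)) * s) := by
  obtain ⟨C, hC, hK⟩ := exists_Kf_le (μ := μ) hp ha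
  have hp1 := sub_pos.2 hp
  have hl : 0 < log 2 := log_pos (by norm_num)
  set A := (1 / (p - 1))^(-a - 1) with hA
  set D := log 2^(-a - 1) with hD
  refine ⟨C * A + C * D + C, by positivity, fun s w hs => ?_⟩
  set z := exp (1 / (p - 1) * s) * w with hz
  set e1 := exp (-(p + 1) / (p - 1) * s) with he1
  set e2 := exp _ with he2
  have hz' : e1 * |z|^(p + 1) = |w|^(p + 1) := by
    rw [hz, exp_mul_abs_rpow, he1, ← mul_assoc, ← exp_add]
    rw [show -(p + 1) / (p - 1) * s + 1 / (p - 1) * (p + 1) * s = 0 by ring]; simp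
  have he12 : e1 ≤ e2 := by
    rw [he1, he2, exp_le_exp]
    refine mul_le_right ?_ hs.le
    rw [div_le_div_iff₀ hp1 (by positivity)]; nlinarith
  have hw0 : 0 ≤ |w|^(p + 1) := rpow_nonneg (abs_nonneg _) _
  have hX : e1 * (|z|^(p + 1) * log (2 + z^2)^(-a - 1)) ≤
      A * s^(-a - 1) * |w|^(p + 1) + D * e2 := by
    rcases le_total (exp (1 / (2 * (p - 1)) * s)) |z| with h | h
    · have h1 := log_ge_of_exp_le h
      have h2 : log (2 + z^2)^(-a - 1) ≤ A * s^(-a - 1) := by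
        rw [hA, ← mul_rpow (by positivity) hs.le]
        refine rpow_le_rpow_of_nonpos (by positivity) ?_ (by linarith)
        refine le_trans (le_of_eq ?_) h1
        field_simp
      rw [← mul_assoc, hz']
      have : 0 ≤ D * e2 := by positivity
      nlinarith
    · have h2 : log (2 + z^2)^(-a - 1) ≤ D := by
        have := log_rpow_neg_le (b := a + 1) (by linarith) z
        rwa [show -(a + 1) = -a - 1 by ring] at this
      have h3 : e1 * |z|^(p + 1) ≤ e2 := by
        have h4 := rpow_le_rpow (abs_nonneg z) h (by linarith : 0 ≤ p + 1)
        rw [← exp_mul] at h4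
        calc _ ≤ e1 * _ := mul_le_left h4 (exp_pos _).le
          _ = e2 := by rw [he1, he2, ← exp_add]; congr 1; field_simp; ring
      have h5 := mul_le_mul h3 h2 (rpow_nonneg (log_two_add_pos z).le _) (exp_pos _).le
      have : 0 ≤ A * s^(-a - 1) * |w|^(p + 1) := by positivity
      linarith
  have h6 := mul_le_left (hK z) (exp_pos (-(p + 1) / (p - 1) * s)).le
  have h11 : 0 ≤ (C * D + C) * (s^(-a - 1) * |w|^(p + 1)) := by positivity
  have h12 : 0 ≤ C * A * e2 := by positivity
  nlinarith

theorem exists_mf_ge (ha : 0 < a) : ∃ v, 0 < v ∧ ∀ z, v ≤ |z| → 1 / 2 ≤ mf a μ z := by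
  have h : Tendsto (fun L => |μ| * L^(-a)) atTop _ :=
    (tendsto_rpow_neg_atTop ha).const_mul _
  rw [mul_zero] at h
  obtain ⟨L0, hL0⟩ := eventually_atTop.1 (h.eventually (gt_mem_nhds (by norm_num : (0 : ℝ) < 1 / 2)))
  refine ⟨exp L0, exp_pos _, fun z hz => ?_⟩
  have h1 : L0 ≤ log (2 + z^2) := by
    rcases le_total L0 0 with h0 | h0
    · exact h0.trans (log_two_add_pos z).le
    · have := log_ge_of_exp_le (c := 1) (by simpa using hz)
      linarith
  have h2 := hL0 _ h1
  rw [← abs_mf_sub_one] at h2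
  linarith [(abs_lt.1 h2).1]

theorem exists_zg_ge (hp : 1 < p) (ha : 0 < a) :
    ∃ c C, 0 < c ∧ 0 < C ∧ ∀ z, c * |z|^(p + 1) - C ≤ z * gf p a μ z - 2 * Gf p a μ z := by
  obtain ⟨C, hC, hK⟩ := exists_Kf_le (μ := μ) hp ha
  obtain ⟨v, hv, hm⟩ := exists_mf_ge (μ := μ) ha
  obtain ⟨C2, hC2, hg⟩ := exists_gf_le (μ := μ) hp ha
  have h : Tendsto (fun L : ℝ => C * L^(-(a + 1))) atTop (𝓝 (C * 0)) :=
    (tendsto_rpow_neg_atTop (by linarith)).const_mul _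
  rw [mul_zero] at h
  obtain ⟨L0, hL0⟩ := eventually_atTop.1 (h.eventually
    (gt_mem_nhds (by linarith : (0 : ℝ) < (p - 1) / 8)))
  set R := max v (exp |L0|) with hR
  have hR0 : 0 < R := hv.trans_le (le_max_left _ _)
  refine ⟨(p - 1) / (4 * (p + 1)), 2 * C + ((p - 1) / (4 * (p + 1)) + 3 * C2) * R^(p + 1),
    by apply div_pos <;> linarith, ?_, fun z => ?_⟩
  · have := rpow_pos_of_pos hR0 (p + 1)
    positivity
  have hc : 0 < (p - 1) / (4 * (p + 1)) := by apply div_pos <;> linarith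
  have hzz : 0 ≤ |z|^(p + 1) := rpow_nonneg (abs_nonneg _) _
  rcases le_total R |z| with hz | hz
  · have h1 := hm z ((le_max_left _ _).trans hz)
    have h2 : L0 ≤ log (2 + z^2) := by
      have := log_ge_of_exp_le (c := 1) (s := |L0|) (z := z)
        (by simpa using (le_max_right _ _).trans hz)
      linarith [le_abs_self L0, abs_nonneg L0]
    have h3 := hL0 _ h2
    have h4 := hK z
    rw [show -(a + 1) = -a - 1 by ring] at h3
    have h5 : |Kf p a μ z| ≤ (p - 1) / 8 * |z|^(p + 1) + C := by
      have := mul_le_right h3.le hzz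
      nlinarith
    have hz2 : z * gf p a μ z = |z|^(p + 1) * mf a μ z := by rw [← abs_rpow_mul_sq hp, gf]; ring
    have e : z * gf p a μ z - 2 * Gf p a μ z =
        ((p - 1) * (z * gf p a μ z) + 2 * Kf p a μ z) / (p + 1) := by
      rw [Kf]; field_simp; ring
    rw [e, le_div_iff₀ (by linarith), hz2]
    have h6 := mul_le_left h1 hzz
    have h7 := (abs_le.1 h5).1
    have h8 : (p - 1) / (4 * (p + 1)) * |z|^(p + 1) * (p + 1) = (p - 1) / 4 * |z|^(p + 1) := by
      field_simp
    have h9 : 0 ≤ ((p - 1) / (4 * (p + 1)) + 3 * C2) * R^(p + 1) * (p + 1) := by positivity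
    nlinarith
  · have h1 := rpow_le_rpow (abs_nonneg z) hz (by linarith : 0 ≤ p + 1)
    have h2 := abs_Gf_le hp (fun z => (hg z).1) hC2.le z
    have h3 : |z * gf p a μ z| ≤ C2 * |z|^(p + 1) := by
      rw [abs_mul]
      calc |z| * |gf p a μ z| ≤ |z| * (C2 * |z|^p) :=
            mul_le_left (hg z).1 (abs_nonneg _)
        _ = C2 * (|z|^(p - 1) * |z| * |z|) := by rw [abs_rpow_mul_self hp]; ring
        _ = C2 * (|z|^(p - 1) * z^2) := by rw [← sq_abs z]; ring
        _ = _ := by rw [abs_rpow_mul_sq hp]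
    have h4 := (abs_le.1 h2).2
    have h5 := (abs_le.1 h3).1
    nlinarith

theorem sqrtReg_pos (hδ : 0 < δ) (w) : 0 < √(w^2 + δ^2) := sqrt_pos.2 (by positivity)

theorem hasDerivAt_sqrtReg (hδ : 0 < δ) (w) :
    HasDerivAt (fun w => √(w^2 + δ^2)) (w / √(w^2 + δ^2)) w := by
  refine (((hasDerivAt_pow 2 w).add_const _).sqrt (by positivity)).congr_deriv ?_
  simp; field_simp

theorem hasDerivAt_signReg (hδ : 0 < δ) (w) :
    HasDerivAt (fun w => w / √(w^2 + δ^2)) (δ^2 / √(w^2 + δ^2)^3) w := by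
  refine ((hasDerivAt_id' w).fun_div (hasDerivAt_sqrtReg hδ w) (sqrtReg_pos hδ w).ne').congr_deriv ?_
  field_simp
  linear_combination (sq_sqrt (by positivity) : √(w^2 + δ^2)^2 = w^2 + δ^2)

theorem abs_signReg_le (hδ : 0 < δ) (w) : |w / √(w^2 + δ^2)| ≤ 1 := by
  rw [abs_div, abs_of_pos (sqrtReg_pos hδ w), div_le_one (sqrtReg_pos hδ w)]
  exact le_sqrt_of_sq_le (by rw [sq_abs]; nlinarith)

theorem abs_le_sqrtReg (w) : |w| ≤ √(w^2 + δ^2) :=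
  le_sqrt_of_sq_le (by rw [sq_abs]; nlinarith)

theorem sqrtReg_le (hδ : 0 < δ) (w) : √(w^2 + δ^2) ≤ |w| + δ := by
  refine sqrt_le_iff.2 ⟨by positivity, ?_⟩
  nlinarith [abs_nonneg w, sq_abs w]

theorem le_sqrtReg (w) : δ ≤ √(w^2 + δ^2) :=
  le_sqrt_of_sq_le (by nlinarith)

theorem SSol.diffW (h : SSol I W H) (hs : s ∈ I) : Differentiable ℝ (fun y => W y s) :=
  (h.c2 s hs).differentiable (by norm_num)

theorem SSol.gr1W (h : SSol I W H) (hs : s ∈ I) : Gr1 (fun y => W y s) :=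
  h.gW.single hs fun _ => rfl

theorem SSol.gr1W' (h : SSol I W H) (hs : s ∈ I) (i) : Gr1 (pd i fun y => W y s) :=
  (h.gW' i).single hs fun _ => rfl

theorem SSol.gr1W'' (h : SSol I W H) (hs : s ∈ I) (i) :
    Gr1 (pd i (pd i fun y => W y s)) := (h.gW'' i).single hs fun _ => rfl

theorem SSol.gWs (h : SSol I W H) : Gr I (fun y s => OU (fun y => W y s) y + H y s) :=
  h.gOU.add h.gH

/-- the regularized `L¹` norm has derivative at most the `L¹` norm of the forcing -/
theorem SSol.sqrtReg_deriv (h : SSol I W H) (hI : IsOpen I) (hδ : 0 < δ)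
    (hs : s ∈ I) :
    ∃ d, HasDerivAt (fun s => ∫ y, √(W y s^2 + δ^2) * rho n y) d s ∧
      d ≤ ∫ y, |H y s| * rho n y := by
  have hψd : ∀ {s}, s ∈ I → ContDiff ℝ 2 fun y => W y s / √(W y s^2 + δ^2) := fun {s} hs =>
    (h.c2 s hs).div (((h.c2 s hs).pow 2).add contDiff_const |>.sqrt fun y => by positivity)
      fun y => (sqrtReg_pos hδ _).ne'
  have hψpd : ∀ i y, pd i (fun y => W y s / √(W y s^2 + δ^2)) y =
      δ^2 / √(W y s^2 + δ^2)^3 * pd i (fun y => W y s) y := fun i y =>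
    pd_comp (hasDerivAt_signReg hδ _) (h.diffW hs y)
  have hψb : Gr I (fun y s => W y s / √(W y s^2 + δ^2)) :=
    .of_bdd fun s _ y => abs_signReg_le hδ _
  refine ⟨_, hasDerivAt_integral_rho hI
    (fun y s hs => (hasDerivAt_sqrtReg hδ _).comp s (h.ws y s hs)) (fun s hs => ?_)
    (fun s hs => (hψd hs).continuous.mul (h.cWs hs)) ?_ (hψb.mul h.gWs) hs, ?_⟩
  · exact (((h.c2 s hs).continuous.pow 2).add continuous_const).sqrt
  · refine ((h.gW.pow 2).add (.const (δ^2 + 1))).of_le fun s hs y => ?_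
    rw [abs_of_pos (sqrtReg_pos hδ _), abs_of_nonneg (by positivity)]
    refine sqrt_le_iff.2 ⟨by positivity, ?_⟩
    nlinarith [sq_nonneg δ]
  · have hψ' : ∀ i, Gr1 (pd i fun y => W y s / √(W y s^2 + δ^2)) := fun i => by
      refine ((h.gr1W' hs i).const_mul (1 / δ)).of_le fun _ _ y => ?_
      rw [hψpd, abs_mul, abs_mul]
      refine mul_le_right ?_ (abs_nonneg _)
      rw [abs_of_pos (by positivity), abs_of_pos (by positivity), div_le_div_iff₀ (by positivity) hδ]
      have := pow_le_pow_left₀ hδ.le (le_sqrtReg (δ := δ) (W y s)) 3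
      nlinarith
    have hib := ou_ibp ((hψd hs).of_le (by norm_num)) (h.c2 s hs) (hψb.single hs fun _ => rfl) hψ' (h.gr1W' hs) (h.gr1W'' hs)
    have hcψ := (hψd hs).continuous
    have i2 : Integrable fun y => W y s / √(W y s^2 + δ^2) * H y s * rho n y :=
      (hψb.mul h.gH).integrable hs (hcψ.mul (h.cH s hs))
    simp only [(fun y => by ring : ∀ y, W y s / √(W y s^2 + δ^2) * (OU (fun y => W y s) y + H y s) * rho n y =
      W y s / √(W y s^2 + δ^2) * OU (fun y => W y s) y * rho n y +
      W y s / √(W y s^2 + δ^2) * H y s * rho n y)]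
    rw [integral_add ((hψb.mul h.gOU).integrable hs (hcψ.mul (OU_continuous (h.c2 s hs)))) i2, hib]
    have h1 : 0 ≤ ∫ y, (∑ i, pd i (fun y => W y s / √(W y s^2 + δ^2)) y *
        pd i (fun y => W y s) y) * rho n y := by
      refine integral_nonneg fun y => mul_nonneg (Finset.sum_nonneg fun i _ => ?_) (rho_pos y).le
      rw [hψpd, mul_assoc]
      exact mul_nonneg (by positivity) (mul_self_nonneg _)
    have h2 : ∫ y, W y s / √(W y s^2 + δ^2) * H y s * rho n y ≤ ∫ y, |H y s| * rho n y := by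
      refine integral_mono i2 (Gr.integrable (θ := fun y s => |H y s|) (h.gH.of_le fun _ _ _ => by rw [abs_abs]) hs
        (h.cH s hs).abs) fun y => mul_le_right ?_ (rho_pos y).le
      refine (le_abs_self _).trans ?_
      rw [abs_mul]
      exact mul_le_of_le_one_left (abs_nonneg _) (abs_signReg_le hδ _)
    linarith

theorem PSol.tendsto_center {f : EE n → ℝ → ℝ} (h : PSol α β v f) {t : ℝ}
    (ht : t ∈ Ioo α β) (y) :
    Tendsto (fun s => v (x + exp (-s / 2) • y) (t - exp (-s))) atTop (𝓝 (v x t)) := by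
  have h1 := hasDerivAt_curve (fun t ht => (h.c2 t ht).differentiable (by norm_num)) h.cgrad (by simpa using ht)
    (h.vt _ _ (by simpa using ht)) (((hasDerivAt_id' (0 : ℝ)).smul_const y).const_add x)
    ((hasDerivAt_pow 2 _).const_sub t)
  have h3 := h1.continuousAt.tendsto.comp (tendsto_exp_atBot.comp (by
      simpa only [neg_div, Function.comp_def, id] using tendsto_neg_atTop_atBot.comp (tendsto_id.atTop_div_const two_pos)) : Tendsto (fun s : ℝ => exp (-s / 2)) atTop (𝓝 0))
  simp [zero_smul, add_zero, ne_eq, OfNat.ofNat_ne_zero, not_false_eq_true, zero_pow,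
    sub_zero] at h3
  refine h3.congr fun s => ?_
  simp [Function.comp]
  rw [← exp_nat_mul]; ring

/-- pointwise bound by the heat kernel average at an earlier time -/
theorem PSol.heat_bound {f : EE n → ℝ → ℝ} (h : PSol α β v f) {t0 t : ℝ}
    (h0 : α < t0) (h0t : t0 < t) (ht : t < β) {A Bs : ℝ} {B : EE n → ℝ} (hA : 0 ≤ A)
    (hBs : 0 ≤ Bs) (cB : Continuous B) (gB : Gr1 B)
    (hf : ∀ y, ∀ t' ∈ Ico t0 t, |f y t'| ≤ A * |v y t'| + B y)
    (hB : ∀ r : ℝ, 0 < r → r^2 ≤ t - t0 → ∫ y, B (x + r • y) * rho n y ≤ Bs) :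
    |v x t| ≤ exp (A * (t - t0)) *
      ((∫ y, |v (x + √(t - t0) • y) t0| * rho n y) + (t - t0) * Bs) := by
  set s0 := -log (t - t0) with hs0
  have es0 : exp (-s0) = t - t0 := by rw [hs0, neg_neg, exp_log (sub_pos.2 h0t)]
  have es0' : exp (-s0 / 2) = √(t - t0) := by
    rw [← es0, show -s0 = -s0 / 2 + -s0 / 2 by ring, exp_add,
      sqrt_mul_self (exp_pos _).le]
    congr 1; ring
  set I : Set ℝ := {s | t - exp (-s) ∈ Ioo α β} with hI
  have hIo : IsOpen I := isOpen_Ioo.preimage (by fun_prop)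
  have hIs : Ici s0 ⊆ I := fun s hs => by
    have h1 : exp (-s) ≤ t - t0 := by rw [← es0]; exact exp_le_exp.2 (neg_le_neg hs)
    have := exp_pos (-s)
    exact ⟨by linarith, by linarith⟩
  have hS := h.toSSol x t (I := I) fun s hs => hs
  set Q : EE n → ℝ → ℝ := fun y s => v (x + exp (-s / 2) • y) (t - exp (-s)) with hQ
  set H : EE n → ℝ → ℝ := fun y s =>
    exp (-s) * f (x + exp (-s / 2) • y) (t - exp (-s)) with hH
  have iQ : ∀ s ∈ I, Integrable fun y => |Q y s| * rho n y := fun s hs =>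
    Gr.integrable (θ := fun y s => |Q y s|) (hS.gW.of_le fun _ _ _ => by rw [abs_abs]) hs
      (hS.c2 s hs).continuous.abs
  have key : ∀ δ, 0 < δ → |v x t| ≤ exp (A * (t - t0)) *
      ((∫ y, |v (x + √(t - t0) • y) t0| * rho n y) + δ + (t - t0) * Bs) := fun δ hδ => by
    set V : ℝ → ℝ := fun s => ∫ y, √(Q y s^2 + δ^2) * rho n y with hV
    have iV : ∀ s ∈ I, Integrable fun y => √(Q y s^2 + δ^2) * rho n y := fun s hs => by
      refine Integrable.mono' ((iQ s hs).add (rho_integrable.const_mul δ))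
        ((((hS.c2 s hs).continuous.pow 2).add continuous_const).sqrt.mul
          rho_cont).aestronglyMeasurable (.of_forall fun y => ?_)
      rw [norm_mul, norm_of_nonneg (sqrt_nonneg _), norm_of_nonneg (rho_pos y).le,
        Pi.add_apply, ← add_mul]
      exact mul_le_right (sqrtReg_le hδ _) (rho_pos y).le
    have hder : ∀ s ∈ Ici s0, ∃ d, HasDerivAt V d s ∧
        d ≤ exp (-s) * (A * V s + Bs) := fun s hs => by
      obtain ⟨d, hd, hle⟩ := hS.sqrtReg_deriv hIo hδ (hIs hs)
      refine ⟨d, hd, hle.trans ?_⟩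
      have hes : exp (-s) ≤ t - t0 := by rw [← es0]; exact exp_le_exp.2 (neg_le_neg hs)
      have iB : Integrable fun y => B (x + exp (-s / 2) • y) * rho n y :=
        Gr.integrable (I := (univ : Set Unit)) (s := ()) (gB.comp_affine x (τ := fun _ => ())
          (fun _ _ => trivial) (fun _ _ => le_rfl)) trivial (cB.comp (by fun_prop))
      have hmono : ∫ y, |H y s| * rho n y ≤ ∫ y, (exp (-s) * (A * (|Q y s| * rho n y) +
          B (x + exp (-s / 2) • y) * rho n y)) := by
        refine integral_mono (Gr.integrable (θ := fun y s => |H y s|)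
          (hS.gH.of_le fun _ _ _ => by rw [abs_abs]) (hIs hs) (hS.cH s (hIs hs)).abs)
          ((((iQ s (hIs hs)).const_mul A).add iB).const_mul _) fun y => ?_
        have h1 := hf (x + exp (-s / 2) • y) (t - exp (-s))
          ⟨by linarith, by linarith [exp_pos (-s)]⟩
        simp only [hH, abs_mul, abs_of_pos (exp_pos (-s))]
        rw [mul_assoc]
        refine mul_le_left ?_ (exp_pos _).le
        rw [← mul_assoc, ← add_mul]
        exact mul_le_right h1 (rho_pos y).le
      refine hmono.trans ?_
      rw [integral_const_mul, integral_add ((iQ s (hIs hs)).const_mul A) iB, integral_const_mul]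
      refine mul_le_left (add_le_add
        (mul_le_left ((fun s hs =>
      integral_mono (iQ s hs) (iV s hs) fun y =>
        mul_le_right (abs_le_sqrtReg _) (rho_pos y).le) s (hIs hs)) hA) (hB _ (exp_pos _) ?_)) (exp_pos _).le
      rw [← exp_nat_mul]
      refine le_trans (le_of_eq ?_) hes
      congr 1; push_cast; ring
    have dE : ∀ s : ℝ, HasDerivAt (fun s => exp (-s)) (-exp (-s)) s := fun s => by
      simpa using (hasDerivAt_id' s).fun_neg.exp
    set X : ℝ → ℝ := fun s => exp (A * exp (-s)) * V s +
      exp (A * (t - t0)) * Bs * exp (-s) with hX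
    have hXd : ∀ s ∈ Ici s0, ∃ d, HasDerivAt X d s ∧ d ≤ 0 := fun s hs => by
      obtain ⟨d, hd, hle⟩ := hder s hs
      refine ⟨_, (((fun s => ((dE s).const_mul A).exp) s).fun_mul hd).fun_add ((dE s).const_mul _), ?_⟩
      have hes : exp (-s) ≤ t - t0 := by rw [← es0]; exact exp_le_exp.2 (neg_le_neg hs)
      have h2 := mul_le_left hle (exp_pos (A * exp (-s))).le
      have h3 := mul_le_right (exp_le_exp.2 (mul_le_left hes hA)) (mul_nonneg hBs (exp_pos (-s)).le)
      nlinarith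
    have hanti : AntitoneOn X (Ici s0) := by
      choose! d hd hd0 using hXd
      refine antitoneOn_of_deriv_nonpos (convex_Ici s0)
        (fun s hs => (hd s hs).continuousAt.continuousWithinAt) (fun s hs => ?_) fun s hs => ?_
      · exact (hd s (interior_subset hs)).differentiableAt.differentiableWithinAt
      · rw [(hd s (interior_subset hs)).deriv]; exact hd0 s (interior_subset hs)
    have hE0 : Tendsto (fun s : ℝ => exp (-s)) atTop (𝓝 0) :=
      tendsto_exp_atBot.comp tendsto_neg_atTop_atBot
    have hVlim : Tendsto V atTop (𝓝 (√(v x t^2 + δ^2))) := by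
      have e : √(v x t^2 + δ^2) = ∫ y, √(v x t^2 + δ^2) * rho n y := by
        rw [integral_const_mul, integral_rho, mul_one]
      rw [e]
      obtain ⟨C, m, hC, hb⟩ := hS.gW
      refine tendsto_integral_filter_of_dominated_convergence
        (fun y => C * ((1 + ‖y‖)^m * rho n y) + δ * rho n y) ?_ ?_
        (((integrable_pow_mul_rho m).const_mul C).add (rho_integrable.const_mul δ)) ?_
      · filter_upwards [eventually_ge_atTop s0] with s hs using (iV s (hIs hs)).aestronglyMeasurable
      · filter_upwards [eventually_ge_atTop s0] with s hs
        refine .of_forall fun y => ?_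
        rw [norm_mul, norm_of_nonneg (sqrt_nonneg _), norm_of_nonneg (rho_pos y).le,
          ← mul_assoc, ← add_mul]
        exact mul_le_right ((sqrtReg_le hδ _).trans
          (add_le_add (hb s (hIs hs) y) le_rfl)) (rho_pos y).le
      · refine .of_forall fun y => Tendsto.mul_const _ ?_
        exact (((h.tendsto_center ⟨h0.trans h0t, ht⟩ y).pow 2).add_const _).sqrt
    have hXlim : Tendsto X atTop (𝓝 (√(v x t^2 + δ^2))) := by
      have h1 : Tendsto (fun s : ℝ => exp (A * exp (-s))) atTop (𝓝 1) := by
        have := (continuous_exp.tendsto (A * 0)).comp (hE0.const_mul A)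
        simpa [Function.comp_def] using this
      simpa using (h1.mul hVlim).add (hE0.const_mul (exp (A * (t - t0)) * Bs))
    have hfin := le_of_tendsto hXlim (by
      filter_upwards [eventually_ge_atTop s0] with s hs using
        hanti (mem_Ici.2 le_rfl) (mem_Ici.2 hs) hs)
    have hV0 : V s0 ≤ (∫ y, |v (x + √(t - t0) • y) t0| * rho n y) + δ := by
      have hs0I : s0 ∈ I := hIs (mem_Ici.2 le_rfl)
      have h1 : V s0 ≤ ∫ y, (|Q y s0| * rho n y + δ * rho n y) :=
        integral_mono (iV s0 hs0I) ((iQ s0 hs0I).add (rho_integrable.const_mul δ)) fun y => by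
          simp only; rw [← add_mul]
          exact mul_le_right (sqrtReg_le hδ _) (rho_pos y).le
      rw [integral_add (iQ s0 hs0I) (rho_integrable.const_mul δ), integral_const_mul,
        integral_rho, mul_one] at h1
      simpa only [hQ, es0, es0', sub_sub_cancel] using h1
    have h5 := (abs_le_sqrtReg (δ := δ) (v x t)).trans hfin
    simp only [hX, es0] at h5
    refine h5.trans ?_
    have := mul_le_left hV0 (exp_pos (A * (t - t0))).le
    nlinarith
  refine le_of_forall_pos_le_add fun ε hε => ?_
  have hE := exp_pos (A * (t - t0))
  have := key (ε / exp (A * (t - t0))) (by positivity)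
  have e : exp (A * (t - t0)) * (ε / exp (A * (t - t0))) = ε := by field_simp
  nlinarith

/-- the rescaled nonlinearity and its primitive -/
def gh (p a m s w : ℝ) : ℝ :=
  exp (-p / (p - 1) * s) * gf p a m (exp (1 / (p - 1) * s) * w)

def Gh (p a m s w : ℝ) : ℝ :=
  exp (-(p + 1) / (p - 1) * s) * Gf p a m (exp (1 / (p - 1) * s) * w)

theorem exists_rsol (hp : 1 < p) (ha : 0 < a) (hu : SolvesU n p a μ T u) (hα : 0 < α)
    (hβ : β < T) : ∃ K, RSol α β u (fun x t => gf p a μ (u x t)) K := by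
  rcases le_or_gt β α with h | h
  · have := Ioo_eq_empty (not_lt.2 h)
    exact ⟨0, by constructor <;> simp [this]⟩
  obtain ⟨h1, h2, h3, h4, -⟩ := hu
  have hβ0 : 0 < β := hα.trans h
  obtain ⟨M, hM⟩ := h4 β ⟨hβ0.le, hβ⟩
  obtain ⟨C, hC, hg⟩ := exists_gf_le hp ha
  have hM0 := (abs_nonneg _).trans (hM 0 0 ⟨le_rfl, hβ0.le⟩)
  have hI : ∀ t ∈ Ioo 0 β, t ∈ Ico 0 T := fun t ht => ⟨ht.1.le, ht.2.trans hβ⟩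
  have hI' : ∀ t ∈ Ioo 0 β, t ∈ Icc 0 β := fun t ht => ⟨ht.1.le, ht.2.le⟩
  have hc : CSol 0 β u (fun x t => gf p a μ (u x t)) M (C * M^p) := by
    refine ⟨fun t ht => h1 t (hI t ht), fun x t ht => ?_,
      fun t ht => (continuous_gf hp).comp (h1 t (hI t ht)).continuous,
      fun y t ht => ((continuous_gf hp).continuousAt.comp
        (h2 y t (hI t ht)).continuousAt).continuousWithinAt,
      fun y t ht => hM y t (hI' t ht), fun y t ht => ((hg _).1).trans (mul_le_left
        (rpow_le_rpow (abs_nonneg _) (hM y t (hI' t ht)) (by linarith)) hC.le)⟩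
    have := (h2 x t (hI t ht)).hasDerivAt
    rw [h3 x t (hI t ht)] at this
    simpa only [gf_eq, add_assoc] using this
  exact hc.toRSol (by positivity) (fun x y t ht s hs =>
    abs_gf_sub_le hp (fun z => (hg z).2) hC.le (hM x t (hI' t ht)) (hM y s (hI' s hs))) hα

theorem RSol.toPSol_gf {K : ℝ} (hp : 1 < p)
    (h : RSol α β u (fun x t => gf p a μ (u x t)) K) : PSol α β u (fun x t => gf p a μ (u x t)) :=
  h.toPSol fun t ht => (continuous_gf hp).comp (h.c2 t ht).continuous

theorem OU_const_mul (c) (y) :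
    OU (fun y => c * f y) y = c * OU f y := by
  unfold OU
  simp only [lap_eq]
  simp only [(fun i => funext fun x => pd_const_mul c : ∀ i, pd i (fun y => c * f y) = fun y => c * pd i f y), pd_const_mul]
  rw [mul_sub, Finset.mul_sum, Finset.mul_sum]
  congr 1
  exact Finset.sum_congr rfl fun i _ => by ring

theorem SSol.exp_mul (h : SSol I W H) (c) {R : ℝ}
    (hR : ∀ s ∈ I, exp (-c * s) ≤ R) :
    SSol I (fun y s => exp (-c * s) * W y s)
      (fun y s => exp (-c * s) * H y s - c * (exp (-c * s) * W y s)) := by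
  have ge : Gr (n := n) I (fun _ s => exp (-c * s)) :=
    .of_bdd fun s hs y => by rw [abs_of_pos (exp_pos _)]; exact hR s hs
  have h1 : ∀ s, ∀ i, pd i (fun y => exp (-c * s) * W y s) =
      fun y => exp _ * pd i (fun y => W y s) y :=
    fun s i => funext fun x => pd_const_mul _
  refine ⟨fun s hs => contDiff_const.mul (h.c2 s hs), fun y s hs => ?_,
    fun s hs => (continuous_const.mul (h.cH s hs)).sub
      (continuous_const.mul (continuous_const.mul (h.c2 s hs).continuous)),
    ge.mul h.gW, (ge.mul h.gH).sub ((ge.mul h.gW).const_mul c), fun i => ?_, fun i => ?_⟩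
  · have d1 : HasDerivAt (fun s => exp (-c * s)) (exp (-c * s) * (-c)) s := by
      simpa using ((hasDerivAt_id' s).const_mul (-c)).exp
    refine (d1.fun_mul (h.ws y s hs)).congr_deriv ?_
    rw [OU_const_mul]; ring
  · simp only [h1]; exact ge.mul (h.gW' i)
  · simp only [h1, pd_const_mul]; exact ge.mul (h.gW'' i)

/-- rescaled solutions in similarity variables, with continuity in time of the generator -/
structure Flow (p a m : ℝ) (I : Set ℝ) (W : EE n → ℝ → ℝ) : Prop where
  sol : SSol I W (fun y s => gh p a m s (W y s) - 1 / (p - 1) * W y s)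
  cOU : ∀ y, ContinuousOn (fun s => OU (fun y => W y s) y) I

theorem wSelf_eq (T') (c : EE n) (y : EE n) (s) :
    wSelf n p T' u c y s = exp (-(1 / (p - 1)) * s) *
      u (c + exp (-s / 2) • y) (T' - exp (-s)) := by
  rw [wSelf]; field_simp

theorem RSol.flow {K : ℝ} (hp : 1 < p)
    (h : RSol α β u (fun x t => gf p a μ (u x t)) K) (c : EE n) (T')
    (hI : ∀ s ∈ I, T' - exp (-s) ∈ Ioo α β) :
    Flow p a μ I (wSelf n p T' u c) := by
  have hp1 := sub_pos.2 hp
  have hS := (h.toPSol_gf hp).toSSol c T' hI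
  have hE := hS.exp_mul _ (fun s hs => by
    have h1 := (hI s hs).1
    rw [show -(1 / (p - 1)) * s = -s * (1 / (p - 1)) by ring, exp_mul]
    exact rpow_le_rpow (exp_pos _).le (by linarith) (by positivity) : ∀ s ∈ I, exp (-(1 / (p - 1)) * s) ≤ (T' - α)^(1 / (p - 1)))
  have e : wSelf n p T' u c = fun y s => exp (-(1 / (p - 1)) * s) *
      u (c + exp (-s / 2) • y) (T' - exp (-s)) := by
    ext y s; exact wSelf_eq T' c y s
  rw [e]
  refine ⟨?_, fun y => ?_⟩
  · convert hE using 3 with y s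
    rw [gh, ← mul_assoc, ← mul_assoc (exp _), ← exp_add, ← exp_add]
    rw [show 1 / (p - 1) * s + -(1 / (p - 1)) * s = 0 by ring, exp_zero, one_mul]
    have h2 : p / (p - 1) = 1 + 1 / (p - 1) := by field_simp; ring
    rw [(show -p / (p - 1) * s = -(1 / (p - 1)) * s + -s by rw [neg_div, h2]; ring)]
  · have e1 : ∀ s ∈ I, OU (fun y => exp (-(1 / (p - 1)) * s) *
        u (c + exp (-s / 2) • y) (T' - exp (-s))) y = exp (-(1 / (p - 1)) * s) *
        (exp (-s / 2)^2 * lap n (fun x => u x (T' - exp (-s))) (c + exp (-s / 2) • y)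
          - ∑ i, y i / 2 * (exp (-s / 2) *
            pd i (fun x => u x (T' - exp (-s))) (c + exp (-s / 2) • y))) := fun s hs => by
      have hc2 := h.c2 _ (hI s hs)
      rw [OU_const_mul, OU, lap_eq, lap_eq]
      have e1 : ∀ i, pd i (fun y => u _ _) y =
          exp (-s / 2) * pd i (fun y => u y _) (c + exp _ • y) :=
        fun i => pd_affine
          (hc2.differentiable (by norm_num) _)
      simp only [pdpd_affine hc2, e1, ← Finset.mul_sum]
    refine ContinuousOn.congr ?_ e1
    have hm : MapsTo (fun s => (c + exp (-s / 2) • y, T' - exp (-s))) I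
        (univ ×ˢ Ioo α β) := fun s hs => ⟨trivial, hI s hs⟩
    have hcm : ContinuousOn (fun s => (c + exp (-s / 2) • y, T' - exp (-s))) I := by fun_prop
    have c1 := h.clap.comp hcm hm
    have c2 := fun i => (h.cgrad i).comp hcm hm
    refine ContinuousOn.mul (by fun_prop) (ContinuousOn.sub (ContinuousOn.mul (by fun_prop) c1) ?_)
    exact continuousOn_finsetSum _ fun i _ => continuousOn_const.mul
      (ContinuousOn.mul (by fun_prop) (c2 i))

theorem Gr.abs {ι : Type*} {I : Set ι} {q : EE n → ι → ℝ} (h : Gr I q) :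
    Gr I (fun y s => |q y s|) := h.of_le fun _ _ _ => by rw [abs_abs]

theorem Gr.abs_rpow {ι : Type*} {I : Set ι} {i : EE n → ι → ℝ} (h : Gr I i) {q : ℝ} (hq : 0 ≤ q) :
    Gr I (fun y s => |i y s|^q) := by
  refine (((Gr.const 1).add h.abs).pow _ : Gr I (fun y s => (1 + |i y s|)^(⌈q⌉₊))).of_le fun s _ y => ?_
  rw [abs_of_nonneg (rpow_nonneg (abs_nonneg _) _), abs_of_nonneg (by positivity : 0 ≤ (1 + |i y s|)^⌈q⌉₊),
    ← rpow_natCast]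
  calc |i y s|^q ≤ (1 + |i y s|)^q :=
        rpow_le_rpow (abs_nonneg _) (by linarith) hq
    _ ≤ _ := rpow_le_rpow_of_exponent_le (by linarith [abs_nonneg (i y s)]) (Nat.le_ceil q)

/-- the Dirichlet integral -/
def dirich (W : EE n → ℝ → ℝ) (s : ℝ) : ℝ :=
  ∫ y, (∑ i, pd i (fun y => W y s) y * pd i (fun y => W y s) y) * rho n y

theorem SSol.gr1 (h : SSol I W H) (hs : s ∈ I) : Gr1 (OU fun y => W y s) :=
  h.gOU.single hs fun _ => rfl

theorem SSol.ibp (h : SSol I W H) {t : ℝ} (hs : s ∈ I) (ht : t ∈ I) :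
    ∫ y, W y s * OU (fun y => W y t) y * rho n y =
      -∫ y, (∑ i, pd i (fun y => W y s) y * pd i (fun y => W y t) y) * rho n y :=
  ou_ibp ((h.c2 s hs).of_le (by norm_num)) (h.c2 t ht) (h.gr1W hs) (h.gr1W' hs) (h.gr1W' ht)
    (h.gr1W'' ht)

theorem SSol.int_mul_OU (h : SSol I W H) {t : ℝ} (hs : s ∈ I) (ht : t ∈ I) :
    Integrable fun y => W y s * OU (fun y => W y t) y * rho n y :=
  Gr1.int ((h.gr1W hs).mul (h.gr1 ht)) ((h.c2 s hs).continuous.mul (OU_continuous (h.c2 t ht)))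

theorem SSol.dirich_sub (h : SSol I W H) {t : ℝ} (hs : s ∈ I) (ht : t ∈ I) :
    dirich W t - dirich W s = -∫ y, (W y t - W y s) *
      (OU (fun y => W y t) y + OU (fun y => W y s) y) * rho n y := by
  simp [(fun y => by ring : ∀ y, (W y t - W y s) * (OU (fun y => W y t) y + OU (fun y => W y s) y) * rho n y =
      (W y t * OU (fun y => W y t) y * rho n y - W y s * OU (fun y => W y s) y * rho n y) +
      (W y t * OU (fun y => W y s) y * rho n y - W y s * OU (fun y => W y t) y * rho n y))]
  have i1 := h.int_mul_OU ht ht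
  have i2 := h.int_mul_OU hs hs
  have i3 := h.int_mul_OU ht hs
  have i4 := h.int_mul_OU hs ht
  rw [integral_add (i1.sub' i2) (i3.sub' i4), integral_sub i1 i2, integral_sub i3 i4,
    h.ibp ht ht, h.ibp hs hs, h.ibp ht hs, h.ibp hs ht]
  have : ∀ y, ∑ i, pd i (fun y => W y t) y * pd i (fun y => W y s) y =
      ∑ i, pd i (fun y => W y s) y * pd i (fun y => W y t) y :=
    fun y => Finset.sum_congr rfl fun i _ => mul_comm _ _
  simp only [this, dirich]
  ring

theorem SSol.dirich_deriv (h : SSol I W H) (hI : IsOpen I)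
    (hc : ∀ y, ContinuousOn (fun s => OU (fun y => W y s) y) I) (hs : s ∈ I) :
    HasDerivAt (dirich W) (-∫ y, (OU (fun y => W y s) y + H y s) *
      (OU (fun y => W y s) y + OU (fun y => W y s) y) * rho n y) s := by
  obtain ⟨e, hε, hb⟩ := Metric.isOpen_iff.1 hI s hs
  obtain ⟨C, m, hC, hWs⟩ := h.gWs
  obtain ⟨D, k, hD, hOU⟩ := h.gOU
  rw [hasDerivAt_iff_tendsto_slope]
  have hnb : ∀ᶠ t in 𝓝[≠] s, t ∈ ball s e :=
    nhdsWithin_le_nhds (ball_mem_nhds s hε)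
  have hlim : Tendsto (fun t => -∫ y, slope (W y) s t *
      (OU (fun y => W y t) y + OU (fun y => W y s) y) * rho n y) (𝓝[≠] s)
      (𝓝 (-∫ y, (OU (fun y => W y s) y + H y s) *
        (OU (fun y => W y s) y + OU (fun y => W y s) y) * rho n y)) := by
    refine (tendsto_integral_filter_of_dominated_convergence
      (fun y => C * (2 * D) * ((1 + ‖y‖)^(m + k) * rho n y)) ?_ ?_
      ((integrable_pow_mul_rho _).const_mul _) ?_).neg
    · filter_upwards [hnb] with t ht
      simp [slope_def_field]
      exact (((((h.c2 t (hb ht)).continuous.sub (h.c2 s hs).continuous).div_const _).mul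
        ((OU_continuous (h.c2 t (hb ht))).add (OU_continuous (h.c2 s hs)))).mul
          rho_cont).aestronglyMeasurable
    · filter_upwards [hnb, self_mem_nhdsWithin] with t ht hne
      refine .of_forall fun y => ?_
      have h2 : |slope (W y) s t| ≤ C * (1 + ‖y‖)^m := by
        rw [slope_def_field, abs_div, div_le_iff₀ (abs_pos.2 (sub_ne_zero.2 hne))]
        exact mvt (convex_ball s e)
          (fun r hr => h.ws y r (hb hr)) (fun r hr => hWs r (hb hr) y)
          (mem_ball_self hε) ht
      have h3 : |OU (fun y => W y t) y + OU (fun y => W y s) y| ≤ 2 * D * (1 + ‖y‖)^k := by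
        have := abs_add_le (OU (fun y => W y t) y) (OU (fun y => W y s) y)
        linarith [hOU t (hb ht) y, hOU s hs y]
      rw [norm_mul, norm_mul, norm_of_nonneg (rho_pos y).le, norm_eq_abs, norm_eq_abs, ← mul_assoc]
      refine mul_le_right ?_ (rho_pos y).le
      calc _ ≤ C * (1 + ‖y‖)^m * (2 * D * (1 + ‖y‖)^k) :=
            mul_le_mul h2 h3 (abs_nonneg _) (by positivity)
        _ = _ := by ring
    · refine .of_forall fun y => Tendsto.mul_const _ (Tendsto.mul ?_ ?_)
      · exact (hasDerivAt_iff_tendsto_slope.1 (h.ws y s hs))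
      · have := (hc y).continuousAt (hI.mem_nhds hs)
        exact (this.tendsto.mono_left nhdsWithin_le_nhds).add_const _
  refine hlim.congr' ?_
  filter_upwards [hnb] with t ht
  rw [slope_def_field, h.dirich_sub hs (hb ht), neg_div, ← integral_div]
  congr 2
  ext y
  rw [slope_def_field]; ring

theorem gh_abs_le (hC : ∀ z, |gf p a μ z| ≤ C * |z|^p) (s w) :
    |gh p a μ s w| ≤ C * |w|^p := by
  rw [gh, abs_mul, abs_of_pos (exp_pos _)]
  refine (mul_le_left (hC _) (exp_pos _).le).trans_eq ?_
  rw [exp_mul_abs_rpow, mul_left_comm, ← mul_assoc (exp _), ← exp_add,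
    show -p / (p - 1) * s + 1 / (p - 1) * p * s = 0 by ring]
  simp

theorem Gh_abs_le (hC : ∀ z, |Gf p a μ z| ≤ C * |z|^(p + 1)) (s w) :
    |Gh p a μ s w| ≤ C * |w|^(p + 1) := by
  rw [Gh, abs_mul, abs_of_pos (exp_pos _)]
  refine (mul_le_left (hC _) (exp_pos _).le).trans_eq ?_
  rw [exp_mul_abs_rpow, mul_left_comm, ← mul_assoc (exp _), ← exp_add,
    show -(p + 1) / (p - 1) * s + 1 / (p - 1) * (p + 1) * s = 0 by ring]
  simp

/-- the rescaled defect of homogeneity -/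
def Kh (p a m s w : ℝ) : ℝ :=
  exp (-(p + 1) / (p - 1) * s) * Kf p a m (exp (1 / (p - 1) * s) * w)

theorem Kh_eq (hp : 1 < p) (s w) :
    Kh p a μ s w = w * gh p a μ s w - (p + 1) * Gh p a μ s w := by
  have h : exp (-(p + 1) / (p - 1) * s) * exp (1 / (p - 1) * s) =
      exp (-p / (p - 1) * s) := by
    rw [← exp_add]; ring
  rw [Kh, Kf, gh, Gh, ← h]; ring

theorem hasDerivAt_Gh (hp : 1 < p) {w : ℝ → ℝ} {w' : ℝ} (hw : HasDerivAt w w' s) :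
    HasDerivAt (fun s => Gh p a μ s (w s))
      (1 / (p - 1) * Kh p a μ s (w s) + gh p a μ s (w s) * w') s := by
  have d : ∀ c, HasDerivAt (fun s => exp _) _ s := fun c => by
    simpa using ((hasDerivAt_id' s).const_mul c).exp
  refine ((d (-(p + 1) / (p - 1))).fun_mul
    ((hasDerivAt_Gf (a := a) (μ := μ) hp _).comp s ((d (1 / (p - 1))).fun_mul hw))).congr_deriv ?_
  have h : exp (-(p + 1) / (p - 1) * s) * exp (1 / (p - 1) * s) =
      exp (-p / (p - 1) * s) := by
    rw [← exp_add]; ring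
  rw [Kh, Kf, gh, ← h]
  simp only [Function.comp]
  ring

namespace Flow

variable (h : Flow p a μ I W)
include h

theorem cont (hs : s ∈ I) : Continuous fun y => W y s := (h.sol.c2 s hs).continuous

end Flow

theorem continuous_gh (hp : 1 < p) (s) : Continuous (gh p a μ s) :=
  continuous_const.mul ((continuous_gf hp).comp (continuous_const.mul continuous_id))

theorem continuous_Gh (hp : 1 < p) (s) : Continuous (Gh p a μ s) :=
  continuous_const.mul ((continuous_iff_continuousAt.2 fun z =>
    (hasDerivAt_Gf hp z).continuousAt).comp (continuous_const.mul continuous_id))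

theorem continuous_Kh (hp : 1 < p) (s) : Continuous (Kh p a μ s) :=
  continuous_const.mul ((continuous_iff_continuousAt.2 fun z =>
    (hasDerivAt_Kf hp z).continuousAt).comp (continuous_const.mul continuous_id))

theorem Gr.gh (hp : 1 < p) (ha : 0 < a) (h : Gr I W) : Gr I (fun y s => gh p a μ s (W y s)) := by
  obtain ⟨C, hC, hg⟩ := exists_gf_le hp ha
  refine ((h.abs_rpow (q := p) (by linarith)).const_mul C).of_le fun s _ y => ?_
  exact (gh_abs_le (fun z => (hg z).1) s _).trans (le_abs_self _)

theorem Gr.Gh (hp : 1 < p) (ha : 0 < a) (h : Gr I W) : Gr I (fun y s => Gh p a μ s (W y s)) := by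
  obtain ⟨C, hC, hg⟩ := exists_gf_le hp ha
  refine ((h.abs_rpow (q := p + 1) (by linarith)).const_mul C).of_le fun s _ y => ?_
  exact (Gh_abs_le (abs_Gf_le hp (fun z => (hg z).1) hC.le) s _).trans (le_abs_self _)

theorem Gr.Kh (hp : 1 < p) (ha : 0 < a) (h : Gr I W) : Gr I (fun y s => Kh p a μ s (W y s)) := by
  simp [Kh_eq hp]
  exact (h.mul (h.gh hp ha)).sub ((h.Gh hp ha).const_mul _)

/-- the time derivative in similarity variables -/
def Ws (p a m : ℝ) (W : EE n → ℝ → ℝ) (y : EE n) (s : ℝ) : ℝ :=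
  OU (fun y => W y s) y + (gh p a m s (W y s) - 1 / (p - 1) * W y s)

def dissip (p a m : ℝ) (W : EE n → ℝ → ℝ) (s : ℝ) : ℝ := ∫ y, Ws p a m W y s^2 * rho n y

def powInt (p : ℝ) (W : EE n → ℝ → ℝ) (s : ℝ) : ℝ := ∫ y, |W y s|^(p + 1) * rho n y

def sqInt (W : EE n → ℝ → ℝ) (s : ℝ) : ℝ := ∫ y, W y s^2 * rho n y

def energy (p a m : ℝ) (W : EE n → ℝ → ℝ) (s : ℝ) : ℝ :=
  1 / 2 * dirich W s + 1 / (2 * (p - 1)) * sqInt W s - ∫ y, Gh p a m s (W y s) * rho n y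

namespace Flow

variable (h : Flow p a μ I W)
include h

theorem gWs : Gr I (fun y s => Ws p a μ W y s) := h.sol.gWs

theorem cWs (hs : s ∈ I) : Continuous fun y => Ws p a μ W y s := h.sol.cWs hs

theorem ws {y : EE n} (hs : s ∈ I) : HasDerivAt (W y) (Ws p a μ W y s) s := h.sol.ws y s hs

theorem sqInt_deriv (hI : IsOpen I) (hs : s ∈ I) :
    HasDerivAt (sqInt W) (∫ y, (2 * W y s * Ws p a μ W y s) * rho n y) s := by
  refine hasDerivAt_integral_rho hI (θ := fun y s => W y s^2) (fun y s hs => ?_)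
    (fun s hs => (h.cont hs).pow 2)
    (fun s hs => (continuous_const.mul (h.cont hs)).mul (h.cWs hs)) (h.sol.gW.pow 2)
    ((h.sol.gW.const_mul 2).mul h.gWs) hs
  simpa using (h.ws hs).fun_pow 2

theorem energy_deriv (hp : 1 < p) (ha : 0 < a) (hI : IsOpen I) (hs : s ∈ I) :
    HasDerivAt (energy p a μ W)
      (-dissip p a μ W s - 1 / (p - 1) * ∫ y, Kh p a μ s (W y s) * rho n y) s := by
  have hp1 : p - 1 ≠ 0 := by linarith
  have d1 : HasDerivAt (dirich W) (-∫ y, Ws p a μ W y s * (OU (fun y => W y s) y +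
    OU (fun y => W y s) y) * rho n y) s := h.sol.dirich_deriv hI h.cOU hs
  have d2 := h.sqInt_deriv hI hs
  have d3 : HasDerivAt (fun s => ∫ y, Gh p a μ s (W y s) * rho n y) (∫ y, (1 / (p - 1) *
      Kh p a μ s (W y s) + gh p a μ s (W y s) * Ws p a μ W y s) * rho n y) s :=
    hasDerivAt_integral_rho hI (θ := fun y s => Gh p a μ s (W y s))
      (fun y s hs => hasDerivAt_Gh hp (h.ws hs))
      (fun s hs => (continuous_Gh hp s).comp (h.cont hs))
      (fun s hs => (continuous_const.mul ((continuous_Kh hp s).comp (h.cont hs))).add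
        (((continuous_gh hp s).comp (h.cont hs)).mul (h.cWs hs)))
      (h.sol.gW.Gh hp ha) (((h.sol.gW.Kh hp ha).const_mul _).add ((h.sol.gW.gh hp ha).mul h.gWs)) hs
  refine (((d1.const_mul (1 / 2)).fun_add (d2.const_mul (1 / (2 * (p - 1))))).fun_sub
    d3).congr_deriv ?_
  have i1 : Integrable fun y => Ws p a μ W y s * (OU (fun y => W y s) y + OU (fun y => W y s) y)
      * rho n y := Gr.integrable (h.gWs.mul (h.sol.gOU.add h.sol.gOU)) hs
        ((h.cWs hs).mul ((OU_continuous (h.sol.c2 s hs)).add (OU_continuous (h.sol.c2 s hs))))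
  have i2 : Integrable fun y => (2 * W y s * Ws p a μ W y s) * rho n y :=
    Gr.integrable ((h.sol.gW.const_mul 2).mul h.gWs) hs
      ((continuous_const.mul (h.cont hs)).mul (h.cWs hs))
  have i3 : Integrable fun y => (1 / (p - 1) *
      Kh p a μ s (W y s) + gh p a μ s (W y s) * Ws p a μ W y s) * rho n y :=
    Gr.integrable (((h.sol.gW.Kh hp ha).const_mul _).add ((h.sol.gW.gh hp ha).mul h.gWs)) hs
      ((continuous_const.mul ((continuous_Kh hp s).comp (h.cont hs))).add
        (((continuous_gh hp s).comp (h.cont hs)).mul (h.cWs hs)))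
  have i4 : Integrable fun y => Ws p a μ W y s^2 * rho n y :=
    Gr.integrable (h.gWs.pow 2) hs ((h.cWs hs).pow 2)
  have i5 : Integrable fun y => Kh p a μ s (W y s) * rho n y :=
    Gr.integrable (h.sol.gW.Kh hp ha) hs ((continuous_Kh hp s).comp (h.cont hs))
  rw [dissip, ← integral_const_mul, ← integral_neg, ← integral_const_mul, ← integral_const_mul,
    ← integral_neg]
  rw [← integral_add (i1.fun_neg.const_mul _) (i2.const_mul _), ← integral_sub
    ((i1.fun_neg.const_mul _).fun_add (i2.const_mul _)) i3, ← integral_sub i4.fun_neg (i5.const_mul _)]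
  refine integral_congr_ae (.of_forall fun y => ?_)
  have e : OU (fun y => W y s) y = Ws p a μ W y s - (gh p a μ s (W y s) - 1 / (p - 1) * W y s) := by
    rw [Ws]; ring
  simp only [e]
  field_simp
  ring

end Flow

theorem int_rho_mono (hf : Integrable fun y => f y * rho n y)
    (hg : Integrable fun y => g y * rho n y) (h : ∀ y, f y ≤ g y) :
    ∫ y, f y * rho n y ≤ ∫ y, g y * rho n y :=
  integral_mono hf hg fun y => mul_le_right (h y) (rho_pos y).le

theorem int_rho_nonneg (h : ∀ y, 0 ≤ f y) : 0 ≤ ∫ y, f y * rho n y :=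
  integral_nonneg fun y => mul_nonneg (h y) (rho_pos y).le

theorem int_rho_affine (hf : Integrable fun y => f y * rho n y) (c d) :
    Integrable (fun y => (c * f y + d) * rho n y) ∧
      ∫ y, (c * f y + d) * rho n y = c * (∫ y, f y * rho n y) + d := by
  simp only [(fun y => by ring : ∀ y, (c * f y + d) * rho n y = c * (f y * rho n y) + d * rho n y)]
  refine ⟨(hf.const_mul c).add (rho_integrable.const_mul d), ?_⟩
  rw [integral_add (hf.const_mul c) (rho_integrable.const_mul d), integral_const_mul,
    integral_const_mul, integral_rho, mul_one]

theorem sq_le_rpow_add_one (hp : 1 < p) (w : ℝ) : w^2 ≤ |w|^(p + 1) + 1 := by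
  rcases le_total |w| 1 with h | h
  · have := rpow_nonneg (abs_nonneg w) (p + 1)
    have := (sq_le_one_iff_abs_le_one w).2 h
    linarith
  · have : |w|^(2 : ℝ) ≤ |w|^(p + 1) := rpow_le_rpow_of_exponent_le h (by linarith)
    rw [rpow_two, sq_abs] at this
    linarith

namespace Flow

variable (h : Flow p a μ I W)
include h

theorem int_pow (hp : 1 < p) (hs : s ∈ I) :
    Integrable fun y => |W y s|^(p + 1) * rho n y :=
  Gr.integrable (h.sol.gW.abs_rpow (q := p + 1) (by linarith)) hs
    ((h.cont hs).abs.rpow_const fun _ => Or.inr (by linarith))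

theorem int_sq (hs : s ∈ I) : Integrable fun y => W y s^2 * rho n y :=
  Gr.integrable (h.sol.gW.pow 2) hs ((h.cont hs).pow 2)

theorem int_Ws_sq (hs : s ∈ I) : Integrable fun y => Ws p a μ W y s^2 * rho n y :=
  Gr.integrable (h.gWs.pow 2) hs ((h.cWs hs).pow 2)

theorem int_Kh (hp : 1 < p) (ha : 0 < a) (hs : s ∈ I) :
    Integrable fun y => Kh p a μ s (W y s) * rho n y :=
  Gr.integrable (h.sol.gW.Kh hp ha) hs ((continuous_Kh hp s).comp (h.cont hs))

theorem int_Gh (hp : 1 < p) (ha : 0 < a) (hs : s ∈ I) :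
    Integrable fun y => Gh p a μ s (W y s) * rho n y :=
  Gr.integrable (h.sol.gW.Gh hp ha) hs ((continuous_Gh hp s).comp (h.cont hs))

theorem int_mul_gh (hp : 1 < p) (ha : 0 < a) (hs : s ∈ I) :
    Integrable fun y => W y s * gh p a μ s (W y s) * rho n y :=
  Gr.integrable (h.sol.gW.mul (h.sol.gW.gh hp ha)) hs
    ((h.cont hs).mul ((continuous_gh hp s).comp (h.cont hs)))

theorem int_mul_Ws (hs : s ∈ I) : Integrable fun y => W y s * Ws p a μ W y s * rho n y :=
  Gr.integrable (h.sol.gW.mul h.gWs) hs ((h.cont hs).mul (h.cWs hs))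

theorem integral_mul_Ws (hp : 1 < p) (ha : 0 < a) (hs : s ∈ I) :
    ∫ y, W y s * Ws p a μ W y s * rho n y = -2 * energy p a μ W s +
      ∫ y, (W y s * gh p a μ s (W y s) - 2 * Gh p a μ s (W y s)) * rho n y := by
  have hp1 : p - 1 ≠ 0 := by linarith
  have i1 := h.sol.int_mul_OU hs hs
  have i2 := h.int_mul_gh hp ha hs
  have i3 := h.int_sq hs
  have i4 := h.int_Gh hp ha hs
  have e1 : ∀ y, W y s * Ws p a μ W y s * rho n y = W y s * OU (fun y => W y s) y * rho n y +
      (W y s * gh p a μ s (W y s) * rho n y - 1 / (p - 1) * (W y s^2 * rho n y)) := fun y => by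
    rw [Ws]; ring
  have e2 : ∀ y, (W y s * gh p a μ s (W y s) - 2 * Gh p a μ s (W y s)) * rho n y =
      W y s * gh p a μ s (W y s) * rho n y - 2 * (Gh p a μ s (W y s) * rho n y) :=
    fun y => by ring
  simp only [e1, e2]
  rw [integral_add i1 (i2.sub' (i3.const_mul _)), integral_sub i2 (i3.const_mul _),
    integral_sub i2 (i4.const_mul _), integral_const_mul, integral_const_mul, h.sol.ibp hs hs,
    energy, sqInt, dirich]
  field_simp
  ring

theorem neg_int_Kh_le (hp : 1 < p) (ha : 0 < a) (hC : ∀ s w, 0 < s →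
      exp (-(p + 1) / (p - 1) * s) * |Kf p a μ (exp (1 / (p - 1) * s) * w)| ≤
        C * s^(-a - 1) * |w|^(p + 1) + C * exp (-(p + 1) / (2 * (p - 1)) * s))
    (h0 : 0 < s) (hs : s ∈ I) :
    -∫ y, Kh p a μ s (W y s) * rho n y ≤ C * s^(-a - 1) * powInt p W s +
      C * exp (-(p + 1) / (2 * (p - 1)) * s) := by
  obtain ⟨i1, e1⟩ := int_rho_affine (h.int_pow hp hs) (C * s^(-a - 1))
    (C * exp (-(p + 1) / (2 * (p - 1)) * s))
  have i2 : Integrable fun y => -Kh p a μ s (W y s) * rho n y := by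
    simpa only [neg_mul] using (h.int_Kh hp ha hs).fun_neg
  have := int_rho_mono i2 i1 fun y => by
    refine le_trans ?_ (hC s (W y s) h0)
    rw [Kh, ← mul_neg]
    exact mul_le_left (neg_le_abs _) (exp_pos _).le
  rw [e1] at this
  simpa only [neg_mul, integral_neg, powInt] using this

theorem powInt_le (hp : 1 < p) (ha : 0 < a) {c : ℝ} (hc : 0 < c) (hC0 : 0 < C)
    (hC : ∀ z, c * |z|^(p + 1) - C ≤ z * gf p a μ z - 2 * Gf p a μ z) (h0 : 0 < s)
    (hs : s ∈ I) : c / 2 * powInt p W s ≤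
      2 * energy p a μ W s + (C + c / 2) + 1 / (2 * c) * dissip p a μ W s := by
  have hp1 := sub_pos.2 hp
  obtain ⟨i1, e1⟩ := int_rho_affine (h.int_pow hp hs) c (-C)
  have i2 : Integrable fun y => (W y s * gh p a μ s (W y s) - 2 * Gh p a μ s (W y s)) * rho n y := by
    simpa only [sub_mul, mul_assoc] using (h.int_mul_gh hp ha hs).sub'
      ((h.int_Gh hp ha hs).const_mul 2)
  have k1 := int_rho_mono i1 i2 fun y => by
    have e : exp (-(p + 1) / (p - 1) * s) * exp (1 / (p - 1) * s) =
        exp (-p / (p - 1) * s) := by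
      rw [← exp_add]; congr 1; ring
    have e' : exp (-(p + 1) / (p - 1) * s) * exp (1 / (p - 1) * (p + 1) * s) = 1 := by
      rw [← exp_add, show -(p + 1) / (p - 1) * s + 1 / (p - 1) * (p + 1) * s = 0 by ring,
        exp_zero]
    have h1 := mul_le_left (hC (exp (1 / (p - 1) * s) * W y s))
      (exp_pos (-(p + 1) / (p - 1) * s)).le
    rw [exp_mul_abs_rpow] at h1
    have h2 : exp (-(p + 1) / (p - 1) * s) ≤ 1 := by
      rw [exp_le_one_iff, neg_div, neg_mul]
      have : 0 < (p + 1) / (p - 1) * s := by positivity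
      linarith
    rw [gh, Gh, ← e]
    nlinarith [mul_le_left h2 hC0.le, congrArg (fun x => c * |W y s|^(p + 1) * x) e']
  rw [e1] at k1
  have k2 := h.integral_mul_Ws hp ha hs
  obtain ⟨i3, e3⟩ := int_rho_affine (h.int_pow hp hs) (c / 2) (c / 2)
  obtain ⟨i4, e4⟩ := int_rho_affine (h.int_Ws_sq hs) (1 / (2 * c)) 0
  have i5 : Integrable fun y => ((c / 2 * |W y s|^(p + 1) + c / 2) +
      (1 / (2 * c) * Ws p a μ W y s^2 + 0)) * rho n y := by
    simpa only [add_mul] using i3.fun_add i4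
  have k3 := int_rho_mono (h.int_mul_Ws hs) i5 fun y => by
    have h1 := sq_le_rpow_add_one hp (W y s)
    have h2 : 0 ≤ (c * W y s - Ws p a μ W y s)^2 / (2 * c) := by positivity
    have h3 : (c * W y s - Ws p a μ W y s)^2 / (2 * c) = c / 2 * W y s^2 -
      W y s * Ws p a μ W y s + 1 / (2 * c) * Ws p a μ W y s^2 := by field_simp; ring
    nlinarith
  have e5 := integral_add i3 i4
  simp only [← add_mul] at e5
  rw [e5, e3, e4] at k3
  rw [dissip, powInt]
  linarith

end Flow

theorem neg_Gh_le_energy (hp : 1 < p) (s) :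
    -∫ y, Gh p a μ s (W y s) * rho n y ≤ energy p a μ W s := by
  have h1 : 0 ≤ dirich W s :=
    int_rho_nonneg fun y => Finset.sum_nonneg fun i _ => mul_self_nonneg _
  have h2 : 0 ≤ sqInt W s := int_rho_nonneg fun y => sq_nonneg _
  have : 0 ≤ 1 / (2 * (p - 1)) * sqInt W s := by positivity
  rw [energy]; linarith

theorem dissip_nonneg (W : EE n → ℝ → ℝ) (s) : 0 ≤ dissip p a μ W s :=
  int_rho_nonneg fun _ => sq_nonneg _

/-- Differential inequality for the energy, uniformly over all flows. -/
theorem exists_energy_ineq (n : ℕ) (μ : ℝ) (hp : 1 < p) (ha : 0 < a) : ∃ k L C s0 : ℝ, 0 < k ∧ 0 < L ∧ 0 < C ∧ 1 ≤ s0 ∧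
    ∀ (I : Set ℝ) (W : EE n → ℝ → ℝ), IsOpen I → Flow p a μ I W → ∀ s ∈ I, s0 ≤ s →
      powInt p W s ≤ k * (energy p a μ W s + L * (dissip p a μ W s + 1)) ∧
      ∃ E', HasDerivAt (energy p a μ W) E' s ∧
        E' ≤ -(1 / 2) * dissip p a μ W s + C * s^(-a - 1) * (energy p a μ W s + L) := by
  have hp1 := sub_pos.2 hp
  obtain ⟨c, C1, hc, hC1, hz⟩ := exists_zg_ge (μ := μ) hp ha
  obtain ⟨C2, hC2, hK⟩ := exists_scaled_Kf_le (μ := μ) hp ha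
  set L1 : ℝ := (C1 + c / 2) / 2 + 1 / (4 * c) with hL1
  have hL1p : 0 < L1 := by positivity
  -- exponential versus power
  have hexp : ∀ᶠ s : ℝ in atTop, exp (-(p + 1) / (2 * (p - 1)) * s) ≤ s^(-a - 1) := by
    have := tendsto_rpow_mul_exp_neg_mul_atTop_nhds_zero (a + 1) ((p + 1) / (2 * (p - 1)))
      (by positivity)
    filter_upwards [this.eventually_le_const (show (0 : ℝ) < 1 by norm_num),
      eventually_gt_atTop 0] with s h1 h2
    have h3 : s^(-a - 1) = (s^(a + 1))⁻¹ := by rw [← rpow_neg h2.le]; congr 1; ring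
    rw [h3, ← one_div, le_div_iff₀ (rpow_pos_of_pos h2 _), mul_comm, neg_div]
    exact h1
  have hsm : ∀ᶠ s : ℝ in atTop, 1 / (p - 1) * C2 * s^(-a - 1) * (4 / c) * L1 ≤ 1 / 2 := by
    have h1 := tendsto_rpow_neg_atTop (show 0 < a + 1 by linarith)
    have h2 := (h1.const_mul (1 / (p - 1) * C2 * (4 / c) * L1))
    rw [mul_zero] at h2
    filter_upwards [h2.eventually_le_const (show (0 : ℝ) < 1 / 2 by norm_num)] with s h3
    rw [show -(a + 1) = -a - 1 by ring] at h3
    linarith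
  obtain ⟨s0, hs0⟩ := eventually_atTop.1 (hexp.and hsm)
  refine ⟨4 / c, L1 + c / 4, 1 / (p - 1) * C2 * (4 / c), max s0 1, by positivity, by positivity,
    by positivity, le_max_right _ _, fun I W hI h s hs hss => ?_⟩
  obtain ⟨q1, q2⟩ := hs0 s ((le_max_left _ _).trans hss)
  have hs1 : 1 ≤ s := (le_max_right _ _).trans hss
  have hD := dissip_nonneg (p := p) (a := a) (μ := μ) W s
  have r1 := h.powInt_le hp ha hc hC1 hz (by linarith) hs
  have r2 : powInt p W s ≤ 4 / c * (energy p a μ W s + L1 * (dissip p a μ W s + 1)) := by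
    have h1 : (C1 + c / 2) + 1 / (2 * c) * dissip p a μ W s ≤
        2 * (L1 * (dissip p a μ W s + 1)) := by
      have h2 : 0 ≤ 1 / (4 * c) := by positivity
      have h3 : 0 ≤ (C1 + c / 2) * dissip p a μ W s := by positivity
      have h4 : 1 / (2 * c) = 2 * (1 / (4 * c)) := by field_simp; ring
      rw [hL1, h4]; nlinarith
    have h5 : c / 2 * powInt p W s ≤ 2 * (energy p a μ W s + L1 * (dissip p a μ W s + 1)) := by
      linarith
    calc powInt p W s = 2 / c * (c / 2 * powInt p W s) := by field_simp
      _ ≤ 2 / c * (2 * (energy p a μ W s + L1 * (dissip p a μ W s + 1))) := by gcongr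
      _ = _ := by ring
  refine ⟨r2.trans (by gcongr; linarith), _, h.energy_deriv hp ha hI hs, ?_⟩
  have r3 := h.neg_int_Kh_le hp ha hK (by linarith) hs
  have hsp : 0 < s^(-a - 1) := rpow_pos_of_pos (by linarith) _
  have r4 : -∫ y, Kh p a μ s (W y s) * rho n y ≤ C2 * s^(-a - 1) * (4 / c *
      (energy p a μ W s + L1 * (dissip p a μ W s + 1)) + 1) := by
    refine r3.trans ?_
    rw [mul_add, mul_one]
    exact add_le_add (mul_le_left r2 (by positivity))
      (mul_le_left q1 hC2.le)
  have r5 := mul_le_left r4 (show 0 ≤ 1 / (p - 1) by positivity)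
  have e6 : (1 : ℝ) = 4 / c * (c / 4) := by field_simp
  have r7 := mul_le_right q2 hD
  have e7 : 1 / (p - 1) * (C2 * s^(-a - 1) * (4 / c *
      (energy p a μ W s + L1 * (dissip p a μ W s + 1)) + 4 / c * (c / 4))) =
      1 / (p - 1) * C2 * s^(-a - 1) * (4 / c) * L1 * dissip p a μ W s +
      1 / (p - 1) * C2 * (4 / c) * s^(-a - 1) * (energy p a μ W s + (L1 + c / 4)) := by ring
  rw [← e6] at e7
  rw [e7] at r5
  linarith

theorem abs_wSelf_le {K T' : ℝ} {c y : EE n}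
    (hK : |u (c + exp (-s / 2) • y) (T' - exp (-s))| ≤ K) :
    |wSelf n p T' u c y s| ≤ exp (-(1 / (p - 1)) * s) * K := by
  rw [wSelf_eq, abs_mul, abs_of_pos (exp_pos _)]
  exact mul_le_left hK (exp_pos _).le

/-- The rescaled solutions are flows on a neighbourhood of `[s, ∞)`, decaying when `T' < T`. -/
theorem exists_flow (hp : 1 < p) (ha : 0 < a) (hu : SolvesU n p a μ T u) {s0 T' : ℝ}
    (h0 : exp (-s0) < T') (hT' : T' < T) (c : EE n) :
    ∃ I, IsOpen I ∧ Ici s0 ⊆ I ∧ Flow p a μ I (wSelf n p T' u c) ∧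
      ∃ K, ∀ s ∈ Ici s0, ∀ y, |wSelf n p T' u c y s| ≤ exp (-(1 / (p - 1)) * s) * K := by
  obtain ⟨K, hK⟩ := exists_rsol hp ha hu (α := (T' - exp (-s0)) / 2) (β := (T' + T) / 2)
    (by linarith) (by linarith)
  set I : Set ℝ := {s | (T' - exp _) / 2 < T' - exp (-s)}
  have hmem : ∀ s ∈ I, T' - exp (-s) ∈ Ioo _ ((T' + T) / 2) :=
    fun s hs => ⟨hs, by have := exp_pos (-s); linarith⟩
  have hsub : Ici s0 ⊆ I := fun s hs => by
    have := exp_le_exp.2 (neg_le_neg hs)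
    change (T' - exp (-s0)) / 2 < T' - exp (-s)
    linarith
  exact ⟨I, isOpen_lt continuous_const (by fun_prop), hsub, hK.flow hp c T' hmem, K,
    fun s hs y => abs_wSelf_le (hK.bu _ _ (hmem s (hsub hs)))⟩

/-- Uniform bound of the initial energies. -/
theorem exists_energy_at (hp : 1 < p) (ha : 0 < a) (hu : SolvesU n p a μ T u) {s0 : ℝ}
    (h1 : 0 ≤ s0) (h0 : exp (-s0) ≤ T / 4) :
    ∃ M, ∀ (c : EE n) (T'), T - exp (-s0) ≤ T' → T' < T →
      energy p a μ (wSelf n p T' u c) s0 ≤ M := by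
  have e0 := exp_pos (-s0)
  obtain ⟨K, hK⟩ := exists_rsol hp ha hu (α := T / 4) (β := T - exp (-s0) / 2)
    (by linarith) (by linarith)
  obtain ⟨C, hC, hg⟩ := exists_gf_le hp ha
  refine ⟨1 / 2 * (∑ _i : Fin n, K * K) + 1 / (2 * (p - 1)) * K^2 + C * K^(p + 1),
    fun c T' h2 h3 => ?_⟩
  have ht : T' - exp (-s0) ∈ Ioo (T / 4) (T - exp (-s0) / 2) :=
    ⟨by linarith, by linarith⟩
  have hK0 := (abs_nonneg _).trans (hK.bu 0 _ ht)
  have hr : exp (-(1 / (p - 1)) * s0) ≤ 1 := by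
    rw [exp_le_one_iff]
    have : 0 ≤ 1 / (p - 1) * s0 := by positivity
    linarith
  have hW : ∀ y, |wSelf n p T' u c y s0| ≤ K := fun y =>
    (abs_wSelf_le (hK.bu _ _ ht)).trans (mul_le_of_le_one_left hK0 hr)
  have hW' : ∀ i y, |pd i (fun y => wSelf n p T' u c y s0) y| ≤ K := fun i y => by
    simp only [wSelf_eq]
    rw [pd_const_mul, pd_affine (((hK.c2 _ ht).differentiable (by norm_num)) (c + exp (-s0 / 2) • y)), abs_mul, abs_mul, abs_of_pos (exp_pos _),
      abs_of_pos (exp_pos _), ← mul_assoc]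
    exact (mul_le_mul (mul_le_one₀ hr (exp_pos _).le (by rw [exp_le_one_iff]; linarith)) (hK.bgrad _ ht i _) (abs_nonneg _)
      zero_le_one).trans_eq (one_mul K)
  refine add_le_add (add_le_add (mul_le_left ?_ (by norm_num))
    (mul_le_left ?_ (by positivity))) ?_
  · refine (le_abs_self _).trans (abs_integral_rho_le fun y => ?_)
    refine (Finset.abs_sum_le_sum_abs _ _).trans (Finset.sum_le_sum fun i _ => ?_)
    rw [abs_mul]
    exact mul_le_mul (hW' i y) (hW' i y) (abs_nonneg _) hK0
  · refine (le_abs_self _).trans (abs_integral_rho_le fun y => ?_)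
    rw [abs_pow]
    exact pow_le_pow_left₀ (abs_nonneg _) (hW y) 2
  · refine (neg_le_abs _).trans (abs_integral_rho_le fun y => (Gh_abs_le (abs_Gf_le hp (fun z => (hg z).1) hC.le) _ _).trans ?_)
    exact mul_le_left (rpow_le_rpow (abs_nonneg _) (hW y) (by linarith)) hC.le

/-- A bounded Lyapunov functional, uniform over the centres `(c, T')` with `T' < T`. -/
theorem exists_lyapunov (hp : 1 < p) (ha : 0 < a) (hT : 0 < T) (hu : SolvesU n p a μ T u) :
    ∃ s0 C, 1 ≤ s0 ∧ 0 < C ∧ exp (-s0) ≤ T / 4 ∧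
      ∀ (c : EE n) (T' : ℝ), T - exp (-s0) ≤ T' → T' < T → ∃ X X' : ℝ → ℝ, ∀ s, s0 ≤ s →
        HasDerivAt X (X' s) s ∧ 0 ≤ X s ∧ X s ≤ C ∧
        dissip p a μ (wSelf n p T' u c) s ≤ -2 * X' s ∧
        powInt p (wSelf n p T' u c) s ≤ C * (1 - X' s) := by
  have hp1 := sub_pos.2 hp
  obtain ⟨k, L, C1, s1, hk, hL, hC1, hs1, hin⟩ := exists_energy_ineq n μ hp ha
  obtain ⟨s2, hs2⟩ := eventually_atTop.1 ((tendsto_exp_neg_atTop_nhds_zero).eventually_le_const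
    (show (0 : ℝ) < T / 4 by positivity))
  set s0 := max s1 s2
  have h1 : 1 ≤ s0 := hs1.trans (le_max_left _ _)
  have h0 : exp (-s0) ≤ T / 4 := hs2 _ (le_max_right _ _)
  obtain ⟨M, hM⟩ := exists_energy_at hp ha hu (by linarith) h0
  obtain ⟨Cg, hCg, hg⟩ := exists_gf_le (μ := μ) hp ha
  have hG := abs_Gf_le hp (fun z => (hg z).1) hCg.le
  set h : ℝ → ℝ := fun s => C1 / a * s^(-a)
  have hh0 : ∀ s, s0 ≤ s → 0 ≤ h s := fun s hs => by
    have : 0 ≤ s^(-a) := rpow_nonneg (by linarith) _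
    positivity
  set C2 := exp (h s0) * |M + L|
  have hC2 : 0 ≤ C2 := by positivity
  refine ⟨s0, C2 + k * (C2 + L) + 2 * k * L, h1, by positivity, h0, fun c T' hT1 hT2 => ?_⟩
  obtain ⟨I, hI, hsub, hF, K, hK⟩ := exists_flow hp ha hu (s0 := s0) (T' := T')
    (by linarith [exp_pos (-s0)]) hT2 c
  set W := wSelf n p T' u c
  have hE : ∀ s, s0 ≤ s → _ := fun s hs =>
    hin I W hI hF s (hsub hs) ((le_max_left _ _).trans hs)
  set X : ℝ → ℝ := fun s => exp (h s) * (energy p a μ W s + L) with hX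
  have hd : ∀ s, s0 ≤ s → ∃ X', HasDerivAt X X' s ∧ dissip p a μ W s ≤ -2 * X' := fun s hs => by
    obtain ⟨-, E', hE1, hE2⟩ := hE s hs
    have hh : HasDerivAt h (-C1 * s^(-a - 1)) s :=
      ((hasDerivAt_rpow_const (p := -a) (Or.inl (by linarith))).const_mul (C1 / a)).congr_deriv (by
        field_simp)
    refine ⟨_, hh.exp.mul (hE1.add_const L), ?_⟩
    have hD := dissip_nonneg (p := p) (a := a) (μ := μ) W s
    have h3 : 1 ≤ exp (h s) := one_le_exp (hh0 s hs)
    nlinarith [mul_le_right h3 hD]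
  have hD : ∀ s, 0 ≤ dissip p a μ W s := dissip_nonneg W
  have hanti : AntitoneOn X (Ici s0) := by
    refine antitoneOn_of_deriv_nonpos (convex_Ici _) (fun s hs => ?_) (fun s hs => ?_)
      (fun s hs => ?_)
    · obtain ⟨X', h1, -⟩ := hd s hs
      exact h1.continuousAt.continuousWithinAt
    · rw [interior_Ici] at hs
      obtain ⟨X', h1, -⟩ := hd s hs.le
      exact h1.differentiableAt.differentiableWithinAt
    · rw [interior_Ici] at hs
      obtain ⟨X', h1, h2⟩ := hd s hs.le
      rw [h1.deriv]
      linarith [hD s]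
  have hlim : ∀ᶠ s in atTop, 0 ≤ X s := by
    have t1 : Tendsto (fun s : ℝ => Cg * |exp (-(1 / (p - 1)) * s) * K|^(p + 1)) atTop
        (𝓝 (Cg * |0 * K|^(p + 1))) := by
      have : Tendsto (fun s : ℝ => exp (-(1 / (p - 1)) * s)) atTop (𝓝 0) := by
        refine tendsto_exp_atBot.comp ?_
        exact tendsto_id.const_mul_atTop_of_neg (neg_lt_zero.2 (by positivity))
      exact ((this.mul_const K).abs.rpow_const (Or.inr (by linarith))).const_mul _
    rw [zero_mul, abs_zero, zero_rpow (by linarith), mul_zero] at t1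
    filter_upwards [t1.eventually_le_const hL, eventually_ge_atTop s0] with s h5 h6
    have h7 : |∫ y, Gh p a μ s (W y s) * rho n y| ≤ L := abs_integral_rho_le fun y =>
      (Gh_abs_le hG _ _).trans (le_trans (mul_le_left
        (rpow_le_rpow (abs_nonneg _) ((hK s h6 y).trans (le_abs_self _)) (by linarith)) hCg.le) h5)
    have h8 := neg_Gh_le_energy (a := a) (μ := μ) (W := W) hp s
    have h9 := (abs_le.1 h7).2
    exact mul_nonneg (exp_pos _).le (by linarith)
  have hX0 : ∀ s, s0 ≤ s → 0 ≤ X s := fun s hs => by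
    obtain ⟨t, ht1, ht2⟩ := (hlim.and (eventually_ge_atTop s)).exists
    exact ht1.trans (hanti hs (hs.trans ht2) ht2)
  have hXC : ∀ s, s0 ≤ s → X s ≤ C2 := fun s hs =>
    (hanti self_mem_Ici hs hs).trans (mul_le_left
      ((add_le_add_left (hM c T' hT1 hT2) L).trans (le_abs_self _)) (exp_pos _).le)
  choose! X' hX' hDX using hd
  refine ⟨X, X', fun s hs => ⟨hX' s hs, hX0 s hs, ?_, hDX s hs, ?_⟩⟩
  · have : 0 ≤ k * (C2 + L) + 2 * k * L := by positivity
    linarith [hXC s hs]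
  · obtain ⟨hP, -⟩ := hE s hs
    have h3 : 1 ≤ exp (h s) := one_le_exp (hh0 s hs)
    have h5 := hXC s hs
    have h6 := hDX s hs
    have h7 := hD s
    have h8 : energy p a μ W s + L * (dissip p a μ W s + 1) ≤ C2 + L * (-2 * X' s) := by
      nlinarith [mul_le_left h6 hL.le]
    have h10 : 0 ≤ -X' s := by linarith
    have h11 : 0 ≤ (C2 + k * (C2 + L)) * -X' s := by positivity
    have h12 : 0 ≤ k * L := by positivity
    nlinarith

theorem sq_int_rho_le (h1 : Integrable fun y => f y * rho n y)
    (h2 : Integrable fun y => f y^2 * rho n y) :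
    (∫ y, f y * rho n y)^2 ≤ ∫ y, f y^2 * rho n y := by
  set m := ∫ y, f y * rho n y
  obtain ⟨i1, e1⟩ := int_rho_affine h1 (2 * m) (-m^2)
  have := int_rho_mono i1 h2 fun y => by nlinarith [sq_nonneg (f y - m)]
  linarith

theorem rho_le_rho_smul (h0 : 0 ≤ δ) (h1 : δ ≤ 1) (y : EE n) : rho n y ≤ rho n (δ • y) := by
  refine mul_le_left (exp_le_exp.2 ?_) (by positivity)
  rw [norm_smul, norm_of_nonneg h0, mul_pow]
  have := mul_le_right (pow_le_one₀ h0 h1 : δ^2 ≤ 1) (sq_nonneg ‖y‖)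
  linarith

theorem int_dilate_le (hf : ∀ y, 0 ≤ f y) (hc : Continuous f)
    (hi : Integrable fun y => f y * rho n y) (h0 : 0 < δ) (h1 : δ ≤ 1) :
    Integrable (fun y => f (δ • y) * rho n y) ∧
      δ^n * ∫ y, f (δ • y) * rho n y ≤ ∫ y, f y * rho n y := by
  have i1 := hi.comp_smul h0.ne'
  have hle : ∀ y, f (δ • y) * rho n y ≤ f _ * rho n _ := fun y =>
    mul_le_left (rho_le_rho_smul h0.le h1 y) (hf _)
  have i2 : Integrable fun y => f (δ • y) * rho n y := by
    refine i1.mono' (((hc.comp (continuous_const_smul δ)).mul rho_cont).aestronglyMeasurable)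
      (.of_forall fun y => ?_)
    rw [norm_of_nonneg (mul_nonneg (hf _) (rho_pos y).le)]
    exact hle y
  refine ⟨i2, ?_⟩
  have h2 := integral_mono i2 i1 hle
  rw [Measure.integral_comp_smul volume (fun y : EE n => f y * rho n y) δ, finrank_euclideanSpace_fin, abs_of_pos (by positivity), smul_eq_mul] at h2
  have := mul_le_left h2 (pow_pos h0 n).le
  rwa [← mul_assoc, mul_inv_cancel₀ (by positivity), one_mul] at this

/-- the dilated mass -/
def sqDil (W : EE n → ℝ → ℝ) (d s : ℝ) : ℝ := ∫ y, W (d • y) s^2 * rho n y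

theorem Gr.dil {q : EE n → ℝ → ℝ} (h : Gr I q) (d : ℝ) : Gr I fun y s => q (d • y) s := by
  simpa using h.comp_affine (c := 0) (fun _ hs => hs)
    fun _ _ => le_rfl

namespace Flow

variable (h : Flow p a μ I W)
include h

theorem sqDil_deriv (hI : IsOpen I) (δ : ℝ) (hs : s ∈ I) :
    HasDerivAt (sqDil W δ) (∫ y, 2 * W (δ • y) s * Ws p a μ W (δ • y) s * rho n y) s := by
  have c1 : ∀ s ∈ I, Continuous fun y => W (δ • y) s := fun s hs =>
    (h.cont hs).comp (continuous_const_smul δ)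
  have c2 : ∀ s ∈ I, Continuous fun y => Ws p a μ W (δ • y) s := fun s hs =>
    (h.cWs hs).comp (continuous_const_smul δ)
  refine hasDerivAt_integral_rho hI (θ := fun y s => W (δ • y) s^2) (fun y s hs => ?_)
    (fun s hs => (c1 s hs).pow 2) (fun s hs => (continuous_const.mul (c1 s hs)).mul (c2 s hs))
    ((h.sol.gW.dil δ).pow 2) (((h.sol.gW.dil δ).const_mul 2).mul (h.gWs.dil δ)) hs
  simpa using (h.ws (y := δ • y) hs).fun_pow 2

theorem sqDil_le (hI : IsOpen I) {s' η : ℝ} (h0 : 0 < δ) (h1 : δ ≤ 1) (hη : 0 < η)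
    (hss : s ≤ s') (hη1 : η * (s' - s) ≤ 1) (hsub : Icc s s' ⊆ I) {X' : ℝ → ℝ}
    (hX : ∀ r ∈ Icc s s', HasDerivAt X (X' r) r ∧ 0 ≤ X r ∧ X r ≤ C ∧
      dissip p a μ W r ≤ -2 * X' r) :
    sqDil W δ s' ≤ exp 1 * (sqDil W δ s + 2 * C / (η * δ^n)) := by
  have hδn : 0 < δ^n := pow_pos h0 n
  set B := 2 * exp 1 / (η * δ^n)
  have hB : 0 < B := by positivity
  have hJ0 : ∀ r, 0 ≤ sqDil W δ r := fun r => int_rho_nonneg fun y => sq_nonneg _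
  set F : ℝ → ℝ := fun r => exp (η * (s' - r)) * sqDil W δ r + B * X r with hF
  have hd : ∀ r ∈ Icc s s', ∃ d, HasDerivAt F d r ∧ d ≤ 0 := fun r hr => by
    obtain ⟨x1, -, -, x2⟩ := hX r hr
    have hrI := hsub hr
    have d1 : HasDerivAt (fun r => exp (η * (s' - r))) (exp (η * (s' - r)) * -η) r := by
      simpa using (((hasDerivAt_id' r).const_sub s').const_mul η).exp
    refine ⟨_, (d1.mul (h.sqDil_deriv hI δ hrI)).add (x1.const_mul B), ?_⟩
    obtain ⟨i1, e1⟩ := int_dilate_le (fun y => sq_nonneg (W y r)) ((h.cont hrI).pow 2)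
      (h.int_sq hrI) h0 h1
    obtain ⟨i2, e2⟩ := int_dilate_le (fun y => sq_nonneg (Ws p a μ W y r)) ((h.cWs hrI).pow 2)
      (h.int_Ws_sq hrI) h0 h1
    have k : ∫ y, 2 * W (δ • y) r * Ws p a μ W (δ • y) r * rho n y ≤
        η * sqDil W δ r + η⁻¹ * ∫ y, Ws p a μ W (δ • y) r^2 * rho n y := by
      rw [sqDil, ← integral_const_mul, ← integral_const_mul,
        ← integral_add (i1.const_mul _) (i2.const_mul _)]
      refine integral_mono (Gr.integrable (((h.sol.gW.dil δ).const_mul 2).mul (h.gWs.dil δ)) hrI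
        ((continuous_const.mul ((h.cont hrI).comp (continuous_const_smul δ))).mul
          ((h.cWs hrI).comp (continuous_const_smul δ))))
        ((i1.const_mul _).add (i2.const_mul _)) fun y => ?_
      have q1 : 0 ≤ η⁻¹ * (η * W (δ • y) r - Ws p a μ W (δ • y) r)^2 * rho n y :=
        mul_nonneg (by positivity) (rho_pos y).le
      have q2 : η⁻¹ * (η * W (δ • y) r - Ws p a μ W (δ • y) r)^2 * rho n y =
        η * (W (δ • y) r^2 * rho n y) + η⁻¹ * (Ws p a μ W (δ • y) r^2 * rho n y) -
          2 * W (δ • y) r * Ws p a μ W (δ • y) r * rho n y := by field_simp; ring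
      simp only
      linarith
    have k2 : η⁻¹ * ∫ y, Ws p a μ W (δ • y) r^2 * rho n y ≤ -(2 / (η * δ^n)) * X' r := by
      have : ∫ y, Ws p a μ W (δ • y) r^2 * rho n y ≤ -2 * X' r / δ^n := by
        rw [le_div_iff₀ hδn, mul_comm]; exact e2.trans x2
      refine (mul_le_left this (inv_pos.2 hη).le).trans_eq ?_
      field_simp
    have k3 : exp (η * (s' - r)) ≤ exp 1 := exp_le_exp.2
      ((mul_le_left (sub_le_sub_left hr.1 s') hη.le).trans hη1)
    have k4 : 0 ≤ -(2 / (η * δ^n)) * X' r :=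
      (mul_nonneg (inv_pos.2 hη).le (int_rho_nonneg fun y => sq_nonneg _)).trans k2
    have k5 := mul_le_left (k.trans (add_le_add_right k2 _))
      (exp_pos (η * (s' - r))).le
    have k6 := mul_le_right k3 k4
    have e : B * X' r = -(exp 1 * (-(2 / (η * δ^n)) * X' r)) := by simp only [B]; ring
    rw [e]
    nlinarith
  have hanti : AntitoneOn F (Icc s s') := by
    refine antitoneOn_of_deriv_nonpos (convex_Icc _ _) (fun r hr => ?_) (fun r hr => ?_)
      (fun r hr => ?_)
    · obtain ⟨d, h1, -⟩ := hd r hr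
      exact h1.continuousAt.continuousWithinAt
    · obtain ⟨d, h1, -⟩ := hd r (interior_subset hr)
      exact h1.differentiableAt.differentiableWithinAt
    · obtain ⟨d, h1, h2⟩ := hd r (interior_subset hr)
      rwa [h1.deriv]
  have hs := left_mem_Icc.2 hss
  have hs' := right_mem_Icc.2 hss
  have h3 := hanti hs hs' hss
  simp only [hF, sub_self, mul_zero, exp_zero, one_mul] at h3
  have h4 := mul_nonneg hB.le (hX s' hs').2.1
  have h5 := mul_le_left (hX s hs).2.2.1 hB.le
  have h6 := mul_le_right (exp_le_exp.2 hη1) (hJ0 s)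
  have e : exp 1 * (sqDil W δ s + 2 * C / (η * δ^n)) =
      exp 1 * sqDil W δ s + B * C := by simp only [B]; ring
  rw [e]; linarith

theorem powInt_ge (hp : 1 < p) (h0 : 0 < δ) (h1 : δ ≤ 1) (hθ : 0 ≤ θ) (hs : s ∈ I) :
    δ^n * (θ^(p - 1) * (sqDil W δ s - θ^2)) ≤ powInt p W s := by
  obtain ⟨i1, e1⟩ := int_dilate_le (fun y => rpow_nonneg (abs_nonneg (W y s)) (p + 1))
    ((h.cont hs).abs.rpow_const fun _ => Or.inr (by linarith)) (h.int_pow hp hs) h0 h1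
  obtain ⟨i2, -⟩ := int_dilate_le (fun y => sq_nonneg (W y s)) ((h.cont hs).pow 2)
      (h.int_sq hs) h0 h1
  refine (mul_le_left ?_ (pow_pos h0 n).le).trans e1
  obtain ⟨i3, e3⟩ := int_rho_affine i2 (θ^(p - 1)) (-(θ^(p - 1) * θ^2))
  have := int_rho_mono i3 i1 fun y => ?_
  · rw [e3] at this
    rw [sqDil]; linarith
  · rw [← abs_rpow_mul_sq hp]
    have : 0 ≤ (|W (δ • y) s|^(p - 1) - θ^(p - 1)) * (W (δ • y) s^2 - θ^2) := by
      rw [← sq_abs (W (δ • y) s)]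
      rcases le_total θ |W (δ • y) s| with h | h
      · exact mul_nonneg (sub_nonneg.2 (rpow_le_rpow hθ h (by linarith)))
          (sub_nonneg.2 (pow_le_pow_left₀ hθ h 2))
      · exact mul_nonneg_of_nonpos_of_nonpos
          (sub_nonpos.2 (rpow_le_rpow (abs_nonneg _) h (by linarith)))
          (sub_nonpos.2 (pow_le_pow_left₀ (abs_nonneg _) h 2))
    have : 0 ≤ |W (δ • y) s|^(p - 1) * θ^2 := by positivity
    linarith

end Flow

theorem wSelf_neg_log {v : ℝ} (hv : 0 < v) (T') (c y : EE n) :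
    wSelf n p T' u c y (-log v) = v^(1 / (p - 1)) * u (c + √v • y) (T' - v) := by
  rw [wSelf, neg_neg, exp_log hv, sqrt_eq_rpow, rpow_def_of_pos hv, rpow_def_of_pos hv]
  congr 3
  · ring
  · ring

/-- Gaussian mean of `u²` at scale `r` -/
def sqMass (u : EE n → ℝ → ℝ) (c : EE n) (r t : ℝ) : ℝ :=
  ∫ y, u (c + r • y) t^2 * rho n y

theorem sqDil_neg_log {v : ℝ} (hv : 0 < v) (T' δ) (c : EE n) :
    sqDil (wSelf n p T' u c) δ (-log v) =
      v^(2 / (p - 1)) * sqMass u c (√v * δ) (T' - v) := by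
  rw [sqDil, sqMass, ← integral_const_mul]
  congr 1
  ext y
  rw [wSelf_neg_log hv, smul_smul, mul_pow, ← rpow_natCast _, ← rpow_mul hv.le, ← mul_assoc]
  congr 3
  ring

theorem exists_sqMass_ge (hp : 1 < p) (ha : 0 < a) (hu : SolvesU n p a μ T u) :
    ∃ c, 0 < c ∧ ∀ (x) (t M), 0 < M → t < T → 0 < t - M^(-(p - 1)) →
      (∀ y, ∀ t' ∈ Ioc 0 t, |u y t'| ≤ M) → M / 2 ≤ |u x t| →
      c * M^2 ≤ sqMass u x (√(M^(-(p - 1)))) (t - M^(-(p - 1))) := by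
  obtain ⟨C, hC, hg⟩ := exists_gf_le hp ha
  refine ⟨exp (-C)^2 / 4, by positivity, fun x t M hM htT ht hub hux => ?_⟩
  set v := M^(-(p - 1))
  have hv : 0 < v := rpow_pos_of_pos hM _
  obtain ⟨K, hK⟩ := exists_rsol hp ha hu (α := (t - v) / 2) (β := (t + T) / 2)
    (by linarith) (by linarith)
  have h1 := (hK.toPSol_gf hp).heat_bound (x := x) (t0 := t - v) (t := t) (by linarith)
    (by linarith) (by linarith) (A := C * M^(p - 1)) (by positivity)
    le_rfl continuous_const (Gr.const 0) (fun y t' ht' => ?_) (fun r _ _ => by simp)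
  · rw [show t - (t - v) = v by ring, mul_assoc C, (show M^(p - 1) * v = 1 by rw [← rpow_add hM]; simp), mul_one, mul_zero, add_zero] at h1
    have ht' : t - v ∈ Ioo ((t - v) / 2) ((t + T) / 2) := ⟨by linarith, by linarith⟩
    have cu : Continuous fun y => u (x + √v • y) (t - v) :=
      (hK.c2 _ ht').continuous.comp (by fun_prop)
    have gu : Gr1 fun y => u (x + √v • y) _ := Gr.of_bdd fun _ _ y => (fun y => hK.bu _ _ ht') y
    have h2 := sq_int_rho_le (Gr1.int gu.abs cu.abs)
      (Gr1.int (gu.abs.pow 2) (cu.abs.pow 2))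
    simp [sq_abs] at h2
    refine le_trans ?_ h2
    have h3 : exp (-C) * (M / 2) ≤ ∫ y, |u (x + √v • y) (t - v)| * rho n y := by
      have := mul_le_left (hux.trans h1) (exp_pos (-C)).le
      rwa [← mul_assoc, ← exp_add, neg_add_cancel, exp_zero, one_mul] at this
    calc _ = (exp (-C) * (M / 2))^2 := by ring
      _ ≤ _ := pow_le_pow_left₀ (by positivity) h3 2
  · rw [add_zero]
    refine (hg _).1.trans ?_
    rw [← abs_rpow_mul_self hp, ← mul_assoc]
    refine mul_le_right (mul_le_left ?_ hC.le) (abs_nonneg _)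
    exact rpow_le_rpow (abs_nonneg _) (hub y t' ⟨by linarith [ht'.1], ht'.2.le⟩) (by linarith)

theorem subcritical (hp : 1 < p) (hpS : 3 ≤ n → p < (n + 2) / (n - 2)) :
    0 < 1 + 2 / (p - 1) - n / 2 := by
  have h0 : 0 < 2 / (p - 1) := by positivity
  rcases Nat.lt_or_ge n 3 with h | h
  · have : (n : ℝ) ≤ 2 := by exact_mod_cast Nat.lt_succ_iff.1 h
    linarith
  · have h3 : (3 : ℝ) ≤ n := by exact_mod_cast h
    have h4 := hpS h
    rw [lt_div_iff₀ (by linarith)] at h4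
    have : (n - 2) / 2 < 2 / (p - 1) := by rw [lt_div_iff₀ (sub_pos.2 hp)]; nlinarith
    linarith

set_option maxHeartbeats 1600000 in
theorem exists_typeI_core (hp : 1 < p) (ha : 0 < a) (hT : 0 < T) (hu : SolvesU n p a μ T u)
    (hpS : 3 ≤ n → p < ((n : ℝ) + 2) / ((n : ℝ) - 2)) :
    ∃ ρ1 N t0 : ℝ, 1 ≤ ρ1 ∧ 0 < N ∧ 0 < t0 ∧ t0 < T ∧ ∀ (x : EE n) (t M : ℝ), N ≤ M → t0 ≤ t →
      (∀ y, ∀ t' ∈ Ioc 0 t, |u y t'| ≤ M) → M / 2 ≤ |u x t| →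
      T - t ≤ M^(-(p - 1)) * ρ1 := by
  have hp1 := sub_pos.2 hp
  have hm := subcritical hp hpS
  set m := 1 + 2 / (p - 1) - (n : ℝ) / 2
  set q := 2 / (p - 1)
  obtain ⟨s0, C, hs0, hC, hτ, hL⟩ := exists_lyapunov hp ha hT hu
  obtain ⟨c0, hc0, hmass⟩ := exists_sqMass_ge hp ha hu
  set c2 := c0 / (2 * exp 1) * 2^(-q)
  have hc2 : 0 < c2 := by positivity
  set c3 := (2 : ℝ)^(-(n : ℝ) / 2) * (c2 / 2)^((p + 1) / 2)
  have hc3 : 0 < c3 := by positivity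
  -- the window length parameter
  obtain ⟨r, hr1, hr2⟩ : ∃ r : ℝ, 3 ≤ r ∧ C * (1 + 3 * C) < c3 * r^m := by
    have := (tendsto_rpow_atTop hm).const_mul_atTop hc3
    exact ((eventually_ge_atTop 3).and (this.eventually_gt_atTop _)).exists
  obtain ⟨ρ1, hρ1, hρ2⟩ : ∃ ρ1 : ℝ, r ≤ ρ1 ∧ 8 * exp 1 * C * r * (ρ1 + 1)^(-m) ≤ c0 := by
    have h1 : Tendsto (fun x : ℝ => 8 * exp 1 * C * r * (x + 1)^(-m)) atTop
        (𝓝 (8 * exp 1 * C * r * 0)) :=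
      ((tendsto_rpow_neg_atTop hm).comp (tendsto_atTop_add_const_right _ 1 tendsto_id)).const_mul _
    rw [mul_zero] at h1
    exact ((eventually_ge_atTop r).and (h1.eventually_le_const hc0)).exists
  have hτ0 := exp_pos (-s0)
  obtain ⟨N, hN1, hN2⟩ : ∃ N : ℝ, 1 ≤ N ∧ N^(-(p - 1)) * (2 * ρ1) ≤ exp (-s0) := by
    have h1 := (tendsto_rpow_neg_atTop hp1).mul_const (2 * ρ1)
    rw [zero_mul] at h1
    exact ((eventually_ge_atTop 1).and (h1.eventually_le_const hτ0)).exists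
  refine ⟨ρ1, N, T - exp (-s0), by linarith, by linarith, by linarith, by linarith,
    fun x t M hNM ht hub hux => ?_⟩
  by_contra hcon
  push Not at hcon
  have hM : 0 < M := by linarith
  set v := M^(-(p - 1))
  have hv : 0 < v := rpow_pos_of_pos hM _
  have hvq : v^q = (M^2)⁻¹ := by
    rw [← rpow_mul hM.le, show -(p - 1) * q = -2 by simp only [q]; field_simp, rpow_neg hM.le, rpow_two]
  have hvτ : v * (2 * ρ1) ≤ exp (-s0) := hN2.trans' <|
    mul_le_right (rpow_le_rpow_of_nonpos (by linarith) hNM (by linarith)) (by linarith)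
  have hvr : v * r ≤ v * ρ1 := mul_le_left hρ1 hv.le
  have hv3 : v * 3 ≤ v * r := mul_le_left hr1 hv.le
  have hsw : ∀ w, 0 < w → w ≤ exp (-s0) → s0 ≤ -log w := fun w h1 h2 => by
    have := log_le_log h1 h2
    rw [log_exp] at this; linarith
  have hlow : c0 * M^2 ≤ sqMass u x (√v) (t - v) :=
    hmass x t M hM (by linarith) (by change 0 < t - v; linarith) hub hux
  have hr0 : 0 < r := by linarith
  have hρ : 0 < ρ1 := by linarith
  have hρ0 : 0 < ρ1 + 1 := by linarith
  have hspread : ∀ σ, 1 ≤ σ → σ ≤ r →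
      c2 * M^2 ≤ sqMass u x (√(v * ((ρ1 + σ) / (ρ1 + 1)))) (t - v * σ) := fun σ hσ1 hσ2 => by
    obtain ⟨X, X', hX⟩ := hL x (t + v * ρ1) (by linarith) (by linarith)
    obtain ⟨I, hI, hsub, hF, -⟩ := exists_flow hp ha hu (s0 := s0) (T' := t + v * ρ1)
      (by linarith) (by linarith) x
    have hv1 : 0 < v * (ρ1 + 1) := by positivity
    have hvσ : 0 < v * (ρ1 + σ) := by positivity
    set δ := √(1 / (ρ1 + 1))
    have hδ0 : 0 < δ := by positivity
    have hδ1 : δ ≤ 1 := sqrt_le_one.2 (by rw [div_le_one hρ0]; linarith)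
    have hs : s0 ≤ -log (v * (ρ1 + σ)) := hsw _ hvσ (le_trans (by nlinarith) hvτ)
    have hlog : ρ1 / r * (-log (v * (ρ1 + 1)) - -log (v * (ρ1 + σ))) ≤ 1 := by
      rw [neg_sub_neg, ← log_div hvσ.ne' hv1.ne']
      have h1 := log_le_sub_one_of_pos (div_pos hvσ hv1)
      have h2 : v * (ρ1 + σ) / (v * (ρ1 + 1)) - 1 ≤ r / ρ1 := by
        rw [mul_div_mul_left _ _ hv.ne', div_sub_one hρ0.ne', div_le_div_iff₀ hρ0 hρ]
        nlinarith
      refine (mul_le_left (h1.trans h2) (by positivity)).trans_eq ?_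
      field_simp
    have key := hF.sqDil_le hI hδ0 hδ1 (by positivity : 0 < ρ1 / r)
      (neg_le_neg (log_le_log hv1 (by nlinarith))) hlog (fun s h => hsub (hs.trans h.1)) fun s h =>
        have k := hX s (hs.trans h.1)
        ⟨k.1, k.2.1, k.2.2.1, k.2.2.2.1⟩
    rw [sqDil_neg_log hv1, sqDil_neg_log hvσ] at key
    change (v * (ρ1 + 1))^q * _ ≤ exp 1 * ((v * (ρ1 + σ))^q * _ + _) at key
    have e1 : √(v * (ρ1 + 1)) * δ = √v := by rw [← sqrt_mul hv1.le]; congr 1; field_simp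
    set k := (ρ1 + σ) / (ρ1 + 1)
    have e2 : √(v * (ρ1 + σ)) * δ = √(v * k) := by rw [← sqrt_mul hvσ.le]; congr 1; ring
    rw [e1, e2, show t + v * ρ1 - v * (ρ1 + 1) = t - v by ring,
      show t + v * ρ1 - v * (ρ1 + σ) = t - v * σ by ring, mul_rpow hv.le hρ0.le,
      mul_rpow hv.le (by linarith), hvq] at key
    set Q := sqMass u x (√(v * k)) (t - v * σ)
    have hQ : 0 ≤ Q := int_rho_nonneg fun y => sq_nonneg _
    have k1 : c0 * (ρ1 + 1)^q ≤ (M^2)⁻¹ * (ρ1 + 1)^q * sqMass u x (√v) (t - v) := by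
      refine (mul_le_left hlow (by positivity)).trans_eq' ?_
      field_simp
    have k2 : (ρ1 + σ)^q ≤ 2^q * (ρ1 + 1)^q := by
      rw [← mul_rpow (by norm_num) hρ0.le]
      exact rpow_le_rpow (by linarith) (by linarith) (by positivity)
    have k3 : 2 * C / (ρ1 / r * δ^n) * exp 1 ≤ c0 / 2 * (ρ1 + 1)^q := by
      have hδn : δ^n = (ρ1 + 1)^(-(n : ℝ) / 2) := by
        simp only [δ, sqrt_eq_rpow, one_div, inv_rpow hρ0.le, ← rpow_neg hρ0.le, ← rpow_mul_natCast hρ0.le]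
        congr 1; ring
      have h1 : (ρ1 + 1)^(-m) * ((ρ1 + 1) * (ρ1 + 1)^q * (ρ1 + 1)^(-(n : ℝ) / 2)) = 1 := by
        rw [← rpow_one_add' hρ0.le (by positivity), ← rpow_add hρ0, ← rpow_add hρ0,
          show -m + (1 + q + -(n : ℝ) / 2) = 0 by ring, rpow_zero]
      rw [← hδn] at h1
      rw [div_mul_eq_mul_div, div_le_iff₀ (by positivity)]
      have h2 := mul_le_right hρ2
        (show 0 ≤ (ρ1 + 1) * (ρ1 + 1)^q * δ^n by positivity)
      rw [mul_assoc (8 * exp 1 * C * r), h1, mul_one] at h2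
      rw [show c0 / 2 * (ρ1 + 1)^q * (ρ1 / r * δ^n) =
        c0 * (2 * ρ1 * (ρ1 + 1)^q * δ^n) / (4 * r) by field_simp; ring, le_div_iff₀ (by positivity)]
      have h4 : c0 * ((ρ1 + 1) * (ρ1 + 1)^q * δ^n) ≤ c0 * (2 * ρ1 * (ρ1 + 1)^q * δ^n) := by
        gcongr; linarith
      linarith
    have h5 : (M^2)⁻¹ * (ρ1 + σ)^q * Q ≤ (M^2)⁻¹ * (2^q * (ρ1 + 1)^q) * Q := by gcongr
    have h6 := mul_le_left h5 (exp_pos 1).le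
    have k5 : c0 / 2 ≤ exp 1 * ((M^2)⁻¹ * 2^q * Q) :=
      le_of_mul_le_mul_right (by linarith [k1.trans key]) (rpow_pos_of_pos hρ0 q)
    refine ((mul_le_right k5 (by positivity)).trans_eq' ?_).trans_eq
      (b := exp 1 * ((M^2)⁻¹ * 2^q * Q) * (M^2 / (exp 1 * 2^q))) ?_
    · simp only [c2]; rw [rpow_neg (by norm_num)]; field_simp
    · field_simp
  -- growth in the variables centred at `t + v r`
  obtain ⟨X, X', hX⟩ := hL x (t + v * r) (by linarith) (by linarith)
  obtain ⟨I, hI, hsub, hF, -⟩ := exists_flow hp ha hu (s0 := s0) (T' := t + v * r)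
    (by linarith) (by linarith) x
  have hgrow : ∀ σ, 1 ≤ σ → σ ≤ r → C * (1 + 3 * C) <
      powInt p (wSelf n p (t + v * r) u x) (-log (v * (r + σ))) := fun σ hσ1 hσ2 => by
    have hvσ : 0 < v * (r + σ) := by positivity
    have hs : s0 ≤ -log (v * (r + σ)) := hsw _ hvσ (le_trans (by nlinarith) hvτ)
    set k := (ρ1 + σ) / (ρ1 + 1)
    have hk1 : 1 ≤ k := by rw [le_div_iff₀ hρ0]; linarith
    have hk2 : k ≤ 2 := by rw [div_le_iff₀ hρ0]; linarith
    set δ := √(k / (r + σ))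
    have hδ0 : 0 < δ := by positivity
    have hδ1 : δ ≤ 1 := sqrt_le_one.2 (by rw [div_le_one (by positivity)]; linarith)
    set θ := √(c2 * r^q / 2)
    have hrq : 0 < r^q := rpow_pos_of_pos hr0 _
    have hθ2 : θ^2 = c2 * r^q / 2 := sq_sqrt (by positivity)
    have hθ0 : 0 < θ := by positivity
    have key := hF.powInt_ge hp hδ0 hδ1 hθ0.le (hsub hs)
    have e2 : √(v * (r + σ)) * δ = √(v * k) := by rw [← sqrt_mul hvσ.le]; congr 1; field_simp
    rw [sqDil_neg_log hvσ, e2, show t + v * r - v * (r + σ) = t - v * σ by ring,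
      mul_rpow hv.le (by linarith), hvq] at key
    have k1 : c2 * r^q ≤ (M^2)⁻¹ * (r + σ)^q * sqMass u x (√(v * k)) (t - v * σ) := by
      have h1 : r^q ≤ (r + σ)^q := rpow_le_rpow hr0.le (by linarith) (by positivity)
      calc c2 * r^q = (M^2)⁻¹ * r^q * (c2 * M^2) := by field_simp
        _ ≤ _ := mul_le_mul (by gcongr) (hspread σ hσ1 hσ2) (by positivity) (by positivity)
    have k2 : (2 * r)^(-(n : ℝ) / 2) ≤ δ^n := by
      have h1 : √(1 / (2 * r)) ≤ δ := sqrt_le_sqrt (by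
        rw [div_le_div_iff₀ (by linarith) (by linarith)]; nlinarith)
      refine (pow_le_pow_left₀ (sqrt_nonneg _) h1 n).trans_eq' ?_
      rw [sqrt_eq_rpow, one_div (2 * r), inv_rpow, ← rpow_neg, ← rpow_mul_natCast] <;> try positivity
      congr 1; ring
    refine hr2.trans_le (le_trans ?_ key)
    calc c3 * r^m = (2 * r)^(-(n : ℝ) / 2) * (θ^(p - 1) * θ^2) := by
          rw [← rpow_two, ← rpow_add hθ0, show θ = (c2 / 2 * r^q)^(1 / 2 : ℝ) by
            simp only [θ]; rw [sqrt_eq_rpow]; congr 1; ring, ← rpow_mul (by positivity),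
            mul_rpow (by positivity) hrq.le, mul_rpow (by norm_num) hr0.le, ← rpow_mul hr0.le,
            show 1 / 2 * (p - 1 + 2) = (p + 1) / 2 by ring,
            show m = -(n : ℝ) / 2 + q * ((p + 1) / 2) by
              simp only [q, m]; field_simp; ring, rpow_add hr0]
          simp only [c3]
          ring
      _ ≤ _ := by
          rw [hθ2]
          gcongr
          linarith
  set A := -log (v * (r + r))
  set B := -log (v * (r + 1))
  have hAB : 1 / 3 < B - A := by
    have e : B - A = -log ((r + 1) / (2 * r)) := by
      rw [show (r + 1) / (2 * r) = v * (r + 1) / (v * (r + r)) by field_simp; ring, log_div] <;> grind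
    have h1 : 1 / 3 ≤ 1 - (r + 1) / (2 * r) := by
      rw [le_sub_iff_add_le, ← le_sub_iff_add_le', div_le_iff₀ (by linarith)]; linarith
    have h2 : (r + 1) / (2 * r) ≠ 1 := by intro h; rw [h] at h1; norm_num at h1
    have := log_lt_sub_one_of_pos (by positivity) h2
    linarith
  have hA : s0 ≤ A := hsw _ (by positivity) (le_trans (by nlinarith) hvτ)
  obtain ⟨s, hs, hsX⟩ := exists_hasDerivAt_eq_slope X X' (by linarith : A < B)
    (fun s hs => (hX s (hA.trans hs.1)).1.continuousAt.continuousWithinAt)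
    (fun s hs => (hX s (hA.trans hs.1.le)).1)
  obtain ⟨-, -, -, -, hP⟩ := hX s (hA.trans hs.1.le)
  have hexp : v * (r + (exp (-s) / v - r)) = exp (-s) := by field_simp; ring
  have hes1 : exp (-s) < v * (r + r) := by rw [← lt_log_iff_exp_lt (by positivity)]; linarith [hs.1]
  have hes2 : v * (r + 1) < exp (-s) := by rw [← log_lt_iff_lt_exp (by positivity)]; linarith [hs.2]
  have hg := hgrow (exp (-s) / v - r)
    (by rw [le_sub_iff_add_le, le_div_iff₀ hv]; linarith)
    (by rw [sub_le_iff_le_add, div_le_iff₀ hv]; linarith)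
  rw [hexp, log_exp, neg_neg] at hg
  have hX'3 : -X' s ≤ 3 * C := by
    rw [hsX, ← neg_div, div_le_iff₀ (by linarith)]
    have h1 := (hX A hA).2.2.1
    have h2 := (hX B (by linarith)).2.1
    nlinarith
  have := mul_le_left (show 1 - X' s ≤ 1 + 3 * C by linarith) hC.le
  linarith

theorem exists_typeI (hp : 1 < p) (ha : 0 < a) (hT : 0 < T) (hu : SolvesU n p a μ T u)
    (hpS : 3 ≤ n → p < ((n : ℝ) + 2) / ((n : ℝ) - 2)) :
    ∃ M s0 : ℝ, 0 < M ∧ ∀ s, s0 ≤ s → ∀ b y, |wSelf n p T u b y s| ≤ M := by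
  have hp1 := sub_pos.2 hp
  obtain ⟨ρ1, N, t0, hρ, hN, ht0, ht0T, H⟩ := exists_typeI_core hp ha hT hu hpS
  obtain ⟨-, -, -, hbd, -⟩ := hu
  obtain ⟨M0, hM0⟩ := hbd t0 ⟨ht0.le, ht0T⟩
  have hM00 := (abs_nonneg _).trans (hM0 0 0 ⟨le_rfl, ht0.le⟩)
  have key : ∀ x, ∀ t ∈ Ico t0 T, N + 2 * M0 < |u x t| →
      T - t ≤ |u x t|^(-(p - 1)) * ρ1 := fun x t ht hx => by
    obtain ⟨K, hK⟩ := hbd t ⟨ht0.le.trans ht.1, ht.2⟩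
    set A := {z | ∃ y, ∃ t' ∈ Ioc 0 t, z = |u y t'|}
    have hA : BddAbove A := ⟨K, by rintro _ ⟨y, t', ht', rfl⟩; exact hK y t' ⟨ht'.1.le, ht'.2⟩⟩
    have hxA : |u x t| ∈ A := ⟨x, t, ⟨ht0.trans_le ht.1, le_rfl⟩, rfl⟩
    have hS := le_csSup hA hxA
    obtain ⟨_, ⟨y, t', ht', rfl⟩, hy⟩ := exists_lt_of_lt_csSup ⟨_, hxA⟩
      (show sSup A / 2 < sSup A by linarith)
    have htt : t0 ≤ t' := by
      by_contra h
      have := hM0 y t' ⟨ht'.1.le, (not_le.1 h).le⟩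
      linarith
    have h1 := H y t' (sSup A) (by linarith) htt
      (fun z τ hτ => le_csSup hA ⟨z, τ, ⟨hτ.1, hτ.2.trans ht'.2⟩, rfl⟩) hy.le
    have h2 := rpow_le_rpow_of_nonpos (by linarith) hS
      (show -(p - 1) ≤ 0 by linarith)
    have := mul_le_right h2 (show 0 ≤ ρ1 by linarith)
    linarith [ht'.2]
  refine ⟨ρ1^(1 / (p - 1)) + T^(1 / (p - 1)) * (N + 2 * M0), -log (T - t0), by positivity,
    fun s hs b y => ?_⟩
  have h1 : exp (-s) ≤ T - t0 := by rw [← le_log_iff_exp_le (by linarith)]; linarith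
  set v := exp (-s)
  have hv : 0 < v := exp_pos _
  rw [wSelf, show -s / (p - 1) = -s * (1 / (p - 1)) by ring, exp_mul, abs_mul,
    abs_of_pos (rpow_pos_of_pos hv _)]
  set x := b + exp (-s / 2) • y
  have hA : 0 ≤ T^(1 / (p - 1)) * (N + 2 * M0) := by positivity
  have hB : 0 ≤ ρ1^(1 / (p - 1)) := by positivity
  rcases le_or_gt |u x (T - v)| (N + 2 * M0) with h | h
  · have := mul_le_mul (rpow_le_rpow hv.le (show v ≤ T by linarith) (by positivity : 0 ≤ 1 / (p - 1)))
      h (abs_nonneg _) (by positivity)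
    linarith
  · have h2 := key x (T - v) ⟨by linarith, by linarith⟩ h
    set U := |u x (T - v)|
    have hU : 0 < U := by linarith
    have h3 := rpow_le_rpow hv.le (show v ≤ U^(-(p - 1)) * ρ1 by linarith)
      (by positivity : 0 ≤ 1 / (p - 1))
    rw [mul_rpow (by positivity) (by linarith), ← rpow_mul hU.le,
      show -(p - 1) * (1 / (p - 1)) = -1 by field_simp, rpow_neg_one] at h3
    have h4 := mul_le_right h3 hU.le
    have h5 : U⁻¹ * ρ1^(1 / (p - 1)) * U = ρ1^(1 / (p - 1)) := by field_simp
    linarith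

theorem deriv2_nonneg_of_isLocalMin {f f' : ℝ → ℝ} {f'' : ℝ} {x : ℝ} (hf : ∀ t, HasDerivAt f (f' t) t)
    (hf' : HasDerivAt f' f'' x) (h : IsLocalMin f x) : 0 ≤ f'' := by
  have e : deriv f = f' := funext fun t => (hf t).deriv
  by_contra hn
  have h2 : IsLocalMin (fun t => - f t) x := by
    refine isLocalMin_of_deriv_deriv_pos ?_ ?_ (hf x).continuousAt.neg
    · rw [deriv.fun_neg', e, deriv.fun_neg, hf'.deriv]; linarith
    · rw [deriv.fun_neg, e, h.hasDerivAt_eq_zero (hf x), neg_zero]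
  have h3 : f =ᶠ[𝓝 x] fun _ => f x := by
    filter_upwards [h, h2] with t h3 h4
    linarith
  have h4 : f' =ᶠ[𝓝 x] fun _ => 0 := by
    have := h3.eventuallyEq_nhds
    filter_upwards [this] with t ht
    have := ht.deriv_eq
    rwa [e, deriv_const] at this
  have := h4.deriv_eq
  rw [hf'.deriv, deriv_const] at this
  exact hn this.ge

theorem OU_nonneg_of_min (hf : ContDiff ℝ 2 f) {y : EE n} (h : ∀ z, f y ≤ f z) :
    0 ≤ OU f y := by
  have hd := hf.differentiable (by norm_num)
  have hl : ∀ i, IsLocalMin (fun t : ℝ => f (y + t • single i 1)) 0 := fun i =>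
    Eventually.of_forall fun t => by simpa using h _
  rw [OU, lap_eq]
  simp only [(fun i => by
    simpa using (hl i).hasDerivAt_eq_zero (pd_line 0 (hd _))), mul_zero, Finset.sum_const_zero, sub_zero]
  exact Finset.sum_nonneg fun i _ => (fun i => by
    simpa using deriv2_nonneg_of_isLocalMin (fun t => pd_line t (hd _))
      (pd_line 0 (pd_differentiable hf _)) (hl i) : ∀ i, 0 ≤ pd i (pd i f) y) i

theorem OU_add (hf : ContDiff ℝ 2 f) (hg : ContDiff ℝ 2 g) (y) :
    OU (fun y => f y + g y) y = OU f y + OU g y := by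
  rw [OU, lap_add hf hg, OU, OU]
  simp only [pd_add (hf.differentiable (by norm_num) y) (hg.differentiable (by norm_num) y),
    mul_add, Finset.sum_add_distrib]
  ring

/-- strict positivity is preserved as long as `D` can only vanish where its source is positive -/
theorem pos_of_source_pos {D G : EE n → ℝ → ℝ}
    (hc : ContinuousOn (fun q => D q.1 q.2) (univ ×ˢ Icc α β))
    (h2 : ∀ s ∈ Icc α β, ContDiff ℝ 2 (fun y => D y s))
    (hd : ∀ y, ∀ s ∈ Icc α β, HasDerivAt (D y) (OU (fun y => D y s) y + G y s) s)
    (h0 : ∀ y, 0 < D y α) {r : ℝ} (hb : ∀ y, ∀ s ∈ Icc α β, D y s ≤ 0 → ‖y‖ ≤ r)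
    (hG : ∀ y, ∀ s ∈ Icc α β, D y s = 0 → 0 < G y s) :
    ∀ y, ∀ s ∈ Icc α β, 0 < D y s := by
  by_contra! hcon
  obtain ⟨y1, s1, hs1, hy1⟩ := hcon
  set B := {q : EE n × ℝ | q ∈ univ ×ˢ Icc α β ∧ D q.1 q.2 ≤ 0}
  have hBk : IsCompact B := by
    refine ((isCompact_closedBall 0 r).prod (isCompact_Icc)).of_isClosed_subset
      (hc.preimage_isClosed_of_isClosed (isClosed_univ.prod isClosed_Icc) isClosed_Iic) fun q hq => ⟨?_, hq.1.2⟩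
    simpa using hb _ _ hq.1.2 hq.2
  obtain ⟨⟨y, s⟩, ⟨⟨-, hs⟩, hy⟩, hmin⟩ := hBk.exists_isMinOn ⟨(y1, s1), ⟨trivial, hs1⟩, hy1⟩
    continuous_snd.continuousOn
  have hpos : ∀ z, ∀ t ∈ Ico α s, 0 < D z t := fun z t ht => by
    by_contra hn
    have := hmin (show (z, t) ∈ B from ⟨⟨trivial, ht.1, ht.2.le.trans hs.2⟩, not_lt.1 hn⟩)
    exact absurd ht.2 (not_lt.2 this)
  have hαs := lt_of_le_of_ne hs.1 fun e => by
    subst e; exact absurd (h0 y) (not_lt.2 hy)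
  have hnn : ∀ z, 0 ≤ D z s := fun z => by
    refine ge_of_tendsto ((hd z s hs).continuousAt.tendsto.mono_left
      (nhdsWithin_le_nhds (s := Iio s))) ?_
    filter_upwards [Ioo_mem_nhdsLT hαs] with t ht
    exact (hpos z t ⟨ht.1.le, ht.2⟩).le
  have hy0 := le_antisymm hy (hnn y)
  have hOU := OU_nonneg_of_min (h2 s hs) fun z => by rw [hy0]; exact hnn z
  have hg := hG y s hs hy0
  have hle : OU (fun y => D y s) y + G y s ≤ 0 := by
    refine le_of_tendsto ((hasDerivAt_iff_tendsto_slope.1 (hd y s hs)).mono_left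
      (nhdsWithin_mono s (show Iio s ⊆ {s}ᶜ from fun t ht => ne_of_lt ht))) ?_
    filter_upwards [Ioo_mem_nhdsLT hαs] with t ht
    rw [slope_def_field, hy0]
    exact div_nonpos_of_nonneg_of_nonpos (by linarith [hpos y t ⟨ht.1.le, ht.2⟩]) (by linarith [ht.2])
  linarith

theorem exists_mf_scaled (hp : 1 < p) (ha : 0 < a) : ∃ C, 0 < C ∧ ∀ s w : ℝ, 0 < s →
    exp (-(1 / (2 * (p - 1))) * s) ≤ |w| →
    |mf a μ (exp (1 / (p - 1) * s) * w) - 1| ≤ C * s^(-a) ∧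
    |exp (1 / (p - 1) * s) * w * mf' a μ (exp (1 / (p - 1) * s) * w)| ≤
      C * s^(-a - 1) := by
  refine ⟨1 + |μ| * (1 / (p - 1))^(-a) + 2 * a * |μ| * (1 / (p - 1))^(-a - 1), by positivity,
    fun s w hs hw => ?_⟩
  have hζ : exp (1 / (2 * (p - 1)) * s) ≤ |exp (1 / (p - 1) * s) * w| := by
    rw [abs_mul, abs_of_pos (exp_pos _)]
    refine le_trans (le_of_eq ?_) (mul_le_left hw (exp_pos _).le)
    rw [← exp_add]; field_simp; ring
  have hL' : 1 / (p - 1) * s ≤ log _ :=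
    le_trans (le_of_eq (by field_simp)) (log_ge_of_exp_le hζ)
  have h0 : 0 < 1 / (p - 1) * s := by positivity
  constructor
  · rw [abs_mf_sub_one]
    have := rpow_le_rpow_of_nonpos h0 hL' (show -a ≤ 0 by linarith)
    rw [mul_rpow (by positivity) hs.le] at this
    have := mul_le_left this (abs_nonneg μ)
    have h3 : 0 ≤ (1 + 2 * a * |μ| * (1 / (p - 1))^(-a - 1)) * s^(-a) := by positivity
    linarith
  · refine (abs_mul_mf' ha _).trans ?_
    have := rpow_le_rpow_of_nonpos h0 hL' (show -a - 1 ≤ 0 by linarith)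
    rw [mul_rpow (by positivity) hs.le] at this
    have := mul_le_left this (by positivity : 0 ≤ 2 * a * |μ|)
    have h3 : 0 ≤ (1 + |μ| * (1 / (p - 1))^(-a)) * s^(-a - 1) := by positivity
    linarith

theorem eventually_exp_neg_le {c : ℝ} (hc : 0 < c) (b : ℝ) {K : ℝ} (hK : 0 < K) :
    ∀ᶠ s : ℝ in atTop, K * exp (-c * s) ≤ s^(-b) := by
  have := (tendsto_rpow_mul_exp_neg_mul_atTop_nhds_zero b c hc).eventually_le_const
    (show 0 < K⁻¹ by positivity)
  filter_upwards [this, eventually_gt_atTop 0] with s h1 h2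
  rw [rpow_neg h2.le, ← one_div, le_div_iff₀ (rpow_pos_of_pos h2 b)]
  calc _ = K * (s^b * exp _) := by ring
    _ ≤ K * K⁻¹ := mul_le_left h1 hK.le
    _ = 1 := mul_inv_cancel₀ hK.ne'

/-- sharp Lipschitz constant of the rescaled nonlinearity -/
theorem exists_gh_sub_le (hp : 1 < p) (ha : 0 < a) {B : ℝ} (hB : 0 < B) :
    ∃ C s0 : ℝ, 0 < C ∧ 1 ≤ s0 ∧ ∀ s m x y : ℝ, s0 ≤ s → m ≤ B → |x| ≤ m → |y| ≤ m →
      |gh p a μ s x - gh p a μ s y| ≤ (p * m^(p - 1) + C * s^(-a)) * |x - y| := by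
  have hp1 := sub_pos.2 hp
  obtain ⟨C1, hC1, h1⟩ := exists_mf_scaled (μ := μ) hp ha
  obtain ⟨C2, hC2, h2⟩ := exists_gf_le (μ := μ) hp ha
  obtain ⟨s1, hs₁⟩ := eventually_atTop.1 (eventually_exp_neg_le (show (0 : ℝ) < 1 / 2 by norm_num) a
    one_pos)
  have hBp := rpow_pos_of_pos hB (p - 1)
  have key : ∀ s v : ℝ, max 1 s1 ≤ s → |v| ≤ B → exp (-s) *
      |gf' p a μ (exp (1 / (p - 1) * s) * v)| ≤
      p * |v|^(p - 1) + ((p + 1) * C1 * B^(p - 1) + C2) * s^(-a) := fun s v hs hv => by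
    have hs1 : 1 ≤ s := (le_max_left _ _).trans hs
    have hsa := rpow_pos_of_pos (show 0 < s by linarith) (-a)
    set ζ := exp (1 / (p - 1) * s) * v with hζ
    have hsc : exp (-s) * |ζ|^(p - 1) = |v|^(p - 1) := by
      rw [hζ, exp_mul_abs_rpow, ← mul_assoc, ← exp_add,
        show -s + 1 / (p - 1) * (p - 1) * s = 0 by field_simp; ring, exp_zero, one_mul]
    have hvB : |v|^(p - 1) ≤ B^(p - 1) := rpow_le_rpow (abs_nonneg _) hv hp1.le
    have hv0 : 0 ≤ |v|^(p - 1) := rpow_nonneg (abs_nonneg _) _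
    rcases le_or_gt (exp (-(1 / (2 * (p - 1))) * s)) |v| with h | h
    · obtain ⟨k1, k2⟩ := h1 s v (by linarith) h
      rw [← hζ] at k1 k2
      have k3 : s^(-a - 1) ≤ s^(-a) := rpow_le_rpow_of_exponent_le hs1 (by linarith)
      have k4 : |gf' p a μ ζ| ≤ |ζ|^(p - 1) * (p + (p + 1) * C1 * s^(-a)) := by
        have e : gf' p a μ ζ = |ζ|^(p - 1) * (p + p * (mf a μ ζ - 1) + ζ * mf' a μ ζ) := by
          rw [gf']; ring
        rw [e, abs_mul, abs_of_nonneg (rpow_nonneg (abs_nonneg _) _)]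
        refine mul_le_left ?_ (rpow_nonneg (abs_nonneg _) _)
        refine (abs_add_three _ _ _).trans ?_
        rw [abs_mul, abs_of_pos (show 0 < p by linarith)]
        have := mul_le_left k1 (show 0 ≤ p by linarith)
        have := mul_le_left k3 hC1.le
        linarith
      have k5 := mul_le_left k4 (exp_pos (-s)).le
      rw [← mul_assoc, hsc] at k5
      have k6 : |v|^(p - 1) * ((p + 1) * C1 * s^(-a)) ≤
        B^(p - 1) * ((p + 1) * C1 * s^(-a)) := mul_le_right hvB (by positivity)
      nlinarith
    · have k1 : |v|^(p - 1) ≤ s^(-a) := by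
        refine le_trans ?_ (hs₁ s ((le_max_right _ _).trans hs))
        refine (rpow_le_rpow (abs_nonneg _) h.le hp1.le).trans_eq ?_
        rw [← exp_mul, one_mul]; congr 1; field_simp
      have k5 := mul_le_left (h2 ζ).2 (exp_pos (-s)).le
      rw [mul_left_comm, hsc] at k5
      have k6 := mul_le_left k1 hC2.le
      have k7 : 0 ≤ p * |v|^(p - 1) := by positivity
      have k8 : 0 ≤ (p + 1) * C1 * B^(p - 1) * s^(-a) := by positivity
      linarith
  refine ⟨(p + 1) * C1 * B^(p - 1) + C2, max 1 s1, by positivity, le_max_left _ _,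
    fun s m x y hs hm hx hy => ?_⟩
  have h := mvt (convex_Icc (-m) m)
    (f := gh p a μ s) (f' := fun v => exp (-p / (p - 1) * s) *
      (gf' p a μ (exp (1 / (p - 1) * s) * v) * exp (1 / (p - 1) * s)))
    (C := p * m^(p - 1) + ((p + 1) * C1 * B^(p - 1) + C2) * s^(-a))
    (fun v _ => ?_) (fun v hv => ?_) (abs_le.1 hy) (abs_le.1 hx)
  · exact h
  · refine .const_mul _ ?_
    exact (hasDerivAt_gf hp _).comp v (by simpa using (hasDerivAt_id' v).const_mul _)
  · have hv' : |v| ≤ m := abs_le.2 hv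
    rw [abs_mul, abs_mul, abs_of_pos (exp_pos _), abs_of_pos (exp_pos _)]
    have e : exp (-s) = exp (-p / (p - 1) * s) * exp (1 / (p - 1) * s) := by
      rw [← exp_add]; congr 1; field_simp; ring
    have k1 := key s v hs (hv'.trans hm)
    have k2 := mul_le_left (rpow_le_rpow (abs_nonneg _) hv' hp1.le)
      (show 0 ≤ p by linarith)
    calc _ = exp (-s) * |gf' p a μ (exp (1 / (p - 1) * s) * v)| := by rw [e]; ring
      _ ≤ _ := by linarith

theorem hasDerivAt_mf_prof (β ε) {Y : ℝ} (hY : 0 < Y) :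
    HasDerivAt (fun Y => mf a μ (ε * Y^(-β)))
      (-β / Y * (ε * Y^(-β) * mf' a μ (ε * Y^(-β)))) Y := by
  refine ((hasDerivAt_mf _).comp Y (((hasDerivAt_id' Y).rpow_const (p := -β) (Or.inl hY.ne')).const_mul ε)).congr_deriv ?_
  rw [rpow_sub_one hY.ne']
  field_simp

/-- variation of the logarithmic factor along the profile -/
theorem exists_mf_prof_sub_le (hp : 1 < p) (ha : 0 < a) :
    ∃ C s0 : ℝ, 0 < C ∧ 1 ≤ s0 ∧ ∀ s Y1 Y2 : ℝ, s0 ≤ s → (p - 1) / 2 ≤ Y1 → Y1 ≤ 2 * (p - 1) →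
      (p - 1) / 2 ≤ Y2 → Y2^(-(1 / (p - 1)) - 1) *
        |mf a μ (exp (1 / (p - 1) * s) * Y1^(-(1 / (p - 1)))) -
          mf a μ (exp (1 / (p - 1) * s) * Y2^(-(1 / (p - 1))))| ≤
        C * s^(-a - 1) * |Y1 - Y2| := by
  have hp1 := sub_pos.2 hp
  obtain ⟨C1, hC1, h1⟩ := exists_mf_scaled (μ := μ) hp ha
  set β := 1 / (p - 1) with hβ
  have hβ0 : 0 < β := by positivity
  set d := ((p - 1) / 2)^(-β - 1)
  have hd : 0 < d := by positivity
  set D := 1 + |μ| * log 2^(-a)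
  obtain ⟨s1, hs₁⟩ := eventually_atTop.1 (eventually_exp_neg_le (show (0 : ℝ) < 1 / 2 by norm_num)
    (a + 1) (show (0 : ℝ) < 1 + 2 * (p - 1) by linarith))
  have hsm : ∀ s, max 1 s1 ≤ s → 0 < s^(-a - 1) ∧ s^(-a - 1) ≤ 1 ∧
      2 * (p - 1) ≤ exp (s / 2) ∧ 1 ≤ s^(-a - 1) * (exp (s / 2) - 2 * (p - 1)) := fun s hs => by
    have hs1 : 1 ≤ s := (le_max_left _ _).trans hs
    have k0 := rpow_pos_of_pos (show 0 < s by linarith) (-a - 1)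
    have k1 : s^(-a - 1) ≤ 1 := rpow_le_one_of_one_le_of_nonpos hs1 (by linarith)
    have k2 := hs₁ s ((le_max_right _ _).trans hs)
    rw [show -(a + 1) = -a - 1 by ring] at k2
    have k3 : exp (-(1 / 2) * s) * exp (s / 2) = 1 := by
      rw [← exp_add, show -(1/2)*s + s/2 = 0 by ring, exp_zero]
    have k4 := mul_le_right k2 (exp_pos (s / 2)).le
    rw [mul_assoc, k3] at k4
    have k5 := mul_le_right k1 (exp_pos (s / 2)).le
    have k6 := mul_le_right k1 (show 0 ≤ 2 * (p - 1) by linarith)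
    exact ⟨k0, k1, by linarith, by linarith⟩
  refine ⟨d * (β * (2 / (p - 1)) * C1 + 2 * D), max 1 s1, by positivity, le_max_left _ _,
    fun s Y1 Y2 hs l1 u1 l2 => ?_⟩
  obtain ⟨k0, k1, k2, k3⟩ := hsm s hs
  have hs1 : 1 ≤ s := (le_max_left _ _).trans hs
  rw [mul_assoc, mul_assoc]
  refine mul_le_mul (rpow_le_rpow_of_nonpos (by positivity) l2 (by linarith)) ?_ (abs_nonneg _) hd.le
  rcases le_or_gt Y2 (exp (s / 2)) with h | h
  · have hm := mvt (convex_Icc ((p - 1) / 2) (exp (s / 2)))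
      (C := β * (2 / (p - 1)) * C1 * s^(-a - 1))
      (fun Y hY => hasDerivAt_mf_prof (a := a) (μ := μ) β (exp (β * s))
        (show 0 < Y by linarith [hY.1])) (fun Y hY => ?_) ⟨l2, h⟩ ⟨l1, u1.trans k2⟩
    · refine hm.trans ?_
      have : 0 ≤ 2 * D * (s^(-a - 1) * |Y1 - Y2|) := by positivity
      linarith
    · have hY0 : 0 < Y := by linarith [hY.1]
      have hw : exp (-(1 / (2 * (p - 1))) * s) ≤ |Y^(-β)| := by
        rw [abs_of_pos (rpow_pos_of_pos hY0 _)]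
        refine le_trans (le_of_eq ?_) (rpow_le_rpow_of_nonpos hY0 hY.2 (show -β ≤ 0 by linarith))
        rw [← exp_mul]; congr 1; rw [hβ]; field_simp
      have k4 := (h1 s (Y^(-β)) (by linarith) hw).2
      rw [abs_mul, abs_div, abs_neg, abs_of_pos hβ0, abs_of_pos hY0]
      have k5 : β / Y ≤ β * (2 / (p - 1)) := by
        rw [div_le_iff₀ hY0, mul_assoc]
        refine le_mul_of_one_le_right hβ0.le ?_
        rw [div_mul_eq_mul_div, le_div_iff₀ hp1]; linarith [hY.1]
      exact (mul_le_mul k5 k4 (abs_nonneg _) (by positivity)).trans (le_of_eq (by ring))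
  · have h3 := abs_mf_le (μ := μ) ha (exp (β * s) * Y1^(-β))
    have h4 := abs_mf_le (μ := μ) ha (exp (β * s) * Y2^(-β))
    have h5 := abs_sub (mf a μ (exp (β * s) * Y1^(-β))) (mf a μ (exp (β * s) * Y2^(-β)))
    have h6 : exp (s / 2) - 2 * (p - 1) ≤ |Y1 - Y2| := by
      rw [abs_sub_comm]; exact le_trans (by linarith) (le_abs_self _)
    have h7 := mul_le_left h6 k0.le
    have h8 : 0 ≤ β * (2 / (p - 1)) * C1 * (s^(-a - 1) * |Y1 - Y2|) := by positivity
    have h9 := mul_le_left (k3.trans h7) (by positivity : 0 ≤ 2 * D)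
    linarith

/-- bounded solutions of `x' = x + g` on a half-line are bounded by the forcing term -/
theorem neg_le_of_deriv_add {x g : ℝ → ℝ} {s1 D : ℝ}
    (hx : ∀ s, s1 ≤ s → HasDerivAt x (x s + g s) s) (hg : ∀ s, s1 ≤ s → g s ≤ D)
    (hl : Tendsto x atTop (𝓝 0)) : -D ≤ x s1 := by
  have hk : ∀ s, s1 ≤ s → HasDerivAt (fun s => exp (-s) * (x s + D))
      (exp (-s) * (g s - D)) s := fun s hs => by
    have h1 : HasDerivAt (fun s => exp (-s)) (-exp (-s)) s := by
      simpa using ((hasDerivAt_id' s).fun_neg).exp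
    refine (h1.fun_mul ((hx s hs).add_const D)).congr_deriv ?_
    ring
  have ha : AntitoneOn (fun s => exp (-s) * (x s + D)) (Ici s1) := by
    refine antitoneOn_of_deriv_nonpos (convex_Ici _)
      (fun s hs => (hk s hs).continuousAt.continuousWithinAt)
      (fun s hs => (hk s (interior_subset hs)).differentiableAt.differentiableWithinAt) fun s hs => ?_
    rw [(hk s (interior_subset hs)).deriv]
    exact mul_nonpos_of_nonneg_of_nonpos (exp_pos _).le
      (by linarith [hg s (interior_subset hs)])
  have ht : Tendsto (fun s => exp (-s) * (x s + D)) atTop (𝓝 0) := by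
    simpa using (tendsto_exp_atBot.comp tendsto_neg_atTop_atBot).mul (hl.add_const D)
  have h0 : 0 ≤ exp (-s1) * (x s1 + D) := by
    refine le_of_tendsto ht ?_
    filter_upwards [eventually_ge_atTop s1] with s hs
    exact ha (mem_Ici.2 le_rfl) hs hs
  have := nonneg_of_mul_nonneg_right h0 (exp_pos _)
  linarith

/-- the spatially homogeneous solution in the variable `φ^{1-p}` -/
structure Prof (p a μ : ℝ) (X : ℝ → ℝ) (C s0 : ℝ) : Prop where
  one_le : 1 ≤ s0
  C_pos : 0 < C
  deriv : ∀ s, s0 ≤ s → HasDerivAt X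
    (X s - (p - 1) * mf a μ (exp (1 / (p - 1) * s) * X s^(-(1 / (p - 1))))) s
  near : ∀ s, s0 ≤ s → |X s - (p - 1)| ≤ C * s^(-a)
  lb : ∀ s, s0 ≤ s → (p - 1) / 2 ≤ X s
  ub : ∀ s, s0 ≤ s → X s ≤ 2 * (p - 1)

theorem exists_prof (hp : 1 < p) (ha : 0 < a) {s0 : ℝ} {φ : ℝ → ℝ} (hpos : ∀ s, s0 ≤ s → 0 < φ s)
    (hode : ∀ s, s0 ≤ s → HasDerivAt φ (-(φ s) / (p - 1) + φ s^p +
        exp (-p * s / (p - 1)) * hfun p a μ (exp (s / (p - 1)) * φ s)) s)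
    (hφlim : Tendsto φ atTop (𝓝 ((p - 1)^(-(1 / (p - 1)))))) :
    ∃ X C s1, Prof p a μ X C s1 ∧ ∀ s, s1 ≤ s → φ s = X s^(-(1 / (p - 1))) := by
  have hp1 := sub_pos.2 hp
  have hκ : 0 < (p - 1)^(-(1 / (p - 1))) := by positivity
  obtain ⟨C, hC, hm⟩ := exists_mf_scaled (μ := μ) hp ha
  have hφX : ∀ s, s0 ≤ s → (φ s^(1 - p))^(-(1 / (p - 1))) = φ s := fun s hs => by
    rw [← rpow_mul (hpos s hs).le, show (1 - p) * -(1 / (p - 1)) = 1 by field_simp; ring, rpow_one]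
  have hd : ∀ s, s0 ≤ s → HasDerivAt (fun s => φ s^(1 - p)) (φ s^(1 - p) - (p - 1) *
      mf a μ (exp _ * (φ s^(1 - p))^(-(1 / (p - 1))))) s := fun s hs => by
    have h0 := hpos s hs
    refine ((hode s hs).rpow_const (Or.inl h0.ne')).congr_deriv ?_
    have e1 : hfun p a μ (exp (s / (p - 1)) * φ s) = exp (s * p / (p - 1)) * φ s^p *
        (mf a μ (exp (1 / (p - 1) * s) * φ s) - 1) := by
      have h1 : hfun p a μ (exp (s / (p - 1)) * φ s) = |exp (s / (p - 1)) * φ s|^(p - 1) *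
          (exp (s / (p - 1)) * φ s) * (mf a μ (exp (s / (p - 1)) * φ s) - 1) := by
        have := gf_eq (p := p) (a := a) (μ := μ) (exp (s / (p - 1)) * φ s)
        rw [gf] at this; linarith
      have h2 : 0 < exp (s / (p - 1)) * φ s := mul_pos (exp_pos _) h0
      rw [h1, abs_of_pos h2, ← rpow_add_one h2.ne', sub_add_cancel, mul_rpow (exp_pos _).le h0.le,
        ← exp_mul]
      congr 3 <;> ring_nf
    have e2 : exp (-p * s / (p - 1)) * exp (s * p / (p - 1)) = 1 := by
      rw [← exp_add, show -p * s / (p - 1) + s * p / (p - 1) = 0 by ring, exp_zero]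
    have e3 : φ s^(1 - p - 1) * φ s^p = 1 := by
      rw [← rpow_add h0, show 1 - p - 1 + p = 0 by ring, rpow_zero]
    rw [hφX s hs, e1]
    generalize mf a μ (exp _ * φ s) = m
    rw [show -(φ s) / (p - 1) + φ s^p + exp (-p * s / (p - 1)) *
      (exp _ * φ s^p * (m - 1)) = -(φ s) / (p - 1) + φ s^p +
      (exp _ * exp (s * p / (p - 1))) * (φ s^p * (m - 1)) by ring, e2]
    calc _ = (1 - p) * (-(1 / (p - 1)) * (φ s^(1 - p - 1) * φ s) +
          m * (φ s^(1 - p - 1) * φ s^p)) := by ring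
      _ = _ := by rw [e3, (show φ s^(1 - p - 1) * φ s = φ s^(1 - p) by rw [← rpow_add_one h0.ne']; ring_nf)]; field_simp; ring
  have hXl : Tendsto (fun s => φ s^(1 - p)) atTop (𝓝 (p - 1)) := by
    have := hφlim.rpow_const (p := 1 - p) (Or.inl hκ.ne')
    rwa [← rpow_mul hp1.le, show -(1 / (p - 1)) * (1 - p) = 1 by field_simp; ring, rpow_one] at this
  have hev : ∀ᶠ s in atTop, exp (-(1 / (2 * (p - 1))) * s) ≤ |φ s| := by
    have h1 : Tendsto (fun s : ℝ => exp (-(1 / (2 * (p - 1))) * s)) atTop (𝓝 0) := by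
      refine tendsto_exp_atBot.comp (tendsto_id.const_mul_atTop_of_neg ?_)
      have : 0 < 1 / (2 * (p - 1)) := by positivity
      linarith
    filter_upwards [h1.eventually_lt_const (half_pos hκ), hφlim.eventually_const_lt (half_lt_self hκ)]
      with s h2 h3
    exact h2.le.trans (h3.le.trans (le_abs_self _))
  obtain ⟨s1, hs1⟩ := eventually_atTop.1 (hev.and ((hXl.eventually_const_lt (show (p - 1) / 2 < p - 1 by
    linarith)).and (hXl.eventually_lt_const (show p - 1 < 2 * (p - 1) by linarith))))
  set s2 := max (max 1 s0) s1
  have hs2 : ∀ s, s2 ≤ s → 1 ≤ s ∧ s0 ≤ s ∧ s1 ≤ s := fun s hs =>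
    ⟨((le_max_left _ _).trans (le_max_left _ _)).trans hs,
      ((le_max_right _ _).trans (le_max_left _ _)).trans hs, (le_max_right _ _).trans hs⟩
  refine ⟨fun s => φ s^(1 - p), (p - 1) * C, s2, ⟨(hs2 _ le_rfl).1, by positivity,
    fun s hs => hd s (hs2 s hs).2.1, fun s hs => ?_, fun s hs => (hs1 s (hs2 s hs).2.2).2.1.le,
    fun s hs => (hs1 s (hs2 s hs).2.2).2.2.le⟩, fun s hs => (hφX s (hs2 s hs).2.1).symm⟩
  have hg : ∀ r, s ≤ r → |(p - 1) * (1 - mf a μ (exp _ * φ r))| ≤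
      (p - 1) * C * s^(-a) := fun r hr => by
    obtain ⟨h1, h2, h3⟩ := hs2 r (hs.trans hr)
    rw [abs_mul, abs_of_pos hp1, abs_sub_comm, mul_assoc]
    refine mul_le_left (((hm r (φ r) (by linarith) (hs1 r h3).1).1).trans ?_) hp1.le
    exact mul_le_left (rpow_le_rpow_of_nonpos (by linarith [(hs2 s hs).1]) hr
      (by linarith)) hC.le
  have hx : ∀ r, s ≤ r → HasDerivAt (fun s => φ s^(1 - p) - (p - 1))
      ((φ r^(1 - p) - (p - 1)) + (p - 1) * (1 - mf a μ (exp _ * φ r))) r :=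
    fun r hr => by
      have h2 := (hs2 r (hs.trans hr)).2.1
      refine ((hd r h2).sub_const _).congr_deriv ?_
      rw [hφX r h2]; ring
  have hl : Tendsto (fun s => φ s^(1 - p) - (p - 1)) atTop (𝓝 0) := by
    simpa using hXl.sub_const (p - 1)
  rw [abs_le]
  refine ⟨neg_le_of_deriv_add (x := fun s => φ s^(1 - p) - (p - 1)) hx (fun r hr => (le_abs_self _).trans (hg r hr)) hl, ?_⟩
  have := neg_le_of_deriv_add
    (fun r hr => (hx r hr).fun_neg.congr_deriv (by ring))
    (fun r hr => (neg_le_abs _).trans (hg r hr)) (by simpa using hl.neg)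
  simp only [neg_le_neg_iff] at this
  exact this

theorem pd_sum {J : Type*} {S : Finset J} {f : J → EE n → ℝ}
    (hf : ∀ j ∈ S, DifferentiableAt ℝ (f j) x) :
    pd i (fun y => ∑ j ∈ S, f j y) x = ∑ j ∈ S, pd i (f j) x := by
  simp [pd, fderiv_fun_sum hf]

/-- partial squared norm with weights `e` -/
def Nl (e : Fin n → ℝ) (y : EE n) : ℝ := ∑ j, e j * y j^2

theorem Nl_contDiff (e : Fin n → ℝ) : ContDiff ℝ 2 (Nl e) := by unfold Nl; fun_prop

theorem Nl_smul (e) (r) (y : EE n) : Nl e (r • y) = r^2 * Nl e y := by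
  simp only [Nl, PiLp.smul_apply, Finset.mul_sum]
  exact Finset.sum_congr rfl fun j _ => by ring

theorem Nl_nonneg (he : ∀ j, e j^2 = e j) (y) : 0 ≤ Nl e y :=
  Finset.sum_nonneg fun j _ => mul_nonneg (he j ▸ sq_nonneg _) (sq_nonneg _)

theorem Nl_le (he : ∀ j, e j^2 = e j) (y) : Nl e y ≤ ‖y‖^2 := by
  rw [EuclideanSpace.real_norm_sq_eq]
  refine Finset.sum_le_sum fun j _ => mul_le_of_le_one_left (sq_nonneg _) ?_
  nlinarith [he j]

theorem pd_Nl (e) (Ξ c) (b : EE n) (i) (x : EE n) :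
    pd i (fun x => Ξ + c * Nl e (x - b)) x = c * (2 * e i * (x i - b i)) := by
  have h1 : pd i (fun x => ∑ j, e j * (x j - b j)^2) x = 2 * e i * (x i - b i) := by
    rw [pd_sum fun j _ => by fun_prop]
    have h : ∀ j, pd i (fun x => e j * (x j - b j)^2) x =
        if i = j then 2 * e j * (x j - b j) else 0 := fun j => by
      rw [pd_comp (f := fun x => x j)
        ((((hasDerivAt_id' (x j)).sub_const _).fun_pow 2).const_mul _) (by fun_prop), pd_coord]
      split_ifs <;> simp; ring
    simp [h]
  simp [Nl, PiLp.sub_apply]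
  rw [pd_add (by fun_prop) (by fun_prop), pd_const, zero_add, pd_const_mul, h1]

theorem pd_Nl_rpow (he : ∀ j, e j^2 = e j) {X c : ℝ} (hΞ : 0 < X) (hc : 0 ≤ c)
    (b) (q) (i) (x : EE n) :
    pd i (fun x => (X + c * Nl e (x - b))^q) x =
      q * (X + c * Nl e (x - b))^(q - 1) * (c * (2 * e i * (x i - b i))) := by
  rw [pd_comp
    (hasDerivAt_rpow_const (Or.inl (show 0 < X + c * Nl e (x - b) by have := Nl_nonneg he (x - b); positivity).ne')) ?_, pd_Nl]
  have := (Nl_contDiff e).differentiable (by norm_num)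
  fun_prop

theorem pdpd_Nl_rpow (he : ∀ j, e j^2 = e j) {X c : ℝ} (hΞ : 0 < X) (hc : 0 ≤ c)
    (b) (q) (i) (x) :
    pd i (pd i (fun x => (X + c * Nl e (x - b))^q)) x =
      q * (q - 1) * (X + c * Nl e (x - b))^(q - 2) * (4 * c^2 * (e i * (x i - b i)^2)) +
      q * (X + c * Nl e (x - b))^(q - 1) * (2 * c * e i) := by
  have hd : DifferentiableAt ℝ (fun x => (X + c * Nl e (x - b))^(q - 1)) x := by
    have := (Nl_contDiff e).differentiable (by norm_num)
    exact (show DifferentiableAt ℝ (fun x => X + c * Nl e _) x by fun_prop).rpow_const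
      (Or.inl (show 0 < X + c * Nl e (x - b) by have := Nl_nonneg he (x - b); positivity).ne')
  rw [funext fun x => pd_Nl_rpow he hΞ hc b q i x]
  have h2 : pd i (fun x => c * (2 * e i * (x i - b i))) x = c * (2 * e i) := by
    have := pd_comp (i := i) (f := fun x => x i)
      (x := x) ((((hasDerivAt_id' _).sub_const (b i)).const_mul (2 * e i)).const_mul c)
      (by fun_prop)
    rw [this, pd_coord]; simp
  rw [pd_mul (hd.const_mul q) (by fun_prop),
    pd_const_mul, pd_Nl_rpow he hΞ hc, h2, show q - 1 - 1 = q - 2 by ring]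
  linear_combination (q * (q - 1) * (X + c * Nl e _)^(q - 2) * (4 * c^2 *
    (x i - b i)^2)) * he i

/-- the physical base of the approximate solution -/
def Yf (X : ℝ → ℝ) (l c T : ℝ) (e : Fin n → ℝ) (b x : EE n) (t : ℝ) : ℝ :=
  (T - t) * (X (-log (T - t)) - 2 * l * c) + c * Nl e (x - b)

/-- source term of the approximate solution -/
def Ff (p a m : ℝ) (X : ℝ → ℝ) (l c T : ℝ) (e : Fin n → ℝ) (b x : EE n) (t : ℝ) : ℝ :=
  Yf X l c T e b x t^(-(1 / (p - 1)) - 1) * mf a m (exp (1 / (p - 1) * -log (T - t)) *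
    X (-log (T - t))^(-(1 / (p - 1)))) - 1 / (p - 1) * (1 / (p - 1) + 1) *
    Yf X l c T e b x t^(-(1 / (p - 1)) - 2) * (4 * c^2 * Nl e (x - b))

theorem Prof.psol {s0 : ℝ} (hP : Prof p a μ X C s0) (hp : 1 < p) (ha : 0 < a) (he : ∀ j, e j^2 = e j) {l : ℝ} (hl : ∑ j, e j = l) {c : ℝ} (hc : 0 ≤ c)
    (hlc : 2 * l * c ≤ (p - 1) / 4) (b : EE n) (hβ : β < T)
    (hα : T - exp (-s0) ≤ α) :
    PSol α β (fun x t => Yf X l c T e b x t^(-(1 / (p - 1)))) (Ff p a μ X l c T e b) := by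
  have hp1 := sub_pos.2 hp
  set q := 1 / (p - 1) with hq
  have hq0 : 0 < q := by positivity
  have hτ : ∀ t ∈ Ioo α β, T - β ≤ T - t ∧ s0 ≤ -log (T - t) := fun t ht => by
    refine ⟨by linarith [ht.2], ?_⟩
    have h1 : log (T - t) ≤ -s0 := by rw [log_le_iff_le_exp (by linarith [ht.2])]; linarith [ht.1]
    linarith
  have hΞ : ∀ t ∈ Ioo α β, (T - β) * ((p - 1) / 4) ≤
      (T - t) * (X (-log (T - t)) - 2 * l * c) := fun t ht =>
    mul_le_mul (hτ t ht).1 (by linarith [hP.lb _ (hτ t ht).2]) (by positivity)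
      (by linarith [(hτ t ht).1])
  have hY0 : 0 < (T - β) * ((p - 1) / 4) := mul_pos (by linarith) (by positivity)
  have hY : ∀ t ∈ Ioo α β, ∀ x, (T - β) * ((p - 1) / 4) ≤ Yf X l c T e b x t := fun t ht x => by
    have := mul_nonneg hc (Nl_nonneg he (x - b))
    rw [Yf]; linarith [hΞ t ht]
  have hXd : ∀ t ∈ Ioo α β, HasDerivAt (fun t => (T - t) * (X (-log (T - t)) - 2 * l * c))
      (2 * l * c - (p - 1) * mf a μ (exp (q * -log (T - t)) *
        X (-log (T - t))^(-q))) t := fun t ht => by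
    have h0 : 0 < T - t := by linarith [(hτ t ht).1]
    have h1 := (hasDerivAt_id' t).const_sub T
    refine (h1.fun_mul (((hP.deriv _ (hτ t ht).2).comp t (h1.log h0.ne').fun_neg).sub_const (2 * l * c))).congr_deriv ?_
    simp only [Function.comp_def, ← hq]
    field_simp; ring
  have hYc : ContinuousOn (fun z : EE n × ℝ => Yf X l c T e b z.1 z.2) (univ ×ˢ Ioo α β) := by
    have h2 := (Nl_contDiff e).continuous
    exact (ContinuousOn.comp (f := Prod.snd) (t := Ioo α β)
        (fun t ht => (hXd t ht).continuousAt.continuousWithinAt) continuous_snd.continuousOn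
        fun z hz => hz.2).add (by fun_prop)
  have hYx : ∀ t, ContDiff ℝ 2 fun x => Yf X l c T e b x t := fun t => by
    have := Nl_contDiff e
    unfold Yf; fun_prop
  have gY : ∀ r : ℝ, r ≤ 0 → Gr (Ioo α β) fun x t => Yf X l c T e b x t^r := fun r hr =>
    .of_bdd fun t ht x => by
      rw [abs_of_pos (rpow_pos_of_pos (hY0.trans_le (hY t ht x)) _)]
      exact rpow_le_rpow_of_nonpos hY0 (hY t ht x) hr
  have cY : ∀ r : ℝ, ∀ t ∈ Ioo α β, Continuous fun x => Yf X l c T e b x t^r := fun r t ht =>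
    (hYx t).continuous.rpow_const fun x => Or.inl (hY0.trans_le (hY t ht x)).ne'
  have gx : ∀ i, Gr (n := n) (Ioo α β) fun x _ => x i - b i := fun i => (Gr.coord i).sub (.const _)
  have gN : Gr (Ioo α β) fun x _ => Nl e (x - b) := by
    exact Gr.sum fun j _ => ((gx j).pow 2).const_mul _
  have cN : Continuous fun x => Nl e (x - b) := (Nl_contDiff e).continuous.comp (by fun_prop)
  have e1 : ∀ t ∈ Ioo α β, ∀ i, pd i (fun x => Yf X l c T e b x t^(-q)) = fun x =>
      -q * Yf X l c T e b x t^(-q - 1) * (c * (2 * e i * (x i - b i))) := fun t ht i =>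
    funext fun x => pd_Nl_rpow he (hY0.trans_le (hΞ t ht)) hc b (-q) i x
  have e2 : ∀ t ∈ Ioo α β, ∀ i x, pd i (pd i (fun x => Yf X l c T e b x t^(-q))) x =
      -q * (-q - 1) * Yf X l c T e b x t^(-q - 2) * (4 * c^2 * (e i * (x i - b i)^2)) +
      -q * Yf X l c T e b x t^(-q - 1) * (2 * c * e i) := fun t ht i x =>
    pdpd_Nl_rpow he (hY0.trans_le (hΞ t ht)) hc b (-q) i x
  refine ⟨fun t ht => (hYx t).rpow_const_of_ne fun x => (hY0.trans_le (hY t ht x)).ne',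
    fun x t ht => ?_, fun t ht => ?_, gY _ (by linarith), ?_, fun i => ?_, fun i => ?_, fun i => ?_⟩
  · have := ((hXd t ht).add_const _).rpow_const (p := -q) (Or.inl (hY0.trans_le (hY t ht x)).ne')
    refine this.congr_deriv ?_
    rw [lap_eq, Finset.sum_congr rfl fun i _ => e2 t ht i x, Finset.sum_add_distrib,
      ← Finset.mul_sum, ← Finset.mul_sum, ← Finset.mul_sum, ← Finset.mul_sum, hl, Ff, ← hq]
    have e3 : ∑ i, e i * (x i - b i)^2 = Nl e (x - b) := rfl
    have e4 : q * (p - 1) = 1 := by rw [hq]; field_simp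
    rw [e3]
    change _ * _ * Yf X l c T e b x t^(-q - 1) = _
    linear_combination (Yf X l c T e b x t^(-q - 1) * mf a μ (exp _ *
        X (-log (T - t))^(-q))) * e4
  · unfold Ff
    exact ((cY _ t ht).mul continuous_const).sub ((continuous_const.mul (cY _ t ht)).mul
      (continuous_const.mul cN))
  · unfold Ff
    exact ((gY _ (by linarith)).mul (.of_bdd fun t _ _ => abs_mf_le ha _)).sub (((gY _ (by linarith)).const_mul _).mul (gN.const_mul _))
  · refine (((gY (-q - 1) (by linarith)).const_mul (-q)).mul
      (((gx i).const_mul (2 * e i)).const_mul c)).of_le fun t ht x => ?_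
    rw [e1 t ht i]
  · refine ((((gY (-q - 2) (by linarith)).const_mul (-q * (-q - 1))).mul
      ((((gx i).pow 2).const_mul (e i)).const_mul (4 * c^2))).add
      (((gY (-q - 1) (by linarith)).const_mul (-q)).mul (.const (2 * c * e i)))).of_le fun t ht x => ?_
    rw [e2 t ht i]
  · have h1 : ContinuousOn (fun z : EE n × ℝ => -q * Yf X l c T e b z.1 z.2^(-q - 1) *
        (c * (2 * e i * (z.1 i - b i)))) _ :=
      ((continuousOn_const.mul (hYc.rpow_const fun z hz =>
        Or.inl (hY0.trans_le (hY z.2 hz.2 z.1)).ne'))).mul (by fun_prop)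
    exact h1.congr fun z hz => by rw [e1 z.2 hz.2 i]

theorem PSol.sub {w f g : EE n → ℝ → ℝ} (h : PSol α β v f) (h' : PSol α β w g) :
    PSol α β (fun x t => v x t - w x t) (fun x t => f x t - g x t) := by
  have e1 : ∀ t ∈ Ioo α β, ∀ i, pd i (fun y => v y t - w y t) =
      fun x => pd i (fun y => v y t) x - pd i (fun y => w y t) x := fun t ht i => funext fun x =>
    pd_sub ((h.c2 t ht).differentiable (by norm_num) x) ((h'.c2 t ht).differentiable (by norm_num) x)
  have e2 : ∀ t ∈ Ioo α β, ∀ i x, pd i (pd i (fun y => v y t - w y t)) x =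
      pd i (pd i (fun y => v y t)) x - pd i (pd i (fun y => w y t)) x := fun t ht i x => by
    rw [e1 t ht i, pd_sub (pd_differentiable (h.c2 t ht) x) (pd_differentiable (h'.c2 t ht) x)]
  refine ⟨fun t ht => (h.c2 t ht).sub (h'.c2 t ht), fun x t ht => ?_,
    fun t ht => (h.cf t ht).sub (h'.cf t ht), h.gv.sub h'.gv, h.gf.sub h'.gf,
    fun i => ((h.gv' i).sub (h'.gv' i)).of_le fun t ht x => by rw [e1 t ht i],
    fun i => ((h.gv'' i).sub (h'.gv'' i)).of_le fun t ht x => by rw [e2 t ht i],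
    fun i => ((h.cgrad i).sub (h'.cgrad i)).congr fun z hz => by
      rw [e1 z.2 hz.2 i, Pi.sub_apply]⟩
  refine ((h.vt x t ht).fun_sub (h'.vt x t ht)).congr_deriv ?_
  simp only [lap_eq, e2 t ht, Finset.sum_sub_distrib]
  ring

theorem rho_sq_le (h0 : 0 ≤ δ) (h1 : δ ≤ 1) (c y : EE n) : rho n y^2 ≤
    (4 * π)^(-(n : ℝ) / 2) * exp (3 / 4 * ‖c‖^2) * exp (-(1 / 8) * ‖y‖^2) *
      rho n (c + δ • y) := by
  have h2 : ‖c + δ • y‖^2 ≤ 3 / 2 * ‖y‖^2 + 3 * ‖c‖^2 := by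
    have h3 := norm_add_le c (δ • y)
    rw [norm_smul, norm_of_nonneg h0] at h3
    have h4 : δ * ‖y‖ ≤ ‖y‖ := mul_le_of_le_one_left (norm_nonneg _) h1
    nlinarith [norm_nonneg (c + δ • y), sq_nonneg (‖y‖ - 2 * ‖c‖)]
  have h5 : exp (-‖y‖^2 / 4)^2 ≤ exp (3 / 4 * ‖c‖^2) *
      exp (-(1 / 8) * ‖y‖^2) * exp (-‖c + δ • y‖^2 / 4) := by
    rw [← exp_add, ← exp_add, ← exp_nat_mul, exp_le_exp]
    linarith
  have := mul_le_left h5 (by positivity : 0 ≤ ((4 * π)^(-(n : ℝ) / 2))^2)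
  unfold rho
  linarith

theorem exists_shifted_l1 (n : ℕ) (h0 : 0 < δ) (h1 : δ ≤ 1) : ∃ K, 0 < K ∧
    ∀ (Q) (ε : ℝ), Continuous Q → Gr1 Q → 0 < ε → ∫ y, Q y^2 * rho n y ≤ ε^2 →
    ∀ c, ∫ y, |Q (c + δ • y)| * rho n y ≤ K * ε * exp (3 / 8 * ‖c‖^2) := by
  set g := (4 * π)^(-(n : ℝ) / 2) with hg
  have hI := integrable_exp_neg_sq (n := n) (show (0 : ℝ) < 1 / 8 by norm_num)
  set J := ∫ y : EE n, exp (-(1 / 8) * ‖y‖^2)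
  refine ⟨((δ^n)⁻¹ + g * J) / 2, by positivity, fun Q ε cQ gQ hε hQ c => ?_⟩
  have hQ3 : Integrable fun y => Q (c + δ • y)^2 * rho n _ :=
    ((Gr1.int (f := fun y => Q y^2) (gQ.pow 2) (cQ.pow 2)).comp_add_left c).comp_smul h0.ne'
  have e1 : ∫ y, Q (c + δ • y)^2 * rho n (c + δ • y) = (δ^n)⁻¹ * ∫ y, Q y^2 * rho n y := by
    have h2 := Measure.integral_comp_smul volume
      (fun y => Q (c + y)^2 * rho n (c + y)) δ
    rw [integral_add_left_eq_self (fun y => Q y^2 * rho n y) c] at h2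
    rw [h2, abs_of_pos (by positivity), smul_eq_mul]
    simp
  set E := exp _ with hE
  have hE0 : 0 < E := exp_pos _
  have hpt : ∀ y, |Q _| * rho n y ≤ 1 / 2 * (E / ε * (Q (c + δ • y)^2 * rho n (c + δ • y)) +
      ε * E * g * exp _) := fun y => by
    have h2 := rho_sq_le h0.le h1 c y
    have h3 := rho_pos (c + δ • y)
    rw [(show exp (3 / 4 * ‖c‖^2) = E^2 by rw [hE, ← exp_nat_mul]; congr 1; push_cast; ring), ← hg] at h2
    set r := rho n (c + δ • y)
    set G := exp _
    set x := |Q _|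
    rw [← sq_abs _]
    have h5 : 0 ≤ E * r / ε * (x - ε * rho n y / (E * r))^2 := by positivity
    have h6 : E * r / ε * (x - ε * rho n y / (E * r))^2 =
        E / ε * (x^2 * r) - 2 * (x * rho n y) + ε * (rho n y^2 / (E * r)) := by
      field_simp
      ring
    have h7 := mul_le_left (show rho n y^2 / (E * r) ≤ E * g * G by rw [div_le_iff₀ (by positivity)]; linarith) hε.le
    linarith
  have i1 : Integrable fun y => |Q (c + δ • y)| * rho n y := by
    refine Gr1.int (f := fun y => |Q _|) ?_ (by fun_prop)
    exact ((Gr.comp_affine (τ := fun _ => ()) gQ c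
      (fun _ _ => trivial) (fun _ _ => le_rfl))).abs
  have h8 := integral_mono i1 (((hQ3.const_mul (E / ε)).fun_add (hI.const_mul _)).const_mul
    (1 / 2)) hpt
  rw [integral_const_mul, integral_add (hQ3.const_mul _) (hI.const_mul _), integral_const_mul,
    integral_const_mul, e1] at h8
  refine h8.trans ?_
  have h9 : E / ε * ((δ^n)⁻¹ * ∫ y, Q y^2 * rho n y) ≤ E / ε * ((δ^n)⁻¹ * ε^2) :=
    mul_le_left (mul_le_left hQ (by positivity)) (by positivity)
  have h10 : E / ε * ((δ^n)⁻¹ * ε^2) = (δ^n)⁻¹ * ε * E := by field_simp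
  linarith

theorem heat_step_scalar {G ER m2 E e p1 p2 e1 es d I X EC : ℝ} (hΓ : 0 < G) (hER : 0 ≤ ER)
    (hm : 0 ≤ m2) (hN : 0 ≤ N) (hε : 0 ≤ e) (hp1 : 0 ≤ p1) (hes : 0 ≤ es) (he1 : 0 ≤ e1)
    (hE : 1 + G * N ≤ E) (hI : 0 ≤ I) (k1 : p1 * I ≤ X * e * E) (k2 : e1 ≤ EC) (k3 : p1 * p2 = es)
    (hd : 0 ≤ d) (hgap : es * d ≤ ER) :
    p1 * (e1 * (I + d * (p2 * e * (1 + 2 * N + 2 * ER * m2)))) ≤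
      EC * (X + ER * (1 + 2 * ER * m2 + 2 / G)) * e * E := by
  have k4 : 1 + 2 * N + 2 * ER * m2 ≤ (1 + 2 * ER * m2 + 2 / G) * E := by
    have : 2 * N = 2 / G * (G * N) := by field_simp
    have h3 : 0 ≤ G * N := by positivity
    have h4 : 0 ≤ (1 + 2 * ER * m2) * (E - 1) := mul_nonneg (by positivity) (by linarith)
    have h5 : 0 ≤ 2 / G * (E - G * N) := mul_nonneg (by positivity) (by linarith)
    linarith
  have k7 := mul_le_mul k2 (add_le_add k1 (mul_le_mul hgap (mul_le_left k4 hε) (by positivity) hER)) (by positivity) (he1.trans k2)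
  rw [← k3] at k7
  linear_combination k7

set_option maxHeartbeats 800000 in
/-- smoothing: weighted `L²` smallness becomes a pointwise Gaussian bound -/
theorem exists_heat_step (n : ℕ) (θ : ℝ) {R : ℝ} (hC : 0 ≤ C) (hR : 0 < R) (hθ : 0 ≤ θ) :
    ∃ K, 0 < K ∧ ∀ (v f : EE n → ℝ → ℝ) (i Z T s1 e : ℝ) (b : EE n), PSol i Z v f →
    i < T - exp (-s1) → T - exp (-(s1 + R)) < Z → 0 < e →
    (∀ y, ∀ s ∈ Ico s1 (s1 + R), exp (-(θ + 1) * s) * |f (b + exp (-s / 2) • y) (T - exp (-s))| ≤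
      C * (exp (-θ * s) * |v (b + exp (-s / 2) • y) (T - exp (-s))|) +
        e * (1 + ‖y‖^2)) →
    (∫ y, (exp (-θ * s1) * v (b + exp (-s1 / 2) • y) (T - exp (-s1)))^2 * rho n y ≤ e^2) →
    ∀ y, exp (-θ * (s1 + R)) *
      |v (b + exp (-(s1 + R) / 2) • y) (T - exp (-(s1 + R)))| ≤
      K * e * exp (3 / 8 * exp (-R) * ‖y‖^2) := by
  have hR1 : exp (-R) < 1 := exp_lt_one_iff.2 (by linarith)
  obtain ⟨K1, hK1, hl1⟩ := exists_shifted_l1 n (δ := √(1 - exp (-R)))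
    (sqrt_pos.2 (by linarith)) (sqrt_le_one.2 (by linarith [exp_pos (-R)]))
  set m2 := ∫ y : EE n, ‖y‖^2 * rho n y
  have hm2 : 0 ≤ m2 := integral_nonneg fun y => mul_nonneg (sq_nonneg _) (rho_pos y).le
  have i2 : Integrable fun y : EE n => ‖y‖^2 * rho n y :=
    Gr1.int (f := fun y => ‖y‖^2) (Gr.norm.pow 2) (by fun_prop)
  set G := 3 / 8 * exp (-R) with hΓ
  have hΓ0 : 0 < G := by positivity
  refine ⟨exp (C * exp R) * (K1 + exp R * (1 + 2 * exp R * m2 + 2 / G)),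
    by positivity, fun v f i Z T s1 e b h hα hβ hε hf hL y => ?_⟩
  set s0 := s1 + R with hs0
  have htt : T - exp (-s0) - (T - exp (-s1)) = exp (-s1) * (1 - exp (-R)) := by
    rw [hs0, neg_add, exp_add]; ring
  have h0t : T - exp (-s1) < T - exp (-s0) := by
    have := mul_pos (exp_pos (-s1)) (sub_pos.2 hR1); linarith
  have hex : exp s0 * exp (-s1) = exp R := by rw [← exp_add]; congr 1; rw [hs0]; ring
  have hgap : exp s0 * (T - exp (-s0) - (T - exp (-s1))) ≤ exp R := by
    rw [htt, ← mul_assoc, hex]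
    exact mul_le_of_le_one_right (exp_pos _).le (by linarith [exp_pos (-R)])
  set Bd : EE n → ℝ := fun x => exp ((θ + 1) * s0) * e * (1 + exp s0 * ‖x - b‖^2) with hBd
  set Bs := exp ((θ + 1) * s0) * e * (1 + 2 * ‖y‖^2 + 2 * exp R * m2) with hBs
  have hBs0 : 0 ≤ Bs := by positivity
  have cB : Continuous Bd := by fun_prop
  have gx : Gr (n := n) (univ : Set Unit) fun x _ => ‖x - b‖^2 := by
    refine Gr.pow (θ := fun x _ => ‖x - b‖) ((Gr.norm.add (.const ‖b‖)).of_le fun s hs x => ?_) 2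
    rw [abs_of_nonneg (norm_nonneg _)]
    exact (norm_sub_le x b).trans (le_abs_self _)
  have gB : Gr1 Bd :=
    ((Gr.const 1).add (gx.const_mul (exp s0))).const_mul (exp ((θ + 1) * s0) * e)
  have hn2 : ‖b + exp (-s0 / 2) • y - b‖^2 * exp s0 = ‖y‖^2 := by
    rw [add_sub_cancel_left, norm_smul, norm_of_nonneg (exp_pos _).le, mul_pow, ← exp_nat_mul,
      mul_right_comm, ← exp_add, show ((2 : ℕ) : ℝ) * (-s0 / 2) + s0 = 0 by push_cast; ring,
      exp_zero, one_mul]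
  have hf' : ∀ x, ∀ t' ∈ Ico (T - exp (-s1)) (T - exp (-s0)), |f x t'| ≤
      C * exp s0 * |v x t'| + Bd x := fun x t' ht' => by
    have hτ : 0 < T - t' := by linarith [ht'.2, exp_pos (-s0)]
    have hlog : exp (log (T - t')) = T - t' := exp_log hτ
    set s := -log (T - t') with hs
    have hs' : T - exp (-s) = t' := by rw [hs, neg_neg, hlog]; ring
    have hsI : s ∈ Ico s1 s0 := by
      rw [← hs'] at ht'
      exact ⟨by have := exp_le_exp.1 (show exp (-s) ≤ exp (-s1) by linarith [ht'.1]); linarith,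
        by have := exp_lt_exp.1 (show exp (-s0) < exp (-s) by linarith [ht'.2]); linarith⟩
    have h1 := hf (exp (s / 2) • (x - b)) s hsI
    rw [smul_smul, ← exp_add, show -s / 2 + s / 2 = 0 by ring, exp_zero, one_smul,
      add_sub_cancel, hs', norm_smul, norm_of_nonneg (exp_pos _).le, mul_pow, ← exp_nat_mul,
      show ((2 : ℕ) : ℝ) * (s / 2) = s by push_cast; ring] at h1
    have h2 := mul_le_left h1 (exp_pos ((θ + 1) * s)).le
    have k1 : exp ((θ + 1) * s) * exp (-(θ + 1) * s) = 1 := by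
      rw [← exp_add, show (θ + 1) * s + -(θ + 1) * s = 0 by ring, exp_zero]
    have k2 : exp ((θ + 1) * s) * exp (-θ * s) = exp s := by rw [← exp_add]; congr 1; ring
    have k3 : exp s ≤ exp s0 := exp_le_exp.2 hsI.2.le
    have k4 : exp ((θ + 1) * s) ≤ exp ((θ + 1) * s0) :=
      exp_le_exp.2 (mul_le_left hsI.2.le (by linarith))
    rw [← mul_assoc, k1, one_mul] at h2
    calc _ ≤ _ := h2
      _ = C * ((exp ((θ + 1) * s) * exp (-θ * s)) * |v x t'|) +
          exp ((θ + 1) * s) * e * (1 + exp s * ‖x - b‖^2) := by ring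
      _ ≤ _ := by rw [k2, mul_assoc C]; simp only [hBd]; gcongr
  have hB : ∀ r : ℝ, 0 < r → r^2 ≤ T - exp (-s0) - (T - exp (-s1)) →
      ∫ z, Bd (b + exp (-s0 / 2) • y + r • z) * rho n z ≤ Bs := fun r hr hr2 => by
    have i3 : Integrable fun z : EE n => (1 + 2 * ‖y‖^2) * rho n z := rho_integrable.const_mul _
    have hpt : ∀ z : EE n, exp ((θ + 1) * s0) * e * (1 + exp s0 *
        ‖b + exp (-s0 / 2) • y + r • z - b‖^2) * rho n z ≤ exp ((θ + 1) * s0) * e *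
        ((1 + 2 * ‖y‖^2) * rho n z + 2 * exp R * (‖z‖^2 * rho n z)) := fun z => by
      have h3 : ‖b + exp (-s0 / 2) • y + r • z - b‖^2 ≤
          2 * ‖b + exp (-s0 / 2) • y - b‖^2 + 2 * (r^2 * ‖z‖^2) := by
        rw [add_sub_right_comm]
        have h4 := norm_add_le (b + exp (-s0 / 2) • y - b) (r • z)
        rw [norm_smul, norm_of_nonneg hr.le] at h4
        nlinarith [norm_nonneg (b + exp (-s0 / 2) • y - b + r • z),
          sq_nonneg (‖b + exp (-s0 / 2) • y - b‖ - r * ‖z‖)]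
      have h5 : exp s0 * r^2 ≤ exp R :=
        (mul_le_left hr2 (exp_pos _).le).trans hgap
      have h6 := mul_le_right h5 (sq_nonneg ‖z‖)
      have h7 := mul_le_left h3 (exp_pos s0).le
      rw [mul_assoc]
      refine mul_le_left ?_ (by positivity)
      rw [← mul_assoc (2 * exp R), ← add_mul]
      refine mul_le_right ?_ (rho_pos z).le
      linarith
    refine (integral_mono_of_nonneg (.of_forall fun z => ?_) ((i3.fun_add
      (i2.const_mul (2 * exp R))).const_mul (exp ((θ + 1) * s0) * e))
      (.of_forall hpt)).trans (le_of_eq ?_)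
    · exact mul_nonneg (by positivity) (rho_pos z).le
    · rw [integral_const_mul, integral_add i3 (i2.const_mul _), integral_const_mul, integral_const_mul,
        integral_rho]; ring
  clear_value Bd Bs
  have hb := h.heat_bound hα h0t hβ (mul_nonneg hC (exp_pos _).le) hBs0 cB gB hf' hB
  have hx : ∀ z : EE n, b + exp (-s0 / 2) • y +
      √(T - exp (-s0) - (T - exp (-s1))) • z = b + exp (-s1 / 2) •
      (exp (-R / 2) • y + √(1 - exp (-R)) • z) := fun z => by
    have e1 : √(exp (-s1)) = exp (-s1 / 2) := by rw [← exp_half]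
    rw [htt, sqrt_mul (exp_pos _).le, e1, smul_add, smul_smul, smul_smul, ← exp_add, add_assoc]
    congr 4; rw [hs0]; ring
  have hS := h.toSSol b T (I := {s1}) fun s hs => by
    rw [mem_singleton_iff.1 hs]; exact ⟨hα, h0t.trans hβ⟩
  have hl := hl1 (fun y => exp (-θ * s1) * v (b + exp (-s1 / 2) • y) (T - exp (-s1))) e
    (continuous_const.mul (hS.c2 s1 rfl).continuous)
    ((hS.gr1W rfl).const_mul _) hε hL (exp (-R / 2) • y)
  have hc : 3 / 8 * ‖exp (-R / 2) • y‖^2 = G * ‖y‖^2 := by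
    rw [norm_smul, norm_of_nonneg (exp_pos _).le, mul_pow, ← exp_nat_mul, hΓ]
    ring
  simp only [hx] at hb
  simp only [abs_mul, abs_of_pos (exp_pos (-θ * s1)), mul_assoc] at hl
  rw [integral_const_mul, hc] at hl
  set I1 := ∫ z, |v _
    (T - exp (-s1))| * rho n z
  have hI1 : 0 ≤ I1 := integral_nonneg fun z => mul_nonneg (abs_nonneg _) (rho_pos z).le
  set E := exp (G * ‖y‖^2)
  have hE1 : 1 + G * ‖y‖^2 ≤ E := by rw [add_comm]; exact add_one_le_exp _
  have k1 : exp (-θ * s0) * I1 ≤ K1 * e * E := by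
    refine (mul_le_right (exp_le_exp.2 ?_) hI1).trans (hl.trans (by linarith))
    rw [hs0]; nlinarith
  have k2 : exp (C * exp s0 * (T - exp (-s0) - (T - exp (-s1)))) ≤
      exp (C * exp R) := by
    rw [exp_le_exp, mul_assoc]; exact mul_le_left hgap hC
  have k3 : exp (-θ * s0) * exp ((θ + 1) * s0) = exp s0 := by rw [← exp_add]; congr 1; ring
  clear_value I1 E
  have hd : 0 ≤ T - exp (-s0) - (T - exp (-s1)) := by
    rw [htt]; exact mul_nonneg (exp_pos _).le (by linarith)
  refine (mul_le_left hb (exp_pos (-θ * s0)).le).trans ?_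
  rw [hBs]
  exact heat_step_scalar hΓ0 (exp_pos R).le hm2 (sq_nonneg ‖y‖) hε.le (exp_pos _).le
    (exp_pos _).le (exp_pos _).le hE1 hI1 k1 k2 k3 hd hgap

theorem abs_rpow_sub_rpow_le {lo x y : ℝ} (hθ : θ ≤ 1) (hlo : 0 < lo) (hx : lo ≤ x) (hy : lo ≤ y) :
    |x^θ - y^θ| ≤ |θ| * lo^(θ - 1) * |x - y| :=
  mvt (convex_Ici lo)
    (fun t ht => hasDerivAt_rpow_const (.inl (hlo.trans_le ht).ne'))
    (fun t ht => by
      rw [abs_mul, abs_of_nonneg (rpow_nonneg (hlo.le.trans ht) _)]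
      exact mul_le_left (rpow_le_rpow_of_nonpos hlo ht (by linarith)) (abs_nonneg _))
    hy hx

/-- second order Taylor bound for negative powers, with the slope frozen at a nearby point `k` -/
theorem abs_rpow_taylor_le {lo k x χ : ℝ} (hβ : 0 ≤ β) (hlo : 0 < lo) (hk : lo ≤ k) (hx : lo ≤ x)
    (hχ : lo ≤ x + χ) :
    |(x + χ)^(-β) - x^(-β) + β * k^(-β - 1) * χ| ≤
      β * ((β + 1) * lo^(-β - 2)) * (|x - k| + |χ|) * |χ| := by
  have h := mvt (convex_uIcc x (x + χ))
    (f := fun t => t^(-β) + β * k^(-β - 1) * t)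
    (f' := fun t => -β * t^(-β - 1) + β * k^(-β - 1) * 1)
    (C := β * ((β + 1) * lo^(-β - 2)) * (|x - k| + |χ|))
    (fun t ht => ?_) (fun t ht => ?_) left_mem_uIcc right_mem_uIcc
  · rw [add_sub_cancel_left] at h
    refine le_trans (le_of_eq ?_) h
    ring
  all_goals have ht' := (le_min hx hχ).trans ht.1
  · exact (hasDerivAt_rpow_const (.inl (hlo.trans_le ht').ne')).fun_add
      ((hasDerivAt_id' t).const_mul _)
  · have h1 := abs_rpow_sub_rpow_le (show -β - 1 ≤ 1 by linarith) hlo ht' hk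
    have h2 : |t - k| ≤ |x - k| + |χ| := by
      have h3 : |t - x| ≤ |χ| := by
        have := abs_sub_left_of_mem_uIcc ht
        rwa [add_sub_cancel_left] at this
      have := abs_add_le (t - x) (x - k)
      rw [sub_add_sub_cancel] at this
      linarith
    rw [abs_of_nonpos (show -β - 1 ≤ 0 by linarith), show -β - 1 - 1 = -β - 2 by ring] at h1
    rw [show -β * t^(-β - 1) + β * k^(-β - 1) * 1 = -(β * (t^(-β - 1) - k^(-β - 1))) by ring,
      abs_neg, abs_mul, abs_of_nonneg hβ, mul_assoc β]
    refine mul_le_left (h1.trans ?_) hβ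
    rw [show -(-β - 1) = β + 1 by ring]
    gcongr

theorem gh_rpow (hp : 1 < p) (s) {Z : ℝ} (hZ : 0 < Z) : gh p a μ s (Z^(-(1 / (p - 1)))) =
    Z^(-(1 / (p - 1)) - 1) * mf a μ (exp (1 / (p - 1) * s) * Z^(-(1 / (p - 1)))) := by
  have hp1 := sub_pos.2 hp
  rw [gh, gf, abs_of_pos (by positivity), mul_rpow (exp_pos _).le (rpow_pos_of_pos hZ (-(1 / (p - 1)))).le, ← exp_mul, ← rpow_mul hZ.le,
    show -(1 / (p - 1)) * (p - 1) = -1 by field_simp, show -(1 / (p - 1)) - 1 = -1 + -(1 / (p - 1)) by ring,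
    rpow_add hZ]
  have : exp (-p / (p - 1) * s) * (exp (1 / (p - 1) * s * (p - 1)) *
      exp (1 / (p - 1) * s)) = 1 := by
    rw [← exp_add, ← exp_add, exp_eq_one_iff]; ring
  linear_combination (Z^(-1 : ℝ) * Z^(-(1 / (p - 1))) * mf a μ _) * this

/-- `Z = X + c (N - 2 l)` stays close to `p - 1` from below -/
theorem Prof.lb_shift {s0 : ℝ} (hP : Prof p a μ X C s0) (hp : 1 < p) (ha : 0 < a)
    {l k : ℝ} (hl : 0 ≤ l) (hk : 0 ≤ k) : ∃ s1, s0 ≤ s1 ∧ ∀ s c N, s1 ≤ s → 0 ≤ c → c * s ≤ k → 0 ≤ N →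
      (C + 2 * l * k) * s^(-(min a 1)) ≤ (p - 1) / 2 ∧
      (p - 1) - (C + 2 * l * k) * s^(-(min a 1)) ≤ X s + c * (N - 2 * l) := by
  have h := (tendsto_rpow_neg_atTop (lt_min ha one_pos)).const_mul (C + 2 * l * k)
  rw [mul_zero] at h
  obtain ⟨s1, hs1⟩ := eventually_atTop.1 (h.eventually_le_const (show 0 < (p - 1) / 2 by linarith))
  refine ⟨max s0 s1, le_max_left _ _, fun s c N hs hc hck hN =>
    ⟨hs1 s ((le_max_right _ _).trans hs), ?_⟩⟩
  have hs0 := (le_max_left _ _).trans hs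
  have h1 := hP.one_le.trans hs0
  have h2 := (abs_le.1 (hP.near s hs0)).1
  have h4 : s^(-(1 : ℝ)) ≤ s^(-(min a 1)) :=
    rpow_le_rpow_of_exponent_le h1 (neg_le_neg (min_le_right _ _))
  rw [rpow_neg_one] at h4
  have h6 := mul_le_left ((show c ≤ k * s⁻¹ by rwa [← div_eq_mul_inv, le_div_iff₀ (by linarith)]).trans (mul_le_left h4 hk)) hl
  have h7 := mul_le_left (rpow_le_rpow_of_exponent_le h1 (neg_le_neg (min_le_left _ _)) : s^(-a) ≤ s^(-(min a 1))) hP.C_pos.le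
  have h8 := mul_nonneg hc hN
  linarith

set_option maxHeartbeats 1000000 in
theorem exists_source_le {C0 s0 : ℝ} (hP : Prof p a μ X C0 s0) (hp : 1 < p) (ha : 0 < a) {l k : ℝ} (hl : 0 ≤ l) (hk : 0 ≤ k) (hM : 0 ≤ M) : ∃ C s1, 0 < C ∧ s0 ≤ s1 ∧
      ∀ s c N w Z Ψ, s1 ≤ s → 0 ≤ c → c * s ≤ k → 0 ≤ N → |w| ≤ M → Z = X s + c * (N - 2 * l) →
      Ψ = Z^(-(1 / (p - 1))) → (p - 1) / 2 ≤ Z ∧ |w - Ψ| ≤ C ∧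
      |gh p a μ s w - (Z^(-(1 / (p - 1)) - 1) * mf a μ (exp (1 / (p - 1) * s) *
        X s^(-(1 / (p - 1)))) - 1 / (p - 1) * (1 / (p - 1) + 1) * Z^(-(1 / (p - 1)) - 2) *
          (4 * c^2 * N))| ≤
      (1 + 1 / (p - 1) + C * (s^(-(min a 1)) + |w - Ψ|)) * |w - Ψ| + C * s^(-(2 : ℝ)) * (1 + N) := by
  have hp1 := sub_pos.2 hp
  have hpp : p * (p - 1)⁻¹ = 1 + 1 / (p - 1) := by field_simp; ring
  set β := 1 / (p - 1) with hβ
  have hβ0 : 0 < β := by positivity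
  set lo := (p - 1) / 2 with hlo
  have hlo0 : 0 < lo := by positivity
  have hP0 := rpow_pos_of_pos hlo0 (-β)
  have hκ := rpow_pos_of_pos hp1 (-β)
  obtain ⟨s2, hs₂, hZ⟩ := hP.lb_shift hp ha hl hk
  set d0 := C0 + 2 * l * k with hd₀
  have hd0 : 0 < d0 := by have := hP.C_pos; positivity
  set D := |-β| * lo^(-β - 1) with hD
  have hD0 : 0 ≤ D := by positivity
  set B := (p - 1)^(-β) + D * lo + (M + lo^(-β)) with hB
  have hB0 : 0 < B := by positivity
  obtain ⟨C1, s3, hC1, hs₃, h1⟩ := exists_gh_sub_le (μ := μ) hp ha hB0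
  obtain ⟨C2, s4, hC2, hs₄, h2⟩ := exists_mf_prof_sub_le (μ := μ) hp ha
  set E := |-(p - 1)| * B⁻¹^(-(p - 1) - 1) * ((p - 1)^(-β) * (p - 1)^(-β))⁻¹ with hE
  have hE0 : 0 ≤ E := by positivity
  set A := β * (β + 1) * lo^(-β - 2) with hA
  have hA0 : 0 ≤ A := by positivity
  refine ⟨p * E * (D * d0 + 1) + C1 + C2 * k * (1 + 2 * l) + A * (4 * k^2) + (M + lo^(-β)),
    max s2 (max s3 s4), by positivity, hs₂.trans (le_max_left _ _), fun s c N w Z Ψ hs hc hck hN hw hZe hΨ => ?_⟩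
  have hs2 := (le_max_left _ _).trans hs
  have hs3 := (le_max_left _ _).trans ((le_max_right _ _).trans hs)
  have hs4 := (le_max_right _ _).trans ((le_max_right _ _).trans hs)
  have hs0 : 0 < s := by linarith
  obtain ⟨z1, z2⟩ := hZ s c N hs2 hc hck hN
  rw [← hZe] at z2
  have hX1 := hP.lb s (hs₂.trans hs2)
  have hX2 := hP.ub s (hs₂.trans hs2)
  set d := d0 * s^(-(min a 1)) with hd
  have hZl : lo ≤ Z := by linarith
  have hZ0 : 0 < Z := hlo0.trans_le hZl
  have hΨ0 : 0 < Ψ := hΨ ▸ rpow_pos_of_pos hZ0 _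
  have hdp : 0 < s^(-(min a 1)) := rpow_pos_of_pos hs0 _
  have hd1 : 0 ≤ d := by positivity
  have hΨ1 : Ψ ≤ (p - 1)^(-β) + D * d := by
    have h3 : Ψ ≤ (p - 1 - d)^(-β) :=
      hΨ ▸ rpow_le_rpow_of_nonpos (by linarith) z2 (by linarith)
    have h4 := le_of_abs_le (abs_rpow_sub_rpow_le (show -β ≤ 1 by linarith) hlo0
      (show lo ≤ p - 1 - d by linarith) (show lo ≤ p - 1 by linarith))
    rw [show p - 1 - d - (p - 1) = -d by ring, abs_neg d, abs_of_nonneg hd1] at h4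
    linarith
  have hΨ2 : Ψ ≤ lo^(-β) := hΨ ▸ rpow_le_rpow_of_nonpos hlo0 hZl (by linarith)
  set q := w - Ψ with hq
  have hqM : |q| ≤ M + lo^(-β) := (abs_sub w Ψ).trans (by rw [abs_of_pos hΨ0]; linarith)
  set m := (p - 1)^(-β) + D * d + |q| with hm
  have hm1 : (p - 1)^(-β) ≤ m := by have := abs_nonneg q; have := mul_nonneg hD0 hd1; linarith
  have hm0 : 0 < m := hκ.trans_le hm1
  have hmB : m ≤ B := by
    have := mul_le_left (show d ≤ lo from z1) hD0
    linarith
  have hmp : m^(p - 1) ≤ (p - 1)⁻¹ + E * (D * d + |q|) := by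
    have h3 := le_of_abs_le (abs_rpow_sub_rpow_le (show -(p - 1) ≤ 1 by linarith) (inv_pos.2 hB0)
      (inv_anti₀ hm0 hmB) (inv_anti₀ hκ (hm1.trans hmB)))
    rw [← rpow_neg_eq_inv_rpow, ← rpow_neg_eq_inv_rpow, neg_neg, ← rpow_mul hp1.le,
      show -β * (p - 1) = -1 by rw [hβ]; field_simp, rpow_neg_one, inv_sub_inv hm0.ne' hκ.ne',
      show (p - 1)^(-β) - m = -(D * d + |q|) by rw [hm]; ring, abs_div, abs_neg (D * d + |q|),
      abs_of_nonneg (show 0 ≤ D * d + |q| by positivity), abs_of_pos (mul_pos hm0 hκ)] at h3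
    have h4 : (D * d + |q|) / (m * (p - 1)^(-β)) ≤
        ((p - 1)^(-β) * (p - 1)^(-β))⁻¹ * (D * d + |q|) := by
      rw [div_eq_inv_mul]
      gcongr
    have h5 := mul_le_left h4 (show 0 ≤ |-(p - 1)| * B⁻¹^(-(p - 1) - 1) by positivity)
    rw [hE]; linarith
  have g1 := h1 s m w Ψ hs3 hmB (by
    have := abs_add_le q Ψ
    rw [sub_add_cancel, abs_of_pos hΨ0] at this; linarith) (by
    rw [abs_of_pos hΨ0]; linarith [abs_nonneg q])
  have g2 := h2 s (X s) Z hs4 hX1 hX2 hZl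
  rw [← hβ] at g2
  have hXZ : |X s - Z| ≤ k * s⁻¹ * ((1 + 2 * l) * (1 + N)) := by
    rw [abs_sub_comm, hZe, add_sub_cancel_left, abs_mul, abs_of_nonneg hc]
    refine mul_le_mul (by rwa [← div_eq_mul_inv, le_div_iff₀ hs0]) ?_ (abs_nonneg _) (by positivity)
    rw [abs_le]; constructor <;> nlinarith [mul_nonneg hl hN]
  have hs5 : s^(-a - 1) * s⁻¹ ≤ s^(-(2 : ℝ)) := by
    rw [← rpow_neg_one, ← rpow_add hs0]
    exact rpow_le_rpow_of_exponent_le (by linarith) (by linarith)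
  have hsa : s^(-a) ≤ s^(-(min a 1)) :=
    rpow_le_rpow_of_exponent_le (by linarith) (neg_le_neg (min_le_left _ _))
  have g3 : C2 * s^(-a - 1) * |X s - Z| ≤ C2 * k * (1 + 2 * l) * s^(-(2 : ℝ)) * (1 + N) := by
    calc _ ≤ C2 * s^(-a - 1) * (k * s⁻¹ * ((1 + 2 * l) * (1 + N))) :=
          mul_le_left hXZ (by positivity)
      _ = C2 * k * (1 + 2 * l) * (s^(-a - 1) * s⁻¹) * (1 + N) := by ring
      _ ≤ _ := by gcongr
  have g4 : β * (β + 1) * Z^(-β - 2) * (4 * c^2 * N) ≤ A * (4 * k^2) * s^(-(2 : ℝ)) * (1 + N) := by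
    have h3 : Z^(-β - 2) ≤ lo^(-β - 2) := rpow_le_rpow_of_nonpos hlo0 hZl (by linarith)
    have h4 : c^2 ≤ k^2 * s^(-(2 : ℝ)) := by
      rw [rpow_neg hs0.le, rpow_two, ← div_eq_mul_inv, le_div_iff₀ (by positivity), ← mul_pow]
      gcongr
    calc _ ≤ β * (β + 1) * lo^(-β - 2) * (4 * (k^2 * s^(-(2 : ℝ))) * (1 + N)) := by
          gcongr; linarith
      _ = _ := by rw [hA]; ring
  have g4' : 0 ≤ β * (β + 1) * Z^(-β - 2) * (4 * c^2 * N) := by positivity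
  refine ⟨hZl, hqM.trans ?_, ?_⟩
  · linarith [show 0 ≤ p * E * (D * d0 + 1) + C1 + C2 * k * (1 + 2 * l) + A * (4 * k^2) by positivity]
  have e1 := gh_rpow (a := a) (μ := μ) hp s hZ0
  rw [← hβ, ← hΨ] at e1
  have hZp : 0 < Z^(-β - 1) := rpow_pos_of_pos hZ0 _
  rw [← abs_of_pos hZp, ← abs_mul] at g2
  set F1 := mf a μ (exp (β * s) * X s^(-β))
  rw [← hΨ] at g2
  set F2 := mf a μ (exp (β * s) * Ψ)
  set G := β * (β + 1) * Z^(-β - 2) * (4 * c^2 * N)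
  rw [show gh p a μ s w - (Z^(-β - 1) * F1 - G) = (gh p a μ s w - gh p a μ s Ψ) -
    Z^(-β - 1) * (F1 - F2) + G by rw [e1]; ring]
  refine (abs_add_le _ _).trans ?_
  rw [abs_of_nonneg g4']
  have g5 := abs_sub (gh p a μ s w - gh p a μ s Ψ) (Z^(-β - 1) * (F1 - F2))
  have g6 : p * m^(p - 1) + C1 * s^(-a) ≤ 1 + β +
      (p * E * (D * d0 + 1) + C1) * (s^(-(min a 1)) + |q|) := by
    have h3 := mul_le_left hmp (show 0 ≤ p by linarith)
    have h4 := mul_le_left hsa hC1.le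
    have h5 : 0 ≤ p * E * s^(-(min a 1)) := by positivity
    have h6 : 0 ≤ p * E * (D * d0) * |q| + C1 * |q| := by positivity
    rw [mul_add, hpp, hd] at h3
    linarith
  have g7 := g1.trans (mul_le_right g6 (abs_nonneg q))
  have h8 : 0 ≤ (C2 * k * (1 + 2 * l) + A * (4 * k^2) + (M + lo^(-β))) *
    ((s^(-(min a 1)) + |q|) * |q|) := by positivity
  have h9 : 0 ≤ (p * E * (D * d0 + 1) + C1 + (M + lo^(-β))) * (s^(-(2 : ℝ)) * (1 + N)) := by
    positivity
  linarith

theorem OU_exp_normsq (A g) (y : EE n) : OU (fun y => exp (A + g * ‖y‖^2)) y =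
    exp (A + g * ‖y‖^2) * (2 * n * g + 4 * g^2 * ‖y‖^2 - g * ‖y‖^2) := by
  have hd : Differentiable ℝ fun y : EE n => A + g * ‖y‖^2 :=
    (((contDiff_norm_sq ℝ (n := 1)).differentiable (by simp)).const_mul g).const_add A
  have h1 : ∀ (i) x, pd i (fun y => exp _) x =
      exp _ * (g * (2 * x i)) := fun i x => by
    rw [pd_comp (Real.hasDerivAt_exp _) (hd x), pd_add (by fun_prop)
      (((contDiff_norm_sq ℝ (n := 1)).differentiable (by simp) x).const_mul g), pd_const,
      pd_const_mul, pd_normsq, zero_add]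
  have h2 : ∀ i, pd i (pd i (fun y => exp _)) y =
      exp _ * (2 * g + 4 * g^2 * y i^2) := fun i => by
    rw [funext (h1 i), pd_mul (hd y).exp (by fun_prop), h1, pd_const_mul, pd_const_mul, pd_coord,
      if_pos rfl]
    ring
  rw [OU, lap_eq]
  simp only [h1, h2]
  set E := exp _
  rw [Finset.sum_congr rfl fun i _ => show y i / 2 * (E * (g * (2 * y i))) = E * g * y i^2 by ring,
    ← Finset.mul_sum, ← Finset.mul_sum, Finset.sum_add_distrib, ← Finset.mul_sum,
    ← Finset.mul_sum, ← EuclideanSpace.real_norm_sq_eq]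
  simp only [Finset.sum_const, Finset.card_univ, Fintype.card_fin]
  ring

theorem barrier_size {q x M1 v L : ℝ} (hx : 0 ≤ x) (hM : 1 ≤ M1) (hν : 0 < v) (hL : 0 < L)
    (hqM : q ≤ M1) (hq : q ≤ exp (-v * L) * exp x) :
    q ≤ 2 * M1 / v * (1 + x) / L := by
  rw [le_div_iff₀ hL, div_mul_eq_mul_div, le_div_iff₀ hν]
  have h0 := mul_pos hν hL
  rcases le_or_gt (v * L / 2) x with h | h
  · have h1 := mul_le_right hqM h0.le
    have h2 := mul_le_left h (show 0 ≤ 2 * M1 by linarith)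
    linarith
  · have h1 : q ≤ (v * L / 2)⁻¹ := by
      refine hq.trans ?_
      rw [← exp_add]
      refine (exp_le_exp.2 (show -v * L + x ≤ -(v * L / 2) by linarith)).trans ?_
      rw [exp_neg]
      exact inv_anti₀ (by positivity) (by linarith [add_one_le_exp (v * L / 2)])
    have h2 := mul_le_right h1 h0.le
    rw [show (v * L / 2)⁻¹ * (v * L) = 2 by field_simp] at h2
    have h3 := mul_nonneg (show 0 ≤ M1 by linarith) hx
    linarith

/-- one-sided Gaussian barrier on a time interval of length `L` -/
theorem exists_barrier (n : ℕ) {C1 M1 v : ℝ} (hC1 : 0 ≤ C1) (hM : 1 ≤ M1) (hν : 0 < v) :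
    ∃ Γ0 : ℝ, 0 < Γ0 ∧ ∀ K, 0 < K → ∃ k : ℝ, 0 < k ∧ ∀ (q H : EE n → ℝ → ℝ) (s0 L i : ℝ),
      0 < L → 0 < i → i * k * exp L ≤ exp (-v * L) →
      ContinuousOn (fun x : EE n × ℝ => q x.1 x.2) (univ ×ˢ Icc s0 (s0 + L)) →
      (∀ s ∈ Icc s0 (s0 + L), ContDiff ℝ 2 (fun y => q y s)) →
      (∀ y, ∀ s ∈ Icc s0 (s0 + L), HasDerivAt (q y) (OU (fun y => q y s) y + H y s) s) →
      (∀ y, ∀ s ∈ Icc s0 (s0 + L), q y s ≤ M1) →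
      (∀ y, q y s0 ≤ K * i * exp (Γ0 * ‖y‖^2)) →
      (∀ y, ∀ s ∈ Icc s0 (s0 + L), 0 ≤ q y s →
        H y s ≤ (1 + C1 / L + C1 * q y s) * q y s + C1 * (i / L) * (1 + ‖y‖^2)) →
      ∀ y, q y (s0 + L) ≤ k * i * exp L * exp (exp (-L) * ‖y‖^2 / 4) := by
  set C2 := C1 * (2 * M1 / v)
  have hC2 : 0 ≤ C2 := by positivity
  set Γ0 := exp (-(C2 + 1)) / 4 with hΓ
  have hΓ0 : 0 < Γ0 := by positivity
  refine ⟨Γ0, hΓ0, fun K hK => ?_⟩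
  set k0 := max (K + 1) Γ0⁻¹ 
  have hk0 : 0 < k0 := lt_max_of_lt_right (by positivity)
  have hkΓ : 1 ≤ k0 * Γ0 := by
    have := mul_le_right (le_max_right (K + 1) Γ0⁻¹) hΓ0.le
    rwa [inv_mul_cancel₀ hΓ0.ne'] at this
  set C3 := 2 * C1 + C2 + 1
  refine ⟨k0 * exp (C3 + n), by positivity, fun q H s0 L i hL hε hεk hqc hq2 hqd hqM hq0 hH => ?_⟩
  set r : ℝ → ℝ := fun s => exp (-(s - s0))
  set h : ℝ → ℝ := fun s => s - s0 + C3 / L * (s - s0) + n * (1 - r s)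
  set Z : ℝ → ℝ := fun s => Γ0 * exp (C2 / L * (s - s0) + (1 - r s))
  set g : ℝ → ℝ := fun s => Z s * r s
  set Y : EE n → ℝ → ℝ := fun y s => i * k0 * exp (h s + g s * ‖y‖^2)
  have dr : ∀ s, HasDerivAt r (-r s) s := fun s => by
    simpa [r] using (((hasDerivAt_id' s).sub_const s0).neg).exp
  have dσ := fun s => (hasDerivAt_id' s).sub_const s0
  have dh : ∀ s, HasDerivAt h (1 + C3 / L + n * r s) s := fun s => by
    refine (((dσ s).fun_add ((dσ s).const_mul (C3 / L))).fun_add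
      (((dr s).const_sub 1).const_mul (n : ℝ))).congr_deriv ?_
    ring
  have dΓ : ∀ s, HasDerivAt Z (Z s * (C2 / L + r s)) s := fun s => by
    refine ((((dσ s).const_mul (C2 / L)).fun_add ((dr s).const_sub 1)).exp.const_mul Γ0).congr_deriv ?_
    simp only [Z]; ring
  have dg : ∀ s, HasDerivAt g (g s * (C2 / L + r s - 1)) s := fun s =>
    ((dΓ s).fun_mul (dr s)).congr_deriv (by simp only [g]; ring)
  have r0 : ∀ s, 0 < r s := fun s => exp_pos _
  have r1 : ∀ s, s0 ≤ s → r s ≤ 1 := fun s hs => exp_le_one_iff.2 (by linarith)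
  have Γlo : ∀ s, s0 ≤ s → Γ0 ≤ Z s := fun s hs => by
    have := sub_nonneg.2 hs
    have : 0 ≤ C2 / L * (s - s0) := by positivity
    exact le_mul_of_one_le_right hΓ0.le (one_le_exp (by linarith [r1 s hs]))
  have Γhi : ∀ s, s ≤ s0 + L → Z s ≤ 1 / 4 := fun s hs => by
    have h1 : C2 / L * (s - s0) ≤ C2 := by
      rw [div_mul_eq_mul_div, div_le_iff₀ hL]
      gcongr; linarith
    refine (mul_le_left (exp_le_exp.2 (by linarith [r0 s] : _ ≤ C2 + 1)) hΓ0.le).trans ?_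
    rw [hΓ, div_mul_eq_mul_div, ← exp_add, neg_add_cancel, exp_zero]
  have g0 : ∀ s, s0 ≤ s → 0 ≤ g s := fun s hs => mul_nonneg (hΓ0.le.trans (Γlo s hs)) (r0 s).le
  have hhi : ∀ s, s0 ≤ s → s ≤ s0 + L → h s ≤ L + C3 + n := fun s hs hs' => by
    have h1 : C3 / L * (s - s0) ≤ C3 := by
      rw [div_mul_eq_mul_div, div_le_iff₀ hL]
      gcongr; linarith
    have := mul_nonneg n.cast_nonneg (r0 s).le
    simp only [h]; linarith
  have hlo : ∀ s, s0 ≤ s → s - s0 ≤ h s := fun s hs => by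
    have h1 := mul_nonneg (show 0 ≤ C3 / L by positivity) (sub_nonneg.2 hs)
    have := mul_nonneg n.cast_nonneg (sub_nonneg.2 (r1 s hs))
    simp only [h]; linarith
  have Ypos : ∀ y s, 0 < Y y s := fun y s => by positivity
  have Ylo : ∀ y s, s0 ≤ s → i * (1 + ‖y‖^2) ≤ Y y s := fun y s hs => by
    have h1 : exp (s - s0) * (1 + g s * ‖y‖^2) ≤ exp (h s + g s * ‖y‖^2) := by
      have := g0 s hs
      rw [exp_add]
      gcongr
      · exact hlo s hs
      · linarith [add_one_le_exp (g s * ‖y‖^2)]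
    have h2 : exp (s - s0) * g s = Z s := by
      simp only [g, r]
      rw [mul_left_comm, ← exp_add, add_neg_cancel, exp_zero, mul_one]
    have h3 : Γ0 * (1 + ‖y‖^2) ≤ exp (s - s0) * (1 + g s * ‖y‖^2) := by
      have := mul_le_right (Γlo s hs) (sq_nonneg ‖y‖)
      have := one_le_exp (sub_nonneg.2 hs)
      rw [mul_one_add (exp _), ← mul_assoc _ (g s), h2]
      linarith [mul_le_left (sq_nonneg ‖y‖) hΓ0.le, Γhi s0 (by linarith), Γlo s0 le_rfl]
    calc i * (1 + ‖y‖^2) ≤ i * ((k0 * Γ0) * (1 + ‖y‖^2)) := by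
          gcongr
          exact le_mul_of_one_le_left (by positivity) hkΓ
      _ = i * k0 * (Γ0 * (1 + ‖y‖^2)) := by ring
      _ ≤ _ := mul_le_left (h3.trans h1) (by positivity)
  have hexp : i * k0 * exp (L + C3 + n) ≤ exp (-v * L) := by
    rw [show L + C3 + n = (C3 + n) + L by ring, exp_add]; linarith
  have key := pos_of_source_pos (D := fun y s => Y y s + (-1) * q y s)
    (G := fun y s => Y y s * (1 + C3 / L + n * r s - 2 * n * g s +
      g s * ‖y‖^2 * (C2 / L + r s - 4 * g s)) - H y s) (α := s0) (β := s0 + L)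
    (r := M1 / (i * (k0 * (Γ0 * exp (-L)))) + 1) ?_ ?_ ?_ ?_ ?_ ?_
  · intro y
    have hL' : s0 ≤ s0 + L := by linarith
    have h2 : Y y (s0 + L) ≤
        k0 * exp (C3 + n) * i * exp L * exp (exp (-L) * ‖y‖^2 / 4) := by
      have h3 : g (s0 + L) ≤ 1 / 4 * exp (-L) := by
        simpa [g, r] using mul_le_right (Γhi (s0 + L) le_rfl) (r0 (s0 + L)).le
      have h4 : exp (h (s0 + L) + g (s0 + L) * ‖y‖^2) ≤
          exp ((C3 + n) + L + exp (-L) * ‖y‖^2 / 4) :=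
        exp_le_exp.2 (by nlinarith [hhi _ hL' le_rfl, sq_nonneg ‖y‖])
      rw [exp_add (C3 + n + L), exp_add (C3 + n)] at h4
      exact (mul_le_left h4 (by positivity)).trans (by linarith)
    linarith [key y (s0 + L) ⟨hL', le_rfl⟩]
  · have hrc : Continuous r := by fun_prop
    refine ContinuousOn.add (Continuous.continuousOn ?_) (hqc.const_smul (-1 : ℝ))
    fun_prop
  · intro s hs
    refine ContDiff.add ?_ (contDiff_const.mul (hq2 s hs))
    exact contDiff_const.mul ((contDiff_const.add (contDiff_const.mul (contDiff_norm_sq ℝ))).exp)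
  · intro y s hs
    have h1 : HasDerivAt (Y y) _ s :=
      ((dh s).fun_add ((dg s).mul_const (‖y‖^2))).exp.const_mul (i * k0)
    refine (h1.fun_add ((hqd y s hs).const_mul (-1))).congr_deriv ?_
    rw [OU_add (contDiff_const.mul ((contDiff_const.add (contDiff_const.mul
      (contDiff_norm_sq ℝ))).exp)) (contDiff_const.mul (hq2 s hs)), OU_const_mul, OU_const_mul,
      OU_exp_normsq]
    ring
  · intro y
    have h2 : K * i * exp (Γ0 * ‖y‖^2) < i * k0 * exp (Γ0 * ‖y‖^2) := by
      have := le_max_left (K + 1) Γ0⁻¹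
      rw [mul_comm i]
      gcongr
      linarith
    simp [Y, h, g, Z, r]
    linarith [hq0 y]
  · intro y s hs hD
    have h2 : i * (k0 * (Γ0 * exp (-L))) * ‖y‖^2 ≤ Y y s := by
      have h3 : Γ0 * exp (-L) ≤ g s :=
        mul_le_mul (Γlo s hs.1) (exp_le_exp.2 (by linarith [hs.2])) (exp_pos _).le
          (hΓ0.le.trans (Γlo s hs.1))
      have h4 := mul_le_right h3 (sq_nonneg ‖y‖)
      have h5 := add_one_le_exp (h s + g s * ‖y‖^2)
      have h6 := mul_le_left (show Γ0 * exp (-L) * ‖y‖^2 ≤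
        exp (h s + g s * ‖y‖^2) by linarith [hlo s hs.1, hs.1]) (mul_pos hε hk0).le
      simp only [Y]; linarith
    have h3 : ‖y‖^2 ≤ M1 / (i * (k0 * (Γ0 * exp (-L)))) := by
      rw [le_div_iff₀ (by positivity)]; linarith [hqM y s hs]
    nlinarith [sq_nonneg (‖y‖ - 1)]
  · intro y s hs hD
    have e : q y s = Y y s := by linarith
    have hx : 0 ≤ g s * ‖y‖^2 := mul_nonneg (g0 s hs.1) (sq_nonneg _)
    have h1 : q y s ≤ 2 * M1 / v * (1 + g s * ‖y‖^2) / L := by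
      refine barrier_size hx hM hν hL (hqM y s hs) ?_
      simp only [e, Y]
      rw [exp_add, ← mul_assoc]
      gcongr
      exact (mul_le_left (exp_le_exp.2 (hhi s hs.1 hs.2)) (by positivity)).trans hexp
    have h2 := hH y s hs (e ▸ (Ypos y s).le)
    have h3 : C1 * q y s ≤ C2 * (1 + g s * ‖y‖^2) / L := by
      refine (mul_le_left h1 hC1).trans_eq ?_
      ring
    have h4 : C1 * (i / L) * (1 + ‖y‖^2) ≤ C1 / L * Y y s :=
      (mul_le_left (Ylo y s hs.1) (show 0 ≤ C1 / L by positivity)).trans_eq' (by ring)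
    have hgr : 0 ≤ r s - 4 * g s := by
      simp only [g]; linarith [mul_le_right (Γhi s hs.2) (r0 s).le]
    have h5 : 0 ≤ (n : ℝ) * (r s - 2 * g s) := mul_nonneg n.cast_nonneg (by linarith [r0 s])
    have h6 := mul_nonneg hx hgr
    have h7 : H y s ≤ (1 + C1 / L + C2 * (1 + g s * ‖y‖^2) / L + C1 / L) * Y y s := by
      have := mul_le_right h3 (Ypos y s).le
      rw [e] at h2 this
      linarith
    have h8 : 1 + C1 / L + C2 * (1 + g s * ‖y‖^2) / L + C1 / L < 1 + C3 / L + n * r s - 2 * n * g s +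
        g s * ‖y‖^2 * (C2 / L + r s - 4 * g s) := by
      have h9 : C3 / L = 2 * (C1 / L) + C2 / L + 1 / L := by ring
      have h10 : C2 * (1 + g s * ‖y‖^2) / L = C2 / L + g s * ‖y‖^2 * (C2 / L) := by ring
      have h11 : 0 < 1 / L := by positivity
      rw [h9, h10]; linarith
    rw [mul_comm (Y y s)]
    exact sub_pos.2 (h7.trans_lt (mul_lt_mul_of_pos_right h8 (Ypos y s)))

/-- `v` in self-similar variables with amplitude exponent `q` -/
def resc (q T : ℝ) (b : EE n) (v : EE n → ℝ → ℝ) (y : EE n) (s : ℝ) : ℝ :=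
  exp (-q * s) * v (b + exp (-s / 2) • y) (T - exp (-s))

theorem RSol.continuousOn {K : ℝ} {f : EE n → ℝ → ℝ} (h : RSol α β u f K) :
    ContinuousOn (fun q => u q.1 q.2) (univ ×ˢ Ioo α β) :=
  continuousOn_of_bound fun ε hε => ⟨K, fun x y t ht s hs => by
    have := abs_sub_le (u x t) (u y t) (u y s)
    have := h.lipx t ht x y
    have := h.lipt y t ht s hs
    linarith⟩

theorem Yf_resc (X) (l c T) (e) (b y : EE n) (s) :
    Yf X l c T e b (b + exp (-s / 2) • y) (T - exp (-s)) =
      exp (-s) * (X s + c * (Nl e y - 2 * l)) := by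
  rw [Yf, sub_sub_cancel, log_exp, neg_neg, add_sub_cancel_left, Nl_smul, ← exp_nat_mul]
  ring

/-- the error `w - Ψ` solves the rescaled equation with an almost linear source -/
theorem exists_error_flow {C0 s0 s2 l k : ℝ}
    (hP : Prof p a μ X C0 s0) (hp : 1 < p) (ha : 0 < a) (hT : 0 < T) (hu : SolvesU n p a μ T u)
    (hM : 0 < M) (hw : ∀ s, s2 ≤ s → ∀ b y, |wSelf n p T u b y s| ≤ M)
    (he : ∀ j, e j^2 = e j) (hl : ∑ j, e j = l) (hl0 : 0 ≤ l) (hk : 0 ≤ k) :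
    ∃ C s3, 0 < C ∧ s0 ≤ s3 ∧ ∀ (b : EE n) (c s1 S : ℝ), s3 ≤ s1 → s1 ≤ S → 0 ≤ c → c * S ≤ k →
      ∃ v f α β, PSol α β v f ∧ α < T - exp (-s1) ∧ T - exp (-S) < β ∧
      ContinuousOn (fun x : EE n × ℝ => resc (1 / (p - 1)) T b v x.1 x.2)
        (univ ×ˢ Icc s1 S) ∧
      (∀ s ∈ Icc s1 S, ContDiff ℝ 2 fun y => resc (1 / (p - 1)) T b v y s) ∧
      (∀ y, ∀ s ∈ Icc s1 S, HasDerivAt (resc (1 / (p - 1)) T b v y)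
        (OU (fun y => resc (1 / (p - 1)) T b v y s) y + (resc (1 / (p - 1) + 1) T b f y s -
          1 / (p - 1) * resc (1 / (p - 1)) T b v y s)) s) ∧
      ∀ y, ∀ s ∈ Icc s1 S, (p - 1) / 2 ≤ X s + c * (Nl e y - 2 * l) ∧
        resc (1 / (p - 1)) T b v y s =
          wSelf n p T u b y s - (X s + c * (Nl e y - 2 * l))^(-(1 / (p - 1))) ∧
        |resc (1 / (p - 1)) T b v y s| ≤ C ∧
        |resc (1 / (p - 1) + 1) T b f y s| ≤ (1 + 1 / (p - 1) + C * (s^(-(min a 1)) +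
          |resc (1 / (p - 1)) T b v y s|)) * |resc (1 / (p - 1)) T b v y s| +
          C * s^(-(2 : ℝ)) * (1 + ‖y‖^2) := by
  have hp1 := sub_pos.2 hp
  set θ := 1 / (p - 1) with hθ
  have hθ0 : 0 < θ := by positivity
  obtain ⟨C, s3, hC, hs3, H⟩ := exists_source_le (μ := μ) hP hp ha hl0 hk hM.le
  refine ⟨C, max (max (s3 + 1) s2) (max (2 - log T) (8 * l * k / (p - 1))), hC,
    hs3.trans ((le_max_left _ _).trans' (le_max_left _ _) |>.trans' (by linarith)),
    fun b c s1 S hs1 hS hc hck => ?_⟩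
  have h1 := ((le_max_left _ _).trans (le_max_left _ _)).trans hs1
  have h2 := ((le_max_right _ _).trans (le_max_left _ _)).trans hs1
  have h3 := ((le_max_left _ _).trans (le_max_right _ _)).trans hs1
  have h4 := ((le_max_right _ _).trans (le_max_right _ _)).trans hs1
  have h0 : 1 ≤ s1 := by linarith [hP.one_le]
  set α := T - exp (-(s1 - 1)) with hα
  set β := T - exp (-(S + 1)) with hβ
  have hα0 : 0 < α := by
    have : exp (-(s1 - 1)) < exp (log T) := exp_lt_exp.2 (by linarith)
    rw [exp_log hT] at this
    linarith
  have hβT : β < T := sub_lt_self _ (exp_pos _)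
  obtain ⟨K, hR⟩ := exists_rsol (μ := μ) hp ha hu hα0 hβT
  have hlc : 2 * l * c ≤ (p - 1) / 4 := by
    rw [div_le_iff₀ hp1] at h4
    have h5 : c * S * (2 * l) ≤ k * (2 * l) := by gcongr
    have h6 := mul_le_right hS hp1.le
    have h7 : 2 * l * c * S ≤ (p - 1) / 4 * S := by linarith
    exact le_of_mul_le_mul_right h7 (by linarith)
  have hV := (hR.toPSol_gf hp).sub (hP.psol hp ha he hl hc hlc b hβT (α := α)
    (sub_le_sub_left (exp_le_exp.2 (by linarith)) _))
  have hI : ∀ s ∈ Icc s1 S, T - exp (-s) ∈ Ioo α β := fun s hs =>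
    ⟨sub_lt_sub_left (exp_lt_exp.2 (by linarith [hs.1])) _,
      sub_lt_sub_left (exp_lt_exp.2 (by linarith [hs.2])) _⟩
  have hE := (hV.toSSol b T hI).exp_mul θ (R := 1) fun s hs =>
    exp_le_one_iff.2 (by have := mul_nonneg hθ0.le (show 0 ≤ s by linarith [hs.1]); linarith)
  have key : ∀ y, ∀ s ∈ Icc s1 S, _ := fun y s hs => H s c (Nl e y) (wSelf n p T u b y s)
    _ _ (by linarith [hs.1]) hc
    ((mul_le_left hs.2 hc).trans hck) (Nl_nonneg he y) (hw s (by linarith [hs.1]) b y)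
    rfl rfl
  have er : ∀ r y, ∀ s ∈ Icc s1 S,
      (Yf X l c T e b _ (T - exp (-s)))^r =
        exp (-r * s) * (X s + c * (Nl e y - 2 * l))^r := fun r y s hs => by
    rw [Yf_resc, mul_rpow (exp_pos _).le (by linarith [(key y s hs).1]), ← exp_mul]
    congr 2; ring
  have eq : ∀ y, ∀ s ∈ Icc s1 S, resc θ T b (fun x t => u x t - Yf X l c T e b x t^(-θ)) y s =
      wSelf n p T u b y s - (X s + c * (Nl e y - 2 * l))^(-θ) := fun y s hs => by
    rw [resc, er _ y s hs, wSelf_eq, mul_sub, ← mul_assoc, ← exp_add, ← hθ,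
      show -θ * s + - -θ * s = 0 by ring, exp_zero, one_mul]
  have eG : ∀ y, ∀ s ∈ Icc s1 S, resc (θ + 1) T b
      (fun x t => gf p a μ (u x t) - Ff p a μ X l c T e b x t) y s =
      gh p a μ s (wSelf n p T u b y s) - ((X s + c * (Nl e y - 2 * l))^(-θ - 1) *
        mf a μ _ - θ * (θ + 1) *
        (X s + c * (Nl e y - 2 * l))^(-θ - 2) * (4 * c^2 * Nl e y)) := fun y s hs => by
    have e1 : exp (-(θ + 1) * s) * exp (-(-θ - 1) * s) = 1 := by
      rw [← exp_add, show -(θ + 1) * s + -(-θ - 1) * s = 0 by ring, exp_zero]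
    have e2 : exp (-(θ + 1) * s) * exp (-(-θ - 2) * s) * exp (-s) = 1 := by
      rw [← exp_add, ← exp_add, show -(θ + 1) * s + -(-θ - 2) * s + -s = 0 by ring, exp_zero]
    have e3 : exp (-(θ + 1) * s) = exp (-p / (p - 1) * s) := by rw [hθ]; congr 2; field_simp; ring
    rw [resc, Ff, ← hθ, er _ y s hs, er _ y s hs, sub_sub_cancel, log_exp, neg_neg,
      add_sub_cancel_left, Nl_smul, ← exp_nat_mul, gh, wSelf_eq, ← hθ,
      ← mul_assoc (exp (θ * s)), ← exp_add, show θ * s + -θ * s = 0 by ring, exp_zero,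
      one_mul, show ((2 : ℕ) : ℝ) * (-s / 2) = -s by push_cast; ring, ← e3]
    linear_combination (-(X s + c * (Nl e y - 2 * l))^(-θ - 1) *
      mf a μ _) * e1 + (θ * (θ + 1) *
        (X s + c * (Nl e y - 2 * l))^(-θ - 2) * (4 * c^2 * Nl e y)) * e2
  refine ⟨_, _, α, β, hV, (hI s1 ⟨le_rfl, hS⟩).1, (hI S ⟨hS, le_rfl⟩).2, ?_, hE.c2,
    fun y s hs => ?_, fun y s hs => ?_⟩
  · have h5 : ContinuousOn (fun x : EE n × ℝ => X x.2) (univ ×ˢ Icc s1 S) := fun x hx =>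
      (((hP.deriv x.2 (by linarith [hx.2.1])).continuousAt).comp continuousAt_snd).continuousWithinAt
    have h6 := (Nl_contDiff e).continuous
    refine ContinuousOn.congr ?_ fun x hx => (eq x.1 x.2 hx.2).trans (by rw [wSelf_eq])
    refine (ContinuousOn.mul (by fun_prop) (hR.continuousOn.comp (f := fun x : EE n × ℝ => (b + exp (-x.2 / 2) • x.1,
        T - exp (-x.2))) (by fun_prop) fun x hx => ⟨trivial, hI _ hx.2⟩)).sub (ContinuousOn.rpow_const (h5.add (by fun_prop))
      fun x hx => Or.inl (by linarith [(key x.1 x.2 hx.2).1]))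
  · refine (hE.ws y s hs).congr_deriv ?_
    rw [resc, ← mul_assoc (exp (-θ * s)), ← exp_add]
    congr 4; ring
  · obtain ⟨k1, k2, k3⟩ := key y s hs
    rw [eG y s hs, eq y s hs]
    refine ⟨k1, rfl, k2, k3.trans (add_le_add_right (mul_le_left ?_ ?_) _)⟩
    · linarith [Nl_le he y]
    · have := rpow_nonneg (show 0 ≤ s by linarith [hs.1]) (-(2 : ℝ)); positivity

theorem rpow_neg_le_of_half_le {S r : ℝ} (hS : 0 < S) (hs : S / 2 ≤ s) (hr : 0 ≤ r) :
    s^(-r) ≤ 2^r * S^(-r) := by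
  refine (rpow_le_rpow_of_nonpos (by positivity) hs (by linarith)).trans_eq ?_
  rw [div_rpow hS.le (by norm_num), rpow_neg (by norm_num : (0 : ℝ) ≤ 2), div_inv_eq_mul, mul_comm]

theorem eventually_scales {v : ℝ} (hν : 0 < v) (R A k) : ∀ᶠ S in atTop,
    1 ≤ log S ∧ log S + R ≤ S / 2 ∧ A ≤ S / 2 ∧ k * log S ≤ S^v := by
  have h1 := (isLittleO_log_rpow_atTop hν).def (c := (|k| + 1)⁻¹) (by positivity)
  have h2 := isLittleO_log_id_atTop.def (c := 1 / 4) (by norm_num)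
  filter_upwards [h1, h2, tendsto_log_atTop.eventually_ge_atTop 1, eventually_ge_atTop (4 * R),
    eventually_ge_atTop (2 * A), eventually_gt_atTop 0] with S h1 h2 h3 h4 h5 h6
  rw [norm_of_nonneg (by linarith), norm_of_nonneg (rpow_nonneg h6.le _),
    inv_mul_eq_div, le_div_iff₀ (by positivity)] at h1
  rw [norm_of_nonneg (by linarith), norm_of_nonneg (show 0 ≤ id S from h6.le), id] at h2
  refine ⟨h3, by linarith, by linarith, ?_⟩
  nlinarith [le_abs_self k]

theorem Prof.exists_taylor {C0 s0 : ℝ} (hP : Prof p a μ X C0 s0) (hp : 1 < p) {l : ℝ}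
    (hl : 0 ≤ l) : ∃ D, 0 ≤ D ∧ ∀ s c N Y, s0 ≤ s → c = (p - 1)^2 / (4 * p * s) → 0 ≤ N → 1 + N ≤ Y →
      (p - 1) / 2 ≤ X s + c * (N - 2 * l) →
      |(X s + c * (N - 2 * l))^(-(1 / (p - 1))) - X s^(-(1 / (p - 1))) +
        (p - 1)^(-(1 / (p - 1))) / (4 * p * s) * (N - 2 * l)| ≤
      D * (s^(-(a + 1)) + s^(-(2 : ℝ))) * Y^2 := by
  have hp1 := sub_pos.2 hp
  have hC := hP.C_pos
  set θ := 1 / (p - 1) with hθ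
  have hθ0 : 0 < θ := by positivity
  set A := θ * ((θ + 1) * ((p - 1) / 2)^(-θ - 2)) with hA
  have hA0 : 0 ≤ A := by positivity
  set m := (p - 1)^2 / (4 * p) * (1 + 2 * l) with hm
  have hm0 : 0 ≤ m := by positivity
  refine ⟨A * (C0 * m + m^2), by positivity, fun s c N Y hs hc hN hY hZ => ?_⟩
  have hs0 : 0 < s := by linarith [hP.one_le]
  have h := abs_rpow_taylor_le hθ0.le (show 0 < (p - 1) / 2 by positivity)
    (show (p - 1) / 2 ≤ p - 1 by linarith) (hP.lb s hs) hZ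
  have e : θ * (p - 1)^(-θ - 1) * (c * (N - 2 * l)) =
      (p - 1)^(-θ) / (4 * p * s) * (N - 2 * l) := by
    rw [rpow_sub hp1, rpow_one, hc, hθ]; field_simp
  rw [e] at h
  have hχ : |c * (N - 2 * l)| ≤ m * s⁻¹ * Y := by
    have h1 : |N - 2 * l| ≤ (1 + 2 * l) * Y := by
      have := mul_nonneg hl (show 0 ≤ Y - 1 by linarith)
      rw [abs_le]; constructor <;> linarith
    have hc0 : c = (p - 1)^2 / (4 * p) * s⁻¹ := by rw [hc]; field_simp
    rw [abs_mul, abs_of_nonneg (show 0 ≤ c by rw [hc]; positivity), hc0, hm]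
    refine (mul_le_left h1 (by positivity)).trans_eq (by ring)
  refine h.trans ?_
  have hX := hP.near s hs
  have e1 : s^(-(a + 1)) = s^(-a) * s⁻¹ := by rw [neg_add, rpow_add hs0, rpow_neg_one]
  have e2 : s^(-(2 : ℝ)) = s⁻¹ * s⁻¹ := by rw [← rpow_neg_one, ← rpow_add hs0]; norm_num
  have ha := rpow_nonneg hs0.le (-a)
  have hi : 0 < s⁻¹ := by positivity
  have hY1 : 1 ≤ Y := by linarith
  rw [e1, e2]
  generalize s^(-a) = x at *
  generalize s⁻¹ = z at *
  calc _ ≤ A * (C0 * x + m * z * Y) * (m * z * Y) := by gcongr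
    _ ≤ A * (C0 * x * Y + m * z * Y) * (m * z * Y) := by
        gcongr A * (?_ + _) * _
        exact le_mul_of_one_le_right (by positivity) hY1
    _ ≤ _ := by
        have h1 : 0 ≤ A * (C0 * m) * (z * z) * Y^2 := by positivity
        have h2 : 0 ≤ A * m^2 * (x * z) * Y^2 := by positivity
        linarith

/-- `L²_ρ` bound for the error from the asymptotic expansion of `w - φ` -/
theorem Prof.exists_l2 {C0 s0 : ℝ} (hP : Prof p a μ X C0 s0) (hp : 1 < p) {l : ℝ}
    (hl : 0 ≤ l) (he : ∀ j, e j^2 = e j) : ∃ D, 0 ≤ D ∧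
      ∀ (w : EE n → ℝ) M s c η, s0 ≤ s → c = (p - 1)^2 / (4 * p * s) → Continuous w → (∀ y, |w y| ≤ M) →
      (∀ y, (p - 1) / 2 ≤ X s + c * (Nl e y - 2 * l)) →
      L2rho n (fun y => w y - X s^(-(1 / (p - 1))) +
        (p - 1)^(-(1 / (p - 1))) / (4 * p * s) * (Nl e y - 2 * l)) ≤ η →
      ∫ y, (w y - (X s + c * (Nl e y - 2 * l))^(-(1 / (p - 1))))^2 * rho n y ≤
        (D * (η + (s^(-(a + 1)) + s^(-(2 : ℝ)))))^2 := by
  obtain ⟨D, hD, H⟩ := hP.exists_taylor hp hl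
  set J := ∫ y : EE n, (1 + ‖y‖)^8 * rho n y
  have hJ : 0 ≤ J := integral_nonneg fun y => mul_nonneg (by positivity) (rho_pos y).le
  refine ⟨2 + 2 * (D^2 * J), by positivity, fun w M s c η hs hc hw hwM hZ hη => ?_⟩
  have hs0 : 0 < s := by linarith [hP.one_le]
  set κ := (p - 1)^(-(1 / (p - 1)))
  set x := X s^(-(1 / (p - 1)))
  set δ := s^(-(a + 1)) + s^(-(2 : ℝ))
  have hδ : 0 ≤ δ := by positivity
  set A : EE n → ℝ := fun y => w y - x + κ / (4 * p * s) * (Nl e y - 2 * l) with hA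
  have hA2 : ∫ y, A y^2 * rho n y ≤ η^2 := by
    rw [← sqrt_le_left ((sqrt_nonneg _).trans hη)]
    exact hη
  have hη0 : 0 ≤ η := (sqrt_nonneg _).trans hη
  have hN := (Nl_contDiff e).continuous
  have iA : Integrable fun y => A y^2 * rho n y := by
    set B := M + |x| + |κ / (4 * p * s)| * (1 + 2 * l)
    refine integrable_of_growth (C := B^2) (m := 4)
      (by fun_prop : Continuous fun y => A y^2).aestronglyMeasurable fun y => ?_
    have h1 : |A y| ≤ B * (1 + ‖y‖)^2 := by
      have h2 : |Nl e y - 2 * l| ≤ (1 + 2 * l) * (1 + ‖y‖)^2 := by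
        have := Nl_nonneg he y
        have := Nl_le he y
        have := norm_nonneg y
        rw [abs_le]; constructor <;> nlinarith
      have h3 := (abs_add_le (w y - x) (κ / (4 * p * s) * (Nl e y - 2 * l))).trans
        (add_le_add (abs_sub (w y) x) (abs_mul _ _).le)
      have h4 := mul_le_left h2 (abs_nonneg (κ / (4 * p * s)))
      have h5 : 0 ≤ (M + |x|) * ((1 + ‖y‖)^2 - 1) := by
        have := (abs_nonneg _).trans (hwM y)
        have := norm_nonneg y
        exact mul_nonneg (by positivity) (by nlinarith)
      have := hwM y
      simp only [hA, B]; linarith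
    rw [abs_of_nonneg (sq_nonneg _), ← sq_abs]
    refine (pow_le_pow_left₀ (abs_nonneg _) h1 2).trans_eq (by ring)
  have i2 := (iA.const_mul 2).fun_add
    (((integrable_pow_mul_rho (n := n) 8)).const_mul (2 * (D * δ)^2))
  refine (integral_mono_of_nonneg (.of_forall fun y => mul_nonneg (sq_nonneg _)
    (rho_pos y).le) i2 (.of_forall fun y => ?_)).trans ?_
  · have h1 := H s c (Nl e y) ((1 + ‖y‖)^2) hs hc (Nl_nonneg he y)
      (by nlinarith [Nl_le he y, norm_nonneg y]) (hZ y)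
    have h2 := pow_le_pow_left₀ (abs_nonneg _) h1 2
    rw [sq_abs] at h2
    set Ψ := (X s + c * (Nl e y - 2 * l))^(-(1 / (p - 1)))
    have h3 : (w y - Ψ)^2 ≤ 2 * A y^2 + 2 * (D * δ)^2 * (1 + ‖y‖)^8 := by
      have e1 : w y - Ψ = A y - (Ψ - x + κ / (4 * p * s) * (Nl e y - 2 * l)) := by
        simp only [hA]; ring
      have h4 := sq_nonneg (A y + (Ψ - x + κ / (4 * p * s) * (Nl e y - 2 * l)))
      rw [e1]
      linarith
    have := mul_le_right h3 (rho_pos y).le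
    simp only
    linarith
  · rw [integral_add (iA.const_mul 2) (((integrable_pow_mul_rho (n := n) 8)).const_mul _),
      integral_const_mul, integral_const_mul]
    set E := D^2 * J with hE
    have hE0 : 0 ≤ E := by positivity
    have h1 : 2 * (D * δ)^2 * J = 2 * E * δ^2 := by rw [hE]; ring
    change _ + 2 * (D * δ)^2 * J ≤ _
    rw [h1, mul_pow]
    have h2 : (2 + 2 * E) * (η^2 + δ^2) ≤ (2 + 2 * E)^2 * (η + δ)^2 := by
      have h3 : η^2 + δ^2 ≤ (η + δ)^2 := by nlinarith [mul_nonneg hη0 hδ]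
      refine mul_le_mul (by nlinarith) h3 (by positivity) (by positivity)
    have h4 : 0 ≤ 2 * E * η^2 + 2 * δ^2 := by positivity
    linarith

/-- the approximate solution is close to the final profile -/
theorem Prof.exists_profile {C0 s0 : ℝ} (hP : Prof p a μ X C0 s0) (hp : 1 < p) {l : ℝ}
    (hl : 0 ≤ l) {R K : ℝ} (hR : 0 ≤ R) (hK : 0 ≤ K) : ∃ C, 0 ≤ C ∧ ∀ S c N, s0 ≤ S → 1 ≤ log S →
      log S + R ≤ S / 2 → 0 ≤ N → N ≤ K → c = (p - 1)^2 / (4 * p * (S - log S - R)) →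
      (p - 1) / 2 ≤ X S + c * (S * N - 2 * l) →
      |(X S + c * (S * N - 2 * l))^(-(1 / (p - 1))) -
        (p - 1)^(-(1 / (p - 1))) * (1 + (p - 1) / (4 * p) * N)^(-(1 / (p - 1)))| ≤
      C * (S^(-a) + log S / S) := by
  have hp1 := sub_pos.2 hp
  set θ := 1 / (p - 1) with hθ
  have hθ0 : 0 < θ := by positivity
  set A := |-θ| * ((p - 1) / 2)^(-θ - 1) with hA
  have hA0 : 0 ≤ A := by positivity
  set m := (p - 1)^2 / (4 * p) with hm
  have hm0 : 0 ≤ m := by positivity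
  refine ⟨A * (C0 + 2 * m * (K * (1 + R) + 2 * l)), by have := hP.C_pos; positivity,
    fun S c N hS hL hLR hN hNK hc hZ => ?_⟩
  have hS0 : 0 < S := by linarith [hP.one_le]
  set L := log S
  have e1 : (p - 1)^(-θ) * (1 + (p - 1) / (4 * p) * N)^(-θ) = (p - 1 + m * N)^(-θ) := by
    rw [← mul_rpow hp1.le (by positivity), hm]; congr 1; field_simp
  have hmN : 0 ≤ m * N := by positivity
  rw [e1]
  refine (abs_rpow_sub_rpow_le (show -θ ≤ 1 by linarith) (show 0 < (p - 1) / 2 by positivity) hZ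
    (by linarith)).trans ?_
  rw [← hA, mul_assoc A]
  refine mul_le_left ?_ hA0
  set σ := S - L - R with hσ
  have hσ0 : 0 < σ := by linarith
  have hcm : c = m / σ := by rw [hc, hm]; field_simp
  have e2 : X S + c * (S * N - 2 * l) - (p - 1 + m * N) =
      (X S - (p - 1)) + m / σ * ((L + R) * N - 2 * l) := by
    rw [hcm]; field_simp; rw [hσ]; ring
  rw [e2]
  have h1 := (abs_add_le (X S - (p - 1)) (m / σ * ((L + R) * N - 2 * l))).trans
    (add_le_add_left (hP.near S hS) _)
  have h2 : |m / σ * ((L + R) * N - 2 * l)| ≤ 2 * m * (K * (1 + R) + 2 * l) * (L / S) := by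
    rw [abs_mul, abs_of_nonneg (by positivity)]
    have h3 : m / σ ≤ 2 * m / S := by
      rw [div_le_div_iff₀ hσ0 hS0]
      have := mul_le_left (show S ≤ 2 * σ by linarith) hm0
      linarith
    have h4 : |(L + R) * N - 2 * l| ≤ (K * (1 + R) + 2 * l) * L := by
      have h5 : (L + R) * N ≤ (1 + R) * L * K := by
        refine mul_le_mul ?_ hNK hN (by positivity)
        have := mul_le_left hL hR
        linarith
      have h6 := mul_le_left hL hl
      have h7 : 0 ≤ (L + R) * N := by positivity
      rw [abs_le]; constructor <;> linarith
    refine (mul_le_mul h3 h4 (abs_nonneg _) (by positivity)).trans_eq (by ring)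
  have h3 : 0 ≤ C0 * (L / S) := by have := hP.C_pos; positivity
  have h4 : 0 ≤ 2 * m * (K * (1 + R) + 2 * l) * S^(-a) := by positivity
  linarith

theorem scale_facts {v S k : ℝ} (hν : 0 < v) (hνa : 2 * v ≤ a) (hν1 : 2 * v ≤ 1) (hk : 0 ≤ k)
    (hL : 1 ≤ log S) (hS : 1 ≤ S) (h : max 1 (2 * k) * log S ≤ S^v) (hs : S / 2 ≤ s) :
    s^(-(2 * v)) ≤ 4 / log S ∧
    s^(-(2 : ℝ)) ≤ 4 * ((S^(-(a + 1)) + S^(-(2 : ℝ)) * log S) / log S) ∧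
    (S^(-(a + 1)) + S^(-(2 : ℝ)) * log S) * k * exp (log S) ≤
      exp (-v * log S) := by
  have hS0 : 0 < S := by linarith
  have hn := rpow_pos_of_pos hS0 (-v)
  have e2 : S^(-v) * S^v = 1 := by rw [← rpow_add hS0, neg_add_cancel, rpow_zero]
  have h1 := mul_le_left h hn.le
  rw [e2] at h1
  set L := log S
  have hL0 : 0 < L := by linarith
  have h2 : S^(-v) * L ≤ 1 := by
    refine le_trans ?_ h1
    gcongr
    exact le_mul_of_one_le_left hL0.le (le_max_left _ _)
  have h3 : S^(-v) * (2 * k * L) ≤ 1 := by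
    refine le_trans ?_ h1
    gcongr
    exact le_max_right _ _
  refine ⟨?_, ?_, ?_⟩
  · rw [le_div_iff₀ hL0]
    have h5 : (2 : ℝ)^(2 * v) ≤ 2 := by
      simpa using rpow_le_rpow_of_exponent_le (by norm_num) hν1
    have h7 := (rpow_neg_le_of_half_le hS0 hs (show 0 ≤ 2 * v by linarith)).trans (mul_le_mul h5 (rpow_le_rpow_of_exponent_le hS (by linarith) : S^(-(2 * v)) ≤ S^(-v)) (by positivity) (by norm_num))
    have := mul_le_right h7 hL0.le
    linarith
  · refine (rpow_neg_le_of_half_le hS0 hs (by norm_num)).trans ?_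
    rw [add_div, mul_div_cancel_right₀ _ hL0.ne']
    have : 0 ≤ S^(-(a + 1)) / L := by positivity
    linarith
  · rw [exp_log hS0, (show exp (-v * log S) = S^(-v) by rw [rpow_def_of_pos hS0, mul_comm])]
    have h4 : S^(-(a + 1)) * S ≤ S^(-v) * S^(-v) := by
      rw [← rpow_add_one hS0.ne', ← rpow_add hS0]
      exact rpow_le_rpow_of_exponent_le hS (by linarith)
    have h5 : S^(-(2 : ℝ)) * S ≤ S^(-v) * S^(-v) := by
      rw [← rpow_add_one hS0.ne', ← rpow_add hS0]
      exact rpow_le_rpow_of_exponent_le hS (by linarith)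
    have h6 : S^(-(a + 1)) * S + S^(-(2 : ℝ)) * S * L ≤ S^(-v) * S^(-v) * (2 * L) := by
      have := mul_le_right h5 hL0.le
      have := mul_le_left hL (mul_pos hn hn).le
      linarith
    calc _ = k * (S^(-(a + 1)) * S + S^(-2) * S * L) := by ring
      _ ≤ k * (S^(-v) * S^(-v) * (2 * L)) := mul_le_left h6 hk
      _ = S^(-v) * (S^(-v) * (2 * k * L)) := by ring
      _ ≤ S^(-v) * 1 := mul_le_left h3 hn.le
      _ = _ := mul_one _

/-- convergence to the profile on `‖y‖ ≤ K √S`, in terms of the approximate solution -/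
theorem exists_error_bound {C0 s0 s2 l s5 C5 : ℝ}
    {b : EE n} (hP : Prof p a μ X C0 s0) (hp : 1 < p) (ha : 0 < a) (hT : 0 < T)
    (hu : SolvesU n p a μ T u) (hM : 0 < M) (hw : ∀ s, s2 ≤ s → ∀ b y, |wSelf n p T u b y s| ≤ M)
    (he : ∀ j, e j^2 = e j) (hl : ∑ j, e j = l) (hl0 : 0 ≤ l) (hC5 : 0 < C5)
    (hcase : ∀ s, s5 ≤ s → L2rho n (fun y => wSelf n p T u b y s - X s^(-(1 / (p - 1))) +
      (p - 1)^(-(1 / (p - 1))) / (4 * p * s) * (Nl e y - 2 * l)) ≤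
      C5 * (s^(-(a + 1)) + s^(-(2 : ℝ)) * log s)) :
    ∃ C R S0, 0 < C ∧ 0 ≤ R ∧ s0 ≤ S0 ∧ ∀ S c, S0 ≤ S → c = (p - 1)^2 / (4 * p * (S - log S - R)) →
      1 ≤ log S ∧ log S + R ≤ S / 2 ∧ ∀ y, (p - 1) / 2 ≤ X S + c * (Nl e y - 2 * l) ∧
      |wSelf n p T u b y S - (X S + c * (Nl e y - 2 * l))^(-(1 / (p - 1)))| ≤
        C * (S^(-a) + log S / S) * exp (‖y‖^2 / S / 4) := by
  have hp1 := sub_pos.2 hp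
  set θ := 1 / (p - 1) with hθ
  have hθ0 : 0 < θ := by positivity
  set k := (p - 1)^2 / (2 * p) with hk
  obtain ⟨C, s3, hC, hs3, HE⟩ := exists_error_flow hP hp ha hT hu hM hw he hl hl0
    (show 0 ≤ k by positivity)
  obtain ⟨D, hD, HD⟩ := hP.exists_l2 hp hl0 he
  set ν := min a 1 / 2
  have hν0 : 0 < ν := half_pos (lt_min ha one_pos)
  have hν2 : min a 1 = 2 * ν := by simp only [ν]; ring
  have hνa := hν2 ▸ min_le_left a 1
  have hν1 := hν2 ▸ min_le_right a 1
  obtain ⟨Γ0, hΓ, HB⟩ := exists_barrier n (show 0 ≤ 4 * C by positivity) (le_max_right C 1) hν0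
  set R := 1 + Γ0⁻¹ with hR
  have hR0 : 0 < R := by positivity
  have hRΓ : 3 / 8 * exp (-R) ≤ Γ0 := by
    have := exp_pos (-R)
    have : exp (-R) ≤ Γ0 := by
      rw [exp_neg, inv_le_comm₀ (exp_pos _) hΓ]
      linarith [add_one_le_exp R]
    linarith
  obtain ⟨K, hK, HK⟩ := exists_heat_step n θ (show 0 ≤ 1 + θ + C * (1 + C) by positivity) hR0 hθ0.le
  set B := 4 * C + D * (C5 + 1) * (2^(a + 1) + 2^(2 : ℝ)) with hB
  have hB0 : 0 < B := by positivity
  obtain ⟨kb, hkb, HB⟩ := HB (K * B) (by positivity)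
  obtain ⟨S1, hS1⟩ := eventually_atTop.1 (eventually_scales hν0 R (max (max s3 s2) (max s5 1))
    (max 1 (2 * kb)))
  refine ⟨kb, R, max S1 s0, hkb, hR0.le, le_max_right _ _, fun S c hS hc => ?_⟩
  obtain ⟨hL, hLR, hA, hkL⟩ := hS1 S ((le_max_left _ _).trans hS)
  refine ⟨hL, hLR, ?_⟩
  have a1 := ((le_max_left _ _).trans (le_max_left _ _)).trans hA
  have a2 := ((le_max_right _ _).trans (le_max_left _ _)).trans hA
  have a3 := ((le_max_left _ _).trans (le_max_right _ _)).trans hA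
  have a4 := ((le_max_right _ _).trans (le_max_right _ _)).trans hA
  have hS0 : 0 < S := by linarith
  set L := log S
  set s1 := S - L - R
  have hs1R : s1 + R = S - L := sub_add_cancel _ _
  have hs12 : S / 2 ≤ s1 := by linarith
  have hs10 : 0 < s1 := by linarith
  have hc0 : 0 ≤ c := by rw [hc]; positivity
  have hcS : c * S ≤ k := by
    rw [hc, hk, div_mul_eq_mul_div, div_le_div_iff₀ (by positivity) (by positivity)]
    have := mul_le_left (show S ≤ 2 * s1 by linarith)
      (show 0 ≤ (p - 1)^2 * (2 * p) by positivity)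
    linarith
  obtain ⟨v, f, α, β, hV, hα, hβ, qc, q2, qd, qk⟩ := HE b c s1 S (by linarith) (by linarith) hc0 hcS
  set q := resc θ T b v with hq
  set G := resc (θ + 1) T b f with hG
  have hε1 : 0 ≤ S^(-(2 : ℝ)) * L := by positivity
  set ε := S^(-(a + 1)) + S^(-(2 : ℝ)) * L with hε
  have hε0 : 0 < ε := by positivity
  have sf : ∀ s ∈ Icc s1 S, _ := fun s hs => scale_facts hν0 hνa hν1 hkb.le hL
    (by linarith) hkL (hs12.trans hs.1)
  have hi1 : s1 ∈ Icc s1 S := ⟨le_rfl, by linarith⟩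
  have hi2 : S ∈ Icc s1 S := ⟨by linarith, le_rfl⟩
  have hl2 : ∫ y, q y s1^2 * rho n y ≤ (B * ε)^2 := by
    have hwc : Continuous fun y => wSelf n p T u b y s1 :=
      ((q2 s1 hi1).continuous.add (Continuous.rpow_const (by have := (Nl_contDiff e).continuous; fun_prop)
        fun y => Or.inl (by linarith [(qk y s1 hi1).1]))).congr fun y =>
          (congrArg (· + _) (qk y s1 hi1).2.1).trans (sub_add_cancel _ _)
    have h1 := HD (fun y => wSelf n p T u b y s1) M s1 c _ (by linarith) hc hwc
      (hw s1 (by linarith) b) (fun y => (qk y s1 hi1).1) (hcase s1 (by linarith))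
    simp only [fun y => (qk y s1 hi1).2.1]
    refine h1.trans (pow_le_pow_left₀ (by
      have := log_nonneg (show 1 ≤ s1 by linarith); positivity) ?_ 2)
    have h2 : s1^(-(a + 1)) ≤ 2^(a + 1) * ε :=
      (rpow_neg_le_of_half_le hS0 hs12 (by linarith)).trans
        (mul_le_left (le_add_of_nonneg_right hε1) (by positivity))
    have h3 : s1^(-(2 : ℝ)) * L ≤ 2^(2 : ℝ) * ε := by
      grw [rpow_neg_le_of_half_le hS0 hs12 zero_le_two, mul_assoc]
      exact mul_le_left (le_add_of_nonneg_left (by positivity)) (by positivity)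
    have h4 : s1^(-(2 : ℝ)) * log s1 ≤ s1^(-(2 : ℝ)) * L :=
      mul_le_left (log_le_log hs10 (by linarith)) (by positivity)
    have h5 : s1^(-(2 : ℝ)) ≤ s1^(-(2 : ℝ)) * L := le_mul_of_one_le_right (by positivity) hL
    grw [h4, h2, h3]
    grw [h5, h3]
    simp only [B]
    have : 0 ≤ C * ε := by positivity
    linarith
  have hst := HK v f α β T s1 (B * ε) b hV hα ((sub_le_sub_left (exp_le_exp.2 (by linarith)) _).trans_lt hβ) (by positivity) (fun y s hs => ?_) hl2
  · rw [hs1R] at hst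
    have hq0 : ∀ y, |q y (S - L)| ≤ K * B * ε * exp (Γ0 * ‖y‖^2) := fun y => by
      rw [hq, resc, abs_mul, abs_of_pos (exp_pos _)]
      grw [hst y, ← mul_assoc, hRΓ]
    have hsub : Icc (S - L) S ⊆ Icc s1 S := Icc_subset_Icc_left (by linarith)
    have hsrc : ∀ y, ∀ s ∈ Icc (S - L) S, |G y s| ≤ (1 + θ + 4 * C / L + 4 * C * |q y s|) * |q y s| +
        4 * C * (ε / L) * (1 + ‖y‖^2) := fun y s hs => by
      obtain ⟨b1, b2, -⟩ := sf s (hsub hs)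
      refine (qk y s (hsub hs)).2.2.2.trans ?_
      rw [hν2]
      have h3 := mul_nonneg hC.le (abs_nonneg (q y s))
      grw [b1, b2]
      refine add_le_add (mul_le_right ?_ (abs_nonneg _)) (by linarith)
      linarith [(by ring : 4 * C / L = C * (4 / L))]
    have hb3 := (sf S hi2).2.2
    have key : ∀ y (σ : ℝ), |σ| = 1 → σ * q y S ≤ kb * ε * exp L * exp (exp (-L) * ‖y‖^2 / 4) := fun y σ h => by
      have hx : ∀ x, |σ * x| = |x| := fun x => by rw [abs_mul, h, one_mul]
      have hx' := fun x => (le_abs_self (σ * x)).trans_eq (hx x)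
      have u := HB (fun y s => σ * q y s) (fun y s => σ * (G y s - θ * q y s)) (S - L) L ε
        (by linarith) hε0 hb3
      rw [sub_add_cancel] at u
      refine u ((qc.mono (Set.prod_mono_right hsub)).const_smul σ)
        (fun s hs => contDiff_const.mul (q2 s (hsub hs))) (fun y s hs => ?_)
        (fun y s hs => (hx' _).trans ((qk y s (hsub hs)).2.2.1.trans (le_max_left _ _)))
        (fun y => (hx' _).trans (hq0 y)) (fun y s hs h0 => ?_) y
      · refine ((qd y s (hsub hs)).const_mul σ).congr_deriv ?_
        rw [OU_const_mul]; ring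
      · have := (hx' _).trans (hsrc y s hs)
        rw [← hx, abs_of_nonneg h0] at this
        linarith
    intro y
    refine ⟨(qk y S hi2).1, ?_⟩
    rw [← (qk y S hi2).2.1]
    refine (abs_le'.2 ⟨by simpa using key y 1 abs_one, by simpa using key y (-1) (by simp)⟩).trans_eq ?_
    rw [exp_neg, exp_log hS0, inv_mul_eq_div, mul_assoc kb]
    congr 2
    rw [hε, add_mul, ← rpow_add_one hS0.ne', mul_right_comm, ← rpow_add_one hS0.ne',
      show -(a + 1) + 1 = -a by ring, show -(2 : ℝ) + 1 = -1 by norm_num, rpow_neg_one]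
    ring
  · have hs' : s ∈ Icc s1 S := ⟨hs.1, by linarith [hs.2]⟩
    have h1 := (qk y s hs').2.2.2
    have h2 := (qk y s hs').2.2.1
    have e1 : |G y s| = exp (-(θ + 1) * s) *
        |f (b + exp (-s / 2) • y) (T - exp (-s))| := by
      rw [hG, resc, abs_mul, abs_of_pos (exp_pos _)]
    have e2 : |q y s| = exp (-θ * s) *
        |v (b + exp (-s / 2) • y) (T - exp (-s))| := by
      rw [hq, resc, abs_mul, abs_of_pos (exp_pos _)]
    rw [← e1, ← e2]
    refine h1.trans (add_le_add (mul_le_right ?_ (abs_nonneg _)) (mul_le_right ?_ (by positivity)))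
    · have h3 : s^(-(min a 1)) ≤ 1 :=
        rpow_le_one_of_one_le_of_nonpos (by linarith [hs.1]) (by linarith)
      gcongr
    · have h3 := mul_le_left (sf s hs').2.1 hC.le
      have h4 : ε / L ≤ ε := div_le_self hε0.le hL
      have h5 : 0 ≤ D * (C5 + 1) * (2^(a + 1) + 2^(2 : ℝ)) * ε := by positivity
      have h6 := mul_le_left h4 (show 0 ≤ 4 * C by positivity)
      rw [hB]
      linarith

end

end Blowup

open Blowup Set in
/-- Convergence extension to the region `|y| ≤ K₀√s`, stable case. -/
theorem stmt4 (n : ℕ) (hn : 1 ≤ n) (p : ℝ) (hp : 1 < p)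
    (hpS : 3 ≤ n → p < ((n : ℝ) + 2) / ((n : ℝ) - 2)) (a : ℝ) (ha : 0 < a) (μ : ℝ)
    (κ : ℝ) (hκ : κ = (p - 1) ^ (-(1 / (p - 1))))
    (T : ℝ) (hT : 0 < T) (u : EuclideanSpace ℝ (Fin n) → ℝ → ℝ)
    (hu : SolvesU n p a μ T u)
    (b : EuclideanSpace ℝ (Fin n)) (hb : BlowupPt n T u b)
    (s₀ : ℝ) (φ : ℝ → ℝ) (hpos : ∀ s, s₀ ≤ s → 0 < φ s)
    (hode : ∀ s, s₀ ≤ s → HasDerivAt φ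
      (-(φ s) / (p - 1) + φ s ^ p +
        Real.exp (-p * s / (p - 1)) * hfun p a μ (Real.exp (s / (p - 1)) * φ s)) s)
    (hφlim : Tendsto φ atTop (nhds κ))
    (hconv : Tendsto (fun s => L2rho n (fun y => wSelf n p T u b y s - κ))
      atTop (nhds 0))
    (l : ℕ) (hl1 : 1 ≤ l) (hln : l ≤ n)
    (hcase : ∃ C > (0:ℝ), ∃ s₁ : ℝ, ∀ s : ℝ, s₁ ≤ s →
      L2rho n (fun y => wSelf n p T u b y s - φ s +
          κ / (4 * p * s) *
            ((∑ j ∈ Finset.univ.filter (fun j : Fin n => (j : ℕ) < l), (y j) ^ 2)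
              - 2 * l)) ≤
        C * (s ^ (-(a + 1)) + s ^ (-(2:ℝ)) * Real.log s)) :
    ∀ K₀ : ℝ, 0 < K₀ → ∃ C > (0:ℝ), ∃ s₁ : ℝ, ∀ s : ℝ, s₁ ≤ s →
      ∀ ξ : EuclideanSpace ℝ (Fin n), ‖ξ‖ ≤ K₀ →
        |wSelf n p T u b (Real.sqrt s • ξ) s -
            κ * (1 + (p - 1) / (4 * p) *
              ∑ j ∈ Finset.univ.filter (fun j : Fin n => (j : ℕ) < l),
                (ξ j) ^ 2) ^ (-(1 / (p - 1)))| ≤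
          C * (s ^ (-a) + Real.log s / s) := by
  intro K₀ hK₀
  set e : Fin n → ℝ := fun j => if (j : ℕ) < l then 1 else 0 with he'
  have he : ∀ j, e j ^ 2 = e j := fun j => by simp only [he']; split_ifs <;> norm_num
  have hl : ∑ j, e j = l := by
    rw [he', Finset.sum_boole, Fin.card_filter_val_lt, min_eq_right hln]
  have hN : ∀ y, ∑ j ∈ Finset.univ.filter (fun j : Fin n => (j : ℕ) < l), (y j) ^ 2 =
      Nl e y := fun y => by
    simp only [Nl, he', Finset.sum_filter, ite_mul, one_mul, zero_mul]
  obtain ⟨C₅, hC₅, s₅, h5⟩ := hcase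
  obtain ⟨M, s₂, hM, hw⟩ := exists_typeI hp ha hT hu hpS
  obtain ⟨X, C₀, s₁, hP, hX⟩ := exists_prof hp ha hpos hode (hκ ▸ hφlim)
  simp only [hN] at h5 ⊢
  subst hκ
  obtain ⟨C, R, S₀, hC, hR, hS₀, H⟩ := exists_error_bound (s5 := max s₅ s₁) hP hp ha hT hu hM hw he hl
    l.cast_nonneg hC₅ fun s hs => by
      rw [← hX s ((le_max_right _ _).trans hs)]
      exact h5 s ((le_max_left _ _).trans hs)
  obtain ⟨C', hC', H'⟩ := hP.exists_profile hp (Nat.cast_nonneg (α := ℝ) l) hR (sq_nonneg K₀)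
  refine ⟨C * exp (K₀ ^ 2 / 4) + C', by positivity, max S₀ 1, fun s hs ξ hξ => ?_⟩
  have hs1 : 1 ≤ s := (le_max_right _ _).trans hs
  have hsS : S₀ ≤ s := (le_max_left _ _).trans hs
  obtain ⟨g1, g2, g3⟩ := H s _ hsS rfl
  obtain ⟨g3, g4⟩ := g3 (√s • ξ)
  have hξ2 : ‖ξ‖ ^ 2 ≤ K₀ ^ 2 := by gcongr
  have hs2 : √s ^ 2 = s := sq_sqrt (by linarith)
  rw [Nl_smul, hs2] at g3 g4
  have g5 := H' s _ (Nl e ξ) (hS₀.trans hsS) g1 g2 (Nl_nonneg he ξ) ((Nl_le he ξ).trans hξ2) rfl g3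
  have g6 : ‖√s • ξ‖ ^ 2 / s ≤ K₀ ^ 2 := by
    rwa [norm_smul, mul_pow, norm_eq_abs, sq_abs, hs2, mul_div_cancel_left₀ _ (by linarith)]
  refine (abs_sub_le _ _ _).trans ((add_le_add (g4.trans ?_) g5).trans_eq (add_mul _ _ _).symm)
  have g7 : 0 ≤ C * (s ^ (-a) + log s / s) := by
    have := log_nonneg hs1
    positivity
  refine (mul_le_mul_of_nonneg_left (exp_le_exp.2 (div_le_div_of_nonneg_right g6
    zero_le_four)) g7).trans_eq ?_
  ring
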